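/- Let q be a power of an odd prime, F_q a finite field with q elements, and G = GSp(2n, F_q). Let H be a finite group containing G as a subgroup of index 2, together with an element τ ∈ H \ G such that τ² = −I (the negative identity matrix of G) and τ⁻¹ g τ = μ(g)⁻¹ g for all g ∈ G, where μ is the similitude character. Then every irreducible character ψ of H satisfies ε(ψ) = 1, i.e. (1/|H|) Σ_{h∈H} ψ(h²) = 1. In particular, every element of H is conjugate in H to its inverse. -/

import Mathlib

open Matrix CategoryTheory
open scoped Classical

noncomputable section

/-- The Frobenius–Schur indicator of a complex-valued function on a finite group. -/
def fsIndicator (G : Type*) [Group G] [Fintype G] (χ : G → ℂ) : ℂ :=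
  (Fintype.card G : ℂ)⁻¹ * ∑ g : G, χ (g * g)

/-- The twisted Frobenius–Schur indicator of a complex-valued function on a finite group,
with respect to a map `σ`. -/
def twistedFSIndicator (G : Type*) [Group G] [Fintype G] (σ : G → G) (χ : G → ℂ) : ℂ :=
  (Fintype.card G : ℂ)⁻¹ * ∑ g : G, χ (g * σ g)

/-- A complex-valued function is real-valued if all its values are real. -/
def IsRealValued {G : Type*} (χ : G → ℂ) : Prop := ∀ g : G, ∃ r : ℝ, χ g = (r : ℂ)

/-- The Gaussian binomial coefficient `binom(m,k)_q` as a real number. -/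
def gbinom (m k : ℕ) (q : ℝ) : ℝ := ∏ i ∈ Finset.Icc 1 k, (q ^ (m - k + i) - 1) / (q ^ i - 1)

section Groups

variable {N F : Type*} [Fintype N] [DecidableEq N] [Field F]

theorem sim_one (J : Matrix N N F) :
    ((1 : GL N F) : Matrix N N F)ᵀ * J * ((1 : GL N F) : Matrix N N F) = ((1 : Fˣ) : F) • J := by
  simp

theorem sim_mul {J : Matrix N N F} (a b : GL N F) (c d : Fˣ)
    (hc : (a : Matrix N N F)ᵀ * J * (a : Matrix N N F) = (c : F) • J)
    (hd : (b : Matrix N N F)ᵀ * J * (b : Matrix N N F) = (d : F) • J) :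
    ((a * b : GL N F) : Matrix N N F)ᵀ * J * ((a * b : GL N F) : Matrix N N F)
      = ((c * d : Fˣ) : F) • J := by
  calc ((a * b : GL N F) : Matrix N N F)ᵀ * J * ((a * b : GL N F) : Matrix N N F)
      = (b : Matrix N N F)ᵀ * ((a : Matrix N N F)ᵀ * J * (a : Matrix N N F)) *
          (b : Matrix N N F) := by
        rw [show ((a * b : GL N F) : Matrix N N F) = (a : Matrix N N F) * b from rfl,
          transpose_mul]
        simp only [Matrix.mul_assoc]
    _ = (b : Matrix N N F)ᵀ * ((c : F) • J) * (b : Matrix N N F) := by rw [hc]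
    _ = (c : F) • ((b : Matrix N N F)ᵀ * J * (b : Matrix N N F)) := by
        rw [Matrix.mul_smul, Matrix.smul_mul]
    _ = (c : F) • ((d : F) • J) := by rw [hd]
    _ = ((c * d : Fˣ) : F) • J := by rw [smul_smul, Units.val_mul]

theorem sim_inv {J : Matrix N N F} (a : GL N F) (c : Fˣ)
    (hc : (a : Matrix N N F)ᵀ * J * (a : Matrix N N F) = (c : F) • J) :
    ((a⁻¹ : GL N F) : Matrix N N F)ᵀ * J * ((a⁻¹ : GL N F) : Matrix N N F)
      = ((c⁻¹ : Fˣ) : F) • J := by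
  have ht : ((a⁻¹ : GL N F) : Matrix N N F)ᵀ * (a : Matrix N N F)ᵀ = 1 := by
    rw [← transpose_mul, a.mul_inv, transpose_one]
  have key : ((a⁻¹ : GL N F) : Matrix N N F)ᵀ * ((a : Matrix N N F)ᵀ * J * (a : Matrix N N F)) *
      ((a⁻¹ : GL N F) : Matrix N N F) = J := by
    calc ((a⁻¹ : GL N F) : Matrix N N F)ᵀ * ((a : Matrix N N F)ᵀ * J * (a : Matrix N N F)) *
        ((a⁻¹ : GL N F) : Matrix N N F)
        = (((a⁻¹ : GL N F) : Matrix N N F)ᵀ * (a : Matrix N N F)ᵀ) * J *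
          ((a : Matrix N N F) * ((a⁻¹ : GL N F) : Matrix N N F)) := by
          simp only [Matrix.mul_assoc]
      _ = J := by rw [ht, a.mul_inv, Matrix.one_mul, Matrix.mul_one]
  have key2 : ((a⁻¹ : GL N F) : Matrix N N F)ᵀ * ((c : F) • J) * ((a⁻¹ : GL N F) : Matrix N N F)
      = (c : F) • (((a⁻¹ : GL N F) : Matrix N N F)ᵀ * J * ((a⁻¹ : GL N F) : Matrix N N F)) := by
    rw [Matrix.mul_smul, Matrix.smul_mul]
  have h3 : (c : F) • (((a⁻¹ : GL N F) : Matrix N N F)ᵀ * J *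
      ((a⁻¹ : GL N F) : Matrix N N F)) = J := by rw [← key2, ← hc, key]
  calc ((a⁻¹ : GL N F) : Matrix N N F)ᵀ * J * ((a⁻¹ : GL N F) : Matrix N N F)
      = ((c⁻¹ : Fˣ) : F) • ((c : F) • (((a⁻¹ : GL N F) : Matrix N N F)ᵀ * J *
          ((a⁻¹ : GL N F) : Matrix N N F))) := by
        rw [smul_smul, ← Units.val_mul, inv_mul_cancel, Units.val_one, one_smul]
    _ = ((c⁻¹ : Fˣ) : F) • J := by rw [h3]

/-- The similitude group of the bilinear form given by the matrix `J`:  all invertible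
matrices `g` with `gᵀ * J * g = c • J` for some nonzero scalar `c` (the similitude of `g`). -/
def similitudeGroup (J : Matrix N N F) : Subgroup (GL N F) where
  carrier := {g | ∃ c : Fˣ, (g : Matrix N N F)ᵀ * J * (g : Matrix N N F) = (c : F) • J}
  one_mem' := ⟨1, sim_one J⟩
  mul_mem' := by rintro a b ⟨c, hc⟩ ⟨d, hd⟩; exact ⟨c * d, sim_mul a b c d hc hd⟩
  inv_mem' := by rintro a ⟨c, hc⟩; exact ⟨c⁻¹, sim_inv a c hc⟩

/-- The isometry group of the bilinear form given by the matrix `J`:  all invertible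
matrices `g` with `gᵀ * J * g = J`. -/
def fixGroup (J : Matrix N N F) : Subgroup (GL N F) where
  carrier := {g | (g : Matrix N N F)ᵀ * J * (g : Matrix N N F) = J}
  one_mem' := by simp
  mul_mem' := by
    intro a b ha hb
    have := sim_mul (J := J) a b 1 1 (by simpa using ha) (by simpa using hb)
    simpa using this
  inv_mem' := by
    intro a ha
    have := sim_inv (J := J) a 1 (by simpa using ha)
    simpa using this

/-- The group of isometries of determinant one of the bilinear form given by the matrix `J`. -/
def specialFixGroup (J : Matrix N N F) : Subgroup (GL N F) where
  carrier := {g | (g : Matrix N N F)ᵀ * J * (g : Matrix N N F) = J ∧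
    ((g : Matrix N N F)).det = 1}
  one_mem' := ⟨by simp, by simp⟩
  mul_mem' := by
    rintro a b ⟨ha1, ha2⟩ ⟨hb1, hb2⟩
    refine ⟨(fixGroup J).mul_mem ha1 hb1, ?_⟩
    rw [show ((a * b : GL N F) : Matrix N N F) = (a : Matrix N N F) * b from rfl,
      Matrix.det_mul, ha2, hb2, one_mul]
  inv_mem' := by
    rintro a ⟨ha1, ha2⟩
    refine ⟨(fixGroup J).inv_mem ha1, ?_⟩
    have h := congrArg Matrix.det a.mul_inv
    rw [Matrix.det_mul, ha2, one_mul, Matrix.det_one] at h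
    exact h

/-- The connected component of the similitude group of the symmetric bilinear form on a
`2 * m`-dimensional space given by the matrix `J`:  all similitudes `g`, with similitude
character `μ`, such that `det g = μ(g) ^ m`. -/
def connSimilitudeGroup (J : Matrix N N F) (m : ℕ) : Subgroup (GL N F) where
  carrier := {g | ∃ c : Fˣ, (g : Matrix N N F)ᵀ * J * (g : Matrix N N F) = (c : F) • J ∧
    ((g : Matrix N N F)).det = (c : F) ^ m}
  one_mem' := ⟨1, sim_one J, by simp⟩
  mul_mem' := by
    rintro a b ⟨c, hc1, hc2⟩ ⟨d, hd1, hd2⟩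
    refine ⟨c * d, sim_mul a b c d hc1 hd1, ?_⟩
    rw [show ((a * b : GL N F) : Matrix N N F) = (a : Matrix N N F) * b from rfl,
      Matrix.det_mul, hc2, hd2, Units.val_mul, mul_pow]
  inv_mem' := by
    rintro a ⟨c, hc1, hc2⟩
    refine ⟨c⁻¹, sim_inv a c hc1, ?_⟩
    have h := congrArg Matrix.det a.mul_inv
    rw [Matrix.det_mul, hc2, Matrix.det_one] at h
    have hc : ((c : F) ^ m)⁻¹ = ((c⁻¹ : Fˣ) : F) ^ m := by
      rw [← inv_pow]
      norm_cast
    rw [← hc]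
    exact (inv_eq_of_mul_eq_one_right h).symm

theorem neg_one_mem_similitudeGroup (J : Matrix N N F) : (-1 : GL N F) ∈ similitudeGroup J := by
  refine ⟨1, ?_⟩
  have h : ((-1 : GL N F) : Matrix N N F) = -1 := by simp
  rw [h]
  simp

/-- The standard symplectic form matrix `[[0, I], [-I, 0]]`. -/
def Jsp (n : ℕ) (F : Type*) [Field F] : Matrix (Fin n ⊕ Fin n) (Fin n ⊕ Fin n) F :=
  Matrix.fromBlocks 0 1 (-1) 0

/-- The standard split symmetric form matrix `[[0, I], [I, 0]]`. -/
def Jsplit (n : ℕ) (F : Type*) [Field F] : Matrix (Fin n ⊕ Fin n) (Fin n ⊕ Fin n) F :=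
  Matrix.fromBlocks 0 1 1 0

/-- A symmetric matrix `J` of size `2n` is split if it is congruent to `[[0, I], [I, 0]]`. -/
def IsSplit {n : ℕ} (J : Matrix (Fin n ⊕ Fin n) (Fin n ⊕ Fin n) F) : Prop :=
  ∃ P : GL (Fin n ⊕ Fin n) F,
    (P : Matrix (Fin n ⊕ Fin n) (Fin n ⊕ Fin n) F)ᵀ * J * P = Jsplit n F

/-- The symplectic similitude group `GSp(2n, F)`. -/
def GSp (n : ℕ) (F : Type*) [Field F] : Subgroup (GL (Fin n ⊕ Fin n) F) :=
  similitudeGroup (Jsp n F)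

/-- The symplectic group `Sp(2n, F)`. -/
def Sp (n : ℕ) (F : Type*) [Field F] : Subgroup (GL (Fin n ⊕ Fin n) F) :=
  fixGroup (Jsp n F)


/-- The underlying matrix of an element of a matrix subgroup. -/
def matOf {S : Subgroup (GL N F)} (g : ↥S) : Matrix N N F := ((g : GL N F) : Matrix N N F)

end Groups

noncomputable instance subgroupFintype {G : Type*} [Group G] [Finite G] (S : Subgroup G) :
    Fintype S := Fintype.ofFinite _

/-- A complex function on a group is positive semidefinite if it has a finite Gram factorisation. -/
def IsPSD {G : Type} [Group G] (θ : G → ℂ) : Prop :=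
  ∃ (ι : Type) (_ : Fintype ι) (f : ι → G → ℂ),
    ∀ g h : G, θ (g⁻¹ * h) = ∑ i, (starRingEnd ℂ) (f i g) * f i h

namespace IsPSD

variable {G K : Type} [Group G] [Group K]

theorem add {θ θ' : G → ℂ} (h : IsPSD θ) (h' : IsPSD θ') : IsPSD (fun g => θ g + θ' g) := by
  obtain ⟨ι, _, f, hf⟩ := h
  obtain ⟨ι', _, f', hf'⟩ := h'
  exact ⟨ι ⊕ ι', inferInstance, Sum.elim f f', fun g k => by simp [hf, hf']⟩

theorem prod {θ : G → ℂ} {θ' : K → ℂ} (h : IsPSD θ) (h' : IsPSD θ') :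
    IsPSD (fun g : G × K => θ g.1 * θ' g.2) := by
  obtain ⟨ι, _, f, hf⟩ := h
  obtain ⟨ι', _, f', hf'⟩ := h'
  refine ⟨ι × ι', inferInstance, fun i g => f i.1 g.1 * f' i.2 g.2, fun g k => ?_⟩
  simp only [Prod.fst_mul, Prod.fst_inv, Prod.snd_mul, Prod.snd_inv, hf, hf',
    Finset.sum_mul_sum, Fintype.sum_prod_type, map_mul]
  exact Finset.sum_congr rfl fun i _ => Finset.sum_congr rfl fun j _ => by ring

theorem extend {θ : K → ℂ} (h : IsPSD θ) [Finite G] (j : K →* G)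
    {Θ : G → ℂ} (h1 : ∀ k, Θ (j k) = θ k) (h0 : ∀ g, g ∉ j.range → Θ g = 0) : IsPSD Θ := by
  obtain ⟨ι, _, f, hf⟩ := h
  have := Fintype.ofFinite (G ⧸ j.range)
  have hr : ∀ g : G, ∃ k : K, g = (g : G ⧸ j.range).out * j k := by
    intro g
    have : ((g : G ⧸ j.range).out : G ⧸ j.range) = (g : G ⧸ j.range) := by simp
    obtain ⟨k, hk⟩ := QuotientGroup.eq.1 this
    exact ⟨k, by rw [hk]; group⟩
  choose κ hκ using hr
  refine ⟨ι × (G ⧸ j.range), inferInstance,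
    fun i g => if (g : G ⧸ j.range) = i.2 then f i.1 (κ g) else 0, fun g k => ?_⟩
  have hsum : ∑ i : ι × (G ⧸ j.range), (starRingEnd ℂ)
      (if (g : G ⧸ j.range) = i.2 then f i.1 (κ g) else 0) *
      (if (k : G ⧸ j.range) = i.2 then f i.1 (κ k) else 0) =
      if (g : G ⧸ j.range) = k then ∑ i, (starRingEnd ℂ) (f i (κ g)) * f i (κ k) else 0 := by
    rw [Fintype.sum_prod_type]
    simp only [apply_ite (starRingEnd ℂ), map_zero, ite_mul, zero_mul, mul_ite, mul_zero,
      Finset.sum_ite_eq, Finset.mem_univ, if_true]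
    split_ifs with h1
    · rfl
    · simp
  rw [hsum]
  split_ifs with hgk
  · rw [← hf, ← h1]
    congr 1
    conv_lhs => rw [hκ g, hκ k, hgk]
    rw [map_mul, map_inv]
    group
  · exact h0 _ fun hmem => hgk (QuotientGroup.eq.2 hmem)

theorem fixedPoints {X : Type} [Finite X] [MulAction K X] :
    IsPSD (fun k : K => ((Nat.card {t : X // k • t = t} : ℕ) : ℂ)) := by
  have := Fintype.ofFinite X
  refine ⟨X × X, inferInstance, fun i g => if g • i.1 = i.2 then 1 else 0, fun g k => ?_⟩
  rw [Fintype.sum_prod_type]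
  simp only [apply_ite (starRingEnd ℂ), map_one, map_zero, ite_mul, one_mul, zero_mul,
    Finset.sum_ite_eq, Finset.mem_univ, if_true]
  rw [Nat.card_eq_fintype_card, Fintype.card_subtype, Finset.sum_boole]
  congr 3
  ext t
  rw [mul_smul, inv_smul_eq_iff]

theorem of_fourier_aux {M : Type} [CommGroup M] [Finite M] {T : Type} [Fintype T] (q : T → M)
    (h : ∀ χ : M →* ℂ, ∃ r : ℝ, 0 ≤ r ∧ ∑ t, χ (q t) = r) :
    IsPSD (fun m : M => ((Nat.card {t : T // q t = m} : ℕ) : ℂ)) := by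
  have := Fintype.ofFinite M
  have h' : ∀ ψ : AddChar (Additive M) ℂ, ∃ r : ℝ, 0 ≤ r ∧
      ∑ t, (starRingEnd ℂ) (ψ (Additive.ofMul (q t))) = r := by
    intro ψ
    obtain ⟨r, hr, h1⟩ := h ⟨⟨fun m => ψ (Additive.ofMul m), by simp⟩, fun a b => by
      simp [AddChar.map_add_eq_mul]⟩
    refine ⟨r, hr, ?_⟩
    rw [← map_sum]
    have h2 : ∑ t, ψ (Additive.ofMul (q t)) = r := h1
    rw [h2, Complex.conj_ofReal]
  choose r hr0 hr using h'
  refine ⟨AddChar (Additive M) ℂ, inferInstance, fun ψ m =>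
    (Real.sqrt (r ψ / Fintype.card M) : ℝ) * ψ (Additive.ofMul m), fun g k => ?_⟩
  have hcard : (Fintype.card M : ℂ) ≠ 0 := by exact_mod_cast Fintype.card_ne_zero
  have key : ∀ ψ : AddChar (Additive M) ℂ,
      (starRingEnd ℂ) ((Real.sqrt (r ψ / Fintype.card M) : ℝ) * ψ (Additive.ofMul g)) *
        ((Real.sqrt (r ψ / Fintype.card M) : ℝ) * ψ (Additive.ofMul k)) =
      (Fintype.card M : ℂ)⁻¹ * ∑ t, ψ (Additive.ofMul (g⁻¹ * k * (q t)⁻¹)) := by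
    intro ψ
    rw [map_mul, Complex.conj_ofReal]
    have hs : ((Real.sqrt (r ψ / Fintype.card M) : ℝ) : ℂ) *
        ((Real.sqrt (r ψ / Fintype.card M) : ℝ) : ℂ) = (Fintype.card M : ℂ)⁻¹ * r ψ := by
      rw [← Complex.ofReal_mul, Real.mul_self_sqrt (div_nonneg (hr0 ψ) (Nat.cast_nonneg _))]
      push_cast
      rw [div_eq_inv_mul]
    have hc : ∀ a : M, (starRingEnd ℂ) (ψ (Additive.ofMul a)) = ψ (Additive.ofMul a⁻¹) := by
      intro a
      rw [ofMul_inv, AddChar.map_neg_eq_conj]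
    calc _ = ((Real.sqrt (r ψ / Fintype.card M) : ℝ) : ℂ) *
        ((Real.sqrt (r ψ / Fintype.card M) : ℝ) : ℂ) *
          ((starRingEnd ℂ) (ψ (Additive.ofMul g)) * ψ (Additive.ofMul k)) := by ring
      _ = _ := by
        rw [hs, ← hr, mul_assoc, Finset.sum_mul]
        congr 1
        refine Finset.sum_congr rfl fun t _ => ?_
        rw [hc, hc, ← AddChar.map_add_eq_mul, ← AddChar.map_add_eq_mul, ← ofMul_mul, ← ofMul_mul]
        congr 2
        rw [mul_comm]
  simp only [key]
  rw [← Finset.mul_sum, Finset.sum_comm]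
  simp only [AddChar.sum_apply_eq_ite]
  rw [Nat.card_eq_fintype_card, Fintype.card_subtype]
  have : ∀ t, (Additive.ofMul (g⁻¹ * k * (q t)⁻¹) = 0) ↔ q t = g⁻¹ * k := by
    intro t
    rw [ofMul_eq_zero, mul_inv_eq_one, eq_comm]
  simp only [this, Fintype.card_additive]
  rw [← Finset.sum_filter, Finset.sum_const, nsmul_eq_mul]
  field_simp

theorem of_fourier [Finite G] (M : Subgroup G) (hM : ∀ a ∈ M, ∀ b ∈ M, a * b = b * a)
    {T : Type} [Fintype T] (q : T → G) (hq : ∀ t, q t ∈ M)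
    (h : ∀ χ : M →* ℂ, ∃ r : ℝ, 0 ≤ r ∧ ∑ t, χ ⟨q t, hq t⟩ = r) :
    IsPSD (fun g : G => ((Nat.card {t : T // q t = g} : ℕ) : ℂ)) := by
  let : CommGroup M := { (inferInstance : Group M) with
    mul_comm := fun a b => Subtype.ext (hM a a.2 b b.2) }
  refine (of_fourier_aux (M := M) (fun t => ⟨q t, hq t⟩) h).extend M.subtype ?_ ?_
  · intro k
    simp [Subtype.ext_iff]
  · intro g hg
    rw [Subgroup.range_subtype] at hg
    have : IsEmpty {t : T // q t = g} := ⟨fun t => hg (t.2 ▸ hq t.1)⟩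
    simp

end IsPSD

/-- A linear involutive anti-automorphism of an algebra. -/
structure AntiInv (F E : Type) [CommSemiring F] [Ring E] [Algebra F E] where
  /-- the underlying map -/
  toFun : E → E
  map_add' : ∀ a b, toFun (a + b) = toFun a + toFun b
  map_mul' : ∀ a b, toFun (a * b) = toFun b * toFun a
  map_smul' : ∀ (c : F) a, toFun (c • a) = c • toFun a
  invol' : ∀ a, toFun (toFun a) = a

namespace AntiInv

variable {F E : Type} [Field F] [Ring E] [Algebra F E] (σ : AntiInv F E)

instance : CoeFun (AntiInv F E) (fun _ => E → E) := ⟨AntiInv.toFun⟩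

@[simp] theorem map_add (a b : E) : σ (a + b) = σ a + σ b := σ.map_add' a b
@[simp] theorem map_mul (a b : E) : σ (a * b) = σ b * σ a := σ.map_mul' a b
@[simp] theorem map_smul (c : F) (a : E) : σ (c • a) = c • σ a := σ.map_smul' c a
@[simp] theorem invol (a : E) : σ (σ a) = a := σ.invol' a
@[simp] theorem map_zero : σ 0 = 0 := by simpa using σ.map_smul 0 0
@[simp] theorem map_one : σ 1 = 1 := by
  have h := σ.map_mul 1 (σ 1)
  simpa using h.symm
@[simp] theorem map_neg (a : E) : σ (-a) = -σ a := by simpa using σ.map_smul (-1) a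
@[simp] theorem map_sub (a b : E) : σ (a - b) = σ a - σ b := by simp [sub_eq_add_neg]
@[simp] theorem map_algebraMap (c : F) : σ (algebraMap F E c) = algebraMap F E c := by
  simp [Algebra.algebraMap_eq_smul_one]
@[simp] theorem map_pow (a : E) (n : ℕ) : σ (a ^ n) = σ a ^ n := by
  induction n with
  | zero => simp
  | succ n ih => rw [pow_succ, map_mul, ih, pow_succ']

theorem injective : Function.Injective σ.toFun := fun a b h => by
  rw [← σ.invol a, ← σ.invol b, h]

end AntiInv

/-- Conjugation by a unit. -/
def cj (F : Type) {E : Type} [Field F] [Ring E] [Algebra F E] (p : Eˣ) : E ≃ₐ[F] E :=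
  { toFun := fun a => p * a * ↑p⁻¹
    invFun := fun a => ↑p⁻¹ * a * p
    left_inv := fun a => by simp [mul_assoc]
    right_inv := fun a => by simp [mul_assoc]
    map_mul' := fun a b => by simp [mul_assoc]
    map_add' := fun a b => by simp [mul_add, add_mul]
    commutes' := fun c => by
      rw [← Algebra.commutes c (p : E), mul_assoc, Units.mul_inv, mul_one] }

section cj

variable {F E : Type} [Field F] [Ring E] [Algebra F E]

theorem cj_apply (p : Eˣ) (a : E) : cj F p a = p * a * ↑p⁻¹ := rfl

theorem cj_cj (p r : Eˣ) (a : E) : cj F p (cj F r a) = cj F (p * r) a := by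
  simp [cj_apply, mul_assoc]

theorem cj_mul_unit (p : Eˣ) (a : E) : cj F p a * p = p * a := by
  simp [cj_apply, mul_assoc]

theorem cj_one (a : E) : cj F (1 : Eˣ) a = a := by simp [cj_apply]

theorem cj_eq_self {p : Eˣ} {a : E} : cj F p a = a ↔ p * a = a * p := by
  rw [cj_apply, Units.mul_inv_eq_iff_eq_mul]

theorem cj_inv_eq {p : Eˣ} {a b : E} : cj F p a = b ↔ cj F p⁻¹ b = a := by
  constructor
  · rintro rfl; rw [cj_cj, inv_mul_cancel, cj_one]
  · rintro rfl; rw [cj_cj, mul_inv_cancel, cj_one]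

theorem AntiInv.cj_sim (σ : AntiInv F E) {p : Eˣ} {c : F} (hc : c ≠ 0)
    (hp : σ p = c • (↑p⁻¹ : E)) (a : E) : σ (cj F p a) = cj F p (σ a) := by
  have h : σ (↑p⁻¹ : E) = c⁻¹ • (p : E) := by
    have h1 : σ (↑p⁻¹ : E) * σ p = 1 := by
      rw [← σ.map_mul, Units.mul_inv, σ.map_one]
    rw [hp] at h1
    calc σ (↑p⁻¹ : E) = c⁻¹ • (σ (↑p⁻¹ : E) * (c • (↑p⁻¹ : E))) * p := by
          simp [mul_assoc, smul_smul, hc]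
      _ = _ := by rw [h1]; simp
  rw [cj_apply, σ.map_mul, σ.map_mul, h, hp, cj_apply]
  simp [mul_assoc, smul_smul, hc]

end cj

/-- Raising to the power `M` extracts semisimple parts in `E`. -/
structure SSPow (F E : Type) [Field F] [Ring E] [Algebra F E] (M : ℕ) : Prop where
  odd : Odd M
  two_lt : 2 < M
  idem : ∀ a : E, (a ^ M) ^ M = a ^ M
  add : ∀ a b : E, a * b = b * a → (a + b) ^ M = a ^ M + b ^ M
  scalar : ∀ c : F, (algebraMap F E c) ^ M = algebraMap F E c

theorem exists_ssPow (F E : Type) [Field F] [Finite F] [Ring E] [Algebra F E] [Finite E]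
    (h2 : (2 : F) ≠ 0) : ∃ M, SSPow F E M := by
  have := Fintype.ofFinite F
  set q := Fintype.card F with hq
  obtain ⟨p, hp⟩ := CharP.exists F
  have hpp : p.Prime := (CharP.char_is_prime_or_zero F p).resolve_right
    (fun h => by subst h; exact CharP.char_ne_zero_of_finite F 0 rfl)
  have : Fact p.Prime := ⟨hpp⟩
  obtain ⟨n, -, hn⟩ := FiniteField.card F p
  have hodd : Odd q := by
    rcases FiniteField.even_card_iff_char_two (F := F) with h
    rw [← Nat.not_even_iff_odd]
    intro he
    apply h2
    have : ringChar F = 2 := FiniteField.even_card_iff_char_two.2 (Nat.even_iff.1 he)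
    have h3 := ringChar.Nat.cast_ringChar (R := F)
    rw [this] at h3
    exact_mod_cast h3
  have hq1 : 1 < q := Fintype.one_lt_card
  have hq2 : 2 < q := by
    obtain ⟨k, hk⟩ := hodd
    omega
  -- an idempotent power of the Frobenius map
  obtain ⟨i, j, hij, hfr⟩ := Finite.exists_ne_map_eq_of_infinite
    (fun k : ℕ => (fun a : E => a ^ q ^ k))
  wlog hlt : i < j generalizing i j
  · exact this j i hij.symm hfr.symm (lt_of_le_of_ne (not_lt.1 hlt) hij.symm)
  obtain ⟨d, hd, rfl⟩ : ∃ d, 0 < d ∧ j = i + d := ⟨j - i, by omega, by omega⟩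
  have h1 : ∀ k, i ≤ k → ∀ a : E, a ^ q ^ (k + d) = a ^ q ^ k := by
    intro k hk a
    obtain ⟨l, rfl⟩ := Nat.exists_eq_add_of_le hk
    have := congrFun hfr (a ^ q ^ l)
    simp only [← pow_mul, ← pow_add] at this
    rw [add_right_comm, add_comm (i + d), add_comm i l]
    exact this.symm
  have hm : ∀ m k, i ≤ k → ∀ a : E, a ^ q ^ (k + m * d) = a ^ q ^ k := by
    intro m
    induction m with
    | zero => simp
    | succ m ih =>
      intro k hk a
      rw [add_mul, one_mul, ← add_assoc, h1 _ (by omega), ih k hk]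
  set k := (i + 1) * d with hk
  have hki : i ≤ k := by nlinarith
  have hk0 : k ≠ 0 := by positivity
  refine ⟨q ^ k, hodd.pow, lt_of_lt_of_le hq2 (Nat.le_self_pow hk0 q), fun a => ?_, ?_, ?_⟩
  · rw [← pow_mul, ← pow_add]
    exact hm (i + 1) k hki a
  · intro a b hab
    nontriviality E
    have hc : CharP E p := charP_of_injective_algebraMap (algebraMap F E).injective p
    rw [hq, hn, ← pow_mul]
    exact add_pow_char_pow_of_commute p _ hab
  · intro c
    rw [← map_pow, hq, FiniteField.pow_card_pow]

namespace SSPow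

variable {F E : Type} [Field F] [Ring E] [Algebra F E] {M : ℕ} (hM : SSPow F E M)
include hM

theorem neg (a : E) : (-a) ^ M = -a ^ M := hM.odd.neg_pow a

theorem sub (a b : E) (h : a * b = b * a) : (a - b) ^ M = a ^ M - b ^ M := by
  rw [sub_eq_add_neg, hM.add _ _ (by simp [h]), hM.neg, sub_eq_add_neg]

theorem smul (c : F) (a : E) : (c • a) ^ M = c • a ^ M := by
  rw [Algebra.smul_def, (show Commute (algebraMap F E c) a from Algebra.commutes c a).mul_pow, hM.scalar, Algebra.smul_def]

theorem two_element {u : E} {k : ℕ} (hu : u ^ 2 ^ k = 1) : u ^ M = u := by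
  have hM1 := hM.two_lt
  have h1 : u ^ (M * (M - 1)) = 1 := by
    have hunit : IsUnit (u ^ M) := (IsUnit.of_pow_eq_one hu (by positivity)).pow M
    have h2 := hM.idem u
    rw [← pow_mul] at h2
    have : u ^ M * u ^ (M * (M - 1)) = u ^ M * 1 := by
      rw [← pow_add, mul_one, ← h2]
      congr 1
      obtain ⟨m, rfl⟩ : ∃ m, M = m + 1 := ⟨M - 1, by omega⟩
      simp; ring
    exact hunit.mul_left_cancel this
  have h3 : orderOf u ∣ M - 1 := by
    have hc : Nat.Coprime (orderOf u) M := by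
      refine Nat.Coprime.coprime_dvd_left (orderOf_dvd_of_pow_eq_one hu) ?_
      exact (Nat.coprime_two_left.2 hM.odd).pow_left k
    exact hc.dvd_of_dvd_mul_left (orderOf_dvd_of_pow_eq_one h1)
  have h4 := orderOf_dvd_iff_pow_eq_one.1 h3
  calc u ^ M = u ^ (M - 1 + 1) := by congr 1; omega
    _ = u := by rw [pow_succ, h4, one_mul]

theorem pow_pred_idem {a : E} (ha : a ^ M = a) : a ^ (M - 1) * a ^ (M - 1) = a ^ (M - 1) := by
  have hM1 := hM.two_lt
  rw [← pow_add]
  have : M - 1 + (M - 1) = M + (M - 2) := by omega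
  rw [this, pow_add, ha, ← pow_succ']
  congr 1; omega

theorem mul_pow_pred {a : E} (ha : a ^ M = a) : a * a ^ (M - 1) = a := by
  have hM1 := hM.two_lt
  rw [← pow_succ', show M - 1 + 1 = M by omega, ha]

end SSPow

/-- A similitude `s` together with a `2`-group `P` of similitudes commuting with it. -/
structure Frame (F E : Type) [Field F] [Ring E] [Algebra F E] where
  /-- the anti-involution -/
  σ : AntiInv F E
  /-- the exponent extracting semisimple parts -/
  M : ℕ
  hM : SSPow F E M
  /-- the similitude -/
  s : Eˣ
  /-- the `2`-group -/
  P : Subgroup Eˣ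
  two : (2 : F) ≠ 0
  s_sim : ∃ c : F, c ≠ 0 ∧ σ s = c • (↑s⁻¹ : E)
  P_sim : ∀ p ∈ P, ∃ c : F, c ≠ 0 ∧ σ p = c • (↑p⁻¹ : E)
  P_two : ∀ p ∈ P, ∃ k : ℕ, p ^ 2 ^ k = 1
  P_s : ∀ p ∈ P, p * s = s * p

namespace Frame

variable {F E : Type} [Field F] [Ring E] [Algebra F E] (D : Frame F E)

/-- Semisimple commutative subalgebras stable under all the data. -/
structure Good (S : Subalgebra F E) : Prop where
  comm : ∀ a ∈ S, ∀ b ∈ S, a * b = b * a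
  ss : ∀ a ∈ S, a ^ D.M = a
  star : ∀ a ∈ S, D.σ a ∈ S
  conj : ∀ p ∈ D.P, ∀ a ∈ S, cj F p a ∈ S
  s_comm : ∀ a ∈ S, a * D.s = D.s * a

theorem good_bot : D.Good ⊥ := by
  have h : ∀ a ∈ (⊥ : Subalgebra F E), ∃ c : F, algebraMap F E c = a :=
    fun a ha => Algebra.mem_bot.1 ha
  refine ⟨?_, ?_, ?_, ?_, ?_⟩ <;> intro a ha
  · obtain ⟨c, rfl⟩ := h a ha
    exact fun b _ => Algebra.commutes c b
  · obtain ⟨c, rfl⟩ := h a ha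
    exact D.hM.scalar c
  · obtain ⟨c, rfl⟩ := h a ha
    simp
  · intro b hb
    obtain ⟨c, rfl⟩ := h b hb
    simp
  · obtain ⟨c, rfl⟩ := h a ha
    exact Algebra.commutes c _

variable {D}

theorem Good.adjoin {S : Subalgebra F E} (hS : D.Good S) {z : E}
    (hz : ∀ a ∈ S, z * a = a * z) (hzs : z * D.s = D.s * z) (hzM : z ^ D.M = z)
    (hzσ : D.σ z ∈ Algebra.adjoin F (insert z (S : Set E)))
    (hzP : ∀ p ∈ D.P, cj F p z ∈ Algebra.adjoin F (insert z (S : Set E))) :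
    D.Good (Algebra.adjoin F (insert z (S : Set E))) := by
  have hle : ∀ a ∈ S, a ∈ Algebra.adjoin F (insert z (S : Set E)) :=
    fun a ha => Algebra.subset_adjoin (Set.mem_insert_of_mem _ ha)
  have hcomm : ∀ a ∈ Algebra.adjoin F (insert z (S : Set E)),
      ∀ b ∈ Algebra.adjoin F (insert z (S : Set E)), a * b = b * a := by
    intro a ha b hb
    refine Algebra.adjoin_induction₂ (R := F) (p := fun a b _ _ => a * b = b * a)
      ?_ ?_ ?_ ?_ ?_ ?_ ?_ ?_ ha hb
    · rintro x y (rfl | hx) (rfl | hy)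
      · rfl
      · exact hz _ hy
      · exact (hz _ hx).symm
      · exact hS.comm _ hx _ hy
    · intro r t; exact Algebra.commutes _ _
    · intro r x _; exact Algebra.commutes _ _
    · intro r x _; exact (Algebra.commutes _ _).symm
    · intro x y w _ _ _ h1 h2; rw [add_mul, mul_add, h1, h2]
    · intro x y w _ _ _ h1 h2; rw [add_mul, mul_add, h1, h2]
    · intro x y w _ _ _ h1 h2; rw [mul_assoc, h2, ← mul_assoc, h1, mul_assoc]
    · intro x y w _ _ _ h1 h2; rw [← mul_assoc, h1, mul_assoc, h2, mul_assoc]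
  refine ⟨hcomm, fun a ha => ?_, fun a ha => ?_, fun p hp a ha => ?_, fun a ha => ?_⟩
  · induction ha using Algebra.adjoin_induction with
    | mem x hx =>
      rcases hx with rfl | hx
      · exact hzM
      · exact hS.ss _ hx
    | algebraMap r => exact D.hM.scalar r
    | add x y hx hy h1 h2 => rw [D.hM.add _ _ (hcomm _ hx _ hy), h1, h2]
    | mul x y hx hy h1 h2 => rw [(show Commute x y from hcomm _ hx _ hy).mul_pow, h1, h2]
  · induction ha using Algebra.adjoin_induction with
    | mem x hx =>
      rcases hx with rfl | hx
      · exact hzσ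
      · exact hle _ (hS.star _ hx)
    | algebraMap r => simp
    | add x y hx hy h1 h2 => rw [D.σ.map_add]; exact add_mem h1 h2
    | mul x y hx hy h1 h2 => rw [D.σ.map_mul]; exact mul_mem h2 h1
  · induction ha using Algebra.adjoin_induction with
    | mem x hx =>
      rcases hx with rfl | hx
      · exact hzP p hp
      · exact hle _ (hS.conj p hp _ hx)
    | algebraMap r => simp
    | add x y hx hy h1 h2 => rw [_root_.map_add]; exact add_mem h1 h2
    | mul x y hx hy h1 h2 => rw [_root_.map_mul]; exact mul_mem h1 h2
  · induction ha using Algebra.adjoin_induction with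
    | mem x hx =>
      rcases hx with rfl | hx
      · exact hzs
      · exact hS.s_comm _ hx
    | algebraMap r => exact Algebra.commutes r _
    | add x y hx hy h1 h2 => rw [add_mul, mul_add, h1, h2]
    | mul x y hx hy h1 h2 => rw [mul_assoc, h2, ← mul_assoc, h1, mul_assoc]

/-- The number of involutions (including the identity) in a subalgebra. -/
def ninv (S : Subalgebra F E) : ℕ := Nat.card {u : E // u ∈ S ∧ u * u = 1}

variable (D)

theorem exists_maximal [Finite E] : ∃ A : Subalgebra F E, D.Good A ∧
    (∀ S, D.Good S → A ≤ S → S ≤ A) ∧ ∀ S, D.Good S → ninv S ≤ ninv A := by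
  have : Finite (Subalgebra F E) := Finite.of_injective _ SetLike.coe_injective
  have hmono : ∀ S T : Subalgebra F E, S ≤ T → ninv S ≤ ninv T := fun S T h =>
    Nat.card_le_card_of_injective (fun u => (⟨u.1, h u.2.1, u.2.2⟩ : {u : E // u ∈ T ∧ u * u = 1}))
      (fun u v huv => Subtype.ext (congrArg (fun w => w.1) huv))
  obtain ⟨B, hB, hBmax⟩ := Set.exists_max_image {S | D.Good S} ninv (Set.toFinite _)
    ⟨⊥, D.good_bot⟩
  obtain ⟨A, hA⟩ := (Set.toFinite {S | D.Good S ∧ ninv B ≤ ninv S}).exists_maximal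
    ⟨B, hB, le_rfl⟩
  refine ⟨A, hA.1.1, fun S hS hAS => hA.2 ⟨hS, hA.1.2.trans (hmono _ _ hAS)⟩ hAS,
    fun S hS => (hBmax S hS).trans hA.1.2⟩

end Frame

section FiniteFields

variable {K : Type} [Field K] [Finite K]

theorem finiteField_ringHom_comm (f g : K →+* K) (x : K) : f (g x) = g (f x) := by
  rcases eq_or_ne x 0 with rfl | hx
  · simp
  obtain ⟨ζ, hζ⟩ := IsCyclic.exists_generator (α := Kˣ)
  have hpow : ∀ f : K →+* K, ∃ k : ℤ, ∀ u : Kˣ, Units.map (f : K →* K) u = u ^ k := by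
    intro f
    obtain ⟨k, hk⟩ := hζ (Units.map (f : K →* K) ζ)
    refine ⟨k, fun u => ?_⟩
    obtain ⟨m, rfl⟩ := hζ u
    simp only at hk ⊢
    rw [map_zpow, ← hk, ← _root_.zpow_mul, ← _root_.zpow_mul, mul_comm]
  obtain ⟨k, hk⟩ := hpow f
  obtain ⟨l, hl⟩ := hpow g
  have h : Units.map (f : K →* K) (Units.map (g : K →* K) (Units.mk0 x hx)) =
      Units.map (g : K →* K) (Units.map (f : K →* K) (Units.mk0 x hx)) := by
    rw [hk, hl, hk, hl, ← _root_.zpow_mul, ← _root_.zpow_mul, mul_comm]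
  exact congrArg Units.val h

theorem nonsquare_mul_nonsquare (h2 : (2 : K) ≠ 0) {a b : K} (ha : ¬ IsSquare a)
    (hb : ¬ IsSquare b) : IsSquare (a * b) := by
  have := Fintype.ofFinite K
  have hchar : ringChar K ≠ 2 := by
    intro h
    have h3 := ringChar.Nat.cast_ringChar (R := K)
    rw [h] at h3
    exact h2 (by exact_mod_cast h3)
  have ha' := (quadraticChar_neg_one_iff_not_isSquare (F := K)).2 ha
  have hb' := (quadraticChar_neg_one_iff_not_isSquare (F := K)).2 hb
  by_contra hab
  have hab' := (quadraticChar_neg_one_iff_not_isSquare (F := K)).2 hab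
  rw [map_mul, ha', hb'] at hab'
  norm_num at hab'

theorem Subfield.exists_sq (L : Subfield K) (h2 : (2 : K) ≠ 0) {a b : K} (haL : a ∈ L)
    (hbL : b ∈ L) (ha : ∀ t ∈ L, t * t ≠ a) (hb : ∀ t ∈ L, t * t ≠ b) :
    ∃ t ∈ L, t * t = a * b := by
  have h2' : (2 : L) ≠ 0 := fun h => h2 (by
    have h' := congrArg L.subtype h
    rwa [map_ofNat, _root_.map_zero] at h')
  obtain ⟨t, ht⟩ := nonsquare_mul_nonsquare h2' (a := (⟨a, haL⟩ : L)) (b := ⟨b, hbL⟩)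
    (by rintro ⟨t, ht⟩; exact ha t t.2 (congrArg Subtype.val ht).symm)
    (by rintro ⟨t, ht⟩; exact hb t t.2 (congrArg Subtype.val ht).symm)
  exact ⟨t, t.2, (congrArg Subtype.val ht).symm⟩

theorem ne_neg_self (h2 : (2 : K) ≠ 0) {θ : K} (h0 : θ ≠ 0) : θ ≠ -θ := by
  intro h
  have h3 : (2 : K) * θ = 0 := by linear_combination h
  exact (mul_ne_zero h2 h0) h3

/-- If `θ` is negated by `γ`, every fixed element of `γ` is a square. -/
theorem exists_sqrt_of_skew (h2 : (2 : K) ≠ 0) (γ : K →+* K) {θ y : K} (h0 : θ ≠ 0)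
    (hθ : γ θ = -θ) (hy : γ y = y) : ∃ ρ, ρ * ρ = y ∧ (γ ρ = ρ ∨ γ ρ = -ρ) := by
  let L := RingHom.eqLocusField γ (RingHom.id K)
  by_cases hs : ∃ t ∈ L, t * t = y
  · obtain ⟨t, ht, hty⟩ := hs
    exact ⟨t, hty, Or.inl ht⟩
  push Not at hs
  have hν : ∀ t ∈ L, t * t ≠ θ * θ := by
    intro t ht htt
    have hγt : γ t = t := ht
    rcases mul_self_eq_mul_self_iff.1 htt with h | h
    · rw [h, hθ] at hγt
      exact ne_neg_self h2 h0 hγt.symm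
    · rw [h, map_neg, hθ] at hγt
      exact ne_neg_self h2 h0 (by simpa using hγt)
  obtain ⟨t, ht, htt⟩ := L.exists_sq h2 (a := y) (b := θ * θ) hy
    (show γ (θ * θ) = θ * θ by rw [map_mul, hθ, neg_mul_neg]) hs hν
  have hγt : γ t = t := ht
  refine ⟨t / θ, ?_, Or.inr ?_⟩
  · rw [div_mul_div_comm, htt, mul_div_assoc, div_self (mul_ne_zero h0 h0), mul_one]
  · rw [map_div₀, hθ, hγt, div_neg]

theorem exists_skew_of_four (h2 : (2 : K) ≠ 0) (γ : K →+* K) (h4 : ∀ x, γ (γ (γ (γ x))) = x)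
    (hne : ∃ x, γ (γ x) ≠ x) : ∃ θ, θ ≠ 0 ∧ γ θ = -θ := by
  obtain ⟨x, hx⟩ := hne
  set α := x - γ (γ x) with hα
  have hα0 : α ≠ 0 := sub_ne_zero.2 (Ne.symm hx)
  have hαδ : γ (γ α) = -α := by rw [hα]; simp [h4]
  set ζ := γ α / α with hζ
  have hζα : γ α = ζ * α := by rw [hζ, div_mul_cancel₀ _ hα0]
  have hζζ : γ ζ * ζ = -1 := by
    have h := hαδ
    rw [hζα, map_mul, hζα] at h
    have h3 : (γ ζ * ζ + 1) * α = 0 := by linear_combination h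
    rcases mul_eq_zero.1 h3 with h | h
    · linear_combination h
    · exact absurd h hα0
  have hν : γ (α * α) = ζ * ζ * (α * α) := by rw [map_mul, hζα]; ring
  have hνδ : γ (γ (α * α)) = α * α := by rw [map_mul, map_mul, hαδ]; ring
  refine ⟨α * α - γ (α * α), ?_, by rw [map_sub, hνδ]; ring⟩
  intro h
  rw [hν] at h
  have h5 : (1 - ζ * ζ) * (α * α) = 0 := by linear_combination h
  rcases mul_eq_zero.1 h5 with h | h
  · have h6 : ζ * ζ = 1 := by linear_combination -h
    rcases mul_self_eq_one_iff.1 h6 with h7 | h7 <;> rw [h7] at hζζ <;> simp at hζζ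
    all_goals
      apply h2
      linear_combination hζζ
  · exact (mul_ne_zero hα0 hα0) h

theorem involution_unique (h2 : (2 : K) ≠ 0) (f g : K →+* K) (hf : ∀ x, f (f x) = x)
    (hg : ∀ x, g (g x) = x) (hf1 : ∃ x, f x ≠ x) (hg1 : ∃ x, g x ≠ x) : f = g := by
  by_contra hfg
  have key : ∀ f g : K →+* K, (∀ x, f (f x) = x) → (∀ x, g (g x) = x) → (∃ x, f x ≠ x) →
      f ≠ g → ∃ ν, ν ≠ 0 ∧ f ν = -ν ∧ g ν = ν := by
    intro f g hf hg ⟨x, hx⟩ hfg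
    by_contra hcon
    push Not at hcon
    have hsk : ∀ θ, f θ = -θ → g θ = -θ := by
      intro θ hθ
      by_contra h
      refine hcon (θ + g θ) (fun h' => h (by linear_combination h')) ?_ ?_
      · rw [map_add, finiteField_ringHom_comm f g, hθ, map_neg]; ring
      · rw [map_add, hg]; ring
    have hx0 : x - f x ≠ 0 := sub_ne_zero.2 (Ne.symm hx)
    have hskx : f (x - f x) = -(x - f x) := by rw [map_sub, hf]; ring
    apply hfg
    ext y
    have h1 := hsk (y - f y) (by rw [map_sub, hf]; ring)
    have h3 : g (y + f y) = y + f y := by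
      have h4 := hsk ((y + f y) * (x - f x)) (by rw [map_mul, hskx, map_add, hf]; ring)
      rw [map_mul, hsk _ hskx] at h4
      have h5 : (g (y + f y) - (y + f y)) * (x - f x) = 0 := by linear_combination -h4
      rcases mul_eq_zero.1 h5 with h | h
      · linear_combination h
      · exact absurd h hx0
    rw [map_sub] at h1
    rw [map_add] at h3
    have h6 : (2 : K) * (f y - g y) = 0 := by linear_combination -h1 - h3
    rcases mul_eq_zero.1 h6 with h | h
    · exact absurd h h2
    · linear_combination h
  obtain ⟨ν, hν0, hν1, hν2⟩ := key f g hf hg hf1 hfg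
  obtain ⟨κ, hκ0, hκ1, hκ2⟩ := key g f hg hf hg1 (Ne.symm hfg)
  obtain ⟨ρ, hρ, hρ'⟩ := exists_sqrt_of_skew h2 (f.comp g) (θ := ν) (y := (ν * κ) * (ν * κ)) hν0
    (by simp [hν1, hν2]) (by simp [hν1, hν2, hκ1, hκ2])
  let L : Subfield K := RingHom.eqLocusField f (RingHom.id K) ⊓ RingHom.eqLocusField g (RingHom.id K)
  have hmem : ∀ t, t ∈ L ↔ f t = t ∧ g t = t := fun t => Iff.rfl
  have hn : ∀ f : K →+* K, ∀ ν, ν ≠ 0 → f ν = -ν → ∀ t, f t = t → t * t ≠ ν * ν := by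
    intro f ν hν0 hν t ht htt
    rcases mul_self_eq_mul_self_iff.1 htt with h | h
    · rw [h, hν] at ht
      exact ne_neg_self h2 hν0 ht.symm
    · rw [h, map_neg, hν] at ht
      exact ne_neg_self h2 hν0 (by simpa using ht)
  obtain ⟨t, ht, htt⟩ := L.exists_sq h2 (a := ν * ν) (b := κ * κ)
    ((hmem _).2 (by simp [hν1, hν2])) ((hmem _).2 (by simp [hκ1, hκ2]))
    (fun t ht => hn f ν hν0 hν1 t ht.1) (fun t ht => hn g κ hκ0 hκ1 t ht.2)
  exact hn f (ν * κ) (mul_ne_zero hν0 hκ0) (by simp [hν1, hκ2]) t ht.1 (by rw [htt]; ring)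

/-- The norm of a quadratic extension of finite fields is surjective. -/
theorem finiteField_exists_norm (h2 : (2 : K) ≠ 0) (f : K →+* K) (hf : ∀ x, f (f x) = x)
    (hf1 : ∃ x, f x ≠ x) {m : K} (hm : f m = m) : ∃ r, r * f r = m := by
  obtain ⟨x, hx⟩ := hf1
  set θ := x - f x with hθ
  have hθ0 : θ ≠ 0 := sub_ne_zero.2 (Ne.symm hx)
  have hθf : f θ = -θ := by rw [hθ, map_sub, hf]; ring
  let L := RingHom.eqLocusField f (RingHom.id K)
  have := Fintype.ofFinite L
  have hcard : Fintype.card L % 2 = 1 := by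
    refine FiniteField.odd_card_of_char_ne_two fun h => ?_
    have h3 := ringChar.Nat.cast_ringChar (R := L)
    rw [h] at h3
    have h' := congrArg L.subtype h3
    rw [map_natCast, _root_.map_zero] at h'
    exact h2 (by exact_mod_cast h')
  let ν : L := ⟨θ * θ, show f (θ * θ) = θ * θ by rw [map_mul, hθf, neg_mul_neg]⟩
  have hν0 : -ν ≠ 0 := neg_ne_zero.2
    fun h => mul_ne_zero hθ0 hθ0 (congrArg Subtype.val h)
  obtain ⟨a, b, hab⟩ := FiniteField.exists_root_sum_quadratic
    (f := Polynomial.X ^ 2 - Polynomial.C (⟨m, hm⟩ : L))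
    (g := Polynomial.C (-ν) * Polynomial.X ^ 2)
    (Polynomial.degree_X_pow_sub_C (by norm_num) _)
    (Polynomial.degree_C_mul_X_pow 2 hν0) hcard
  refine ⟨a + b * θ, ?_⟩
  have ha : f a = a := a.2
  have hb : f b = b := b.2
  have hab' : (a : K) ^ 2 - m + -(θ * θ) * (b : K) ^ 2 = 0 := by
    simpa [ν] using congrArg Subtype.val hab
  rw [map_add, map_mul, ha, hb, hθf]
  linear_combination hab'

end FiniteFields

/-- The idempotent attached to an involution. -/
def ee (F : Type) {E : Type} [Field F] [Ring E] [Algebra F E] (w : E) : E := (2 : F)⁻¹ • (1 + w)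

section ee

variable {F E : Type} [Field F] [Ring E] [Algebra F E]

theorem ee_mul_self (h2 : (2 : F) ≠ 0) {w : E} (hw : w * w = 1) : ee F w * ee F w = ee F w := by
  have h : (1 + w) * (1 + w) = (2 : F) • (1 + w) := by
    rw [two_smul, add_mul, mul_add, mul_add, hw]; simp; abel
  rw [ee, smul_mul_smul_comm, h, smul_smul, mul_assoc, inv_mul_cancel₀ h2, mul_one]

theorem ee_one (h2 : (2 : F) ≠ 0) : ee F (1 : E) = 1 := by
  rw [ee, ← two_smul F (1 : E), smul_smul, inv_mul_cancel₀ h2, one_smul]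

theorem ee_add_neg (h2 : (2 : F) ≠ 0) (w : E) : ee F w + ee F (-w) = 1 := by
  rw [ee, ee, ← smul_add, show (1 + w + (1 + -w)) = (2 : F) • (1 : E) by rw [two_smul]; abel,
    smul_smul, inv_mul_cancel₀ h2, one_smul]

theorem ee_mul_neg (h2 : (2 : F) ≠ 0) {w : E} (hw : w * w = 1) : ee F w * ee F (-w) = 0 := by
  have := ee_add_neg h2 w
  rw [← eq_sub_iff_add_eq'] at this
  rw [this, mul_sub, mul_one, ee_mul_self h2 hw, sub_self]

theorem eq_ee (h2 : (2 : F) ≠ 0) (w : E) : w = (2 : F) • ee F w - 1 := by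
  rw [ee, smul_smul, mul_inv_cancel₀ h2]; simp

theorem ee_mem (A : Subalgebra F E) {w : E} (hw : w ∈ A) : ee F w ∈ A :=
  A.smul_mem (add_mem (one_mem _) hw) _

theorem eq_zero_of_self_eq_neg (h2 : (2 : F) ≠ 0) {x : E} (h : x = -x) : x = 0 := by
  have : (2 : F) • x = 0 := by rw [two_smul]; nth_rewrite 1 [h]; simp
  simpa [h2] using this

end ee

namespace Frame

variable {F E : Type} [Field F] [Ring E] [Algebra F E]

/-- A maximal good subalgebra with only trivial symmetric involutions. -/
structure Prim (D : Frame F E) (A : Subalgebra F E) (w : E) : Prop where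
  good : D.Good A
  max : ∀ S, D.Good S → A ≤ S → S ≤ A
  inv : ∀ S, D.Good S → ninv S ≤ ninv A
  w_mem : w ∈ A
  w_sq : w * w = 1
  w_cases : w = 1 ∨ D.σ w = -w
  invs : ∀ u ∈ A, u * u = 1 → u = 1 ∨ u = -1 ∨ u = w ∨ u = -w

theorem exists_prim {D : Frame F E} {A : Subalgebra F E} (good : D.Good A)
    (max : ∀ S, D.Good S → A ≤ S → S ≤ A) (inv : ∀ S, D.Good S → ninv S ≤ ninv A)
    (hs : ∀ u ∈ A, u * u = 1 → D.σ u = u → u = 1 ∨ u = -1) : ∃ w, D.Prim A w := by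
  have key : ∀ u ∈ A, u * u = 1 → D.σ u = u ∨ D.σ u = -u := by
    intro u hu huu
    have h1 := good.star u hu
    have h3 : D.σ u * D.σ u = 1 := by rw [← D.σ.map_mul, huu, D.σ.map_one]
    have h4 : u * D.σ u * (u * D.σ u) = 1 := by
      rw [mul_assoc, ← mul_assoc (D.σ u), good.comm _ h1 _ hu, mul_assoc, h3, mul_one, huu]
    have h5 : D.σ u = u * (u * D.σ u) := by rw [← mul_assoc, huu, one_mul]
    rcases hs _ (mul_mem hu h1) h4 (by simp) with h | h <;> rw [h] at h5
    · left; simpa using h5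
    · right; simpa using h5
  by_cases hsk : ∃ w ∈ A, w * w = 1 ∧ D.σ w = -w
  · obtain ⟨w, hw, hww, hσ⟩ := hsk
    refine ⟨w, good, max, inv, hw, hww, Or.inr hσ, fun u hu huu => ?_⟩
    rcases key u hu huu with h | h
    · rcases hs u hu huu h with h | h <;> simp [h]
    · have hc := good.comm _ hu _ hw
      have h5 : u = (u * w) * w := by rw [mul_assoc, hww, mul_one]
      rcases hs (u * w) (mul_mem hu hw)
        (by rw [mul_assoc, ← mul_assoc w, ← hc, mul_assoc, hww, mul_one, huu])
        (by rw [D.σ.map_mul, h, hσ, neg_mul_neg, ← hc]) with h | h <;> rw [h] at h5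
      · right; right; left; simpa using h5
      · right; right; right; simpa using h5
  · push Not at hsk
    refine ⟨1, good, max, inv, one_mem _, one_mul 1, Or.inl rfl, fun u hu huu => ?_⟩
    rcases key u hu huu with h | h
    · rcases hs u hu huu h with h | h <;> simp [h]
    · exact absurd h (hsk u hu huu)

namespace Prim

variable {D : Frame F E} {A : Subalgebra F E} {w : E} (h : D.Prim A w)
include h

theorem neg (hw : D.σ w = -w) : D.Prim A (-w) where
  good := h.good
  max := h.max
  inv := h.inv
  w_mem := neg_mem h.w_mem
  w_sq := by rw [neg_mul_neg, h.w_sq]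
  w_cases := Or.inr (by rw [D.σ.map_neg, hw])
  invs := fun u hu huu => by
    rcases h.invs u hu huu with h | h | h | h <;> simp [h]

theorem mem_of {z : E} (hz : ∀ a ∈ A, z * a = a * z) (hzs : z * D.s = D.s * z)
    (hzM : z ^ D.M = z) (hzσ : D.σ z ∈ Algebra.adjoin F (insert z (A : Set E)))
    (hzP : ∀ p ∈ D.P, cj F p z ∈ Algebra.adjoin F (insert z (A : Set E))) : z ∈ A := by
  refine h.max _ (h.good.adjoin hz hzs hzM hzσ hzP) ?_
    (Algebra.subset_adjoin (Set.mem_insert _ _))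
  exact fun a ha => Algebra.subset_adjoin (Set.mem_insert_of_mem _ ha)

theorem mem_of_fixed {z : E} (hz : ∀ a ∈ A, z * a = a * z) (hzs : z * D.s = D.s * z)
    (hzM : z ^ D.M = z) (hzσ : D.σ z = z ∨ D.σ z = -z)
    (hzP : ∀ p ∈ D.P, cj F p z = z) : z ∈ A := by
  have hmem : z ∈ Algebra.adjoin F (insert z (A : Set E)) :=
    Algebra.subset_adjoin (Set.mem_insert _ _)
  refine h.mem_of hz hzs hzM ?_ fun p hp => by rw [hzP p hp]; exact hmem
  rcases hzσ with h | h <;> rw [h]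
  · exact hmem
  · exact neg_mem hmem

theorem w_eq_one_of_symm (hσ : D.σ w = w) : w = 1 := by
  rcases h.w_cases with h1 | h1
  · exact h1
  · rw [h1] at hσ
    have := eq_zero_of_self_eq_neg D.two hσ.symm
    have h3 := h.w_sq
    rw [this, zero_mul] at h3
    rw [← mul_one w, ← h3, mul_zero]

theorem symm_inv {u : E} (hu : u ∈ A) (huu : u * u = 1) (hσ : D.σ u = u) : u = 1 ∨ u = -1 := by
  rcases h.invs u hu huu with rfl | rfl | rfl | rfl
  · simp
  · simp
  · exact Or.inl (h.w_eq_one_of_symm hσ)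
  · right
    rw [h.w_eq_one_of_symm (by simpa using hσ)]

theorem idem {g : E} (hg : g ∈ A) (hgg : g * g = g) :
    g = 0 ∨ g = 1 ∨ g = ee F w ∨ g = ee F (-w) := by
  have h2 := D.two
  have hg' : g = (2 : F)⁻¹ • (1 + ((2 : F) • g - 1)) := by simp [smul_smul, h2]
  have key := h.invs ((2 : F) • g - 1) (sub_mem (A.smul_mem hg _) (one_mem _)) (by
    rw [sub_mul, mul_sub, smul_mul_smul_comm, hgg, mul_smul]; simp [two_smul])
  rcases key with h | h | h | h <;> rw [h] at hg'
  · right; left; rw [hg', ← ee, ee_one h2]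
  · left; rw [hg']; simp
  · right; right; left; rw [hg', ee]
  · right; right; right; rw [hg', ee]

theorem symm_idem {g : E} (hg : g ∈ A) (hgg : g * g = g) (hσ : D.σ g = g) : g = 0 ∨ g = 1 := by
  have h2 := D.two
  have hg' : g = (2 : F)⁻¹ • (1 + ((2 : F) • g - 1)) := by simp [smul_smul, h2]
  have key := h.symm_inv (u := (2 : F) • g - 1) (sub_mem (A.smul_mem hg _) (one_mem _)) (by
    rw [sub_mul, mul_sub, smul_mul_smul_comm, hgg, mul_smul]; simp [two_smul])
    (by simp [hσ])
  rcases key with h | h <;> rw [h] at hg'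
  · right; rw [hg', ← ee, ee_one h2]
  · left; rw [hg']; simp

theorem unit_of_symm {a : E} (ha : a ∈ A) (hσ : D.σ a = a ∨ D.σ a = -a) :
    a = 0 ∨ a ^ (D.M - 1) = 1 := by
  have hM := D.hM
  have haM := h.good.ss a ha
  have hev : Even (D.M - 1) := hM.odd.tsub_odd odd_one
  rcases h.symm_idem (pow_mem ha (D.M - 1)) (hM.pow_pred_idem haM)
    (by rw [D.σ.map_pow]; rcases hσ with hσ | hσ <;> rw [hσ]; exact hev.neg_pow a) with h1 | h1
  · left
    rw [← hM.mul_pow_pred haM, h1, mul_zero]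
  · exact Or.inr h1

theorem ee_mem' : ee F w ∈ A := ee_mem A h.w_mem

theorem ee_sq : ee F w * ee F w = ee F w := ee_mul_self D.two h.w_sq

theorem ee_mul_ee_neg : ee F w * ee F (-w) = 0 := ee_mul_neg D.two h.w_sq

theorem corner_unit {a : E} (ha : a ∈ A) (hea : ee F w * a = a) :
    a = 0 ∨ a ^ (D.M - 1) = ee F w := by
  have hM := D.hM
  have haM := h.good.ss a ha
  have hM1 := hM.two_lt
  have h1 : ee F w * a ^ (D.M - 1) = a ^ (D.M - 1) := by
    obtain ⟨m, hm⟩ : ∃ m, D.M - 1 = m + 1 := ⟨D.M - 2, by omega⟩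
    rw [hm, pow_succ', ← mul_assoc, hea]
  have hz : a ^ (D.M - 1) = 0 → a = 0 := fun h0 => by
    rw [← hM.mul_pow_pred haM, h0, mul_zero]
  rcases h.idem (pow_mem ha (D.M - 1)) (hM.pow_pred_idem haM) with h0 | h0 | h0 | h0
  · exact Or.inl (hz h0)
  · rw [h0, mul_one] at h1
    right; rw [h0, h1]
  · exact Or.inr h0
  · rw [h0, h.ee_mul_ee_neg] at h1
    exact Or.inl (hz (by rw [h0, h1]))

theorem ee_ne_zero [Nontrivial E] : ee F w ≠ 0 := by
  intro h0
  have h1 := eq_ee D.two w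
  rw [h0, smul_zero, zero_sub] at h1
  rcases h.w_cases with h3 | h3
  · rw [h3] at h1
    exact one_ne_zero (eq_zero_of_self_eq_neg D.two h1)
  · rw [h1] at h3
    simp only [AntiInv.map_neg, AntiInv.map_one, neg_neg] at h3
    exact one_ne_zero (eq_zero_of_self_eq_neg D.two h3.symm)

theorem sigma_cj {p : Eˣ} (hp : p ∈ D.P) (a : E) : D.σ (cj F p a) = cj F p (D.σ a) := by
  obtain ⟨c, hc, hpc⟩ := D.P_sim p hp
  exact D.σ.cj_sim hc hpc a

theorem cj_w [Nontrivial E] {p : Eˣ} (hp : p ∈ D.P) : cj F p w = w ∨ (cj F p w = -w ∧ D.σ w = -w) := by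
  rcases h.w_cases with h1 | h1
  · left; rw [h1, _root_.map_one]
  have h3 : D.σ (cj F p w) = -cj F p w := by rw [h.sigma_cj hp, h1, _root_.map_neg]
  rcases h.invs _ (h.good.conj p hp _ h.w_mem) (by rw [← _root_.map_mul, h.w_sq, _root_.map_one])
    with h0 | h0 | h0 | h0
  · rw [h0, D.σ.map_one] at h3
    exact absurd (eq_zero_of_self_eq_neg D.two h3) one_ne_zero
  · rw [h0, D.σ.map_neg, D.σ.map_one, neg_neg] at h3
    exact absurd (eq_zero_of_self_eq_neg D.two h3.symm) one_ne_zero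
  · exact Or.inl h0
  · exact Or.inr ⟨h0, h1⟩

end Prim

end Frame

namespace Frame.Prim

variable {F E : Type} [Field F] [Ring E] [Algebra F E]
variable {D : Frame F E} {A : Subalgebra F E} {w : E} (h : D.Prim A w)

/-- The field underlying a maximal good subalgebra. -/
def kk (h : D.Prim A w) : Subalgebra F E where
  carrier := {a | a ∈ A ∧ (w = 1 ∨ D.σ a = a)}
  mul_mem' := by
    rintro a b ⟨ha, ha'⟩ ⟨hb, hb'⟩
    refine ⟨mul_mem ha hb, ?_⟩
    rcases ha' with h1 | ha'
    · exact Or.inl h1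
    rcases hb' with h1 | hb'
    · exact Or.inl h1
    right; rw [D.σ.map_mul, ha', hb', h.good.comm _ ha _ hb]
  add_mem' := by
    rintro a b ⟨ha, ha'⟩ ⟨hb, hb'⟩
    refine ⟨add_mem ha hb, ?_⟩
    rcases ha' with h1 | ha'
    · exact Or.inl h1
    rcases hb' with h1 | hb'
    · exact Or.inl h1
    right; rw [D.σ.map_add, ha', hb']
  algebraMap_mem' := fun c => ⟨A.algebraMap_mem c, Or.inr (D.σ.map_algebraMap c)⟩

theorem kk_le {a : E} (ha : a ∈ h.kk) : a ∈ A := ha.1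

include h in
theorem w_skew (h1 : w ≠ 1) : D.σ w = -w := h.w_cases.resolve_left h1

include h in
theorem sigma_ee (h1 : w ≠ 1) : D.σ (ee F w) = ee F (-w) := by
  simp [ee, h.w_skew h1]

include h in
theorem sigma_ee_neg (h1 : w ≠ 1) : D.σ (ee F (-w)) = ee F w := by
  simp [ee, h.w_skew h1]

theorem kk_conj {p : Eˣ} (hp : p ∈ D.P) {a : E} (ha : a ∈ h.kk) : cj F p a ∈ h.kk := by
  refine ⟨h.good.conj p hp _ ha.1, ?_⟩
  rcases ha.2 with h1 | h1
  · exact Or.inl h1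
  · right; rw [h.sigma_cj hp, h1]

theorem kk_unit {a : E} (ha : a ∈ h.kk) : a = 0 ∨ a ^ (D.M - 1) = 1 := by
  rcases ha.2 with h1 | h1
  · subst h1
    have := h.corner_unit (a := a) ha.1 (by rw [ee_one D.two, one_mul])
    rwa [ee_one D.two] at this
  · exact h.unit_of_symm ha.1 (Or.inl h1)

include h in
theorem ee_neg_eq_zero (h1 : w = 1) : ee F (-w) = 0 := by
  rw [h1, ee, add_neg_cancel, smul_zero]

theorem exists_kk {a : E} (ha : a ∈ A) : ∃ k ∈ h.kk, ee F w * a = ee F w * k := by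
  by_cases h1 : w = 1
  · exact ⟨a, ⟨ha, Or.inl h1⟩, rfl⟩
  · refine ⟨ee F w * a + D.σ (ee F w * a), ⟨?_, Or.inr ?_⟩, ?_⟩
    · exact add_mem (mul_mem h.ee_mem' ha) (h.good.star _ (mul_mem h.ee_mem' ha))
    · rw [D.σ.map_add, D.σ.invol, add_comm]
    · rw [D.σ.map_mul, h.sigma_ee h1, h.good.comm _ (h.good.star _ ha) _
        (ee_mem A (neg_mem h.w_mem)), mul_add, ← mul_assoc, ← mul_assoc, h.ee_sq, h.ee_mul_ee_neg,
        zero_mul, add_zero]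

theorem exists_kk_neg {a : E} (ha : a ∈ A) : ∃ k ∈ h.kk, ee F (-w) * a = ee F (-w) * k := by
  by_cases h1 : w = 1
  · exact ⟨0, zero_mem _, by rw [h.ee_neg_eq_zero h1, zero_mul, zero_mul]⟩
  · obtain ⟨k, hk, hak⟩ := (h.neg (h.w_skew h1)).exists_kk ha
    rcases hk.2 with h2 | h2
    · have h4 : w = -1 := by rw [← h2, neg_neg]
      have h5 := h.w_skew h1
      rw [h4, D.σ.map_neg, D.σ.map_one, neg_neg] at h5
      exact absurd (h4.trans h5) h1
    · exact ⟨k, ⟨hk.1, Or.inr h2⟩, hak⟩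

theorem decomp {a : E} (ha : a ∈ A) : ∃ k ∈ h.kk, ∃ l ∈ h.kk, a = ee F w * k + ee F (-w) * l := by
  obtain ⟨k, hk, h1⟩ := h.exists_kk ha
  obtain ⟨l, hl, h2⟩ := h.exists_kk_neg ha
  refine ⟨k, hk, l, hl, ?_⟩
  rw [← h1, ← h2, ← add_mul, ee_add_neg D.two, one_mul]

variable [Nontrivial E]

theorem kk_isField : IsField h.kk where
  exists_pair_ne := ⟨0, 1, zero_ne_one⟩
  mul_comm := fun a b => Subtype.ext (h.good.comm _ a.2.1 _ b.2.1)
  mul_inv_cancel := fun {a} ha => ⟨a ^ (D.M - 2), Subtype.ext (by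
    have h1 := (h.kk_unit a.2).resolve_left (fun h0 => ha (Subtype.ext h0))
    have := D.hM.two_lt
    change (a : E) * (a : E) ^ (D.M - 2) = 1
    rw [← pow_succ', show D.M - 2 + 1 = D.M - 1 by omega, h1])⟩

theorem kk_cancel {k : E} (hk : k ∈ h.kk) (h0 : ee F w * k = 0) : k = 0 := by
  refine (h.kk_unit hk).resolve_right fun h1 => h.ee_ne_zero ?_
  have := D.hM.two_lt
  rw [← mul_one (ee F w), ← h1, show D.M - 1 = D.M - 2 + 1 by omega, pow_succ', ← mul_assoc, h0,
    zero_mul]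

/-- Conjugation on the field. -/
def cjK (p : Eˣ) (hp : p ∈ D.P) : h.kk →+* h.kk :=
  ((cj F p : E →ₐ[F] E) : E →+* E).restrict h.kk h.kk (fun _ ha => h.kk_conj hp ha)

theorem cjK_coe (p : Eˣ) (hp : p ∈ D.P) (a : h.kk) : (h.cjK p hp a : E) = cj F p a := rfl

variable [Finite E]

include h in
theorem cj_comm {p r : Eˣ} (hp : p ∈ D.P) (hr : r ∈ D.P) {a : E} (ha : a ∈ A) :
    cj F p (cj F r a) = cj F r (cj F p a) := by
  let := h.kk_isField.toField
  have hk : ∀ k ∈ h.kk, cj F p (cj F r k) = cj F r (cj F p k) := fun k hk =>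
    congrArg Subtype.val (finiteField_ringHom_comm (h.cjK p hp) (h.cjK r hr) ⟨k, hk⟩)
  have hw : cj F p (cj F r w) = cj F r (cj F p w) := by
    rcases h.cj_w hp with h1 | ⟨h1, -⟩ <;> rcases h.cj_w hr with h2 | ⟨h2, -⟩ <;> simp [h1, h2]
  obtain ⟨k, hk1, l, hl, rfl⟩ := h.decomp ha
  simp [ee, hk k hk1, hk l hl, hw]

theorem exists_sqrt {p : Eˣ} (hp : p ∈ D.P) {θ y : E} (hθ : θ ∈ h.kk) (hy : y ∈ h.kk) (h0 : θ ≠ 0)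
    (h1 : cj F p θ = -θ) (h2 : cj F p y = y) :
    ∃ ρ ∈ h.kk, ρ * ρ = y ∧ (cj F p ρ = ρ ∨ cj F p ρ = -ρ) := by
  let := h.kk_isField.toField
  obtain ⟨ρ, hρ, hρ'⟩ := exists_sqrt_of_skew (K := h.kk) (fun h3 => D.two (by
      have h4 := congrArg Subtype.val h3
      have h5 : algebraMap F E 2 = 0 := by rw [map_ofNat]; exact h4
      simpa using h5)) (h.cjK p hp) (θ := ⟨θ, hθ⟩)
    (y := ⟨y, hy⟩) (fun h3 => h0 (congrArg Subtype.val h3)) (Subtype.ext h1) (Subtype.ext h2)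
  refine ⟨ρ, ρ.2, congrArg Subtype.val hρ, ?_⟩
  rcases hρ' with h3 | h3
  · exact Or.inl (congrArg Subtype.val h3)
  · exact Or.inr (congrArg Subtype.val h3)

end Frame.Prim

/-- A `2`-group acting on a nontrivial coset space of a `2`-group fixes a nontrivial coset. -/
theorem exists_fixed_coset {G : Type} [Group G] [Finite G] (P I K : Subgroup G)
    (hP : ∀ p ∈ P, ∃ k : ℕ, p ^ 2 ^ k = 1) (hI : ∀ p ∈ I, ∃ k : ℕ, p ^ 2 ^ k = 1)
    (hne : ¬ I ≤ K) (hPI : ∀ p ∈ P, ∀ u ∈ I, p * u * p⁻¹ ∈ I)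
    (hPK : ∀ p ∈ P, ∀ u ∈ K, p * u * p⁻¹ ∈ K) :
    ∃ u ∈ I, u ∉ K ∧ ∀ p ∈ P, u⁻¹ * (p * u * p⁻¹) ∈ K := by
  let X := I ⧸ K.subgroupOf I
  let act : P → I → I := fun p u => ⟨p * u * p⁻¹, hPI p p.2 u u.2⟩
  let aX : P → X → X := fun p => Quotient.map' (act p) (by
    intro a b hab
    rw [QuotientGroup.leftRel_apply] at hab ⊢
    have h1 : (a : G)⁻¹ * b ∈ K := hab
    have h2 := hPK p p.2 _ h1
    change ((p : G) * a * (p : G)⁻¹)⁻¹ * (p * b * (p : G)⁻¹) ∈ K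
    convert h2 using 1
    group)
  have haX : ∀ p u, aX p (QuotientGroup.mk u : X) = (QuotientGroup.mk (act p u) : X) :=
    fun p u => rfl
  let : MulAction P X :=
    { smul := aX
      one_smul := by
        intro x
        induction x using QuotientGroup.induction_on with
        | H u =>
          change aX 1 _ = _
          rw [haX]
          congr 1
          exact Subtype.ext (by simp [act])
      mul_smul := by
        intro p r x
        induction x using QuotientGroup.induction_on with
        | H u =>
          change aX (p * r) _ = aX p (aX r _)
          rw [haX, haX, haX]
          congr 1
          exact Subtype.ext (by simp [act, mul_assoc]) }
  have hsm : ∀ (p : P) (u : I), p • (QuotientGroup.mk u : X) = QuotientGroup.mk (act p u) :=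
    fun p u => rfl
  have hPp : IsPGroup 2 P := fun p => by
    obtain ⟨k, hk⟩ := hP p p.2
    exact ⟨k, Subtype.ext hk⟩
  have hIp : IsPGroup 2 I := fun p => by
    obtain ⟨k, hk⟩ := hI p p.2
    exact ⟨k, Subtype.ext hk⟩
  have : Fact (Nat.Prime 2) := ⟨Nat.prime_two⟩
  obtain ⟨n, hn⟩ := IsPGroup.iff_card.1 hIp
  have hcard : 2 ∣ Nat.card X := by
    have h1 : Nat.card X ∣ 2 ^ n := hn ▸ Subgroup.card_quotient_dvd_card _
    obtain ⟨m, -, hm⟩ := (Nat.dvd_prime_pow Nat.prime_two).1 h1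
    rw [hm]
    refine dvd_pow_self 2 fun h0 => hne ?_
    rw [h0, pow_zero] at hm
    have : (K.subgroupOf I) = ⊤ := Subgroup.index_eq_one.1 hm
    exact Subgroup.subgroupOf_eq_top.1 this
  obtain ⟨y, hy, hne'⟩ := hPp.exists_fixed_point_of_prime_dvd_card_of_fixed_point X hcard
    (a := (QuotientGroup.mk (1 : I) : X)) (by
      intro p
      rw [hsm]
      congr 1
      exact Subtype.ext (by simp [act]))
  induction y using QuotientGroup.induction_on with
  | H u =>
    refine ⟨u, u.2, fun hu => hne' ?_, fun p hp => ?_⟩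
    · rw [QuotientGroup.eq]
      simpa [Subgroup.mem_subgroupOf] using hu
    · have h1 := hy ⟨p, hp⟩
      rw [hsm, eq_comm, QuotientGroup.eq] at h1
      exact h1

namespace Frame

variable {F E : Type} [Field F] [Ring E] [Algebra F E]

/-- The units lying in a subalgebra of a finite algebra. -/
def unitsOf [Finite E] (A : Subalgebra F E) : Subgroup Eˣ where
  carrier := {u | (u : E) ∈ A}
  one_mem' := one_mem A
  mul_mem' := fun {a b} (ha : (a : E) ∈ A) (hb : (b : E) ∈ A) => by
    change ((a * b : Eˣ) : E) ∈ A
    rw [Units.val_mul]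
    exact mul_mem ha hb
  inv_mem' := fun {u} hu => by
    have := isOfFinOrder_of_finite u
    obtain ⟨n, hn, h1⟩ := this.exists_pow_eq_one
    have : u⁻¹ = u ^ (n - 1) := by
      rw [inv_eq_iff_mul_eq_one, ← pow_succ', Nat.sub_add_cancel hn, h1]
    change ((u⁻¹ : Eˣ) : E) ∈ A
    rw [this, Units.val_pow_eq_pow_val]
    exact pow_mem hu _

theorem inv_mem_of [Finite E] {A : Subalgebra F E} {u : Eˣ} (hu : (u : E) ∈ A) :
    ((u⁻¹ : Eˣ) : E) ∈ A := (unitsOf A).inv_mem hu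

/-- The units commuting with a subalgebra. -/
def centOf (A : Subalgebra F E) : Subgroup Eˣ where
  carrier := {u | ∀ a ∈ A, cj F u a = a}
  one_mem' := fun a _ => cj_one a
  mul_mem' := fun {u v} ha hb a haA => by rw [← cj_cj, hb a haA, ha a haA]
  inv_mem' := fun {u} hu a ha => by
    rw [← cj_inv_eq]; exact hu a ha

theorem coe_conj (p u : Eˣ) : ((p * u * p⁻¹ : Eˣ) : E) = cj F p u := rfl

variable {D : Frame F E} {A : Subalgebra F E} {w : E}

theorem Good.conj_units [Finite E] (hA : D.Good A) {p : Eˣ} (hp : p ∈ D.P) {u : Eˣ}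
    (hu : u ∈ unitsOf A) : p * u * p⁻¹ ∈ unitsOf A := hA.conj p hp u hu

theorem Good.conj_cent (hA : D.Good A) {p : Eˣ} (hp : p ∈ D.P) {u : Eˣ}
    (hu : u ∈ centOf A) : p * u * p⁻¹ ∈ centOf A := by
  intro a ha
  have h1 := hA.conj _ (D.P.inv_mem hp) a ha
  rw [mul_assoc, ← cj_cj, ← cj_cj, hu _ h1, cj_cj, mul_inv_cancel, cj_one]

/-- Without trivial symmetric involutions there is one whose conjugates are its negatives. -/
theorem Good.exists_involution [Finite E] (hA : D.Good A)
    (hs : ∃ u ∈ A, u * u = 1 ∧ D.σ u = u ∧ u ≠ 1 ∧ u ≠ -1) :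
    ∃ u ∈ A, u * u = 1 ∧ D.σ u = u ∧ u ≠ 1 ∧ u ≠ -1 ∧
      ∀ p ∈ D.P, cj F p u = u ∨ cj F p u = -u := by
  let I : Subgroup Eˣ :=
    { carrier := {u | (u : E) ∈ A ∧ u * u = 1 ∧ D.σ u = u}
      one_mem' := ⟨one_mem A, mul_one 1, D.σ.map_one⟩
      mul_mem' := by
        rintro a b ⟨ha, haa, hσa⟩ ⟨hb, hbb, hσb⟩
        have hc : a * b = b * a := Units.ext (hA.comm _ ha _ hb)
        refine ⟨mul_mem ha hb, ?_, ?_⟩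
        · rw [mul_assoc, ← mul_assoc b, ← hc, mul_assoc, hbb, mul_one, haa]
        · rw [Units.val_mul, D.σ.map_mul, hσa, hσb, hA.comm _ hb _ ha]
      inv_mem' := by
        rintro a ⟨ha, haa, hσa⟩
        have : a⁻¹ = a := inv_eq_of_mul_eq_one_right haa
        rw [Set.mem_ofPred_eq, this]
        exact ⟨ha, haa, hσa⟩ }
  let K : Subgroup Eˣ :=
    { carrier := {u | u = 1 ∨ u = -1}
      one_mem' := Or.inl rfl
      mul_mem' := by rintro a b (rfl | rfl) (rfl | rfl) <;> simp
      inv_mem' := by rintro a (rfl | rfl) <;> simp }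
  obtain ⟨u, ⟨hu, huu, hσ⟩, huK, hP⟩ := exists_fixed_coset D.P I K D.P_two
    (fun p hp => ⟨1, by rw [pow_one, pow_two]; exact hp.2.1⟩)
    (fun hle => by
      obtain ⟨u, hu, huu, hσ, h1, h2⟩ := hs
      rcases hle (show (⟨u, u, huu, huu⟩ : Eˣ) ∈ I from ⟨hu, Units.ext huu, hσ⟩) with h | h
      · exact h1 (congrArg Units.val h)
      · exact h2 (congrArg Units.val h))
    (by
      rintro p hp u ⟨hu, huu, hσ⟩
      refine ⟨hA.conj p hp u hu, ?_, ?_⟩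
      · simp only [mul_assoc, inv_mul_cancel_left]
        rw [← mul_assoc u, huu, one_mul, mul_inv_cancel]
      · obtain ⟨c, hc, hpc⟩ := D.P_sim p hp
        rw [coe_conj (F := F), D.σ.cj_sim hc hpc, hσ])
    (by rintro p hp u (rfl | rfl) <;> simp [K])
  refine ⟨u, hu, congrArg Units.val huu, hσ, fun h => huK (Or.inl (Units.ext h)),
    fun h => huK (Or.inr (Units.ext h)), fun p hp => ?_⟩
  rcases hP p hp with h | h
  · left
    rw [inv_mul_eq_one] at h
    rw [← coe_conj, ← h]
  · right
    rw [inv_mul_eq_iff_eq_mul] at h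
    rw [← coe_conj, h]; simp

theorem P_pow_M {p : Eˣ} (hp : p ∈ D.P) : (p : E) ^ D.M = p := by
  obtain ⟨k, hk⟩ := D.P_two p hp
  exact D.hM.two_element (k := k) (by rw [← Units.val_pow_eq_pow_val, hk, Units.val_one])

theorem P_inv_eq {p : Eˣ} (hp : p ∈ D.P) : ((p⁻¹ : Eˣ) : E) = (p : E) ^ (D.M - 2) := by
  have h1 := P_pow_M hp
  have h2 := D.hM.two_lt
  have h3 : p * p ^ (D.M - 2) = 1 := by
    have : p ^ D.M = p := Units.ext (by simpa using h1)
    rw [← pow_succ', show D.M - 2 + 1 = D.M - 1 by omega]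
    rw [show D.M = D.M - 1 + 1 by omega, pow_succ] at this
    simpa using this
  rw [inv_eq_of_mul_eq_one_right h3, Units.val_pow_eq_pow_val]

namespace Prim
variable (h : D.Prim A w)
include h

theorem mem_of_cent [Finite E] {p : Eˣ} (hp : p ∈ D.P) (hc : p ∈ centOf A) : (p : E) ∈ A := by
  by_contra hpA
  obtain ⟨u, ⟨huP, huc⟩, huK, hu⟩ := exists_fixed_coset D.P (D.P ⊓ centOf A) (D.P ⊓ unitsOf A)
    D.P_two (fun p hp => D.P_two p hp.1) (fun hle => hpA (hle ⟨hp, hc⟩).2)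
    (fun p hp u hu => ⟨D.P.mul_mem (D.P.mul_mem hp hu.1) (D.P.inv_mem hp),
      h.good.conj_cent hp hu.2⟩)
    (fun p hp u hu => ⟨D.P.mul_mem (D.P.mul_mem hp hu.1) (D.P.inv_mem hp),
      h.good.conj_units hp hu.2⟩)
  have hmem : (u : E) ∈ Algebra.adjoin F (insert (u : E) (A : Set E)) :=
    Algebra.subset_adjoin (Set.mem_insert _ _)
  refine huK ⟨huP, h.mem_of (fun a ha => ?_) (congrArg Units.val (D.P_s u huP)) (P_pow_M huP) ?_
    fun p hp => ?_⟩
  · exact cj_eq_self.1 (huc a ha)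
  · obtain ⟨c, hc, huc⟩ := D.P_sim u huP
    rw [huc, P_inv_eq huP]
    exact Subalgebra.smul_mem _ (pow_mem hmem _) _
  · have h1 := (hu p hp).2
    have h3 : cj F p (u : E) = u * ((u⁻¹ * (p * u * p⁻¹) : Eˣ) : E) := by
      rw [← coe_conj, ← Units.val_mul, mul_inv_cancel_left]
    rw [h3]
    exact mul_mem hmem (Algebra.subset_adjoin (Set.mem_insert_of_mem _ h1))

variable [Nontrivial E] [Finite E]

theorem comm_mem {p r : Eˣ} (hp : p ∈ D.P) (hr : r ∈ D.P) :
    ((r⁻¹ * (p * r * p⁻¹) : Eˣ) : E) ∈ A := by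
  refine h.mem_of_cent (D.P.mul_mem (D.P.inv_mem hr) (D.P.mul_mem (D.P.mul_mem hp hr)
    (D.P.inv_mem hp))) fun a ha => ?_
  have h1 := h.good.conj _ (D.P.inv_mem hp) a ha
  rw [← cj_cj, ← cj_cj, ← cj_cj, h.cj_comm hp hr h1, cj_cj p, mul_inv_cancel, cj_one, cj_cj,
    inv_mul_cancel, cj_one]

theorem cj_sq_w {b : Eˣ} (hb : b ∈ D.P) : cj F (b * b) w = w := by
  rw [← cj_cj]
  rcases h.cj_w hb with h1 | ⟨h1, -⟩ <;> simp [h1]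

theorem cent_of_kk {p : Eˣ} (hw : cj F p w = w) (hk : ∀ k ∈ h.kk, cj F p k = k) :
    p ∈ centOf A := by
  intro a ha
  obtain ⟨k, hk1, l, hl, rfl⟩ := h.decomp ha
  simp [ee, hw, hk k hk1, hk l hl]

end Prim
end Frame

/-- A fixed point of `γ ^ 2` whose `γ`-norm is a square has a square root fixed by `γ ^ 2`. -/
theorem exists_sqrt_of_norm {K : Type} [Field K] [Finite K] (h2 : (2 : K) ≠ 0) (γ : K →+* K)
    {θ y c : K} (h0 : θ ≠ 0) (hθ : γ θ = -θ) (hc : γ c = c) (hy : y * γ y = c * c)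
    (hyy : γ (γ y) = y) : ∃ ρ, ρ * ρ = y ∧ γ (γ ρ) = ρ := by
  have key : ∀ ρ : K, (γ ρ = ρ ∨ γ ρ = -ρ) → γ (γ ρ) = ρ := by
    rintro ρ (h | h) <;> simp [h]
  by_cases hu : c + y = 0
  · obtain ⟨ρ, hρ, hρ'⟩ := exists_sqrt_of_skew h2 γ (y := y) h0 hθ
      (by rw [← neg_eq_of_add_eq_zero_right hu, map_neg, hc])
    exact ⟨ρ, hρ, key ρ hρ'⟩
  · set u := c + y with hudef
    have hγu0 : γ u ≠ 0 := by simpa using hu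
    have h1 : y * γ u = c * u := by rw [hudef, _root_.map_add, hc, mul_add, hy]; ring
    have hγγu : γ (γ u) = u := by simp [hudef, hc, hyy]
    obtain ⟨ρ, hρ, hρ'⟩ := exists_sqrt_of_skew h2 γ (y := c / (u * γ u)) h0 hθ
      (by rw [map_div₀, _root_.map_mul, hγγu, hc, mul_comm u])
    refine ⟨u * ρ, ?_, by rw [_root_.map_mul, _root_.map_mul, hγγu, key ρ hρ']⟩
    have h3 : u * ρ * (u * ρ) = u * u * (c / (u * γ u)) := by rw [← hρ]; ring
    rw [h3]
    field_simp
    linear_combination -h1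

namespace Frame

variable {F E : Type} [Field F] [Ring E] [Algebra F E]
variable {D : Frame F E} {A : Subalgebra F E} {w : E}

/-- A good subalgebra is commutative. -/
abbrev Good.commRing (hA : D.Good A) : CommRing A :=
  { (inferInstance : Ring A) with mul_comm := fun a b => Subtype.ext (hA.comm _ a.2 _ b.2) }

namespace Prim
variable (h : D.Prim A w)
include h

theorem dec_mul {a b c d : E} (ha : a ∈ A) (hb : b ∈ A) (hc : c ∈ A) (hd : d ∈ A) :
    (ee F w * a + ee F (-w) * b) * (ee F w * c + ee F (-w) * d) =
      ee F w * (a * c) + ee F (-w) * (b * d) := by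
  let := h.good.commRing
  refine congrArg Subtype.val (a₁ := (⟨ee F w, h.ee_mem'⟩ * ⟨a, ha⟩ +
    ⟨ee F (-w), ee_mem A (neg_mem h.w_mem)⟩ * ⟨b, hb⟩) * (⟨ee F w, h.ee_mem'⟩ * ⟨c, hc⟩ +
    ⟨ee F (-w), ee_mem A (neg_mem h.w_mem)⟩ * ⟨d, hd⟩ : A)) (a₂ := (⟨ee F w, h.ee_mem'⟩ *
    (⟨a, ha⟩ * ⟨c, hc⟩) + ⟨ee F (-w), ee_mem A (neg_mem h.w_mem)⟩ * (⟨b, hb⟩ * ⟨d, hd⟩) : A)) ?_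
  have h1 : (⟨ee F w, h.ee_mem'⟩ : A) * ⟨ee F w, h.ee_mem'⟩ = ⟨ee F w, h.ee_mem'⟩ :=
    Subtype.ext h.ee_sq
  have h3 : (⟨ee F (-w), ee_mem A (neg_mem h.w_mem)⟩ : A) = 1 - ⟨ee F w, h.ee_mem'⟩ :=
    Subtype.ext (eq_sub_of_add_eq' (ee_add_neg D.two w))
  rw [h3]
  generalize (⟨ee F w, h.ee_mem'⟩ : A) = x at *
  generalize (⟨a, ha⟩ : A) = a at *
  generalize (⟨b, hb⟩ : A) = b at *
  generalize (⟨c, hc⟩ : A) = c at *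
  generalize (⟨d, hd⟩ : A) = d at *
  linear_combination (a * c - a * d - b * c + b * d) * h1

variable [Nontrivial E]

omit h in
theorem kk_cancel_neg (h : D.Prim A w) (h1 : w ≠ 1) {k : E} (hk : k ∈ h.kk)
    (h0 : ee F (-w) * k = 0) : k = 0 := by
  refine h.kk_cancel hk ?_
  have h3 := congrArg D.σ.toFun h0
  rw [D.σ.map_mul, D.σ.map_zero, hk.2.resolve_left h1, h.sigma_ee_neg h1,
    h.good.comm _ hk.1 _ h.ee_mem'] at h3
  exact h3

omit h in
theorem dec_inj (h : D.Prim A w) {a b c d : E} (ha : a ∈ h.kk) (hb : b ∈ h.kk) (hc : c ∈ h.kk)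
    (hd : d ∈ h.kk)
    (heq : ee F w * a + ee F (-w) * b = ee F w * c + ee F (-w) * d) :
    a = c ∧ (w ≠ 1 → b = d) := by
  have e1 := h.ee_sq
  have e2 := h.ee_mul_ee_neg
  have e3 : ee F (-w) * ee F (-w) = ee F (-w) :=
    ee_mul_self D.two (by rw [neg_mul_neg, h.w_sq])
  have e4 : ee F (-w) * ee F w = 0 := by
    rw [h.good.comm _ (ee_mem A (neg_mem h.w_mem)) _ h.ee_mem', e2]
  refine ⟨sub_eq_zero.1 (h.kk_cancel (sub_mem ha hc) ?_),
    fun h1 => sub_eq_zero.1 (h.kk_cancel_neg h1 (sub_mem hb hd) ?_)⟩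
  · have := congrArg (fun x => ee F w * x) heq
    simp only [mul_add, ← mul_assoc, e1, e2, zero_mul, add_zero] at this
    rw [mul_sub, this, sub_self]
  · have := congrArg (fun x => ee F (-w) * x) heq
    simp only [mul_add, ← mul_assoc, e3, e4, zero_mul, zero_add] at this
    rw [mul_sub, this, sub_self]

variable [Finite E]

omit [Finite E] in
theorem two_ne : (2 : h.kk) ≠ 0 := fun h3 => D.two (by
  have h4 := congrArg Subtype.val h3
  have h5 : algebraMap F E 2 = 0 := by rw [map_ofNat]; exact h4
  simpa using h5)

omit h in
theorem exists_skew (h : D.Prim A w) {b : Eˣ} (hb : b ∈ D.P) (hd : ((b * b : Eˣ) : E) ∉ A)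
    (h4 : ((b * b * (b * b) : Eˣ) : E) ∈ A) : ∃ θ ∈ h.kk, θ ≠ 0 ∧ cj F b θ = -θ := by
  let := h.kk_isField.toField
  obtain ⟨x, hx, hx'⟩ : ∃ x ∈ h.kk, cj F (b * b) x ≠ x := by
    by_contra hcon
    push Not at hcon
    exact hd (h.mem_of_cent (D.P.mul_mem hb hb) (h.cent_of_kk (h.cj_sq_w hb) hcon))
  obtain ⟨θ, h1, h3⟩ := exists_skew_of_four (K := h.kk) h.two_ne (h.cjK b hb) (fun x => by
      refine Subtype.ext ?_
      simp only [cjK_coe]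
      rw [cj_cj, cj_cj, cj_cj, cj_eq_self, show b * b * b * b = b * b * (b * b) by group]
      exact h.good.comm _ h4 _ x.2.1) ⟨⟨x, hx⟩, fun h5 => hx' (by
        have := congrArg Subtype.val h5
        simp only [cjK_coe] at this
        rw [← cj_cj, this])⟩
  exact ⟨θ, θ.2, fun h5 => h1 (Subtype.ext h5), congrArg Subtype.val h3⟩

omit h in
theorem exists_root (h : D.Prim A w) {b : Eˣ} (hb : b ∈ D.P)
    (h4 : ((b * b * (b * b) : Eˣ) : E) ∈ A) {θ : E} (hθ : θ ∈ h.kk) (hθ0 : θ ≠ 0)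
    (hbθ : cj F b θ = -θ) :
    ∃ ρ ∈ A, cj F (b * b) ρ = ρ ∧ ρ * ρ = ((b * b * (b * b) : Eˣ) : E) := by
  set a := ((b * b * (b * b) : Eˣ) : E) with ha
  have hab : cj F b a = a := by rw [ha, ← coe_conj]; congr 1; group
  have key : ∀ ρ : E, (cj F b ρ = ρ ∨ cj F b ρ = -ρ) → cj F (b * b) ρ = ρ := by
    rintro ρ (h | h) <;> rw [← cj_cj] <;> simp [h]
  obtain ⟨y, hy, z, hz, hyz⟩ := h.decomp h4
  have hfin : ∀ r ∈ h.kk, ∀ s ∈ h.kk, cj F (b * b) r = r → cj F (b * b) s = s → r * r = y →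
      ee F (-w) * (s * s) = ee F (-w) * z →
      ∃ ρ ∈ A, cj F (b * b) ρ = ρ ∧ ρ * ρ = a := by
    intro r hr s hs hr1 hs1 hr2 hs2
    refine ⟨ee F w * r + ee F (-w) * s, add_mem (mul_mem h.ee_mem' hr.1)
      (mul_mem (ee_mem A (neg_mem h.w_mem)) hs.1), ?_, ?_⟩
    · simp [ee, h.cj_sq_w hb, hr1, hs1]
    · rw [h.dec_mul hr.1 hs.1 hr.1 hs.1, hr2, hs2, ← hyz]
  rcases h.cj_w hb with hw | ⟨hw, hσ⟩
  · have h1 : cj F b y = y ∧ (w ≠ 1 → cj F b z = z) := by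
      refine h.dec_inj (h.kk_conj hb hy) (h.kk_conj hb hz) hy hz ?_
      rw [← hyz, ← hab]
      conv_rhs => rw [hyz]
      simp [ee, hw]
    obtain ⟨r, hr, hr1, hr2⟩ := h.exists_sqrt hb hθ hy hθ0 hbθ h1.1
    by_cases hw1 : w = 1
    · exact hfin r hr 0 (zero_mem _) (key r hr2) (by simp) hr1
        (by rw [h.ee_neg_eq_zero hw1, zero_mul, zero_mul])
    · obtain ⟨s, hs, hs1, hs2⟩ := h.exists_sqrt hb hθ hz hθ0 hbθ (h1.2 hw1)
      exact hfin r hr s hs (key r hr2) (key s hs2) hr1 (by rw [hs1])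
  · have hw1 : w ≠ 1 := by
      rintro rfl
      rw [_root_.map_one] at hw
      exact one_ne_zero (eq_zero_of_self_eq_neg D.two hw)
    have h1 : cj F b z = y ∧ (w ≠ 1 → cj F b y = z) := by
      refine h.dec_inj (h.kk_conj hb hz) (h.kk_conj hb hy) hy hz ?_
      rw [← hyz, ← hab]
      conv_rhs => rw [hyz]
      simp [ee, hw, add_comm]
    have h1' := h1.2 hw1
    obtain ⟨c, hc, hbc⟩ := D.P_sim _ (D.P.mul_mem hb hb)
    have hnorm : y * z = (c * c) • 1 := by
      have e1 : a * D.σ a = (c * c) • (1 : E) := by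
        rw [ha, Units.val_mul, D.σ.map_mul, hbc]
        have : ((b * b : Eˣ) : E) * ((b * b)⁻¹ : Eˣ) = 1 := Units.mul_inv _
        rw [smul_mul_smul_comm, mul_smul_comm]
        congr 1
        rw [mul_assoc, ← mul_assoc ((b * b : Eˣ) : E) ((b * b)⁻¹ : Eˣ), this, one_mul, this]
      have e3 : D.σ a = ee F w * z + ee F (-w) * y := by
        rw [hyz, D.σ.map_add, D.σ.map_mul, D.σ.map_mul, h.sigma_ee hw1, h.sigma_ee_neg hw1,
          hy.2.resolve_left hw1, hz.2.resolve_left hw1, add_comm,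
          h.good.comm _ hz.1 _ h.ee_mem', h.good.comm _ hy.1 _ (ee_mem A (neg_mem h.w_mem))]
      rw [e3, hyz, h.dec_mul hy.1 hz.1 hz.1 hy.1, h.good.comm _ hz.1 _ hy.1, ← add_mul,
        ee_add_neg D.two, one_mul] at e1
      exact e1
    let := h.kk_isField.toField
    obtain ⟨r, hr1, hr2⟩ := exists_sqrt_of_norm (K := h.kk) h.two_ne (h.cjK b hb) (θ := ⟨θ, hθ⟩)
      (y := ⟨y, hy⟩) (c := algebraMap F h.kk c) (fun h5 => hθ0 (congrArg Subtype.val h5))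
      (Subtype.ext hbθ) (Subtype.ext (by
        change cj F b (algebraMap F E c) = algebraMap F E c
        simp)) (Subtype.ext (by
        change y * cj F b y = algebraMap F E c * algebraMap F E c
        rw [h1', hnorm, Algebra.smul_def, mul_one, _root_.map_mul]))
      (Subtype.ext (by
        change cj F b (cj F b y) = y
        rw [h1', h1.1]))
    have hr1' : (r : E) * r = y := congrArg Subtype.val hr1
    have hr2' : cj F b (cj F b r) = r := congrArg Subtype.val hr2
    refine hfin r r.2 (cj F b r) (h.kk_conj hb r.2) (by rw [← cj_cj, hr2'])
      (by rw [← cj_cj, hr2']) hr1' ?_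
    rw [← _root_.map_mul, hr1', h1']

end Prim
end Frame

namespace Frame

variable {F E : Type} [Field F] [Ring E] [Algebra F E]
variable {D : Frame F E} {A : Subalgebra F E} {w : E}

/-- The elements of a good subalgebra fixed by an element of the `2`-group. -/
def fixSub (A : Subalgebra F E) (d : Eˣ) : Subalgebra F E where
  carrier := {a | a ∈ A ∧ cj F d a = a}
  mul_mem' := fun ha hb => ⟨mul_mem ha.1 hb.1, by rw [_root_.map_mul, ha.2, hb.2]⟩
  add_mem' := fun ha hb => ⟨add_mem ha.1 hb.1, by rw [_root_.map_add, ha.2, hb.2]⟩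
  algebraMap_mem' := fun c => ⟨A.algebraMap_mem c, by simp⟩

theorem unit_of_sq {A : Subalgebra F E} [Finite E] {ρ : E} (hρ : ρ ∈ A) {a : Eˣ}
    (h : ρ * ρ = a) : ∃ r ∈ unitsOf A, (r : E) = ρ := by
  have hc : ρ * a = a * ρ := by rw [← h, mul_assoc]
  have hc' : ρ * (a⁻¹ : Eˣ) = (a⁻¹ : Eˣ) * ρ := by
    rw [Units.mul_inv_eq_iff_eq_mul, mul_assoc, hc, ← mul_assoc, Units.inv_mul, one_mul]
  refine ⟨⟨ρ, ρ * (a⁻¹ : Eˣ), ?_, ?_⟩, hρ, rfl⟩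
  · rw [← mul_assoc, h, Units.mul_inv]
  · rw [hc', mul_assoc, h, Units.inv_mul]

namespace Prim

variable [Nontrivial E] [Finite E]

theorem fixSub_good (h : D.Prim A w) {d : Eˣ} (hd : d ∈ D.P) : D.Good (fixSub A d) where
  comm := fun a ha b hb => h.good.comm a ha.1 b hb.1
  ss := fun a ha => h.good.ss a ha.1
  star := fun a ha => ⟨h.good.star a ha.1, by rw [← h.sigma_cj hd, ha.2]⟩
  conj := fun p hp a ha => ⟨h.good.conj p hp a ha.1, by rw [h.cj_comm hd hp ha.1, ha.2]⟩
  s_comm := fun a ha => h.good.s_comm a ha.1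

theorem fixed_of_pow_four (h : D.Prim A w) {d : Eˣ} (hw : cj F d w = w) {i : E}
    (hi : i ∈ h.kk) (hii : i * i = -1) (hdi : cj F d i = i) {x : E} (hx : x ∈ A)
    (hx4 : x * x * (x * x) = 1) : cj F d x = x := by
  obtain ⟨k, hk, l, hl, rfl⟩ := h.decomp hx
  have key : ∀ k ∈ h.kk, k * k * (k * k) = 1 → cj F d k = k := by
    intro k hk hk4
    let := h.kk_isField.toField
    have h1 : (⟨k, hk⟩ - 1 : h.kk) * ((⟨k, hk⟩ + 1) * ((⟨k, hk⟩ - ⟨i, hi⟩) *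
        (⟨k, hk⟩ + ⟨i, hi⟩))) = 0 := by
      have e1 : (⟨k, hk⟩ * ⟨k, hk⟩ * (⟨k, hk⟩ * ⟨k, hk⟩) : h.kk) = 1 := Subtype.ext hk4
      have e2 : (⟨i, hi⟩ * ⟨i, hi⟩ : h.kk) = -1 := Subtype.ext hii
      linear_combination e1 - (⟨k, hk⟩ * ⟨k, hk⟩ - 1 : h.kk) * e2
    have hz : ∀ y : h.kk, (⟨k, hk⟩ : h.kk) - y = 0 → k = y := fun y hy =>
      congrArg Subtype.val (sub_eq_zero.1 hy)
    have hz' : ∀ y : h.kk, (⟨k, hk⟩ : h.kk) + y = 0 → k = -y := fun y hy =>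
      congrArg Subtype.val (eq_neg_of_add_eq_zero_left hy)
    rcases mul_eq_zero.1 h1 with h1 | h1
    · rw [hz _ h1]; exact _root_.map_one _
    rcases mul_eq_zero.1 h1 with h1 | h1
    · rw [hz' _ h1, _root_.map_neg]; exact congrArg Neg.neg (_root_.map_one _)
    rcases mul_eq_zero.1 h1 with h1 | h1
    · rw [hz _ h1]; exact hdi
    · rw [hz' _ h1, _root_.map_neg]; exact congrArg Neg.neg hdi
  rw [h.dec_mul hk.1 hl.1 hk.1 hl.1, h.dec_mul (mul_mem hk.1 hk.1) (mul_mem hl.1 hl.1)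
    (mul_mem hk.1 hk.1) (mul_mem hl.1 hl.1)] at hx4
  obtain ⟨h1, h2⟩ := h.dec_inj (c := 1) (d := 1) (mul_mem (mul_mem hk hk) (mul_mem hk hk))
    (mul_mem (mul_mem hl hl) (mul_mem hl hl)) (one_mem _) (one_mem _)
    (by rw [hx4, mul_one, mul_one, ee_add_neg D.two])
  by_cases hw1 : w = 1
  · rw [h.ee_neg_eq_zero hw1]
    simp [ee, hw, key k hk h1]
  · simp [ee, hw, key k hk h1, key l hl (h2 hw1)]

theorem sq_eq_one_of_inverted {d : Eˣ} (hd : ∀ x ∈ A, x * x * (x * x) = 1 → cj F d x = x) :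
    ∀ (k : ℕ) (x : Eˣ), x ∈ unitsOf A → d * x * d⁻¹ = x⁻¹ → x ^ 2 ^ k = 1 → x * x = 1 := by
  intro k
  induction k with
  | zero => intro x _ _ h; rw [pow_zero, pow_one] at h; rw [h, one_mul]
  | succ k ih =>
    cases k with
    | zero => intro x _ _ h; rwa [zero_add, pow_one, pow_two] at h
    | succ k =>
      intro x hx hdx h
      refine ih x hx hdx ?_
      have h1 : d * x ^ 2 ^ k * d⁻¹ = x ^ 2 ^ k := Units.ext (hd _ (pow_mem hx _) (by
        rw [← Units.val_mul, ← Units.val_mul, ← pow_add, ← pow_add,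
          show 2 ^ k + 2 ^ k + (2 ^ k + 2 ^ k) = 2 ^ (k + 1 + 1) by ring, h, Units.val_one]))
      rw [← conj_pow, hdx, inv_pow] at h1
      rw [pow_succ, pow_mul, pow_two]
      nth_rewrite 1 [← h1]
      exact inv_mul_cancel _

/-- The square of an element of the `2`-group lies in the algebra if its fourth power does. -/
theorem sq_mem_of_four (h : D.Prim A w) {b : Eˣ} (hb : b ∈ D.P)
    (h4 : ((b * b * (b * b) : Eˣ) : E) ∈ A) : ((b * b : Eˣ) : E) ∈ A := by
  by_contra hdA
  obtain ⟨θ, hθ, hθ0, hbθ⟩ := h.exists_skew hb hdA h4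
  obtain ⟨ρ', hρA, hdρ, hρρ⟩ := h.exists_root hb h4 hθ hθ0 hbθ
  obtain ⟨ρ, hρ, rfl⟩ := unit_of_sq hρA hρρ
  obtain ⟨i, hi, hii, hbi⟩ := h.exists_sqrt hb (y := -1) hθ (neg_mem (one_mem _)) hθ0 hbθ
    (by simp)
  have hw := h.cj_sq_w hb
  have hdi : cj F (b * b) i = i := by
    rcases hbi with h | h <;> rw [← cj_cj] <;> simp [h]
  have hd : b * b ∈ D.P := D.P.mul_mem hb hb
  generalize b * b = d at *
  replace hρρ : ρ * ρ = d * d := Units.ext hρρ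
  have hdρ' : d * ρ = ρ * d := Units.ext (by
    rw [cj_eq_self] at hdρ; exact hdρ)
  have hρinv : ρ⁻¹ ∈ unitsOf A := (unitsOf A).inv_mem hρ
  have hcom : ∀ x ∈ unitsOf A, ∀ y ∈ unitsOf A, x * y = y * x := fun x hx y hy =>
    Units.ext (h.good.comm _ hx _ hy)
  set f := d * ρ⁻¹ with hf
  have hfρ : f * ρ = d := by rw [hf]; group
  have hρf : ρ * f = d := by rw [hf, ← mul_assoc, ← hdρ']; group
  have hff : f * f = 1 := by
    have : ρ * f * (f * ρ) = ρ * ρ := by rw [hρf, hfρ, hρρ]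
    have h2 : f * (f * ρ) = ρ := mul_left_cancel (by rw [← mul_assoc]; exact this)
    rw [← mul_assoc] at h2
    exact mul_eq_right.1 h2
  have hfA : f ∉ unitsOf A := fun hfA => hdA (by
    have := (unitsOf A).mul_mem hfA hρ
    rwa [hfρ] at this)
  have hρM : ((ρ⁻¹ : Eˣ) : E) ∈ A := hρinv
  -- conjugation by `f` and `d` agree on `A`
  have hcjf : ∀ x ∈ unitsOf A, f * x * f⁻¹ = d * x * d⁻¹ := by
    intro x hx
    rw [hf, _root_.mul_inv_rev, inv_inv, mul_assoc d, hcom _ hρinv _ hx]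
    group
  have hconj : ∀ p ∈ D.P, ∃ m ∈ fixSub A d, cj F p f = f * m := by
    intro p hp
    set m0 := d⁻¹ * (p * d * p⁻¹) with hm0
    have hm0A : m0 ∈ unitsOf A := h.comm_mem hp hd
    have hpρ : p * ρ * p⁻¹ ∈ unitsOf A := h.good.conj_units hp hρ
    set m := ρ * m0 * (p * ρ * p⁻¹)⁻¹ with hm
    have hmA : m ∈ unitsOf A :=
      (unitsOf A).mul_mem ((unitsOf A).mul_mem hρ hm0A) ((unitsOf A).inv_mem hpρ)
    have hpf : p * f * p⁻¹ = f * m := by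
      have e : f * m = f * ρ * m0 * (p * ρ * p⁻¹)⁻¹ := by rw [hm]; simp only [mul_assoc]
      rw [e, hfρ, hm0, hf]
      group
    have hinv : d * m * d⁻¹ = m⁻¹ := by
      rw [← hcjf m hmA]
      have h1 : f * m * (f * m) = 1 := by
        rw [← hpf]
        have : p * f * p⁻¹ * (p * f * p⁻¹) = p * (f * f) * p⁻¹ := by group
        rw [this, hff]; group
      have h2 : f⁻¹ = f := inv_eq_of_mul_eq_one_right hff
      rw [h2]
      exact eq_inv_of_mul_eq_one_left (by rw [mul_assoc]; exact h1)
    have hmm : m * m = d * d * (m0 * m0) * (p * (d * d) * p⁻¹)⁻¹ := by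
      have e1 : m * m = ρ * ρ * (m0 * m0) * ((p * ρ * p⁻¹)⁻¹ * (p * ρ * p⁻¹)⁻¹) := by
        have c1 := hcom _ ((unitsOf A).inv_mem hpρ) _ ((unitsOf A).mul_mem hρ hm0A)
        have c2 := hcom _ hm0A _ hρ
        calc m * m = ρ * m0 * ((p * ρ * p⁻¹)⁻¹ * (ρ * m0)) * (p * ρ * p⁻¹)⁻¹ := by
              rw [hm]; simp only [mul_assoc]
          _ = ρ * (m0 * ρ) * m0 * ((p * ρ * p⁻¹)⁻¹ * (p * ρ * p⁻¹)⁻¹) := by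
              rw [c1]; simp only [mul_assoc]
          _ = _ := by rw [c2]; simp only [mul_assoc]
      rw [e1, ← hρρ]
      group
    obtain ⟨k, hk⟩ := D.P_two (m * m) (by
      have hm0P : m0 ∈ D.P := D.P.mul_mem (D.P.inv_mem hd)
        (D.P.mul_mem (D.P.mul_mem hp hd) (D.P.inv_mem hp))
      have hdd := D.P.mul_mem hd hd
      rw [hmm]
      exact D.P.mul_mem (D.P.mul_mem hdd (D.P.mul_mem hm0P hm0P))
        (D.P.inv_mem (D.P.mul_mem (D.P.mul_mem hp hdd) (D.P.inv_mem hp))))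
    have hm1 := sq_eq_one_of_inverted (A := A) (d := d)
      (fun x hx hx4 => h.fixed_of_pow_four hw hi hii hdi hx hx4) (k + 1) m hmA hinv
      (by rw [pow_succ', pow_mul, pow_two, hk])
    refine ⟨m, ⟨hmA, ?_⟩, congrArg Units.val hpf⟩
    have : m⁻¹ = m := inv_eq_of_mul_eq_one_right hm1
    rw [this] at hinv
    exact congrArg Units.val hinv
  have hK := h.fixSub_good hd
  have hρK : (ρ : E) ∈ fixSub A d := ⟨hρ, hdρ⟩
  have hσρ : ∃ r ∈ fixSub A d, r * D.σ ρ = 1 := by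
    refine ⟨D.σ (ρ⁻¹ : Eˣ), hK.star _ ⟨hρM, ?_⟩, by rw [← D.σ.map_mul, Units.mul_inv, D.σ.map_one]⟩
    have : d * ρ⁻¹ * d⁻¹ = ρ⁻¹ := by
      rw [mul_inv_eq_iff_eq_mul, eq_inv_mul_iff_mul_eq, ← mul_assoc, ← hdρ', mul_assoc,
        mul_inv_cancel, mul_one]
    exact congrArg Units.val this
  have hρ' : ((ρ⁻¹ : Eˣ) : E) ∈ fixSub A d := by
    refine ⟨hρM, ?_⟩
    have : d * ρ⁻¹ * d⁻¹ = ρ⁻¹ := by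
      rw [mul_inv_eq_iff_eq_mul, eq_inv_mul_iff_mul_eq, ← mul_assoc, ← hdρ', mul_assoc,
        mul_inv_cancel, mul_one]
    exact congrArg Units.val this
  have hle : ∀ x ∈ fixSub A d, x ∈ Algebra.adjoin F (insert (f : E) (fixSub A d : Set E)) :=
    fun x hx => Algebra.subset_adjoin (Set.mem_insert_of_mem _ hx)
  have hfmem : (f : E) ∈ Algebra.adjoin F (insert (f : E) (fixSub A d : Set E)) :=
    Algebra.subset_adjoin (Set.mem_insert _ _)
  have hnew : D.Good (Algebra.adjoin F (insert (f : E) (fixSub A d : Set E))) := by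
    refine hK.adjoin ?_ ?_ ?_ ?_ ?_
    · intro x hx
      have h1 : (ρ⁻¹ : Eˣ) * x = x * (ρ⁻¹ : Eˣ) := h.good.comm _ hρM _ hx.1
      rw [hf, Units.val_mul, mul_assoc, h1, ← mul_assoc, cj_eq_self.1 hx.2, mul_assoc]
    · have h1 := h.good.s_comm _ hρM
      have h2 := congrArg Units.val (D.P_s _ hd)
      rw [Units.val_mul, Units.val_mul] at h2
      rw [hf, Units.val_mul, mul_assoc, h1, ← mul_assoc, h2, mul_assoc]
    · refine D.hM.two_element (k := 1) ?_
      rw [pow_one, pow_two, ← Units.val_mul, hff, Units.val_one]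
    · obtain ⟨c, hc, hdc⟩ := D.P_sim d hd
      obtain ⟨r, hr, hrρ⟩ := hσρ
      have h1 : D.σ f = r * (c • ((ρ⁻¹ * f : Eˣ) : E)) := by
        have h2 : ρ⁻¹ * f = d⁻¹ := by
          rw [← hfρ, _root_.mul_inv_rev, inv_eq_of_mul_eq_one_right hff]
        have h3 : D.σ d = D.σ ρ * D.σ f := by rw [← D.σ.map_mul, ← Units.val_mul, hfρ]
        rw [h2, ← hdc, h3, ← mul_assoc, hrρ, one_mul]
      rw [h1]
      exact mul_mem (hle _ hr) (Subalgebra.smul_mem _ (mul_mem (hle _ hρ') hfmem) _)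
    · intro p hp
      obtain ⟨m, hm, hpm⟩ := hconj p hp
      rw [hpm]
      exact mul_mem hfmem (hle _ hm)
  have hlt : ninv A < ninv (Algebra.adjoin F (insert (f : E) (fixSub A d : Set E))) := by
    have hwK : w ∈ fixSub A d := ⟨h.w_mem, hw⟩
    have hinvK : ∀ u ∈ A, u * u = 1 → u ∈ fixSub A d := by
      intro u hu huu
      rcases h.invs u hu huu with rfl | rfl | rfl | rfl
      · exact one_mem _
      · exact neg_mem (one_mem _)
      · exact hwK
      · exact neg_mem hwK
    unfold ninv
    refine (Set.ncard_lt_ncard (s := {u : E | u ∈ A ∧ u * u = 1})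
      (t := {u | u ∈ Algebra.adjoin F (insert (f : E) (fixSub A d : Set E)) ∧ u * u = 1})
      ?_ (Set.toFinite _) :)
    refine ⟨fun u hu => ⟨hle _ (hinvK u hu.1 hu.2), hu.2⟩, fun hsub => hfA ?_⟩
    exact (hsub (show (f : E) ∈ _ from ⟨hfmem, by
      rw [← Units.val_mul, hff, Units.val_one]⟩)).1
  exact absurd (h.inv _ hnew) (not_le.2 hlt)

/-- Squares of elements of the `2`-group lie in the algebra. -/
theorem sq_mem (h : D.Prim A w) {b : Eˣ} (hb : b ∈ D.P) : ((b * b : Eˣ) : E) ∈ A := by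
  obtain ⟨k, hk⟩ := D.P_two b hb
  have h1 : b ^ 2 ^ k ∈ unitsOf A := by rw [hk]; exact (unitsOf A).one_mem
  clear hk
  induction k with
  | zero => rw [pow_zero, pow_one] at h1; exact (unitsOf A).mul_mem h1 h1
  | succ k ih =>
    cases k with
    | zero => rwa [zero_add, pow_one, pow_two] at h1
    | succ k =>
      refine ih ?_
      have h2 := h.sq_mem_of_four (b := b ^ 2 ^ k) (D.P.pow_mem hb _) (by
        rw [← pow_add, ← pow_add,
          show 2 ^ k + 2 ^ k + (2 ^ k + 2 ^ k) = 2 ^ (k + 1 + 1) by ring]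
        exact h1)
      rw [← pow_add, ← mul_two, ← pow_succ] at h2
      exact h2

theorem cj_sq (h : D.Prim A w) {b : Eˣ} (hb : b ∈ D.P) {a : E} (ha : a ∈ A) :
    cj F b (cj F b a) = a := by
  rw [cj_cj, cj_eq_self]
  exact h.good.comm _ (h.sq_mem hb) _ ha

theorem exists_moved (h : D.Prim A w) {b : Eˣ} (hb : b ∈ D.P) (hbA : (b : E) ∉ A)
    (hw : cj F b w = w) : ∃ k ∈ h.kk, cj F b k ≠ k := by
  by_contra hcon
  push Not at hcon
  exact hbA (h.mem_of_cent hb (h.cent_of_kk hw hcon))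

theorem exists_delta (h : D.Prim A w) {b : Eˣ} (hb : b ∈ D.P) (hbA : (b : E) ∉ A)
    (hw : cj F b w = w) : ∃ δ ∈ h.kk, δ ≠ 0 ∧ cj F b δ = -δ := by
  obtain ⟨k, hk, hbk⟩ := h.exists_moved hb hbA hw
  refine ⟨k - cj F b k, sub_mem hk (h.kk_conj hb hk), sub_ne_zero.2 (Ne.symm hbk), ?_⟩
  rw [_root_.map_sub, h.cj_sq hb hk.1, neg_sub]

theorem mul_mem_of_not_mem (h : D.Prim A w) {b c : Eˣ} (hb : b ∈ D.P) (hbA : (b : E) ∉ A)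
    (hbw : cj F b w = w) (hc : c ∈ D.P) (hcA : (c : E) ∉ A) (hcw : cj F c w = w) :
    ((b * c : Eˣ) : E) ∈ A := by
  refine h.mem_of_cent (D.P.mul_mem hb hc) (h.cent_of_kk (by rw [← cj_cj, hcw, hbw]) ?_)
  let := h.kk_isField.toField
  obtain ⟨k, hk, hbk⟩ := h.exists_moved hb hbA hbw
  obtain ⟨l, hl, hcl⟩ := h.exists_moved hc hcA hcw
  have key := involution_unique (K := h.kk) h.two_ne (h.cjK b hb) (h.cjK c hc)
    (fun x => Subtype.ext (h.cj_sq hb x.2.1)) (fun x => Subtype.ext (h.cj_sq hc x.2.1))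
    ⟨⟨k, hk⟩, fun h1 => hbk (congrArg Subtype.val h1)⟩
    ⟨⟨l, hl⟩, fun h1 => hcl (congrArg Subtype.val h1)⟩
  intro x hx
  have h1 : cj F b (cj F c x) = cj F c (cj F c x) :=
    congrArg Subtype.val (DFunLike.congr_fun key (⟨cj F c x, h.kk_conj hc hx⟩ : h.kk))
  rw [← cj_cj, h1, h.cj_sq hc hx.1]

end Prim
end Frame

namespace Frame

variable {F E : Type} [Field F] [Ring E] [Algebra F E]

/-- The centralizer of a subalgebra and the similitude. -/
def cent (D : Frame F E) (A : Subalgebra F E) : Subalgebra F E where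
  carrier := {d | (∀ a ∈ A, d * a = a * d) ∧ d * D.s = D.s * d}
  mul_mem' := fun {x y} hx hy => ⟨fun a ha => by
      rw [mul_assoc, hy.1 a ha, ← mul_assoc, hx.1 a ha, mul_assoc], by
      rw [mul_assoc, hy.2, ← mul_assoc, hx.2, mul_assoc]⟩
  add_mem' := fun {x y} hx hy => ⟨fun a ha => by rw [add_mul, mul_add, hx.1 a ha, hy.1 a ha], by
      rw [add_mul, mul_add, hx.2, hy.2]⟩
  algebraMap_mem' := fun c => ⟨fun a _ => Algebra.commutes c a, Algebra.commutes c _⟩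

/-- The elements of the `2`-group fixing `w`. -/
def Plus (D : Frame F E) (w : E) : Subgroup Eˣ where
  carrier := {p | p ∈ D.P ∧ cj F p w = w}
  one_mem' := ⟨D.P.one_mem, cj_one w⟩
  mul_mem' := fun {x y} hx hy => ⟨D.P.mul_mem hx.1 hy.1, by rw [← cj_cj, hy.2, hx.2]⟩
  inv_mem' := fun {x} hx => ⟨D.P.inv_mem hx.1, cj_inv_eq.1 hx.2⟩

/-- The elements of `cent` fixed by a group. -/
def fixCent (D : Frame F E) (A : Subalgebra F E) (Q : Subgroup Eˣ) : Subalgebra F E where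
  carrier := {d | d ∈ D.cent A ∧ ∀ p ∈ Q, cj F p d = d}
  mul_mem' := fun hx hy => ⟨mul_mem hx.1 hy.1, fun p hp => by
    rw [_root_.map_mul, hx.2 p hp, hy.2 p hp]⟩
  add_mem' := fun hx hy => ⟨add_mem hx.1 hy.1, fun p hp => by
    rw [_root_.map_add, hx.2 p hp, hy.2 p hp]⟩
  algebraMap_mem' := fun c => ⟨Subalgebra.algebraMap_mem _ c, fun p _ => by simp⟩

variable {D : Frame F E} {A : Subalgebra F E} {w : E}

theorem sigma_pow (σ : AntiInv F E) (a : E) (n : ℕ) : σ (a ^ n) = σ a ^ n := by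
  induction n with
  | zero => simp
  | succ n ih => rw [pow_succ, σ.map_mul, ih, pow_succ']

theorem Good.le_cent (hA : D.Good A) {a : E} (ha : a ∈ A) : a ∈ D.cent A :=
  ⟨fun b hb => hA.comm _ ha _ hb, hA.s_comm _ ha⟩

theorem Good.sigma_cent (hA : D.Good A) {d : E} (hd : d ∈ D.cent A) : D.σ d ∈ D.cent A := by
  constructor
  · intro a ha
    have := congrArg D.σ.toFun (hd.1 _ (hA.star _ ha))
    rw [D.σ.map_mul, D.σ.map_mul, D.σ.invol] at this
    exact this.symm
  · obtain ⟨c, hc, hs⟩ := D.s_sim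
    have h1 := congrArg D.σ.toFun hd.2
    rw [D.σ.map_mul, D.σ.map_mul, hs, smul_mul_assoc, mul_smul_comm] at h1
    have h2 : ((D.s⁻¹ : Eˣ) : E) * D.σ d = D.σ d * (D.s⁻¹ : Eˣ) := by
      have := congrArg (c⁻¹ • ·) h1
      simpa [smul_smul, hc] using this
    rw [Units.eq_mul_inv_iff_mul_eq, mul_assoc, Units.inv_mul_eq_iff_eq_mul] at h2
    exact h2

theorem Good.conj_cent' (hA : D.Good A) {p : Eˣ} (hp : p ∈ D.P) {d : E} (hd : d ∈ D.cent A) :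
    cj F p d ∈ D.cent A := by
  constructor
  · intro a ha
    have h1 := hA.conj _ (D.P.inv_mem hp) a ha
    have h2 : a = cj F p (cj F p⁻¹ a) := by rw [cj_cj, mul_inv_cancel, cj_one]
    rw [h2, ← _root_.map_mul, ← _root_.map_mul, hd.1 _ h1]
  · have h2 : (D.s : E) = cj F p D.s := by
      rw [eq_comm, cj_eq_self]
      exact congrArg Units.val (D.P_s p hp)
    rw [h2, ← _root_.map_mul, ← _root_.map_mul, hd.2]

theorem Good.cj_cent (hA : D.Good A) {p : Eˣ} (hp : (p : E) ∈ A) {d : E} (hd : d ∈ D.cent A) :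
    cj F p d = d := cj_eq_self.2 (hd.1 _ hp).symm

namespace Prim

variable (h : D.Prim A w)
include h

theorem pow_mem_of_symm {d : E} (hd : d ∈ D.fixCent A D.P) (hσ : D.σ d = d ∨ D.σ d = -d) :
    d ^ D.M ∈ A := by
  have h1 : d ^ D.M ∈ D.fixCent A D.P := pow_mem hd _
  refine h.mem_of_fixed h1.1.1 h1.1.2 (D.hM.idem d) ?_ h1.2
  rw [sigma_pow]
  rcases hσ with h | h <;> rw [h]
  · exact Or.inl rfl
  · exact Or.inr (D.hM.neg d)

theorem sigma_fix {d : E} (hd : d ∈ D.fixCent A D.P) : D.σ d ∈ D.fixCent A D.P :=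
  ⟨h.good.sigma_cent hd.1, fun p hp => by rw [← h.sigma_cj hp, hd.2 p hp]⟩

theorem idem_fix (hsw : w = 1 ∨ ∃ p ∈ D.P, cj F p w = -w) {g : E} (hg : g ∈ D.fixCent A D.P)
    (hgg : g * g = g) : g = 0 ∨ g = 1 := by
  have hf := h.sigma_fix hg
  have hff : D.σ g * D.σ g = D.σ g := by rw [← D.σ.map_mul, hgg]
  have hM := D.hM
  have hM2 := hM.two_lt
  have hgM : ∀ n, g ^ (n + 1) = g := by
    intro n
    induction n with
    | zero => exact pow_one g
    | succ n ih => rw [pow_succ, ih, hgg]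
  have hsy : D.σ (g * D.σ g) = g * D.σ g := by rw [D.σ.map_mul, D.σ.invol]
  have hz := h.pow_mem_of_symm (mul_mem hg hf) (Or.inl hsy)
  have hzs : D.σ ((g * D.σ g) ^ D.M) = (g * D.σ g) ^ D.M := by rw [sigma_pow, hsy]
  rcases h.unit_of_symm hz (Or.inl hzs) with h0 | h1
  · left
    set f := D.σ g with hfdef
    have hu : g - f ∈ D.fixCent A D.P := sub_mem hg hf
    have huσ : D.σ (g - f) = -(g - f) := by rw [D.σ.map_sub, hfdef, D.σ.invol, neg_sub]
    have hzA := h.pow_mem_of_symm hu (Or.inr huσ)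
    set z := (g - f) ^ D.M with hzdef
    have hzσ : D.σ z = -z := by rw [hzdef, sigma_pow, huσ, hM.neg]
    have hcomm : Commute ((g - f) * (g - f)) g := by
      change (g - f) * (g - f) * g = g * ((g - f) * (g - f))
      have e1 : (g - f) * (g - f) * g = g * g * g - g * f * g - f * (g * g) + (f * f) * g := by
        noncomm_ring
      have e2 : g * ((g - f) * (g - f)) = g * g * g - (g * g) * f - g * f * g + g * (f * f) := by
        noncomm_ring
      rw [e1, e2, hgg, hff, hgg]
      abel
    have e0 : (g - f) * (g - f) * g = g - g * f * g := by
      have e1 : (g - f) * (g - f) * g = g * g * g - g * f * g - f * (g * g) + (f * f) * g := by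
        noncomm_ring
      rw [e1, hgg, hff, hgg]
      abel
    have hgfg : (g * f * g) ^ D.M = 0 := by
      have : ∀ n, (g * f * g) ^ (n + 1) = (g * f) ^ (n + 1) * g := by
        intro n
        induction n with
        | zero => simp
        | succ n ih =>
          rw [pow_succ, ih, pow_succ (g * f) (n + 1)]
          rw [mul_assoc, ← mul_assoc g (g * f), ← mul_assoc g g, hgg, mul_assoc]
          simp only [mul_assoc]
      rw [show D.M = (D.M - 1) + 1 by omega, this, show (D.M - 1) + 1 = D.M by omega, h0, zero_mul]
    have hzg : z * z * g = g := by
      have e1 : ((g - f) * (g - f) * g) ^ D.M = z * z * g := by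
        rw [hcomm.mul_pow, (Commute.refl (g - f)).mul_pow, show g ^ D.M = g by
          rw [show D.M = (D.M - 1) + 1 by omega, hgM]]
      rw [← e1, e0, hM.sub _ _ (by
        rw [mul_assoc, mul_assoc, mul_assoc, hgg, ← mul_assoc, hgg]), hgfg, sub_zero,
        show g ^ D.M = g by rw [show D.M = (D.M - 1) + 1 by omega, hgM]]
    have hz2 : z * z - 1 ∈ A := sub_mem (mul_mem hzA hzA) (one_mem _)
    have hz2g : (z * z - 1) * g = 0 := by rw [sub_mul, hzg, one_mul, sub_self]
    rcases h.unit_of_symm hz2 (Or.inl (by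
      rw [D.σ.map_sub, D.σ.map_mul, hzσ, neg_mul_neg, D.σ.map_one])) with h2 | h2
    · have h3 := sub_eq_zero.1 h2
      have hzP : ∀ p ∈ D.P, cj F p z = z := fun p hp => (pow_mem hu D.M).2 p hp
      have key : z = -z → g = 0 := fun h4 => by
        have h5 := eq_zero_of_self_eq_neg D.two h4
        rw [← hzg, h5, zero_mul, zero_mul]
      rcases h.invs z hzA h3 with h4 | h4 | h4 | h4
      · rw [h4, D.σ.map_one] at hzσ
        exact key (by rw [h4]; exact hzσ)
      · rw [h4, D.σ.map_neg, D.σ.map_one] at hzσ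
        exact key (by rw [h4]; exact hzσ)
      · rcases hsw with rfl | ⟨p, hp, hpw⟩
        · rw [h4, D.σ.map_one] at hzσ
          exact key (by rw [h4]; exact hzσ)
        · have := hzP p hp
          rw [h4, hpw] at this
          exact key (by rw [h4]; exact this.symm)
      · rcases hsw with rfl | ⟨p, hp, hpw⟩
        · rw [h4, D.σ.map_neg, D.σ.map_one] at hzσ
          exact key (by rw [h4]; exact hzσ)
        · have := hzP p hp
          rw [h4, _root_.map_neg, hpw] at this
          exact key (by rw [h4]; exact this.symm)
    · rw [← one_mul g, ← h2, show D.M - 1 = D.M - 2 + 1 by omega, pow_succ, mul_assoc, hz2g,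
        mul_zero]
  · right
    have h2 : (1 - g) * (g * D.σ g) = 0 := by
      rw [sub_mul, one_mul, ← mul_assoc, hgg, sub_self]
    have h3 : (1 - g) * ((g * D.σ g) ^ D.M) ^ (D.M - 1) = 0 := by
      obtain ⟨m, hm⟩ : ∃ m, D.M * (D.M - 1) = m + 1 :=
        ⟨D.M * (D.M - 1) - 1, by have : 0 < D.M * (D.M - 1) := Nat.mul_pos (by omega) (by omega)
                                 omega⟩
      rw [← pow_mul, hm, pow_succ', ← mul_assoc, h2, zero_mul]
    rw [h1, mul_one] at h3
    exact (sub_eq_zero.1 h3).symm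

theorem nilp_or_unit (hsw : w = 1 ∨ ∃ p ∈ D.P, cj F p w = -w) {d : E}
    (hd : d ∈ D.fixCent A D.P) : d ^ D.M = 0 ∨ (d ^ D.M) ^ (D.M - 1) = 1 := by
  have hM := D.hM.idem d
  have hM2 := D.hM.two_lt
  rcases h.idem_fix hsw (pow_mem (pow_mem hd D.M) (D.M - 1)) (D.hM.pow_pred_idem hM) with h1 | h1
  · left
    rw [← hM, show D.M = D.M - 1 + 1 by omega, pow_succ, show D.M - 1 + 1 = D.M by omega, h1,
      zero_mul]
  · exact Or.inr h1

theorem nilp_add [Nontrivial E] [Finite E] (hsw : w = 1 ∨ ∃ p ∈ D.P, cj F p w = -w) {x y : E}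
    (hx : x ∈ D.fixCent A D.P) (hy : y ∈ D.fixCent A D.P) (hx0 : x ^ D.M = 0) (hy0 : y ^ D.M = 0) :
    (x + y) ^ D.M = 0 := by
  have hM2 := D.hM.two_lt
  refine (h.nilp_or_unit hsw (add_mem hx hy)).resolve_right fun h1 => ?_
  obtain ⟨m, hm⟩ : ∃ m, D.M * (D.M - 1) = m + 1 :=
    ⟨D.M * (D.M - 1) - 1, by have : 0 < D.M * (D.M - 1) := Nat.mul_pos (by omega) (by omega)
                             omega⟩
  rw [← pow_mul, hm, pow_succ'] at h1
  set u := (x + y) ^ m with hu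
  have huD : u ∈ D.fixCent A D.P := pow_mem (add_mem hx hy) _
  have key : ∀ t ∈ D.fixCent A D.P, t ^ D.M = 0 → (t * u) ^ D.M = 0 := by
    intro t ht ht0
    refine (h.nilp_or_unit hsw (mul_mem ht huD)).resolve_right fun h2 => ?_
    rw [← pow_mul, hm, pow_succ', mul_assoc] at h2
    have h3 : IsUnit t := IsUnit.of_mul_eq_one _ h2
    have h4 := h3.pow D.M
    rw [ht0] at h4
    exact not_isUnit_zero h4
  have h2 := key x hx hx0
  have h3 := key y hy hy0
  have h4 : y * u = 1 - x * u := by rw [← h1]; noncomm_ring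
  rw [h4, D.hM.sub _ _ (by simp), h2, one_pow, sub_zero] at h3
  exact one_ne_zero h3

/-- Semisimple parts of elements of the fixed algebra lie in `A`. -/
theorem pow_mem_of_fix [Nontrivial E] [Finite E] (hsw : w = 1 ∨ ∃ p ∈ D.P, cj F p w = -w) {d : E}
    (hd : d ∈ D.fixCent A D.P) : d ^ D.M ∈ A := by
  have hσd := h.sigma_fix hd
  have hp := h.pow_mem_of_symm (add_mem hd hσd) (Or.inl (by
    rw [D.σ.map_add, D.σ.invol, add_comm]))
  have hm := h.pow_mem_of_symm (sub_mem hd hσd) (Or.inr (by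
    rw [D.σ.map_sub, D.σ.invol, neg_sub]))
  have hnil : ∀ a : E, (a - a ^ D.M) ^ D.M = 0 := fun a => by
    rw [D.hM.sub _ _ ((Commute.self_pow a D.M).eq), D.hM.idem, sub_self]
  set a := d + D.σ d with ha
  set b := d - D.σ d with hb
  have haD : a ∈ D.fixCent A D.P := add_mem hd hσd
  have hbD : b ∈ D.fixCent A D.P := sub_mem hd hσd
  have hz : (2 : F)⁻¹ • (a ^ D.M + b ^ D.M) ∈ A := A.smul_mem (add_mem hp hm) _
  set z := (2 : F)⁻¹ • (a ^ D.M + b ^ D.M) with hzdef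
  set n := (2 : F)⁻¹ • ((a - a ^ D.M) + (b - b ^ D.M)) with hndef
  have hnD : n ∈ D.fixCent A D.P := Subalgebra.smul_mem _ (add_mem
    (sub_mem haD (pow_mem haD _)) (sub_mem hbD (pow_mem hbD _))) _
  have hn0 : n ^ D.M = 0 := by
    rw [hndef, D.hM.smul, h.nilp_add hsw (sub_mem haD (pow_mem haD _))
      (sub_mem hbD (pow_mem hbD _)) (hnil a) (hnil b), smul_zero]
  have hdz : d = z + n := by
    rw [hzdef, hndef, ← smul_add, ha, hb]
    have : ∀ x y u v : E, x + y + (u - x + (v - y)) = u + v := fun x y u v => by abel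
    rw [this, show d + D.σ d + (d - D.σ d) = (2 : F) • d by rw [two_smul]; abel, smul_smul,
      inv_mul_cancel₀ D.two, one_smul]
  rw [hdz, D.hM.add _ _ (hnD.1.1 z hz).symm, h.good.ss z hz, hn0, add_zero]
  exact hz

omit h in
theorem pow_mem_of_orthogonal (h : D.Prim A w) {x y : E} (hx : x ∈ D.cent A) (hy : y ∈ D.cent A)
    (hex : ee F w * x = x) (hey : ee F (-w) * y = y) (hxy : (x + y) ^ D.M ∈ A) : x ^ D.M ∈ A := by
  have hM2 := D.hM.two_lt
  have e4 : ee F (-w) * ee F w = 0 := by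
    rw [h.good.comm _ (ee_mem A (neg_mem h.w_mem)) _ h.ee_mem', h.ee_mul_ee_neg]
  have h1 : x * y = 0 := by
    rw [← hey, ← mul_assoc, hx.1 _ (ee_mem A (neg_mem h.w_mem)), ← hex, ← mul_assoc, e4, zero_mul,
      zero_mul]
  have h2 : y * x = 0 := by
    rw [← hex, ← mul_assoc, hy.1 _ h.ee_mem', ← hey, ← mul_assoc, h.ee_mul_ee_neg, zero_mul,
      zero_mul]
  rw [D.hM.add _ _ (by rw [h1, h2])] at hxy
  have h3 := mul_mem h.ee_mem' hxy
  have e1 : ∀ z : E, ∀ e : E, ∀ n, e * z = z → e * z ^ (n + 1) = z ^ (n + 1) := fun z e n hz => by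
    rw [pow_succ', ← mul_assoc, hz]
  rw [mul_add, show D.M = D.M - 1 + 1 by omega, e1 _ _ _ hex, ← e1 y _ _ hey, ← mul_assoc,
    h.ee_mul_ee_neg, zero_mul, add_zero] at h3
  rwa [show D.M - 1 + 1 = D.M by omega] at h3

omit h in
theorem pow_mem_corner [Nontrivial E] [Finite E] (h : D.Prim A w) (hw1 : w ≠ 1) {x : E}
    (hx : x ∈ D.fixCent A (D.Plus w)) (hex : ee F w * x = x) : x ^ D.M ∈ A := by
  by_cases hsw : ∃ p ∈ D.P, cj F p w = -w
  · obtain ⟨b, hb, hbw⟩ := hsw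
    have hbi : cj F b⁻¹ w = -w := by
      rw [cj_inv_eq, inv_inv, _root_.map_neg, hbw, neg_neg]
    refine h.pow_mem_of_orthogonal (y := cj F b x) hx.1 (h.good.conj_cent' hb hx.1) hex ?_ ?_
    · rw [← hex, _root_.map_mul, show cj F b (ee F w) = ee F (-w) by simp [ee, hbw], ← mul_assoc,
        ee_mul_self D.two (by rw [neg_mul_neg, h.w_sq])]
    · refine h.pow_mem_of_fix (Or.inr ⟨b, hb, hbw⟩) ⟨add_mem hx.1 (h.good.conj_cent' hb hx.1),
        fun p hp => ?_⟩
      rw [_root_.map_add]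
      rcases h.cj_w hp with hpw | ⟨hpw, -⟩
      · rw [hx.2 p ⟨hp, hpw⟩, cj_cj, show p * b = b * (b⁻¹ * (p * b)) by group, ← cj_cj,
          hx.2 (b⁻¹ * (p * b)) ⟨D.P.mul_mem (D.P.inv_mem hb) (D.P.mul_mem hp hb), by
            rw [← cj_cj, ← cj_cj, hbw, _root_.map_neg, hpw, _root_.map_neg, hbi, neg_neg]⟩]
      · rw [cj_cj, hx.2 (p * b) ⟨D.P.mul_mem hp hb, by
          rw [← cj_cj, hbw, _root_.map_neg, hpw, neg_neg]⟩, add_comm,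
          show p = b * (b⁻¹ * p) by group, ← cj_cj, hx.2 (b⁻¹ * p)
            ⟨D.P.mul_mem (D.P.inv_mem hb) hp, by
              rw [← cj_cj, hpw, _root_.map_neg, hbi, neg_neg]⟩]
  · have hplus : D.P ≤ D.Plus w := fun p hp =>
      ⟨hp, (h.cj_w hp).resolve_right fun h1 => hsw ⟨p, hp, h1.1⟩⟩
    have hxP : x ∈ D.fixCent A D.P := ⟨hx.1, fun p hp => hx.2 p (hplus hp)⟩
    refine h.pow_mem_of_orthogonal (y := D.σ x) hx.1 (h.good.sigma_cent hx.1) hex ?_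
      (h.pow_mem_of_symm (add_mem hxP (h.sigma_fix hxP)) (Or.inl (by
        rw [D.σ.map_add, D.σ.invol, add_comm])))
    nth_rewrite 2 [← hex]
    rw [D.σ.map_mul, h.sigma_ee hw1, (h.good.sigma_cent hx.1).1 _
      (ee_mem A (neg_mem h.w_mem))]

omit h in
theorem plus_neg : D.Plus (-w) = D.Plus w := by
  ext p
  constructor
  · rintro ⟨h1, h2⟩; exact ⟨h1, by simpa using h2⟩
  · rintro ⟨h1, h2⟩; exact ⟨h1, by simpa using h2⟩

/-- Semisimple parts of elements fixed by `Plus` lie in `A`. -/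
theorem pow_mem_of_plus [Nontrivial E] [Finite E] {d : E} (hd : d ∈ D.fixCent A (D.Plus w)) :
    d ^ D.M ∈ A := by
  by_cases hw1 : w = 1
  · refine h.pow_mem_of_fix (Or.inl hw1) ⟨hd.1, fun p hp => hd.2 p ⟨hp, ?_⟩⟩
    rw [hw1, _root_.map_one]
  · have he : ∀ v ∈ A, v * v = 1 → (v = w ∨ v = -w) → ee F v * d ∈ D.fixCent A (D.Plus w) := by
      intro v hv _ hvw
      refine mul_mem ⟨h.good.le_cent (ee_mem A hv), fun p hp => ?_⟩ hd
      rcases hvw with rfl | rfl <;> simp [ee, hp.2]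
    have hn := h.neg (h.w_skew hw1)
    have hww : -w * -w = 1 := by rw [neg_mul_neg, h.w_sq]
    have h1 := h.pow_mem_corner hw1 (he w h.w_mem h.w_sq (Or.inl rfl)) (by
      rw [← mul_assoc, h.ee_sq])
    have h2 := hn.pow_mem_corner (x := ee F (-w) * d) (fun h3 => by
        have h4 := h.w_skew hw1
        have h5 : w = -1 := by rw [← h3, neg_neg]
        rw [h5, D.σ.map_neg, D.σ.map_one, neg_neg] at h4
        exact hw1 (h5.trans h4)) (by
        rw [plus_neg]; exact he (-w) (neg_mem h.w_mem) hww (Or.inr rfl))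
      (by rw [← mul_assoc, ee_mul_self D.two hww])
    have h3 : d = ee F w * d + ee F (-w) * d := by rw [← add_mul, ee_add_neg D.two, one_mul]
    have h4 : ee F w * d * (ee F (-w) * d) = ee F (-w) * d * (ee F w * d) := by
      have e2 := h.ee_mem'
      have e3 := ee_mem (F := F) A (neg_mem h.w_mem)
      rw [mul_assoc, ← mul_assoc d, hd.1.1 _ e3, mul_assoc, ← mul_assoc, mul_assoc _ d,
        ← mul_assoc d, hd.1.1 _ e2, mul_assoc, ← mul_assoc, h.good.comm _ e2 _ e3]
      simp only [mul_assoc]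
    rw [h3, D.hM.add _ _ h4]
    exact add_mem h1 h2

omit h in
/-- Idempotents of the corner commuting with `A` and the similitude lie in `A`. -/
theorem idem_mem [Nontrivial E] [Finite E] (h : D.Prim A w) {g : E} (hg : g ∈ D.cent A)
    (hgg : g * g = g) (heg : ee F w * g = g) : g ∈ A := by
  have hM := D.hM
  have hM2 := hM.two_lt
  have hgM : ∀ n, g ^ (n + 1) = g := by
    intro n
    induction n with
    | zero => exact pow_one g
    | succ n ih => rw [pow_succ, ih, hgg]
  have hgY : (∀ p ∈ D.Plus w, cj F p g = g) → g ∈ A := fun hfix => by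
    have := h.pow_mem_of_plus ⟨hg, hfix⟩
    rwa [show D.M = (D.M - 1) + 1 by omega, hgM] at this
  by_cases hPA : ∀ p ∈ D.Plus w, (p : E) ∈ A
  · exact hgY fun p hp => h.good.cj_cent (hPA p hp) hg
  push Not at hPA
  obtain ⟨b, ⟨hb, hbw⟩, hbA⟩ := hPA
  obtain ⟨δ, hδ, hδ0, hbδ⟩ := h.exists_delta hb hbA hbw
  have hbe : cj F b (ee F w) = ee F w := by simp [ee, hbw]
  have hYb : ∀ y ∈ D.cent A, cj F b y = y → y ∈ D.fixCent A (D.Plus w) := by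
    intro y hy hby
    refine ⟨hy, fun p hp => ?_⟩
    by_cases hpA : (p : E) ∈ A
    · exact h.good.cj_cent hpA hy
    · have hbi : ((b⁻¹ : Eˣ) : E) ∉ A := fun h1 => hbA (by
        have := inv_mem_of h1; rwa [inv_inv] at this)
      have h1 := h.mul_mem_of_not_mem (D.P.inv_mem hb) hbi (cj_inv_eq.1 hbw) hp.1 hpA hp.2
      rw [show p = b * (b⁻¹ * p) by group, ← cj_cj, h.good.cj_cent h1 hy, hby]
  have hhC := h.good.conj_cent' hb hg
  have hbb : cj F b (cj F b g) = g := by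
    rw [cj_cj]; exact h.good.cj_cent (h.sq_mem hb) hg
  have hhh : cj F b g * cj F b g = cj F b g := by rw [← _root_.map_mul, hgg]
  have heh : ee F w * cj F b g = cj F b g := by
    nth_rewrite 1 [← hbe]; rw [← _root_.map_mul, heg]
  have heA := h.ee_mem'
  have heC := h.good.le_cent heA
  set k := cj F b g with hk
  have hge : g * ee F w = g := by rw [hg.1 _ heA, heg]
  have hke : k * ee F w = k := by rw [hhC.1 _ heA, heh]
  set e := ee F w with he
  have hee : e * e = e := h.ee_sq
  set y := g + k - e with hy
  set v := g - k with hv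
  have hyC : y ∈ D.cent A := sub_mem (add_mem hg hhC) heC
  have hvC : v ∈ D.cent A := sub_mem hg hhC
  have hyA : y ^ D.M ∈ A := h.pow_mem_of_plus (hYb y hyC (by
    rw [hy, _root_.map_sub, _root_.map_add, hbb, hbe, ← hk, add_comm k]))
  have hyv : y * v = -(v * y) := by
    have e1 : y * v = g * g - g * k + k * g - k * k - e * g + e * k := by rw [hy, hv]; noncomm_ring
    have e2 : v * y = g * g + g * k - g * e - k * g - k * k + k * e := by rw [hy, hv]; noncomm_ring
    rw [e1, e2, hgg, hhh, heg, heh, hge, hke]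
    abel
  have hyv2 : v * v = e - y * y := by
    have e1 : v * v = g * g - g * k - k * g + k * k := by rw [hv]; noncomm_ring
    have e2 : y * y = g * g + g * k - g * e + k * g + k * k - k * e - e * g - e * k + e * e := by
      rw [hy]; noncomm_ring
    rw [e1, e2, hgg, hhh, heg, heh, hge, hke, hee]
    abel
  have hyMv : y ^ D.M * v = 0 := by
    have h1 : y ^ D.M * v = -(v * y ^ D.M) := by
      have h2 : SemiconjBy v y (-y) := by
        change v * y = -y * v
        rw [neg_mul, hyv, neg_neg]
      have h3 := (h2.pow_right D.M).eq
      rw [hM.neg] at h3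
      rw [h3, neg_mul, neg_neg]
    rw [hvC.1 _ hyA] at h1
    exact eq_zero_of_self_eq_neg D.two h1
  have hey : e * y = y := by rw [hy, mul_sub, mul_add, heg, heh, hee]
  have hepow : ∀ (z : E) (n : ℕ), e * z = z → e * z ^ (n + 1) = z ^ (n + 1) := fun z n hz => by
    rw [pow_succ', ← mul_assoc, hz]
  have hev : e * v = v := by rw [hv, mul_sub, heg, heh]
  rcases h.corner_unit hyA (by
    rw [show D.M = D.M - 1 + 1 by omega]; exact hepow y _ hey) with h0 | h0
  · exfalso
    have hδA := hδ.1
    have hδC := h.good.le_cent hδA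
    have hbv : cj F b v = -v := by rw [hv, _root_.map_sub, hbb, neg_sub]
    have huY := hYb (δ * v) (mul_mem hδC hvC) (by
      rw [_root_.map_mul, hbδ, hbv, neg_mul_neg])
    have hz := h.pow_mem_of_plus huY
    have hbz : cj F b ((δ * v) ^ D.M) = (δ * v) ^ D.M := (pow_mem huY D.M).2 b ⟨hb, hbw⟩
    have hδv : Commute δ v := (hvC.1 _ hδA).symm
    have heδ : Commute e δ := h.good.comm _ heA _ hδA
    have hvM : v ^ D.M * v ^ D.M = e := by
      rw [← (Commute.refl v).mul_pow, hyv2, hM.sub _ _ (by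
        rw [← mul_assoc, hey, mul_assoc, hyC.1 _ heA, hey]), (Commute.refl y).mul_pow, h0,
        mul_zero, sub_zero, h.good.ss _ heA]
    have hzz : (δ * v) ^ D.M * (δ * v) ^ D.M = δ * e * (δ * e) := by
      rw [hδv.mul_pow, h.good.ss _ hδA]
      have c1 : v ^ D.M * δ = δ * v ^ D.M := ((hδv.pow_right D.M).eq).symm
      rw [mul_assoc, ← mul_assoc _ δ, c1, mul_assoc, hvM, mul_assoc, ← mul_assoc e δ, heδ.eq,
        mul_assoc δ e e, hee]
    set z := (δ * v) ^ D.M with hzdef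
    have hδe : δ * e ∈ A := mul_mem hδA heA
    have hez : e * z = z := by
      rw [hzdef, show D.M = D.M - 1 + 1 by omega]
      refine hepow _ _ ?_
      rw [← mul_assoc, heδ.eq, mul_assoc, hev]
    have heδe : e * (δ * e) = δ * e := by rw [← mul_assoc, heδ.eq, mul_assoc, hee]
    have hfac : (z - δ * e) * (z + δ * e) = 0 := by
      have c2 := h.good.comm _ hz _ hδe
      rw [sub_mul, mul_add, mul_add, hzz, c2]
      abel
    have hδe0 : δ * e = -(δ * e) → False := fun h1 => by
      have h2 := eq_zero_of_self_eq_neg D.two h1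
      rw [← heδ.eq] at h2
      exact hδ0 (h.kk_cancel hδ h2)
    have hbδe : cj F b (δ * e) = -(δ * e) := by rw [_root_.map_mul, hbδ, hbe, neg_mul]
    rcases h.corner_unit (sub_mem hz hδe) (by rw [mul_sub, hez, heδe]) with h1 | h1
    · have h2 := sub_eq_zero.1 h1
      rw [h2, hbδe] at hbz
      exact hδe0 hbz.symm
    · have h2 : e * (z + δ * e) = 0 := by
        have h1' : (z - δ * e) ^ (D.M - 1) = e := h1
        have h5 : (z - δ * e) ^ (D.M - 1) * (z + δ * e) = 0 := by
          rw [show D.M - 1 = D.M - 2 + 1 by omega, pow_succ, mul_assoc, hfac, mul_zero]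
        rwa [h1'] at h5
      rw [mul_add, hez, heδe] at h2
      have h3 := eq_neg_of_add_eq_zero_left h2
      rw [h3, _root_.map_neg, hbδe] at hbz
      exact hδe0 (neg_injective hbz.symm)
  · have hv0 : v = 0 := by
      have h0' : (y ^ D.M) ^ (D.M - 1) = e := h0
      have h5 : (y ^ D.M) ^ (D.M - 1) * v = 0 := by
        rw [show D.M - 1 = D.M - 2 + 1 by omega, pow_succ, mul_assoc, hyMv, mul_zero]
      rwa [h0', hev] at h5
    have hgk : g = k := sub_eq_zero.1 hv0
    exact hgY (hYb g hg hgk.symm).2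

end Prim
end Frame

theorem exists_cyclic_proj {K V : Type} [Field K] [AddCommGroup V] [Module K V]
    (N e : Module.End K V) (hN : IsNilpotent N) (he : e * e = e) (he0 : e ≠ 0)
    (hNe : N * e = e * N) :
    ∃ (T : Module.End K V) (k : ℕ) (v y : V), y ≠ 0 ∧ T y = y ∧ T * N = N * T ∧ e * T = T ∧ T * e = T ∧
      e v = v ∧ ∀ x, ∃ c : ℕ → K, T x = ∑ i ∈ Finset.range k, c i • (N ^ i) v := by
  have hex : ∃ k, N ^ k * e = 0 := by
    obtain ⟨k, hk⟩ := hN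
    exact ⟨k, by rw [hk, zero_mul]⟩
  have hcomm : ∀ n, e * N ^ n = N ^ n * e := fun n =>
    ((show Commute e N from hNe.symm).pow_right n).eq
  obtain ⟨k, hk⟩ : ∃ k, Nat.find hex = k + 1 := by
    rcases h : Nat.find hex with _ | k
    · exact absurd (by simpa [h] using Nat.find_spec hex) he0
    · exact ⟨k, rfl⟩
  have hk1 : N ^ (k + 1) * e = 0 := hk ▸ Nat.find_spec hex
  have hk0 : N ^ k * e ≠ 0 := Nat.find_min hex (by omega)
  have hz : ∀ n, k < n → ∀ x, (N ^ n) (e x) = 0 := fun n hn x => by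
    obtain ⟨m, rfl⟩ := Nat.exists_eq_add_of_lt hn
    have := congrArg (fun f => (N ^ m * f) x) hk1
    rw [show k + m + 1 = m + (k + 1) by omega, pow_add]
    simpa using this
  obtain ⟨v0, hv0⟩ : ∃ v0, (N ^ k) (e v0) ≠ 0 := by
    by_contra! h
    exact hk0 (LinearMap.ext h)
  have hee : ∀ x, e (e x) = e x := fun x => congrArg (fun f => f x) he
  set v := e v0 with hv
  obtain ⟨f0, hf0⟩ : ∃ f0 : Module.Dual K V, f0 ((N ^ k) v) ≠ 0 := by
    by_contra! h
    exact hv0 ((Module.forall_dual_apply_eq_zero_iff K _).1 h)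
  set f : Module.Dual K V := (f0 ((N ^ k) v))⁻¹ • f0 with hf
  have hf1 : f ((N ^ k) v) = 1 := by simp [hf, hf0]
  let T : Module.End K V := ∑ i ∈ Finset.range (k + 1),
    (f ∘ₗ (N ^ (k - i)) ∘ₗ e).smulRight ((N ^ i) v)
  have hT : ∀ x, T x = ∑ i ∈ Finset.range (k + 1), f ((N ^ (k - i)) (e x)) • (N ^ i) v := by
    intro x
    simp [T, LinearMap.sum_apply]
  have heN : ∀ i x, e ((N ^ i) x) = (N ^ i) (e x) := fun i x =>
    congrArg (fun f => f x) (hcomm i)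
  have hadd : ∀ i j x, (N ^ i) ((N ^ j) x) = (N ^ (i + j)) x := fun i j x => by
    rw [pow_add]; rfl
  refine ⟨T, k + 1, v, (N ^ k) v, hv0, ?_, ?_, ?_, ?_, hee v0, fun x => ⟨_, hT x⟩⟩
  · rw [hT, Finset.sum_range_succ, Finset.sum_eq_zero, zero_add]
    · rw [heN, hv, hee, hadd]
      simp [← hv, hf1]
    · intro i hi
      rw [heN, hv, hee, hadd, hz _ (by have := Finset.mem_range.1 hi; omega)]
      simp
  · ext x
    change T (N x) = N (T x)
    rw [hT, hT, map_sum, Finset.sum_range_succ', Finset.sum_range_succ]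
    have h1 : ∀ y, (N ^ 1) y = N y := fun y => by rw [pow_one]
    congr 1
    · refine Finset.sum_congr rfl fun i hi => ?_
      have hi := Finset.mem_range.1 hi
      have e1 : (N ^ (k - (i + 1))) (e (N x)) = (N ^ (k - i)) (e x) := by
        rw [← h1, heN, hadd, show k - (i + 1) + 1 = k - i by omega]
      rw [e1, _root_.map_smul, ← h1, hadd, add_comm 1 i]
    · have e1 : (N ^ k) (e (N x)) = 0 := by
        rw [← h1, heN, hadd, hz _ (by omega)]
      have e2 : N ((N ^ k) v) = 0 := by
        rw [← h1, hadd, hv, hz _ (by omega)]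
      simp [e1, e2]
  · ext x
    change e (T x) = T x
    rw [hT, map_sum]
    refine Finset.sum_congr rfl fun i _ => ?_
    rw [_root_.map_smul, heN, hv, hee]
  · ext x
    change T (e x) = T x
    rw [hT, hT]
    simp only [hee]

/-- `u` is a similitude with multiplier `c`. -/
def AntiInv.IsSim {F E : Type} [Field F] [Ring E] [Algebra F E] (σ : AntiInv F E) (u : Eˣ)
    (c : F) : Prop := c ≠ 0 ∧ σ u = c • (↑u⁻¹ : E)

namespace AntiInv.IsSim

variable {F E : Type} [Field F] [Ring E] [Algebra F E] {σ : AntiInv F E} {u v : Eˣ} {c d : F}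

theorem one : σ.IsSim 1 1 := ⟨one_ne_zero, by simp⟩

theorem mul (h : σ.IsSim u c) (h' : σ.IsSim v d) : σ.IsSim (u * v) (c * d) :=
  ⟨mul_ne_zero h.1 h'.1, by
    rw [Units.val_mul, σ.map_mul, h.2, h'.2, smul_mul_smul_comm, _root_.mul_inv_rev, Units.val_mul,
      mul_comm d c]⟩

theorem iff_mul : σ.IsSim u c ↔ c ≠ 0 ∧ σ u * u = c • (1 : E) := by
  constructor
  · rintro ⟨h0, h⟩; exact ⟨h0, by rw [h, smul_mul_assoc, Units.inv_mul]⟩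
  · rintro ⟨h0, h⟩
    exact ⟨h0, by rw [← mul_one (σ u), ← Units.mul_inv u, ← mul_assoc, h, smul_one_mul]⟩

theorem inv (h : σ.IsSim u c) : σ.IsSim u⁻¹ c⁻¹ := by
  refine ⟨inv_ne_zero h.1, ?_⟩
  have h1 : σ (↑u⁻¹ : E) * σ u = 1 := by rw [← σ.map_mul, Units.mul_inv, σ.map_one]
  rw [h.2, mul_smul_comm] at h1
  have h2 := congrArg (fun z => (c⁻¹ • z) * (u : E)) h1
  simp only [smul_smul, inv_mul_cancel₀ h.1, one_smul] at h2
  rw [mul_assoc, Units.inv_mul, mul_one, smul_mul_assoc, one_mul] at h2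
  simpa using h2

theorem unique [Nontrivial E] (h : σ.IsSim u c) (h' : σ.IsSim u d) : c = d := by
  have h1 := (iff_mul.1 h).2.symm.trans (iff_mul.1 h').2
  have h2 : (c - d) • (1 : E) = 0 := by rw [sub_smul, h1, sub_self]
  exact sub_eq_zero.1 ((smul_eq_zero.1 h2).resolve_right one_ne_zero)

theorem conj (h : σ.IsSim u c) (a : E) : σ (cj F u a) = cj F u (σ a) :=
  σ.cj_sim h.1 h.2 a

end AntiInv.IsSim

/-- The scalar units. -/
def scal (F : Type) {E : Type} [Field F] [Ring E] [Algebra F E] : Fˣ →* Eˣ :=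
  Units.map (algebraMap F E : F →* E)

theorem scal_coe {F E : Type} [Field F] [Ring E] [Algebra F E] (c : Fˣ) :
    ((scal F c : Eˣ) : E) = algebraMap F E c := rfl

theorem scal_comm {F E : Type} [Field F] [Ring E] [Algebra F E] (c : Fˣ) (u : Eˣ) :
    scal F c * u = u * scal F c := by
  ext; exact Algebra.commutes _ _

theorem scal_sim {F E : Type} [Field F] [Ring E] [Algebra F E] (σ : AntiInv F E) (c : Fˣ) :
    σ.IsSim (scal F c) (c * c) :=
  AntiInv.IsSim.iff_mul.2 ⟨by simp, by simp [scal_coe, Algebra.smul_def]⟩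

namespace Frame

section Ring

variable {F E : Type} [Field F] [Ring E] [Algebra F E] {D : Frame F E} {A : Subalgebra F E} {w : E}

theorem s_inv_pow [Finite E] (D : Frame F E) : ∃ n : ℕ, (↑(D.s⁻¹) : E) = (D.s : E) ^ n := by
  have h1 := orderOf_pos D.s
  refine ⟨orderOf D.s - 1, ?_⟩
  rw [← Units.val_pow_eq_pow_val]
  congr 1
  rw [inv_eq_iff_mul_eq_one, ← pow_succ', Nat.sub_add_cancel h1, pow_orderOf_eq_one]

/-- The subalgebra generated by `A` and the similitude. -/
def RR (D : Frame F E) (A : Subalgebra F E) : Subalgebra F E :=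
  Algebra.adjoin F (insert (D.s : E) (A : Set E))

theorem le_RR {a : E} (ha : a ∈ A) : a ∈ D.RR A := Algebra.subset_adjoin (Set.mem_insert_of_mem _ ha)

theorem s_mem_RR : (D.s : E) ∈ D.RR A := Algebra.subset_adjoin (Set.mem_insert _ _)

theorem Good.RR_comm (hA : D.Good A) {r t : E} (hr : r ∈ D.RR A) (ht : t ∈ D.RR A) :
    r * t = t * r := by
  have key : ∀ z : E, (∀ a ∈ A, z * a = a * z) → z * D.s = D.s * z →
      ∀ r ∈ D.RR A, z * r = r * z := by
    intro z h1 h2 r hr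
    induction hr using Algebra.adjoin_induction with
    | mem x hx =>
      rcases hx with rfl | hx
      · exact h2
      · exact h1 x hx
    | algebraMap c => exact (Algebra.commutes c z).symm
    | add x y _ _ hx hy => rw [mul_add, add_mul, hx, hy]
    | mul x y _ _ hx hy => rw [← mul_assoc, hx, mul_assoc, hy, mul_assoc]
  exact key r (fun a ha => (key a (fun b hb => hA.comm a ha b hb) (hA.s_comm a ha) r hr).symm)
    (key _ (fun a ha => (hA.s_comm a ha).symm) rfl r hr).symm t ht

theorem Good.RR_le_cent (hA : D.Good A) {r : E} (hr : r ∈ D.RR A) : r ∈ D.cent A :=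
  ⟨fun _ ha => hA.RR_comm hr (le_RR ha), hA.RR_comm hr s_mem_RR⟩

theorem Prim.s_pow_mem [Finite E] (h : D.Prim A w) : (D.s : E) ^ D.M ∈ A := by
  have hc : ∀ a ∈ A, (D.s : E) ^ D.M * a = a * (D.s : E) ^ D.M := fun a ha =>
    ((show Commute (D.s : E) a from (h.good.s_comm a ha).symm).pow_left _).eq
  refine h.mem_of hc ((Commute.refl (D.s : E)).pow_left _).eq (D.hM.idem _) ?_ ?_
  · obtain ⟨c, hc0, hs⟩ := D.s_sim
    obtain ⟨n, hn⟩ := D.s_inv_pow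
    rw [sigma_pow, hs, hn, smul_pow, ← pow_mul, mul_comm n, pow_mul]
    exact Subalgebra.smul_mem _ (pow_mem (Algebra.subset_adjoin (Set.mem_insert _ _)) _) _
  · intro p hp
    rw [_root_.map_pow, cj_eq_self.2 (congrArg Units.val (D.P_s p hp))]
    exact Algebra.subset_adjoin (Set.mem_insert _ _)

theorem Prim.RR_pow_mem [Finite E] (h : D.Prim A w) {r : E} (hr : r ∈ D.RR A) : r ^ D.M ∈ A := by
  unfold RR at hr
  induction hr using Algebra.adjoin_induction with
  | mem x hx =>
    rcases hx with rfl | hx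
    · exact h.s_pow_mem
    · exact pow_mem hx _
  | algebraMap c => rw [D.hM.scalar]; exact Subalgebra.algebraMap_mem _ _
  | add x y hx hy ihx ihy =>
    rw [D.hM.add _ _ (h.good.RR_comm hx hy)]; exact add_mem ihx ihy
  | mul x y hx hy ihx ihy =>
    rw [(show Commute x y from h.good.RR_comm hx hy).mul_pow]; exact mul_mem ihx ihy

theorem Prim.RR_sigma [Finite E] (h : D.Prim A w) {r : E} (hr : r ∈ D.RR A) : D.σ r ∈ D.RR A := by
  unfold RR at hr
  induction hr using Algebra.adjoin_induction with
  | mem x hx =>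
    rcases hx with rfl | hx
    · obtain ⟨c, hc0, hs⟩ := D.s_sim
      obtain ⟨n, hn⟩ := D.s_inv_pow
      rw [hs, hn]
      exact Subalgebra.smul_mem _ (pow_mem s_mem_RR _) _
    · exact le_RR (h.good.star _ hx)
  | algebraMap c => simp
  | add x y hx hy ihx ihy => rw [D.σ.map_add]; exact add_mem ihx ihy
  | mul x y hx hy ihx ihy => rw [D.σ.map_mul]; exact mul_mem ihy ihx

theorem Prim.RR_cj (h : D.Prim A w) {p : Eˣ} (hp : p ∈ D.P) {r : E}
    (hr : r ∈ D.RR A) : cj F p r ∈ D.RR A := by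
  unfold RR at hr
  induction hr using Algebra.adjoin_induction with
  | mem x hx =>
    rcases hx with rfl | hx
    · rw [cj_eq_self.2 (congrArg Units.val (D.P_s p hp))]; exact s_mem_RR
    · exact le_RR (h.good.conj p hp _ hx)
  | algebraMap c => simp
  | add x y hx hy ihx ihy => rw [_root_.map_add]; exact add_mem ihx ihy
  | mul x y hx hy ihx ihy => rw [_root_.map_mul]; exact mul_mem ihx ihy

end Ring

section End

variable {F V : Type} [Field F] [AddCommGroup V] [Module F V] [Finite V]
  {D : Frame F (Module.End F V)} {A : Subalgebra F (Module.End F V)} {w : Module.End F V}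

theorem Prim.exists_cyclic_corner [Nontrivial (Module.End F V)] [Finite (Module.End F V)]
    (h : D.Prim A w) : ∃ v, (ee F w : Module.End F V) v = v ∧
      ∀ x, ∃ r ∈ D.RR A, (ee F w : Module.End F V) x = r v := by
  let := h.kk_isField.toField
  set N : Module.End F V := D.s - (D.s : Module.End F V) ^ D.M with hN
  have hNR : N ∈ D.RR A := sub_mem s_mem_RR (pow_mem s_mem_RR _)
  have hNnil : N ^ D.M = 0 := by
    rw [hN, D.hM.sub _ _ ((Commute.self_pow _ _).eq), D.hM.idem, sub_self]
  have hNA := (h.good.RR_le_cent hNR).1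
  have heA := h.ee_mem'
  let N' : Module.End h.kk V :=
    { toFun := N, map_add' := N.map_add,
      map_smul' := fun k x => congrArg (fun f => f x) (hNA k (h.kk_le k.2)) }
  let e' : Module.End h.kk V :=
    { toFun := (ee F w : Module.End F V), map_add' := (ee F w : Module.End F V).map_add,
      map_smul' := fun k x => congrArg (fun f => f x) (h.good.comm _ heA k (h.kk_le k.2)) }
  have hN' : ∀ n x, (N' ^ n) x = (N ^ n) x := by
    intro n
    induction n with
    | zero => intro x; rfl
    | succ n ih => intro x; rw [pow_succ, pow_succ]; exact ih _
  obtain ⟨T, k, v, y, hy, hTy, hTN, heT, hTe, hev, hT⟩ := exists_cyclic_proj N' e'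
    ⟨D.M, LinearMap.ext fun x => by rw [hN', hNnil]; rfl⟩
    (LinearMap.ext fun x => congrArg (fun f => f x) h.ee_sq)
    (fun h0 => h.ee_ne_zero (LinearMap.ext fun x => congrArg (fun f => f x) h0))
    (LinearMap.ext fun x => congrArg (fun f => f x) (hNA _ heA))
  let t : Module.End F V :=
    { toFun := T, map_add' := T.map_add,
      map_smul' := fun c x => T.map_smul (algebraMap F h.kk c) x }
  have hte : t * ee F w = t := LinearMap.ext fun x => congrArg (fun f => f x) hTe
  have het : ee F w * t = t := LinearMap.ext fun x => congrArg (fun f => f x) heT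
  have htN : t * N = N * t := LinearMap.ext fun x => congrArg (fun f => f x) hTN
  have htk : ∀ k ∈ h.kk, t * k = k * t := fun k hk => LinearMap.ext fun x =>
    T.map_smul (⟨k, hk⟩ : h.kk) x
  have htA : ∀ a ∈ A, t * a = a * t := by
    intro a ha
    obtain ⟨k, hk, hak⟩ := h.exists_kk ha
    rw [← hte, mul_assoc, hak, ← mul_assoc, hte, htk k hk, ← het, ← mul_assoc, ← mul_assoc,
      h.good.comm k (h.kk_le hk) _ heA, ← hak, h.good.comm _ heA a ha, mul_assoc]
  have htc : t ∈ D.cent A := by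
    refine ⟨htA, ?_⟩
    have : (D.s : Module.End F V) = N + (D.s : Module.End F V) ^ D.M := by rw [hN]; abel
    rw [this, mul_add, add_mul, htN, htA _ h.s_pow_mem]
  have hpow : ∀ n, (t ^ n) y = y := by
    intro n
    induction n with
    | zero => rfl
    | succ n ih =>
      rw [pow_succ]
      change (t ^ n) (T y) = y
      rw [hTy, ih]
  have hM2 := D.hM.two_lt
  have hgg := D.hM.pow_pred_idem (D.hM.idem t)
  obtain ⟨g, hg⟩ : ∃ g, g = (t ^ D.M) ^ (D.M - 1) := ⟨_, rfl⟩
  rw [← hg] at hgg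
  obtain ⟨m, hm⟩ : ∃ m, D.M * (D.M - 1) = m + 1 :=
    ⟨D.M * (D.M - 1) - 1, by have : 0 < D.M * (D.M - 1) := Nat.mul_pos (by omega) (by omega)
                             omega⟩
  have hgt : g = t * t ^ m := by rw [hg, ← pow_mul, hm, pow_succ']
  have heg : ee F w * g = g := by rw [hgt, ← mul_assoc, het]
  have hgA := h.idem_mem (hg ▸ pow_mem (pow_mem htc _) _) hgg heg
  have hgn : ∀ n, g ^ (n + 1) = g := by
    intro n
    induction n with
    | zero => exact pow_one g
    | succ n ih => rw [pow_succ, ih, hgg]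
  have hgy : g y = y := by rw [hg, ← pow_mul]; exact hpow _
  have hge : g = ee F w := by
    rcases h.corner_unit hgA heg with h0 | h0
    · rw [h0] at hgy
      exact absurd hgy.symm hy
    · rwa [show D.M - 1 = D.M - 2 + 1 by omega, hgn] at h0
  refine ⟨v, hev, fun x => ?_⟩
  obtain ⟨c, hc⟩ := hT ((t ^ m) x)
  refine ⟨∑ i ∈ Finset.range k, (c i : Module.End F V) * N ^ i, sum_mem fun i _ =>
    mul_mem (le_RR (h.kk_le (c i).2)) (pow_mem hNR _), ?_⟩
  rw [← hge, hgt]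
  refine hc.trans ?_
  rw [LinearMap.sum_apply]
  refine Finset.sum_congr rfl fun i _ => ?_
  rw [hN']
  rfl

theorem Prim.exists_cyclic [Nontrivial (Module.End F V)] [Finite (Module.End F V)]
    (h : D.Prim A w) : ∃ v, ∀ x, ∃ r ∈ D.RR A, x = r v := by
  obtain ⟨v1, hv1, h1⟩ := h.exists_cyclic_corner
  by_cases hw : w = 1
  · refine ⟨v1, fun x => ?_⟩
    obtain ⟨r, hr, hx⟩ := h1 x
    refine ⟨r, hr, ?_⟩
    rw [← hx, hw, ee_one D.two]
    rfl
  · have hn := h.neg (h.w_skew hw)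
    obtain ⟨v2, hv2, h2⟩ := hn.exists_cyclic_corner
    refine ⟨v1 + v2, fun x => ?_⟩
    obtain ⟨r1, hr1, hx1⟩ := h1 x
    obtain ⟨r2, hr2, hx2⟩ := h2 x
    have heA := h.ee_mem'
    have heA' := hn.ee_mem'
    refine ⟨r1 * ee F w + r2 * ee F (-w), add_mem (mul_mem hr1 (le_RR heA))
      (mul_mem hr2 (le_RR heA')), ?_⟩
    have e1 : (ee F w : Module.End F V) v2 = 0 := by
      rw [← hv2]; exact congrArg (fun f => f v2) h.ee_mul_ee_neg
    have e2 : (ee F (-w) : Module.End F V) v1 = 0 := by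
      rw [← hv1]
      exact congrArg (fun f => f v1) ((h.good.comm _ heA' _ heA).trans h.ee_mul_ee_neg)
    have e3 : (ee F w : Module.End F V) x + (ee F (-w) : Module.End F V) x = x := congrArg (fun f => f x) (ee_add_neg D.two w)
    change x = r1 ((ee F w : Module.End F V) (v1 + v2)) + r2 ((ee F (-w) : Module.End F V) (v1 + v2))
    rw [_root_.map_add (ee F w), _root_.map_add (ee F (-w)), hv1, hv2, e1, e2, add_zero, zero_add, ← hx1, ← hx2, e3]

end End
end Frame

theorem sum_eq_filter_of_equivariant {M T : Type} [Group M] [Fintype M] [Fintype T]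
    (act : M → T ≃ T) (g : T → ℂ) (η : T → M →* ℂ) (h : ∀ m t, g (act m t) = η t m * g t) :
    ∑ t, g t = ∑ t with η t = 1, g t := by
  have h0 : (Fintype.card M : ℂ) ≠ 0 := by simp
  apply mul_left_cancel₀ h0
  calc (Fintype.card M : ℂ) * ∑ t, g t = ∑ m : M, ∑ t, g (act m t) := by
        simp_rw [Equiv.sum_comp]
        simp
    _ = ∑ t, ∑ m : M, η t m * g t := by
        rw [Finset.sum_comm]; simp_rw [h]
    _ = ∑ t, (if η t = 1 then (Fintype.card M : ℂ) else 0) * g t := by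
        refine Finset.sum_congr rfl fun t _ => ?_
        rw [← Finset.sum_mul, sum_hom_units]
        split_ifs <;> simp
    _ = _ := by
        rw [Finset.mul_sum, Finset.sum_filter]
        refine Finset.sum_congr rfl fun t _ => ?_
        split_ifs <;> simp

theorem exists_nonneg_sum {T : Type} [Fintype T] (p : T → Prop) (f : T → ℂ)
    (h1 : ∀ t, p t → f t = 1) (h2 : ∀ t, ¬ p t → f t = 1 ∨ f t = -1)
    (h3 : (Finset.univ.filter fun t => ¬ p t).card ≤ (Finset.univ.filter p).card) :
    ∃ r : ℝ, 0 ≤ r ∧ ∑ t, f t = r := by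
  have hf : ∀ t, ∃ r : ℝ, f t = r ∧ (if p t then 1 else -1) ≤ r := by
    intro t
    by_cases hp : p t
    · exact ⟨1, by simp [h1 t hp], by simp [hp]⟩
    · rcases h2 t hp with h | h
      · exact ⟨1, by simp [h], by simp [hp]⟩
      · exact ⟨-1, by simp [h], by simp [hp]⟩
  choose g hg hg' using hf
  refine ⟨∑ t, g t, ?_, by rw [Complex.ofReal_sum]; exact Finset.sum_congr rfl fun t _ => hg t⟩
  refine le_trans ?_ (Finset.sum_le_sum fun t _ => hg' t)
  rw [Finset.sum_ite]
  simp only [Finset.sum_const, nsmul_eq_mul, mul_one, mul_neg]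
  have : ((Finset.univ.filter fun t => ¬ p t).card : ℝ) ≤ (Finset.univ.filter p).card := by
    exact_mod_cast h3
  linarith

/-- The number of twisted square roots. -/
def theta {F E : Type} [Field F] [Ring E] [Algebra F E] (σ : AntiInv F E) (L : Subgroup Eˣ)
    (x : Eˣ) (c : F) (h : Eˣ) : ℂ :=
  (Nat.card {t : Eˣ // x * t ∈ L ∧ σ.IsSim t c ∧ (t * t : E) = (-c) • (h : E)} : ℕ)

/-- The data attached to a similitude `s` and a `2`-group `P` commuting with it. -/
structure TData {F E : Type} [Field F] [Ring E] [Algebra F E] (σ : AntiInv F E) (s : Eˣ)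
    (P L : Subgroup Eˣ) (x : Eˣ) : Prop where
  P_le : P ≤ L
  s_mem : s ∈ L
  comm : ∀ l ∈ L, l * s = s * l
  sim : ∀ l ∈ L, ∃ c, σ.IsSim l c
  scal_mem : ∀ c : Fˣ, scal F c ∈ L
  x_sim : σ.IsSim x (-1)
  x_sq : x * x = 1
  conj : ∀ l ∈ L, x * l * x ∈ L
  x_s : ∀ c, σ.IsSim s c → ((x * s * x * s : Eˣ) : E) = c • (1 : E)
  psd : ∀ c, c ≠ 0 → IsPSD (fun h : L => theta σ L x c h)

namespace Frame

variable {F E : Type} [Field F] [Ring E] [Algebra F E] {D : Frame F E} {A : Subalgebra F E} {w : E}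

/-- An involutive antisimilitude inducing the anti-involution on the commutative algebra. -/
structure Base (D : Frame F E) (A : Subalgebra F E) (x : Eˣ) : Prop where
  sq : x * x = 1
  sim : D.σ.IsSim x (-1)
  conj : ∀ r ∈ D.RR A, (x * r * x : E) = D.σ r
  cent : ∀ z : E, (∀ r ∈ D.RR A, z * r = r * z) → z ∈ D.RR A

theorem P_isSim {p : Eˣ} (hp : p ∈ D.P) : ∃ c, D.σ.IsSim p c := D.P_sim p hp

theorem Prim.exists_norm [Finite E] [Nontrivial E] (h : D.Prim A w) {c : F} (hc : c ≠ 0)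
    (hb : w = 1 → ∃ b ∈ D.P, (b : E) ∉ A) : ∃ m : Eˣ, (m : E) ∈ A ∧ D.σ.IsSim m c := by
  suffices ∃ m ∈ A, m * D.σ m = c • (1 : E) by
    obtain ⟨m, hm, hmm⟩ := this
    have h1 : m * (c⁻¹ • D.σ m) = 1 := by
      rw [mul_smul_comm, hmm, smul_smul, inv_mul_cancel₀ hc, one_smul]
    have h2 : (c⁻¹ • D.σ m) * m = 1 := by
      rw [h.good.comm _ (A.smul_mem (h.good.star _ hm) _) _ hm, h1]
    refine ⟨⟨m, _, h1, h2⟩, hm, AntiInv.IsSim.iff_mul.2 ⟨hc, ?_⟩⟩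
    change D.σ m * m = _
    rw [h.good.comm _ (h.good.star _ hm) _ hm, hmm]
  by_cases hw : w = 1
  · by_cases hσ : ∃ a ∈ A, D.σ a ≠ a
    · let := h.kk_isField.toField
      have hk : ∀ a ∈ A, a ∈ h.kk := fun a ha => ⟨ha, Or.inl hw⟩
      have : Finite h.kk := Subtype.finite
      obtain ⟨a, ha, hσa⟩ := hσ
      let f : h.kk →+* h.kk :=
        { toFun := fun a => ⟨D.σ a, hk _ (h.good.star _ (h.kk_le a.2))⟩
          map_one' := Subtype.ext D.σ.map_one
          map_zero' := Subtype.ext D.σ.map_zero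
          map_add' := fun a b => Subtype.ext (D.σ.map_add _ _)
          map_mul' := fun a b => Subtype.ext ((D.σ.map_mul _ _).trans
            (h.good.comm _ (h.good.star _ (h.kk_le b.2)) _ (h.good.star _ (h.kk_le a.2)))) }
      obtain ⟨r, hr⟩ := finiteField_exists_norm h.two_ne f
        (fun x => Subtype.ext (D.σ.invol _)) ⟨⟨a, hk a ha⟩, fun h1 => hσa (congrArg Subtype.val h1)⟩
        (m := algebraMap F h.kk c) (Subtype.ext (by
          change D.σ (algebraMap F E c) = algebraMap F E c; simp))
      refine ⟨r, h.kk_le r.2, ?_⟩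
      have := congrArg Subtype.val hr
      rw [Algebra.smul_def, mul_one]
      exact this
    · push Not at hσ
      obtain ⟨b, hb, hbA⟩ := hb hw
      obtain ⟨δ, hδ, hδ0, hbδ⟩ := h.exists_delta hb hbA (by rw [hw, _root_.map_one])
      obtain ⟨ρ, hρ, hρρ, -⟩ := h.exists_sqrt hb hδ (y := c • (1 : E))
        ⟨A.smul_mem (one_mem _) _, Or.inl hw⟩ hδ0 hbδ (by simp)
      exact ⟨ρ, h.kk_le hρ, by rw [hσ _ (h.kk_le hρ), hρρ]⟩
  · have hs := h.w_skew hw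
    refine ⟨c • ee F w + ee F (-w), add_mem (A.smul_mem h.ee_mem' _)
      (ee_mem A (neg_mem h.w_mem)), ?_⟩
    rw [D.σ.map_add, D.σ.map_smul, h.sigma_ee hw, h.sigma_ee_neg hw, add_mul, mul_add, mul_add,
      smul_mul_smul_comm, h.ee_mul_ee_neg, smul_mul_assoc, h.ee_sq, mul_smul_comm,
      ee_mul_self D.two (by rw [neg_mul_neg, h.w_sq]),
      h.good.comm _ (ee_mem A (neg_mem h.w_mem)) _ h.ee_mem', h.ee_mul_ee_neg, smul_zero, zero_add,
      add_zero, ← smul_add, ee_add_neg D.two]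

end Frame

namespace Frame

variable {F E : Type} [Field F] [Ring E] [Algebra F E] {D : Frame F E} {A : Subalgebra F E} {w : E}
  {x : Eˣ}

/-- The units of the commutative algebra of multiplier one. -/
def M1 [Finite E] (D : Frame F E) (A : Subalgebra F E) : Subgroup Eˣ where
  carrier := {r | (r : E) ∈ D.RR A ∧ D.σ.IsSim r 1}
  one_mem' := ⟨one_mem _, AntiInv.IsSim.one⟩
  mul_mem' := fun h h' => ⟨mul_mem h.1 h'.1, by simpa using h.2.mul h'.2⟩
  inv_mem' := fun h => ⟨inv_mem_of h.1, by simpa using h.2.inv⟩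

/-- The group generated by `P` and the similitudes in the commutative algebra. -/
def LL [Finite E] (h : D.Prim A w) : Subgroup Eˣ where
  carrier := {l | ∃ r b : Eˣ, (r : E) ∈ D.RR A ∧ (∃ c, D.σ.IsSim r c) ∧ b ∈ D.P ∧ l = r * b}
  one_mem' := ⟨1, 1, one_mem _, ⟨1, AntiInv.IsSim.one⟩, D.P.one_mem, (one_mul 1).symm⟩
  mul_mem' := by
    rintro _ _ ⟨r, b, hr, ⟨c, hc⟩, hb, rfl⟩ ⟨r', b', hr', ⟨c', hc'⟩, hb', rfl⟩
    obtain ⟨d, hd⟩ := P_isSim hb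
    refine ⟨r * (b * r' * b⁻¹), b * b', mul_mem hr (h.RR_cj hb hr'),
      ⟨_, hc.mul ((hd.mul hc').mul hd.inv)⟩, D.P.mul_mem hb hb', by group⟩
  inv_mem' := by
    rintro _ ⟨r, b, hr, ⟨c, hc⟩, hb, rfl⟩
    obtain ⟨d, hd⟩ := P_isSim hb
    have hbi := D.P.inv_mem hb
    refine ⟨b⁻¹ * r⁻¹ * b⁻¹⁻¹, b⁻¹, h.RR_cj hbi (inv_mem_of hr),
      ⟨_, (hd.inv.mul hc.inv).mul hd.inv.inv⟩, hbi, by group⟩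

theorem mem_LL_of [Finite E] (h : D.Prim A w) {r : Eˣ} (hr : (r : E) ∈ D.RR A) {c : F}
    (hc : D.σ.IsSim r c) : r ∈ LL h :=
  ⟨r, 1, hr, ⟨c, hc⟩, D.P.one_mem, (mul_one r).symm⟩

theorem LL_sim [Finite E] (h : D.Prim A w) {l : Eˣ} (hl : l ∈ LL h) : ∃ c, D.σ.IsSim l c := by
  obtain ⟨r, b, -, ⟨c, hc⟩, hb, rfl⟩ := hl
  obtain ⟨d, hd⟩ := P_isSim hb
  exact ⟨_, hc.mul hd⟩

theorem LL_conj_RR [Finite E] (h : D.Prim A w) {l : Eˣ} (hl : l ∈ LL h) {r : E}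
    (hr : r ∈ D.RR A) : cj F l r ∈ D.RR A := by
  obtain ⟨r', b, hr', -, hb, rfl⟩ := hl
  rw [← cj_cj, cj_eq_self.2 (h.good.RR_comm hr' (h.RR_cj hb hr))]
  exact h.RR_cj hb hr

theorem LL_conj_M1 [Finite E] (h : D.Prim A w) {l : Eˣ} (hl : l ∈ LL h) {r : Eˣ}
    (hr : r ∈ D.M1 A) : l * r * l⁻¹ ∈ D.M1 A := by
  obtain ⟨c, hc⟩ := LL_sim h hl
  refine ⟨LL_conj_RR h hl hr.1, ?_⟩
  have := (hc.mul hr.2).mul hc.inv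
  rwa [mul_one, mul_inv_cancel₀ hc.1] at this

theorem M1_comm [Finite E] (h : D.Prim A w) {r t : Eˣ} (hr : r ∈ D.M1 A) (ht : t ∈ D.M1 A) :
    r * t = t * r := by
  ext; exact h.good.RR_comm hr.1 ht.1

theorem M1_le_LL [Finite E] (h : D.Prim A w) : D.M1 A ≤ LL h := fun _ hr => mem_LL_of h hr.1 hr.2

namespace Base

theorem conj_M1 [Finite E] (hx : D.Base A x) {r : Eˣ} (hr : r ∈ D.M1 A) : x * r * x = r⁻¹ := by
  ext
  have := hx.conj r hr.1
  rw [hr.2.2, one_smul] at this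
  exact this

theorem inv (hx : D.Base A x) : x⁻¹ = x := by rw [inv_eq_iff_mul_eq_one, hx.sq]

theorem cj_eq (hx : D.Base A x) {r : E} (hr : r ∈ D.RR A) : cj F x r = D.σ r := by
  rw [cj_apply, hx.inv, hx.conj r hr]

theorem rho [Finite E] (hx : D.Base A x) (h : D.Prim A w) {b : Eˣ} (hb : b ∈ D.P) :
    x * b * x * b⁻¹ ∈ D.M1 A := by
  obtain ⟨d, hd⟩ := P_isSim hb
  refine ⟨hx.cent _ fun r hr => ?_, ?_⟩
  · have hbi := h.RR_cj (D.P.inv_mem hb) hr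
    refine (cj_eq_self (F := F)).1 ?_
    rw [← cj_cj, ← cj_cj, ← cj_cj, hx.cj_eq hbi, ← hd.conj, cj_cj, mul_inv_cancel, cj_one,
      hx.cj_eq (h.RR_sigma hr), D.σ.invol]
  · have := ((hx.sim.mul hd).mul hx.sim).mul hd.inv
    simpa [hd.1] using this

theorem LL_conj [Finite E] (hx : D.Base A x) (h : D.Prim A w) {l : Eˣ} (hl : l ∈ LL h) :
    x * l * x ∈ LL h := by
  obtain ⟨r, b, hr, ⟨c, hc⟩, hb, rfl⟩ := hl
  have h1 : x * r * x ∈ LL h := by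
    refine mem_LL_of h ?_ ((hx.sim.mul hc).mul hx.sim)
    rw [Units.val_mul, Units.val_mul, hx.conj _ hr]
    exact h.RR_sigma hr
  have h2 := (LL h).mul_mem h1 ((LL h).mul_mem (M1_le_LL h (hx.rho h hb))
    ((LL h).mul_mem (mem_LL_of h (one_mem _) AntiInv.IsSim.one)
      ⟨1, b, one_mem _, ⟨1, AntiInv.IsSim.one⟩, hb, (one_mul b).symm⟩))
  convert h2 using 1
  rw [show x * (r * b) * x = x * r * (b * x) by group]
  rw [show x * r * x * (x * b * x * b⁻¹ * (1 * b)) = x * r * (x * x) * (b * x) by group, hx.sq,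
    mul_one]

/-- The square of an element of the twisted coset lies in the commutative algebra. -/
theorem sq_mem [Nontrivial E] [Finite E] (hx : D.Base A x) (h : D.Prim A w) {t : Eˣ} (ht : x * t ∈ LL h) :
    ((t * t : Eˣ) : E) ∈ D.RR A := by
  obtain ⟨r, b, hr, -, hb, hrb⟩ := ht
  have h0 : t = x * (r * b) := by rw [← hrb, ← mul_assoc, hx.sq, one_mul]
  have h1 : t * t = (x * r * x) * (x * b * x * b⁻¹) * (b * r * b⁻¹) * (b * b) := by
    rw [show (x * r * x) * (x * b * x * b⁻¹) * (b * r * b⁻¹) * (b * b)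
      = x * r * (x * x) * (b * x * r * b) by group, hx.sq, h0]
    group
  rw [h1]
  refine mul_mem (mul_mem (mul_mem ?_ (hx.rho h hb).1) (h.RR_cj hb hr)) (le_RR (h.sq_mem hb))
  rw [Units.val_mul, Units.val_mul, hx.conj _ hr]
  exact h.RR_sigma hr

/-- The normalized square. -/
def qq (F : Type) {E : Type} [Field F] [Ring E] [Algebra F E] (c : Fˣ) (t : Eˣ) : Eˣ :=
  scal F (-c⁻¹) * (t * t)

theorem qq_mem [Nontrivial E] [Finite E] (hx : D.Base A x) (h : D.Prim A w) {c : Fˣ} {t : Eˣ} (ht : x * t ∈ LL h)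
    (hc : D.σ.IsSim t (c : F)) : qq F c t ∈ D.M1 A := by
  refine ⟨mul_mem (by rw [scal_coe]; exact Subalgebra.algebraMap_mem _ _) (hx.sq_mem h ht), ?_⟩
  have := (scal_sim D.σ (-c⁻¹)).mul (hc.mul hc)
  rwa [show (((-c⁻¹ : Fˣ) : F) * ((-c⁻¹ : Fˣ) : F) * ((c : F) * c)) = 1 by
    push_cast
    have := c.ne_zero
    field_simp] at this

theorem qq_comm (c : Fˣ) (t : Eˣ) : t * qq F c t * t⁻¹ = qq F c t := by
  rw [qq, ← mul_assoc, ← scal_comm]; group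

/-- A character of `M1`, extended by zero. -/
def ext0 [Finite E] (χ : D.M1 A →* ℂ) (u : Eˣ) : ℂ := if h : u ∈ D.M1 A then χ ⟨u, h⟩ else 0

theorem ext0_of [Finite E] (χ : D.M1 A →* ℂ) {u : Eˣ} (h : u ∈ D.M1 A) :
    ext0 χ u = χ ⟨u, h⟩ := dif_pos h

theorem ext0_mul [Finite E] (χ : D.M1 A →* ℂ) {u v : Eˣ} (hu : u ∈ D.M1 A) (hv : v ∈ D.M1 A) :
    ext0 χ (u * v) = ext0 χ u * ext0 χ v := by
  rw [ext0_of χ hu, ext0_of χ hv, ext0_of χ (mul_mem hu hv), ← _root_.map_mul]; rfl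

theorem ext0_one [Finite E] (χ : D.M1 A →* ℂ) : ext0 χ 1 = 1 := by
  rw [ext0_of χ (one_mem _)]; exact _root_.map_one χ

theorem ext0_pow [Finite E] (χ : D.M1 A →* ℂ) {u : Eˣ} (hu : u ∈ D.M1 A) (n : ℕ) :
    ext0 χ (u ^ n) = ext0 χ u ^ n := by
  induction n with
  | zero => rw [pow_zero, pow_zero, ext0_one]
  | succ n ih => rw [pow_succ, ext0_mul χ (pow_mem hu n) hu, ih, pow_succ]

theorem ext0_inv [Finite E] (χ : D.M1 A →* ℂ) {u : Eˣ} (hu : u ∈ D.M1 A) :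
    ext0 χ u * ext0 χ u⁻¹ = 1 := by
  rw [← ext0_mul χ hu (inv_mem hu), mul_inv_cancel, ext0_one]

/-- Elements stabilizing a character. -/
def Stab [Finite E] (χ : D.M1 A →* ℂ) (l : Eˣ) : Prop :=
  ∀ r ∈ D.M1 A, ext0 χ (l * r * l⁻¹) = ext0 χ r

/-- Elements commuting with `w`, inside the commutative algebra when `w = 1`. -/
def IsPlus (D : Frame F E) (A : Subalgebra F E) (w : E) (l : Eˣ) : Prop :=
  cj F l w = w ∧ (w = 1 → (l : E) ∈ D.RR A)

end Base
end Frame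

namespace Frame.Base

variable {F E : Type} [Field F] [Ring E] [Algebra F E] {D : Frame F E} {A : Subalgebra F E} {w : E}
  {x : Eˣ}

theorem qq_sq_of_stab [Nontrivial E] [Finite E] (hx : D.Base A x) (h : D.Prim A w) (χ : D.M1 A →* ℂ)
    {c : Fˣ} {t : Eˣ} (ht : x * t ∈ LL h) (hc : D.σ.IsSim t (c : F)) (hst : Stab χ (x * t)) :
    x * t * qq F c t * (x * t)⁻¹ = (qq F c t)⁻¹ ∧ ext0 χ (qq F c t) * ext0 χ (qq F c t) = 1 := by
  have hq := hx.qq_mem h ht hc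
  have h1 : x * t * qq F c t * (x * t)⁻¹ = (qq F c t)⁻¹ := by
    rw [_root_.mul_inv_rev, show x * t * qq F c t * (t⁻¹ * x⁻¹) = x * (t * qq F c t * t⁻¹) * x⁻¹ by group,
      qq_comm, hx.inv, hx.conj_M1 hq]
  refine ⟨h1, ?_⟩
  have h2 := hst _ hq
  rw [h1] at h2
  nth_rewrite 2 [← h2]
  exact ext0_inv χ hq

theorem qq_eq_one [Finite E] (hx : D.Base A x) {c : Fˣ} {t : Eˣ} (hc : D.σ.IsSim t (c : F))
    (hl : ((x * t : Eˣ) : E) ∈ D.RR A) : qq F c t = 1 := by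
  have h1 := hx.conj _ hl
  have h2 := (AntiInv.IsSim.iff_mul.1 (hx.sim.mul hc)).2
  rw [← h1] at h2
  have h3 : (t * t : E) = (-(c : F)) • (1 : E) := by
    rw [neg_one_mul] at h2
    rw [← h2, ← Units.val_mul, ← Units.val_mul, ← Units.val_mul, ← Units.val_mul]
    congr 1
    rw [show x * (x * t) * x * (x * t) = (x * x) * t * (x * x) * t by group, hx.sq]; group
  ext
  rw [qq, Units.val_mul, Units.val_mul, h3, scal_coe, mul_smul_comm, mul_one, Units.val_one,
    Algebra.algebraMap_eq_smul_one, smul_smul]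
  simp

theorem exists_twist [Nontrivial E] [Finite E] (h : D.Prim A w) (hw : w ≠ 1) {b k : Eˣ}
    (hb : b ∈ D.P) (hbA : (b : E) ∉ A) (hbw : cj F b w = w) (hk : (k : E) ∈ A)
    (hkσ : D.σ.IsSim k 1) (hbk : b * k * b⁻¹ = k⁻¹) :
    ∃ r ∈ D.M1 A, b * r * b⁻¹ = k * r := by
  have hki : ((k⁻¹ : Eˣ) : E) ∈ A := inv_mem_of hk
  have hbk' : cj F b (k : E) = ((k⁻¹ : Eˣ) : E) := congrArg Units.val hbk
  have hbki : cj F b ((k⁻¹ : Eˣ) : E) = (k : E) := by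
    have : b * k⁻¹ * b⁻¹ = k := by
      rw [show b * k⁻¹ * b⁻¹ = (b * k * b⁻¹)⁻¹ by group, hbk, inv_inv]
    exact congrArg Units.val this
  have hsk : D.σ k = ((k⁻¹ : Eˣ) : E) := by rw [hkσ.2, one_smul]
  have hbe : cj F b (ee F w) = ee F w := by
    rw [ee, _root_.map_smul, _root_.map_add, _root_.map_one, hbw]
  have heA : ee F w ∈ A := h.ee_mem'
  obtain ⟨y, hyA, hye, hyb, hy0⟩ : ∃ y ∈ A, ee F w * y = y ∧ cj F b y = k * y ∧ y ≠ 0 := by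
    obtain ⟨δ, hδ, hδ0, hbδ⟩ := h.exists_delta hb hbA hbw
    have hδA := h.kk_le hδ
    by_contra! hcon
    have h1 := hcon (ee F w * (1 + (k⁻¹ : Eˣ))) (mul_mem heA (add_mem (one_mem _) hki))
      (by rw [← mul_assoc, h.ee_sq]) (by
        rw [_root_.map_mul, hbe, _root_.map_add, _root_.map_one, hbki, ← mul_assoc,
          h.good.comm _ hk _ heA, mul_assoc, mul_add (k : E), Units.mul_inv, mul_one, add_comm])
    have h2 := hcon (ee F w * (δ * (1 - (k⁻¹ : Eˣ))))
      (mul_mem heA (mul_mem hδA (sub_mem (one_mem _) hki)))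
      (by rw [← mul_assoc, h.ee_sq]) (by
        rw [_root_.map_mul, hbe, _root_.map_mul, hbδ, _root_.map_sub, _root_.map_one, hbki,
          ← mul_assoc (k : E),
          h.good.comm _ hk _ heA, mul_assoc, ← mul_assoc (k : E), h.good.comm _ hk _ hδA, mul_assoc,
          mul_sub (k : E), Units.mul_inv, mul_one, neg_mul, ← mul_neg, neg_sub])
    let := h.kk_isField.toField
    obtain ⟨δ', h4⟩ : ∃ z : E, z * δ = 1 := by
      have hd : (⟨δ, hδ⟩ : h.kk) ≠ 0 := fun h3 => hδ0 (congrArg Subtype.val h3)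
      exact ⟨_, congrArg Subtype.val (inv_mul_cancel₀ hd)⟩
    have h3 : ee F w * (1 - ((k⁻¹ : Eˣ) : E)) = 0 := by
      have : δ * (ee F w * (1 - ((k⁻¹ : Eˣ) : E))) = 0 := by
        rw [← mul_assoc, h.good.comm _ hδA _ heA, mul_assoc, h2]
      rw [← one_mul (ee F w * (1 - ((k⁻¹ : Eˣ) : E)))]
      nth_rewrite 1 [← h4]
      rw [mul_assoc, this, mul_zero]
    have h5 : (2 : F) • ee F w = 0 := by
      have := congrArg₂ (· + ·) h1 h3
      simp only [mul_add, mul_sub, mul_one, add_zero] at this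
      rw [two_smul, ← this]; abel
    exact h.ee_ne_zero (by simpa [D.two] using h5)
  have hM := D.hM.two_lt
  obtain ⟨z, hzA, hze, hyz⟩ : ∃ z ∈ A, ee F w * z = z ∧ y * z = ee F w := by
    refine ⟨ee F w * y ^ (D.M - 2), mul_mem heA (pow_mem hyA _), by rw [← mul_assoc, h.ee_sq], ?_⟩
    rw [← mul_assoc, h.good.comm _ hyA _ heA, hye, ← pow_succ',
      show D.M - 2 + 1 = D.M - 1 by omega]
    exact (h.corner_unit hyA hye).resolve_left hy0
  have hzy : z * y = ee F w := by rw [h.good.comm _ hzA _ hyA, hyz]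
  have hzb : cj F b z = ((k⁻¹ : Eˣ) : E) * z := by
    have h1 : k * y * cj F b z = ee F w := by rw [← hyb, ← _root_.map_mul, hyz, hbe]
    have h2 : ee F w * cj F b z = cj F b z := by
      have := congrArg (cj F b) hze
      rwa [_root_.map_mul, hbe] at this
    rw [← h2, ← hzy, mul_assoc]
    have h3 : y * cj F b z = ((k⁻¹ : Eˣ) : E) * ee F w := by
      rw [← h1, mul_assoc, Units.inv_mul_cancel_left]
    rw [h3, ← mul_assoc, h.good.comm _ hzA _ hki, mul_assoc, h.good.comm _ hzA _ heA, hze]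
  have hyz0 : D.σ y * y = 0 := by
    rw [← hye, D.σ.map_mul, h.sigma_ee hw, mul_assoc, ← mul_assoc (ee F (-w)),
      h.good.comm _ (ee_mem A (neg_mem h.w_mem)) _ heA, h.ee_mul_ee_neg, zero_mul, mul_zero]
  have hzz0 : z * D.σ z = 0 := by
    rw [← hze, D.σ.map_mul, h.sigma_ee hw, mul_assoc,
      h.good.comm _ (h.good.star _ hzA) _ (ee_mem A (neg_mem h.w_mem)), ← mul_assoc z,
      h.good.comm _ hzA _ (ee_mem A (neg_mem h.w_mem)), mul_assoc, ← mul_assoc, h.ee_mul_ee_neg,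
      zero_mul]
  have hrA : y + D.σ z ∈ A := add_mem hyA (h.good.star _ hzA)
  have hr : D.σ (y + D.σ z) * (y + D.σ z) = 1 := by
    rw [D.σ.map_add, D.σ.invol, add_mul, mul_add, mul_add, hyz0, hzz0, hzy, ← D.σ.map_mul, hzy,
      h.sigma_ee hw, zero_add, add_zero, add_comm, ee_add_neg D.two]
  let r : Eˣ := ⟨y + D.σ z, D.σ (y + D.σ z),
    by rw [h.good.comm _ hrA _ (h.good.star _ hrA), hr], hr⟩
  refine ⟨r, ⟨le_RR hrA, AntiInv.IsSim.iff_mul.2 ⟨one_ne_zero, by rw [one_smul]; exact hr⟩⟩, ?_⟩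
  ext
  change cj F b (y + D.σ z) = k * (y + D.σ z)
  obtain ⟨d, hd⟩ := P_isSim hb
  rw [_root_.map_add, hyb, ← hd.conj, hzb, D.σ.map_mul, hkσ.inv.2, inv_inv, inv_one, one_smul,
    h.good.comm _ (h.good.star _ hzA) _ hk, mul_add]

/-- The normalized square is killed by the character on the plus part. -/
theorem ext0_qq_of_plus [Nontrivial E] [Finite E] (hx : D.Base A x) (h : D.Prim A w)
    (χ : D.M1 A →* ℂ) {c : Fˣ} {t : Eˣ} (ht : x * t ∈ LL h) (hc : D.σ.IsSim t (c : F))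
    (hst : Stab χ (x * t)) (hpl : IsPlus D A w (x * t)) : ext0 χ (qq F c t) = 1 := by
  by_cases hl : ((x * t : Eˣ) : E) ∈ D.RR A
  · rw [hx.qq_eq_one hc hl, ext0_one]
  have hw : w ≠ 1 := fun hw => hl (hpl.2 hw)
  have hq := hx.qq_mem h ht hc
  obtain ⟨hq1, hq2⟩ := hx.qq_sq_of_stab h χ ht hc hst
  obtain ⟨r, b, hr, -, hb, hrb⟩ := ht
  have hbA : (b : E) ∉ A := fun hbA => hl (by
    rw [hrb]; exact mul_mem hr (le_RR hbA))
  have hcj : ∀ u : Eˣ, (u : E) ∈ D.RR A → x * t * u * (x * t)⁻¹ = b * u * b⁻¹ := by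
    intro u hu
    have h1 : r * (b * u * b⁻¹) = (b * u * b⁻¹) * r :=
      Units.ext (h.good.RR_comm hr (h.RR_cj hb hu))
    rw [hrb, show r * b * u * (r * b)⁻¹ = r * (b * u * b⁻¹) * r⁻¹ by group, h1,
      mul_inv_cancel_right]
  have hbw : cj F b w = w := by
    have h1 := hpl.1
    rwa [hrb, ← cj_cj, cj_eq_self.2 (h.good.RR_comm hr
      (le_RR (h.good.conj b hb _ h.w_mem)))] at h1
  obtain ⟨k, hk⟩ : ∃ k, k = qq F c t ^ D.M := ⟨_, rfl⟩
  have hkM : k ∈ D.M1 A := hk ▸ pow_mem hq _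
  have hkA : (k : E) ∈ A := by
    rw [hk, Units.val_pow_eq_pow_val]; exact h.RR_pow_mem hq.1
  have hbk : b * k * b⁻¹ = k⁻¹ := by
    rw [← hcj _ hkM.1, hk, ← conj_pow, hq1, inv_pow]
  obtain ⟨u, hu, hbu⟩ := exists_twist h hw hb hbA hbw hkA hkM.2 hbk
  have h1 := hst _ hu
  rw [hcj _ hu.1, hbu, ext0_mul χ hkM hu] at h1
  have hu0 : ext0 χ u ≠ 0 := left_ne_zero_of_mul_eq_one (ext0_inv χ hu)
  have h2 : ext0 χ k = 1 := by
    field_simp at h1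
    exact h1
  rw [hk, ext0_pow χ hq] at h2
  obtain ⟨m, hm⟩ := D.hM.odd
  rwa [hm, pow_succ, pow_mul, pow_two, hq2, one_pow, one_mul] at h2

end Frame.Base

namespace Frame.Base

variable {F E : Type} [Field F] [Ring E] [Algebra F E] {D : Frame F E} {A : Subalgebra F E} {w : E}
  {x : Eˣ}

theorem Stab.mul [Finite E] (h : D.Prim A w) {χ : D.M1 A →* ℂ} {l l' : Eˣ} (hs : Stab χ l)
    (hs' : Stab χ l') (hl' : l' ∈ LL h) : Stab χ (l * l') := fun r hr => by
  rw [show l * l' * r * (l * l')⁻¹ = l * (l' * r * l'⁻¹) * l⁻¹ by group,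
    hs _ (LL_conj_M1 h hl' hr), hs' _ hr]

theorem Stab.inv [Finite E] (h : D.Prim A w) {χ : D.M1 A →* ℂ} {l : Eˣ} (hs : Stab χ l)
    (hl : l ∈ LL h) : Stab χ l⁻¹ := fun r hr => by
  rw [← hs _ (LL_conj_M1 h ((LL h).inv_mem hl) hr)]
  congr 1
  group

theorem Stab.of_mem [Finite E] (h : D.Prim A w) {χ : D.M1 A →* ℂ} {m : Eˣ} (hm : (m : E) ∈ A) :
    Stab χ m := fun r hr => by
  rw [show m * r = r * m from Units.ext (h.good.RR_comm (le_RR hm) hr.1), mul_inv_cancel_right]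

theorem isPlus_mul [Nontrivial E] [Finite E] (h : D.Prim A w) {l l' m : Eˣ} (hl : l ∈ LL h)
    (hl' : l' ∈ LL h) (hn : ¬ IsPlus D A w l) (hn' : ¬ IsPlus D A w l') (hm : (m : E) ∈ A) :
    IsPlus D A w (l * l'⁻¹ * m) := by
  have hmw : cj F m w = w := cj_eq_self.2 (h.good.comm _ hm _ h.w_mem)
  have key : ∀ l ∈ LL h, ¬ IsPlus D A w l → (w = 1 ∨ cj F l w = -w) := by
    rintro _ ⟨r, b, hr, -, hb, rfl⟩ hn
    have h1 : cj F (r * b) w = cj F b w := by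
      rw [← cj_cj, cj_eq_self.2 (h.good.RR_comm hr (le_RR (h.good.conj b hb _ h.w_mem)))]
    by_cases hw : w = 1
    · exact Or.inl hw
    right
    rw [h1]
    exact ((h.cj_w hb).resolve_left fun h2 => hn ⟨h1.trans h2, fun h3 => absurd h3 hw⟩).1
  by_cases hw : w = 1
  · have key2 : ∀ l ∈ LL h, ¬ IsPlus D A w l → ∃ r b : Eˣ, (r : E) ∈ D.RR A ∧ b ∈ D.P ∧ l = r * b ∧
        (b : E) ∉ A := by
      rintro _ ⟨r, b, hr, -, hb, rfl⟩ hn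
      refine ⟨r, b, hr, hb, rfl, fun hbA => hn ⟨by rw [hw, _root_.map_one], fun _ => ?_⟩⟩
      exact mul_mem hr (le_RR hbA)
    obtain ⟨r, b, hr, hb, rfl, hbA⟩ := key2 l hl hn
    obtain ⟨r', b', hr', hb', rfl, hbA'⟩ := key2 l' hl' hn'
    refine ⟨by rw [hw, _root_.map_one], fun _ => ?_⟩
    rw [show r * b * (r' * b')⁻¹ * m = r * (b * b'⁻¹) * r'⁻¹ * m by group]
    refine mul_mem (mul_mem (mul_mem hr (le_RR ?_)) (inv_mem_of hr')) (le_RR hm)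
    refine h.mul_mem_of_not_mem hb hbA (by rw [hw, _root_.map_one]) (D.P.inv_mem hb')
      (fun h3 => hbA' (by simpa using inv_mem_of h3)) (by rw [hw, _root_.map_one])
  · refine ⟨?_, fun h1 => absurd h1 hw⟩
    have h1 := (key l hl hn).resolve_left hw
    have h2 : cj F l'⁻¹ w = -w := by
      rw [cj_inv_eq, inv_inv, _root_.map_neg, (key l' hl' hn').resolve_left hw, neg_neg]
    rw [← cj_cj, ← cj_cj, hmw, h2, _root_.map_neg, h1, neg_neg]

theorem psd [Nontrivial E] [Finite E] (hx : D.Base A x) (h : D.Prim A w) {c : F} (hc : c ≠ 0) :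
    IsPSD (fun l : LL h => theta D.σ (LL h) x c l) := by
  obtain ⟨c, rfl⟩ : ∃ c' : Fˣ, c' = c := ⟨Units.mk0 c hc, rfl⟩
  let T : Type := {t : Eˣ // x * t ∈ LL h ∧ D.σ.IsSim t (c : F)}
  have : Finite T := Subtype.finite
  let : Fintype T := Fintype.ofFinite T
  have : Finite (D.M1 A) := Subtype.finite
  let : Fintype (D.M1 A) := Fintype.ofFinite _
  have hqm : ∀ t : T, qq F c t.1 ∈ D.M1 A := fun t => hx.qq_mem h t.2.1 t.2.2
  have hle := M1_le_LL h
  have key := IsPSD.of_fourier (G := LL h) ((D.M1 A).subgroupOf (LL h))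
    (fun a ha b hb => Subtype.ext (M1_comm h ha hb))
    (T := T) (fun t => ⟨qq F c t.1, hle (hqm t)⟩) (fun t => hqm t) ?_
  · convert key using 2 with l
    rw [theta]
    congr 1
    refine Nat.card_congr ⟨fun t => ⟨⟨t.1, t.2.1, t.2.2.1⟩, ?_⟩, fun t => ⟨t.1.1, t.1.2.1, t.1.2.2, ?_⟩,
      fun _ => rfl, fun _ => rfl⟩
    · ext
      change ((qq F c t.1 : Eˣ) : E) = (l.1 : E)
      rw [qq, Units.val_mul, Units.val_mul, t.2.2.2, scal_coe, mul_smul_comm,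
        Algebra.algebraMap_eq_smul_one, smul_mul_assoc, one_mul, smul_smul]
      simp
    · have h1 : ((qq F c t.1.1 : Eˣ) : E) = (l.1 : E) := congrArg (fun u : LL h => (u.1 : E)) t.2
      rw [← h1, qq, Units.val_mul, Units.val_mul, scal_coe,
        Algebra.algebraMap_eq_smul_one, smul_mul_assoc, one_mul, smul_smul]
      simp
  · intro χ0
    let χ : D.M1 A →* ℂ := χ0.comp (Subgroup.subgroupOfEquivOfLe hle).symm.toMonoidHom
    have hsum : ∀ t : T, χ0 ⟨⟨qq F c t.1, hle (hqm t)⟩, hqm t⟩ = ext0 χ (qq F c t.1) := by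
      intro t
      rw [ext0_of χ (hqm t)]
      rfl
    simp_rw [hsum]
    have hconj : ∀ t : T, ∀ r ∈ D.M1 A, t.1 * r * t.1⁻¹ = (x * t.1 * r * (x * t.1)⁻¹)⁻¹ ∧
        x * t.1 * r * (x * t.1)⁻¹ ∈ D.M1 A := by
      intro t r hr
      have h1 := LL_conj_M1 h t.2.1 hr
      refine ⟨?_, h1⟩
      rw [← hx.conj_M1 h1, _root_.mul_inv_rev, hx.inv,
        show x * (x * t.1 * r * (t.1⁻¹ * x)) * x = (x * x) * t.1 * r * t.1⁻¹ * (x * x) by group,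
        hx.sq]
      group
    let act : D.M1 A → T ≃ T := fun r =>
      { toFun := fun t => ⟨r.1 * t.1, by
          rw [show x * (r.1 * t.1) = (x * r.1 * x) * (x⁻¹ * t.1) by group, hx.inv, hx.conj_M1 r.2]
          exact mul_mem (hle (inv_mem r.2)) t.2.1, by simpa using r.2.2.mul t.2.2⟩
        invFun := fun t => ⟨r.1⁻¹ * t.1, by
          rw [show x * (r.1⁻¹ * t.1) = (x * r.1⁻¹ * x) * (x⁻¹ * t.1) by group, hx.inv,
            hx.conj_M1 (inv_mem r.2)]
          exact mul_mem (hle (inv_mem (inv_mem r.2))) t.2.1,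
          by simpa using (inv_mem r.2 : r.1⁻¹ ∈ D.M1 A).2.mul t.2.2⟩
        left_inv := fun t => Subtype.ext (inv_mul_cancel_left _ _)
        right_inv := fun t => Subtype.ext (mul_inv_cancel_left _ _) }
    have hm2 : ∀ t : T, ∀ r ∈ D.M1 A, t.1 * r * t.1⁻¹ ∈ D.M1 A := fun t r hr => by
      rw [(hconj t r hr).1]; exact inv_mem (hconj t r hr).2
    let η : T → D.M1 A →* ℂ := fun t =>
      { toFun := fun r => ext0 χ r.1 * ext0 χ (t.1 * r.1 * t.1⁻¹)
        map_one' := by simp [ext0_one]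
        map_mul' := fun r r' => by
          rw [Subgroup.coe_mul, ext0_mul χ r.2 r'.2,
            show t.1 * (r.1 * r'.1) * t.1⁻¹ = (t.1 * r.1 * t.1⁻¹) * (t.1 * r'.1 * t.1⁻¹) by group,
            ext0_mul χ (hm2 t _ r.2) (hm2 t _ r'.2)]
          ring }
    have hη : ∀ t : T, η t = 1 → Stab χ (x * t.1) := by
      intro t ht r hr
      have h1 : ext0 χ r * ext0 χ (t.1 * r * t.1⁻¹) = 1 := DFunLike.congr_fun ht ⟨r, hr⟩
      rw [(hconj t r hr).1] at h1
      have h2 := ext0_inv χ (hconj t r hr).2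
      exact mul_right_cancel₀ (right_ne_zero_of_mul_eq_one h1) (h2.trans h1.symm)
    have hη' : ∀ t : T, Stab χ (x * t.1) → η t = 1 := by
      intro t ht
      ext r
      change ext0 χ r.1 * ext0 χ (t.1 * r * t.1⁻¹) = 1
      rw [(hconj t r r.2).1, ← ht r r.2]
      exact ext0_inv χ (hconj t r r.2).2
    rw [sum_eq_filter_of_equivariant act (fun t => ext0 χ (qq F c t.1)) η ?_]
    swap
    · intro r t
      change ext0 χ (qq F c (r.1 * t.1)) = ext0 χ r.1 * ext0 χ (t.1 * r.1 * t.1⁻¹) * _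
      rw [← ext0_mul χ r.2 (hm2 t _ r.2), ← ext0_mul χ (mul_mem r.2 (hm2 t _ r.2)) (hqm t)]
      congr 1
      rw [qq, qq, ← mul_assoc _ (scal F (-c⁻¹)), ← scal_comm]
      group
    rw [← Finset.sum_coe_sort]
    refine exists_nonneg_sum (fun t => IsPlus D A w (x * t.1.1)) _ ?_ ?_ ?_
    · rintro ⟨t, ht⟩ hp
      exact hx.ext0_qq_of_plus h χ t.2.1 t.2.2 (hη t (Finset.mem_filter.1 ht).2) hp
    · rintro ⟨t, ht⟩ -
      have := (hx.qq_sq_of_stab h χ t.2.1 t.2.2 (hη t (Finset.mem_filter.1 ht).2)).2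
      exact mul_self_eq_one_iff.1 this
    · rcases Finset.eq_empty_or_nonempty (Finset.univ.filter fun t :
        {t // t ∈ Finset.univ.filter fun t => η t = 1} => ¬ IsPlus D A w (x * t.1.1)) with h0 | ⟨⟨t1, ht1⟩, hn1⟩
      · rw [h0]; simp
      replace hn1 := (Finset.mem_filter.1 hn1).2
      have hs1 := hη t1 (Finset.mem_filter.1 ht1).2
      obtain ⟨m, hm, hmc⟩ := h.exists_norm (c := -(c : F)) (neg_ne_zero.2 c.ne_zero) (by
        intro hw
        obtain ⟨r, b, hr, -, hb, hrb⟩ := t1.2.1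
        refine ⟨b, hb, fun hbA => hn1 ⟨by
          have h1 := _root_.map_one (cj F (x * t1.1))
          rwa [← hw] at h1, fun _ => ?_⟩⟩
        change ((x * t1.1 : Eˣ) : E) ∈ _
        rw [hrb]; exact mul_mem hr (le_RR hbA))
      have hl : ∀ t : T, x * (t.1 * t1.1⁻¹ * x * m) = (x * t.1) * (x * t1.1)⁻¹ * m := fun t => by
        rw [_root_.mul_inv_rev, hx.inv]; group
      let g : {t // t ∈ Finset.univ.filter fun t => η t = 1} →
          {t // t ∈ Finset.univ.filter fun t => η t = 1} := fun t =>
        ⟨⟨t.1.1 * t1.1⁻¹ * x * m, by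
            rw [hl]
            exact mul_mem (mul_mem t.1.2.1 (inv_mem t1.2.1)) (mem_LL_of h (le_RR hm) hmc), by
            have := ((t.1.2.2.mul t1.2.2.inv).mul hx.sim).mul hmc
            rwa [mul_inv_cancel₀ c.ne_zero, one_mul, neg_one_mul, neg_neg] at this⟩, by
          refine Finset.mem_filter.2 ⟨Finset.mem_univ _, hη' _ ?_⟩
          change Stab χ (x * (t.1.1 * t1.1⁻¹ * x * m))
          rw [hl]
          exact Stab.mul h (Stab.mul h (hη _ (Finset.mem_filter.1 t.2).2) (Stab.inv h hs1 t1.2.1)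
            (inv_mem t1.2.1)) (Stab.of_mem h hm) (mem_LL_of h (le_RR hm) hmc)⟩
      refine Finset.card_le_card_of_injOn g ?_ ?_
      · intro t ht
        replace ht := (Finset.mem_filter.1 ht).2
        refine Finset.mem_coe.2 (Finset.mem_filter.2 ⟨Finset.mem_univ _, ?_⟩)
        change IsPlus D A w (x * (t.1.1 * t1.1⁻¹ * x * m))
        rw [hl]
        exact isPlus_mul h t.1.2.1 t1.2.1 ht hn1 hm
      · intro t _ t' _ htt
        have h1 : t.1.1 * t1.1⁻¹ * x * m = t'.1.1 * t1.1⁻¹ * x * m :=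
          congrArg (fun u : {t // t ∈ Finset.univ.filter fun t => η t = 1} => u.1.1) htt
        have h2 := mul_right_cancel (mul_right_cancel (mul_right_cancel h1))
        exact Subtype.ext (Subtype.ext h2)

end Frame.Base

/-- `σ` is the adjunction for the symplectic form `B`. -/
structure Adj {F V : Type} [Field F] [AddCommGroup V] [Module F V] (B : LinearMap.BilinForm F V)
    (σ : AntiInv F (Module.End F V)) : Prop where
  alt : ∀ v, B v v = 0
  nondeg : ∀ v, (∀ u, B v u = 0) → v = 0
  adj : ∀ (a : Module.End F V) u v, B (a u) v = B u (σ a v)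

namespace Adj

variable {F V : Type} [Field F] [AddCommGroup V] [Module F V] {B : LinearMap.BilinForm F V}
    {σ : AntiInv F (Module.End F V)}

theorem skew (h : Adj B σ) (u v : V) : B u v = -B v u :=
  ((LinearMap.IsAlt.neg (B := B) h.alt v u)).symm ▸ rfl

theorem nondeg' (h : Adj B σ) {v v' : V} (hv : ∀ u, B u v = B u v') : v = v' := by
  rw [← sub_eq_zero]
  apply h.nondeg
  intro u
  rw [h.skew, _root_.map_sub, hv, sub_self, neg_zero]

theorem isSim_iff (h : Adj B σ) {t : (Module.End F V)ˣ} {c : F} :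
    σ.IsSim t c ↔ c ≠ 0 ∧ ∀ u v, B (t.1 u) (t.1 v) = c * B u v := by
  rw [AntiInv.IsSim.iff_mul]
  refine and_congr_right fun _ => ⟨fun h1 u v => ?_, fun h1 => ?_⟩
  · rw [h.adj, ← Module.End.mul_apply, h1]
    simp
  · ext v
    refine h.nondeg' fun u => ?_
    rw [Module.End.mul_apply, ← h.adj, h1]
    simp

end Adj

namespace Frame

variable {F V : Type} [Field F] [AddCommGroup V] [Module F V] [Finite V]
  {D : Frame F (Module.End F V)} {A : Subalgebra F (Module.End F V)} {w : Module.End F V}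
  {B : LinearMap.BilinForm F V}

theorem Prim.exists_base [Nontrivial (Module.End F V)] [Finite (Module.End F V)]
    (h : D.Prim A w) (hB : Adj B D.σ) : ∃ x, D.Base A x := by
  obtain ⟨v, hv⟩ := h.exists_cyclic
  have hinj : ∀ r ∈ D.RR A, ∀ r' ∈ D.RR A, r v = r' v → r = r' := by
    intro r hr r' hr' hrr
    ext u
    obtain ⟨t, ht, rfl⟩ := hv u
    rw [← Module.End.mul_apply, ← Module.End.mul_apply, h.good.RR_comm hr ht,
      h.good.RR_comm hr' ht, Module.End.mul_apply, Module.End.mul_apply, hrr]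
  let φ : D.RR A →ₗ[F] V :=
    { toFun := fun r => r.1 v
      map_add' := fun _ _ => rfl
      map_smul' := fun _ _ => rfl }
  let e : D.RR A ≃ₗ[F] V := LinearEquiv.ofBijective φ
    ⟨fun r r' hrr => Subtype.ext (hinj _ r.2 _ r'.2 hrr), fun u => by
      obtain ⟨r, hr, hu⟩ := hv u
      exact ⟨⟨r, hr⟩, hu.symm⟩⟩
  let f : D.RR A →ₗ[F] D.RR A :=
    { toFun := fun r => ⟨D.σ r.1, h.RR_sigma r.2⟩
      map_add' := fun _ _ => Subtype.ext (D.σ.map_add _ _)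
      map_smul' := fun _ _ => Subtype.ext (D.σ.map_smul _ _) }
  let X : Module.End F V := e.toLinearMap ∘ₗ f ∘ₗ e.symm.toLinearMap
  have hX : ∀ r ∈ D.RR A, X (r v) = D.σ r v := by
    intro r hr
    have : e.symm (r v) = ⟨r, hr⟩ := by rw [LinearEquiv.symm_apply_eq]; rfl
    change e (f (e.symm (r v))) = _
    rw [this]
    rfl
  have hXX : X * X = 1 := by
    ext u
    obtain ⟨r, hr, rfl⟩ := hv u
    rw [Module.End.mul_apply, hX _ hr, hX _ (h.RR_sigma hr), D.σ.invol]
    rfl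
  refine ⟨⟨X, X, hXX, hXX⟩, Units.ext hXX, hB.isSim_iff.2 ⟨neg_ne_zero.2 one_ne_zero, ?_⟩, ?_, ?_⟩
  · intro u u'
    obtain ⟨r, hr, rfl⟩ := hv u
    obtain ⟨r', hr', rfl⟩ := hv u'
    change B (X (r v)) (X (r' v)) = _
    rw [hX _ hr, hX _ hr', hB.adj, D.σ.invol, ← Module.End.mul_apply,
      show r * D.σ r' = D.σ (r' * D.σ r) by rw [D.σ.map_mul, D.σ.invol], ← hB.adj, hB.skew,
      hB.adj r, ← Module.End.mul_apply, h.good.RR_comm hr' (h.RR_sigma hr), neg_one_mul]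
  · intro r hr
    ext u
    obtain ⟨r', hr', rfl⟩ := hv u
    change X (r (X (r' v))) = _
    rw [hX _ hr', ← Module.End.mul_apply r, hX _ (mul_mem hr (h.RR_sigma hr')), D.σ.map_mul,
      D.σ.invol, h.good.RR_comm hr' (h.RR_sigma hr), Module.End.mul_apply]
  · intro z hz
    obtain ⟨r, hr, hrz⟩ := hv (z v)
    suffices z = r by rwa [this]
    ext u
    obtain ⟨r', hr', rfl⟩ := hv u
    rw [← Module.End.mul_apply, hz _ hr', Module.End.mul_apply, hrz, ← Module.End.mul_apply,
      h.good.RR_comm hr' hr, Module.End.mul_apply]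

theorem Prim.exists_TData [Nontrivial (Module.End F V)] [Finite (Module.End F V)]
    (h : D.Prim A w) (hB : Adj B D.σ) : ∃ L x, TData D.σ D.s D.P L x := by
  obtain ⟨x, hx⟩ := h.exists_base hB
  obtain ⟨c0, hc0, hs⟩ := D.s_sim
  refine ⟨LL h, x, ?_⟩
  refine
    { P_le := fun p hp => ⟨1, p, one_mem _, ⟨1, AntiInv.IsSim.one⟩, hp, (one_mul p).symm⟩
      s_mem := mem_LL_of h s_mem_RR ⟨hc0, hs⟩
      comm := ?_
      sim := fun l hl => LL_sim h hl
      scal_mem := fun c => mem_LL_of h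
        (by rw [scal_coe]; exact Subalgebra.algebraMap_mem _ _) (scal_sim D.σ c)
      x_sim := hx.sim
      x_sq := hx.sq
      conj := fun l hl => hx.LL_conj h hl
      x_s := ?_
      psd := fun c hc => hx.psd h hc }
  · rintro _ ⟨r, b, hr, -, hb, rfl⟩
    rw [mul_assoc, D.P_s b hb, ← mul_assoc, ← mul_assoc]
    congr 1
    exact Units.ext (h.good.RR_comm hr s_mem_RR)
  · intro c hc
    rw [Units.val_mul, Units.val_mul, Units.val_mul, hx.conj _ s_mem_RR]
    exact (AntiInv.IsSim.iff_mul.1 hc).2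

end Frame

theorem IsPSD.comp {G K : Type} [Group G] [Group K] {θ : G → ℂ} (h : IsPSD θ) (j : K →* G) :
    IsPSD (fun k => θ (j k)) := by
  obtain ⟨ι, _, f, hf⟩ := h
  exact ⟨ι, inferInstance, fun i k => f i (j k), fun g k => by
    simp only [← hf, _root_.map_mul, _root_.map_inv]⟩

/-- An orthogonal decomposition, in terms of algebras with anti-involution. -/
structure Split {F E E₁ E₂ : Type} [Field F] [Ring E] [Algebra F E] [Ring E₁] [Algebra F E₁]
    [Ring E₂] [Algebra F E₂] (σ : AntiInv F E) (σ₁ : AntiInv F E₁) (σ₂ : AntiInv F E₂) where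
  /-- the embedding -/
  emb : E₁ × E₂ →ₐ[F] E
  inj : Function.Injective emb
  star : ∀ a, σ (emb a) = emb (σ₁ a.1, σ₂ a.2)
  range : ∀ b, b * emb (1, -1) = emb (1, -1) * b → ∃ a, emb a = b

namespace Split

variable {F E E₁ E₂ : Type} [Field F] [Ring E] [Algebra F E] [Ring E₁] [Algebra F E₁]
    [Ring E₂] [Algebra F E₂] {σ : AntiInv F E} {σ₁ : AntiInv F E₁} {σ₂ : AntiInv F E₂}
    (S : Split σ σ₁ σ₂)

/-- The embedding on units. -/
def embU : E₁ˣ × E₂ˣ →* Eˣ :=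
  (Units.map (S.emb : E₁ × E₂ →* E)).comp MulEquiv.prodUnits.symm.toMonoidHom

theorem embU_coe (a : E₁ˣ × E₂ˣ) : (S.embU a : E) = S.emb (a.1, a.2) := rfl

theorem embU_inj : Function.Injective S.embU := fun a b hab => by
  have := S.inj (congrArg Units.val hab)
  exact Prod.ext (Units.ext (congrArg Prod.fst this)) (Units.ext (congrArg Prod.snd this))

theorem isSim {a : E₁ˣ × E₂ˣ} {c : F} :
    σ.IsSim (S.embU a) c ↔ σ₁.IsSim a.1 c ∧ σ₂.IsSim a.2 c := by
  simp only [AntiInv.IsSim.iff_mul]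
  rw [embU_coe, S.star, ← _root_.map_mul,
    show (c • (1 : E)) = S.emb (c • 1) by rw [_root_.map_smul, _root_.map_one], S.inj.eq_iff,
    Prod.ext_iff]
  constructor
  · rintro ⟨h1, h2, h3⟩; exact ⟨⟨h1, h2⟩, ⟨h1, h3⟩⟩
  · rintro ⟨⟨h1, h2⟩, ⟨_, h3⟩⟩; exact ⟨h1, h2, h3⟩

theorem exists_embU {l : Eˣ} (hl : (l : E) * S.emb (1, -1) = S.emb (1, -1) * l) :
    ∃ a, S.embU a = l := by
  obtain ⟨a, ha⟩ := S.range _ hl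
  obtain ⟨b, hb⟩ := S.range ((l⁻¹ : Eˣ) : E) (by
    rw [Units.inv_mul_eq_iff_eq_mul, ← mul_assoc, hl, Units.mul_inv_cancel_right])
  have h1 : a * b = 1 := S.inj (by rw [_root_.map_mul, ha, hb, Units.mul_inv, _root_.map_one])
  have h2 : b * a = 1 := S.inj (by rw [_root_.map_mul, ha, hb, Units.inv_mul, _root_.map_one])
  refine ⟨⟨⟨a.1, b.1, congrArg Prod.fst h1, congrArg Prod.fst h2⟩,
    ⟨a.2, b.2, congrArg Prod.snd h1, congrArg Prod.snd h2⟩⟩, Units.ext ?_⟩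
  rw [embU_coe]
  exact ha

/-- Pairs of elements with a common multiplier. -/
def amalgam (σ₁ : AntiInv F E₁) (σ₂ : AntiInv F E₂) (L₁ : Subgroup E₁ˣ) (L₂ : Subgroup E₂ˣ) :
    Subgroup (E₁ˣ × E₂ˣ) where
  carrier := {a | a.1 ∈ L₁ ∧ a.2 ∈ L₂ ∧ ∃ c : F, σ₁.IsSim a.1 c ∧ σ₂.IsSim a.2 c}
  one_mem' := ⟨one_mem _, one_mem _, 1, AntiInv.IsSim.one, AntiInv.IsSim.one⟩
  mul_mem' := by
    rintro a b ⟨h1, h2, c, h3, h4⟩ ⟨h1', h2', c', h3', h4'⟩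
    exact ⟨mul_mem h1 h1', mul_mem h2 h2', _, h3.mul h3', h4.mul h4'⟩
  inv_mem' := by
    rintro a ⟨h1, h2, c, h3, h4⟩
    exact ⟨inv_mem h1, inv_mem h2, _, h3.inv, h4.inv⟩

theorem smul_iff {a b : E₁ˣ × E₂ˣ} {c : F} : (S.embU a : E) = c • (S.embU b : E) ↔
    (a.1 : E₁) = c • (b.1 : E₁) ∧ (a.2 : E₂) = c • (b.2 : E₂) := by
  rw [embU_coe, embU_coe, ← _root_.map_smul, S.inj.eq_iff, Prod.ext_iff]
  rfl

/-- The counting function of a product is a product. -/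
theorem card_prod (L₁ : Subgroup E₁ˣ) (L₂ : Subgroup E₂ˣ) (x : E₁ˣ × E₂ˣ) {d : F}
    (hx : σ.IsSim (S.embU x) d) (c : F) (a : E₁ˣ × E₂ˣ) :
    ((Nat.card {t : E₁ˣ × E₂ˣ // x * t ∈ amalgam σ₁ σ₂ L₁ L₂ ∧ σ.IsSim (S.embU t) c ∧
      (S.embU (t * t) : E) = (-c) • (S.embU a : E)} : ℕ) : ℂ) =
    theta σ₁ L₁ x.1 c a.1 * theta σ₂ L₂ x.2 c a.2 := by
  rw [theta, theta, ← Nat.cast_mul, ← Nat.card_prod]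
  congr 1
  have hx' := S.isSim.1 hx
  refine Nat.card_congr ⟨fun t => (⟨t.1.1, t.2.1.1, (S.isSim.1 t.2.2.1).1,
    (S.smul_iff.1 t.2.2.2).1⟩, ⟨t.1.2, t.2.1.2.1, (S.isSim.1 t.2.2.1).2,
    (S.smul_iff.1 t.2.2.2).2⟩), fun t => ⟨(t.1.1, t.2.1), ⟨t.1.2.1, t.2.2.1, _,
      hx'.1.mul t.1.2.2.1, hx'.2.mul t.2.2.2.1⟩, S.isSim.2 ⟨t.1.2.2.1, t.2.2.2.1⟩,
      S.smul_iff.2 ⟨t.1.2.2.2, t.2.2.2.2⟩⟩, fun _ => rfl, fun _ => rfl⟩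

theorem theta_map (L₁ : Subgroup E₁ˣ) (L₂ : Subgroup E₂ˣ) (x : E₁ˣ × E₂ˣ) {d : F}
    (hx : σ.IsSim (S.embU x) d) (c : F) (a : E₁ˣ × E₂ˣ) :
    theta σ ((amalgam σ₁ σ₂ L₁ L₂).map S.embU) (S.embU x) c (S.embU a) =
    theta σ₁ L₁ x.1 c a.1 * theta σ₂ L₂ x.2 c a.2 := by
  rw [← S.card_prod L₁ L₂ x hx c a, theta]
  congr 1
  let f : {t : E₁ˣ × E₂ˣ // x * t ∈ amalgam σ₁ σ₂ L₁ L₂ ∧ σ.IsSim (S.embU t) c ∧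
      (S.embU (t * t) : E) = (-c) • (S.embU a : E)} →
      {t : Eˣ // S.embU x * t ∈ (amalgam σ₁ σ₂ L₁ L₂).map S.embU ∧ σ.IsSim t c ∧
        (t * t : E) = (-c) • (S.embU a : E)} := fun t =>
    ⟨S.embU t.1, ⟨_, t.2.1, S.embU.map_mul _ _⟩, t.2.2.1, by
      rw [← Units.val_mul, ← _root_.map_mul]
      exact t.2.2.2⟩
  refine (Nat.card_congr (Equiv.ofBijective f ⟨fun t t' htt => ?_, ?_⟩)).symm
  · exact Subtype.ext (S.embU_inj (congrArg Subtype.val htt))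
  · rintro ⟨t, ⟨k, hk, hkt⟩, hc, ht⟩
    obtain rfl : t = S.embU (x⁻¹ * k) := by rw [_root_.map_mul, hkt, _root_.map_inv]; group
    exact ⟨⟨x⁻¹ * k, by rwa [mul_inv_cancel_left], hc, by rwa [_root_.map_mul]⟩, rfl⟩

theorem amalgam_psd {L₁ : Subgroup E₁ˣ} {L₂ : Subgroup E₂ˣ} {x : E₁ˣ × E₂ˣ} {c : F}
    (h₁ : IsPSD (fun h : L₁ => theta σ₁ L₁ x.1 c h))
    (h₂ : IsPSD (fun h : L₂ => theta σ₂ L₂ x.2 c h)) :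
    IsPSD (fun a : amalgam σ₁ σ₂ L₁ L₂ => theta σ₁ L₁ x.1 c a.1.1 * theta σ₂ L₂ x.2 c a.1.2) :=
  (h₁.prod h₂).comp (K := amalgam σ₁ σ₂ L₁ L₂)
    { toFun := fun a => (⟨a.1.1, a.2.1⟩, ⟨a.1.2, a.2.2.1⟩)
      map_one' := rfl
      map_mul' := fun _ _ => rfl }

variable {s₁ : E₁ˣ} {s₂ : E₂ˣ} {P₁ L₁ : Subgroup E₁ˣ} {P₂ L₂ : Subgroup E₂ˣ} {x₁ : E₁ˣ} {x₂ : E₂ˣ}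

theorem scal_eq (c : Fˣ) : S.embU (scal F c, scal F c) = scal F c := by
  ext
  rw [embU_coe, scal_coe, scal_coe, scal_coe, ← S.emb.commutes]
  rfl

theorem amalgam_conj (h₁ : TData σ₁ s₁ P₁ L₁ x₁) (h₂ : TData σ₂ s₂ P₂ L₂ x₂)
    {a : E₁ˣ × E₂ˣ} (ha : a ∈ amalgam σ₁ σ₂ L₁ L₂) :
    (x₁, x₂) * a * (x₁, x₂) ∈ amalgam σ₁ σ₂ L₁ L₂ := by
  obtain ⟨h3, h4, c, h5, h6⟩ := ha
  exact ⟨h₁.conj _ h3, h₂.conj _ h4, _, (h₁.x_sim.mul h5).mul h₁.x_sim,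
    (h₂.x_sim.mul h6).mul h₂.x_sim⟩

/-- Data for the orthogonal sum. -/
theorem tdata_sum [Finite E] {s : Eˣ} {P : Subgroup Eˣ} (h₁ : TData σ₁ s₁ P₁ L₁ x₁)
    (h₂ : TData σ₂ s₂ P₂ L₂ x₂) (hs : S.embU (s₁, s₂) = s) (hss : ∃ c, σ.IsSim s c)
    (hP : ∀ p ∈ P, (∃ c, σ.IsSim p c) ∧ ∃ a, a.1 ∈ P₁ ∧ a.2 ∈ P₂ ∧ S.embU a = p) :
    TData σ s P ((amalgam σ₁ σ₂ L₁ L₂).map S.embU) (S.embU (x₁, x₂)) where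
  P_le := by
    intro p hp
    obtain ⟨⟨c, hc⟩, a, ha1, ha2, rfl⟩ := hP p hp
    exact ⟨a, ⟨h₁.P_le ha1, h₂.P_le ha2, c, S.isSim.1 hc⟩, rfl⟩
  s_mem := by
    obtain ⟨c, hc⟩ := hss
    rw [← hs] at hc
    exact ⟨(s₁, s₂), ⟨h₁.s_mem, h₂.s_mem, c, S.isSim.1 hc⟩, hs⟩
  comm := by
    rintro _ ⟨a, ha, rfl⟩
    rw [← hs, ← _root_.map_mul, ← _root_.map_mul]
    congr 1
    exact Prod.ext (h₁.comm _ ha.1) (h₂.comm _ ha.2.1)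
  sim := by
    rintro _ ⟨a, ⟨_, _, c, hc⟩, rfl⟩
    exact ⟨c, S.isSim.2 hc⟩
  scal_mem := fun c => ⟨_, ⟨h₁.scal_mem c, h₂.scal_mem c, _, scal_sim _ c, scal_sim _ c⟩, S.scal_eq c⟩
  x_sim := S.isSim.2 ⟨h₁.x_sim, h₂.x_sim⟩
  x_sq := by
    rw [← _root_.map_mul, ← S.embU.map_one]
    congr 1
    exact Prod.ext h₁.x_sq h₂.x_sq
  conj := by
    rintro _ ⟨a, ha, rfl⟩
    rw [← _root_.map_mul, ← _root_.map_mul]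
    exact ⟨_, amalgam_conj h₁ h₂ ha, rfl⟩
  x_s := by
    intro c hc
    rw [← hs] at hc
    rw [← hs, ← _root_.map_mul, ← _root_.map_mul, ← _root_.map_mul, embU_coe,
      ← _root_.map_one S.emb, ← _root_.map_smul]
    congr 1
    exact Prod.ext (h₁.x_s _ (S.isSim.1 hc).1) (h₂.x_s _ (S.isSim.1 hc).2)
  psd := by
    intro c hc
    refine (amalgam_psd (x := (x₁, x₂)) (h₁.psd c hc) (h₂.psd c hc)).extend
      (S.embU.subgroupMap _) ?_ ?_
    · rintro ⟨a, ha⟩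
      exact S.theta_map L₁ L₂ (x₁, x₂) (S.isSim.2 ⟨h₁.x_sim, h₂.x_sim⟩) c a
    · intro g hg
      exact absurd (MonoidHom.range_eq_top.2 (S.embU.subgroupMap_surjective _) ▸ Subgroup.mem_top g) hg

end Split

namespace Split

variable {F E E₁ : Type} [Field F] [Ring E] [Algebra F E] [Ring E₁] [Algebra F E₁]
    {σ : AntiInv F E} {σ₁ : AntiInv F E₁}

/-- A similitude exchanging the two halves of an orthogonal decomposition. -/
structure Swap (S : Split σ σ₁ σ₁) (g : Eˣ) (γ : E₁ˣ) (m : F) : Prop where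
  comm : ∀ a, g * S.embU a = S.embU (γ * a.2 * γ⁻¹, a.1) * g
  sq : g * g = S.embU (γ, γ)
  sim : σ.IsSim g m
  ne : (1 : E₁) ≠ -1

variable {S : Split σ σ₁ σ₁} {g : Eˣ} {γ : E₁ˣ} {m : F}

namespace Swap

theorem sim_γ (W : S.Swap g γ m) : σ₁.IsSim γ (m * m) :=
  (S.isSim.1 (W.sq ▸ W.sim.mul W.sim)).1

theorem not_embU (W : S.Swap g γ m) (a b : E₁ˣ × E₁ˣ) : S.embU a * g ≠ S.embU b := by
  intro h
  obtain rfl : g = S.embU (a⁻¹ * b) := by rw [_root_.map_mul, _root_.map_inv, ← h]; group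
  have h1 := W.comm (1, -1)
  rw [← _root_.map_mul, ← _root_.map_mul] at h1
  have h2 := congrArg Prod.snd (S.embU_inj h1)
  apply W.ne
  have h3 : (-1 : E₁ˣ) = 1 := by
    have h4 : -(a.2⁻¹ * b.2) = a.2⁻¹ * b.2 := by simpa using h2
    rwa [← neg_one_mul, mul_eq_right] at h4
  simpa using (congrArg Units.val h3).symm

theorem mem_of_sim {L₁ : Subgroup E₁ˣ} (W : S.Swap g γ m) (hγ : γ ∈ L₁) {a : E₁ˣ × E₁ˣ}
    (ha : a ∈ amalgam σ₁ σ₁ L₁ L₁) : (γ * a.2 * γ⁻¹, a.1) ∈ amalgam σ₁ σ₁ L₁ L₁ := by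
  obtain ⟨h1, h2, c, h3, h4⟩ := ha
  refine ⟨mul_mem (mul_mem hγ h2) (inv_mem hγ), h1, c, ?_, h3⟩
  have := (W.sim_γ.mul h4).mul W.sim_γ.inv
  convert this using 1
  rw [mul_comm, ← mul_assoc, inv_mul_cancel₀ W.sim_γ.1, one_mul]

/-- The group generated by the amalgam and the swap. -/
def double {L₁ : Subgroup E₁ˣ} (W : S.Swap g γ m) (hγ : γ ∈ L₁) : Subgroup Eˣ where
  carrier := {l | ∃ a ∈ amalgam σ₁ σ₁ L₁ L₁, l = S.embU a ∨ l = S.embU a * g}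
  one_mem' := ⟨1, one_mem _, Or.inl (_root_.map_one _).symm⟩
  mul_mem' := by
    have hγ' : (γ, γ) ∈ amalgam σ₁ σ₁ L₁ L₁ := ⟨hγ, hγ, _, W.sim_γ, W.sim_γ⟩
    rintro _ _ ⟨a, ha, rfl | rfl⟩ ⟨b, hb, rfl | rfl⟩
    · exact ⟨a * b, mul_mem ha hb, Or.inl (_root_.map_mul _ _ _).symm⟩
    · exact ⟨a * b, mul_mem ha hb, Or.inr (by rw [_root_.map_mul, mul_assoc])⟩
    · exact ⟨a * _, mul_mem ha (W.mem_of_sim hγ hb), Or.inr (by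
        rw [_root_.map_mul, mul_assoc, W.comm, ← mul_assoc])⟩
    · exact ⟨a * _ * _, mul_mem (mul_mem ha (W.mem_of_sim hγ hb)) hγ', Or.inl (by
        rw [_root_.map_mul, _root_.map_mul, ← W.sq, ← mul_assoc, mul_assoc _ g, W.comm]
        group)⟩
  inv_mem' := by
    have hγ' : (γ, γ) ∈ amalgam σ₁ σ₁ L₁ L₁ := ⟨hγ, hγ, _, W.sim_γ, W.sim_γ⟩
    rintro _ ⟨a, ha, rfl | rfl⟩
    · exact ⟨a⁻¹, inv_mem ha, Or.inl (_root_.map_inv _ _).symm⟩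
    · refine ⟨(γ, γ)⁻¹ * _, mul_mem (inv_mem hγ') (W.mem_of_sim hγ (inv_mem ha)), Or.inr ?_⟩
      rw [_root_.map_mul, mul_assoc, ← W.comm, _root_.map_inv, ← W.sq, _root_.map_inv]
      group

theorem mem_double {L₁ : Subgroup E₁ˣ} {W : S.Swap g γ m} {hγ : γ ∈ L₁} {l : Eˣ} :
    l ∈ W.double hγ ↔ ∃ a ∈ amalgam σ₁ σ₁ L₁ L₁, l = S.embU a ∨ l = S.embU a * g := Iff.rfl

theorem embU_mem_double {L₁ : Subgroup E₁ˣ} {W : S.Swap g γ m} {hγ : γ ∈ L₁} {a : E₁ˣ × E₁ˣ} :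
    S.embU a ∈ W.double hγ ↔ a ∈ amalgam σ₁ σ₁ L₁ L₁ := by
  rw [mem_double]
  constructor
  · rintro ⟨b, hb, h | h⟩
    · rwa [S.embU_inj h]
    · exact absurd h.symm (W.not_embU _ _)
  · exact fun h => ⟨a, h, Or.inl rfl⟩

theorem embU_mul_mem_double {L₁ : Subgroup E₁ˣ} {W : S.Swap g γ m} {hγ : γ ∈ L₁} {a : E₁ˣ × E₁ˣ} :
    S.embU a * g ∈ W.double hγ ↔ a ∈ amalgam σ₁ σ₁ L₁ L₁ := by
  rw [mem_double]
  constructor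
  · rintro ⟨b, hb, h | h⟩
    · exact absurd h (W.not_embU _ _)
    · rwa [S.embU_inj (mul_right_cancel h)]
  · exact fun h => ⟨a, h, Or.inr rfl⟩

theorem sq_mul (W : S.Swap g γ m) (t : E₁ˣ × E₁ˣ) : (S.embU t * g) * (S.embU t * g) =
    S.embU (t.1 * γ * t.2, t.2 * t.1 * γ) := by
  have : (t.1 * γ * t.2, t.2 * t.1 * γ) = t * (γ * t.2 * γ⁻¹, t.1) * (γ, γ) :=
    Prod.ext (by simp [mul_assoc]) (by simp [mul_assoc])
  rw [this, _root_.map_mul, _root_.map_mul, ← W.sq, ← mul_assoc, mul_assoc _ g, W.comm]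
  group

/-- The twisted double coset space on which pairs act. -/
abbrev Tw (σ₁ : AntiInv F E₁) (L₁ : Subgroup E₁ˣ) (x₁ : E₁ˣ) (c : F) : Type :=
  {t : E₁ˣ // x₁ * t ∈ L₁ ∧ σ₁.IsSim t c}

/-- Pairs of isometries. -/
def isom (σ₁ : AntiInv F E₁) (L₁ : Subgroup E₁ˣ) : Subgroup (E₁ˣ × E₁ˣ) where
  carrier := {a | a.1 ∈ L₁ ∧ a.2 ∈ L₁ ∧ σ₁.IsSim a.1 1 ∧ σ₁.IsSim a.2 1}
  one_mem' := ⟨one_mem _, one_mem _, AntiInv.IsSim.one, AntiInv.IsSim.one⟩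
  mul_mem' := by
    rintro a b ⟨h1, h2, h3, h4⟩ ⟨h1', h2', h3', h4'⟩
    exact ⟨mul_mem h1 h1', mul_mem h2 h2', by simpa using h3.mul h3', by simpa using h4.mul h4'⟩
  inv_mem' := by
    rintro a ⟨h1, h2, h3, h4⟩
    exact ⟨inv_mem h1, inv_mem h2, by simpa using h3.inv, by simpa using h4.inv⟩

/-- The action of pairs of isometries. -/
@[reducible] def twAction {s₁ : E₁ˣ} {P₁ L₁ : Subgroup E₁ˣ} {x₁ : E₁ˣ} (h : TData σ₁ s₁ P₁ L₁ x₁)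
    (c : F) : MulAction (isom σ₁ L₁) (Tw σ₁ L₁ x₁ c) where
  smul a t := ⟨a.1.1 * t.1 * a.1.2⁻¹, by
    have : x₁ * (a.1.1 * t.1 * a.1.2⁻¹) = (x₁ * a.1.1 * x₁) * (x₁ * t.1) * a.1.2⁻¹ := by
      have := h.x_sq
      calc _ = x₁ * a.1.1 * 1 * t.1 * a.1.2⁻¹ := by group
        _ = _ := by rw [← this]; group
    rw [this]
    exact mul_mem (mul_mem (h.conj _ a.2.1) t.2.1) (inv_mem a.2.2.1), by
    simpa using (a.2.2.2.1.mul t.2.2).mul a.2.2.2.2.inv⟩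
  one_smul t := Subtype.ext (show (1 : E₁ˣ) * t.1 * 1⁻¹ = t.1 by simp)
  mul_smul a b t := Subtype.ext (show (a.1.1 * b.1.1) * t.1 * (a.1.2 * b.1.2)⁻¹ =
    a.1.1 * (b.1.1 * t.1 * b.1.2⁻¹) * a.1.2⁻¹ by group)

theorem card_split {T : Type} [Finite T] (p q : T → Prop) :
    Nat.card {t // p t} = Nat.card {t // p t ∧ q t} + Nat.card {t // p t ∧ ¬ q t} := by
  have := Fintype.ofFinite T
  simp only [Nat.card_eq_fintype_card, Fintype.card_subtype]
  rw [← Finset.filter_filter, ← Finset.filter_filter, Finset.card_filter_add_card_filter_not]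

variable {s₁ : E₁ˣ} {P₁ L₁ : Subgroup E₁ˣ} {x₁ : E₁ˣ}

/-- The even part of the counting function. -/
theorem card_even [Finite E] (h : TData σ₁ s₁ P₁ L₁ x₁) (W : S.Swap g γ m) (hγ : γ ∈ L₁) (c : F)
    (a : E₁ˣ × E₁ˣ) :
    ((Nat.card {t : Eˣ // (S.embU (x₁, x₁) * t ∈ W.double hγ ∧ σ.IsSim t c ∧
      (t * t : E) = (-c) • (S.embU a : E)) ∧ ∃ b, S.embU b = t} : ℕ) : ℂ) =
    theta σ₁ L₁ x₁ c a.1 * theta σ₁ L₁ x₁ c a.2 := by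
  rw [← S.card_prod L₁ L₁ (x₁, x₁) (S.isSim.2 ⟨h.x_sim, h.x_sim⟩) c a]
  congr 1
  let f : {t : E₁ˣ × E₁ˣ // (x₁, x₁) * t ∈ amalgam σ₁ σ₁ L₁ L₁ ∧ σ.IsSim (S.embU t) c ∧
      (S.embU (t * t) : E) = (-c) • (S.embU a : E)} →
      {t : Eˣ // (S.embU (x₁, x₁) * t ∈ W.double hγ ∧ σ.IsSim t c ∧
        (t * t : E) = (-c) • (S.embU a : E)) ∧ ∃ b, S.embU b = t} := fun t =>
    ⟨S.embU t.1, ⟨by rw [← _root_.map_mul, embU_mem_double]; exact t.2.1, t.2.2.1, by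
      rw [← Units.val_mul, ← _root_.map_mul]
      exact t.2.2.2⟩, _, rfl⟩
  refine (Nat.card_congr (Equiv.ofBijective f ⟨fun t t' htt => ?_, ?_⟩)).symm
  · exact Subtype.ext (S.embU_inj (congrArg Subtype.val htt))
  · rintro ⟨_, ⟨hk, hc, ht⟩, b, rfl⟩
    rw [← _root_.map_mul, embU_mem_double] at hk
    exact ⟨⟨b, hk, hc, by rwa [_root_.map_mul]⟩, rfl⟩

/-- The odd part of the counting function. -/
theorem card_odd [Nontrivial E₁] [Finite E] (h : TData σ₁ s₁ P₁ L₁ x₁) (W : S.Swap g γ m)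
    (hγ : γ ∈ L₁) {c : F} (hc : c ≠ 0) (a : isom σ₁ L₁) :
    Nat.card {t : Eˣ // (S.embU (x₁, x₁) * t ∈ W.double hγ ∧ σ.IsSim t c ∧
      (t * t : E) = (-c) • (S.embU a.1 : E)) ∧ ¬ ∃ b, S.embU b = t} =
    Nat.card {t : Tw σ₁ L₁ x₁ (c * m) // (twAction h (c * m)).smul a t = t} := by
  have hm := W.sim.1
  have hx : x₁⁻¹ = x₁ := inv_eq_of_mul_eq_one_left h.x_sq
  obtain ⟨⟨a, b⟩, ha, hb, ha1, hb1⟩ := a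
  simp only at ha hb ha1 hb1
  let z : E₁ˣ := scal F (Units.mk0 (-c) (neg_ne_zero.2 hc))
  have hz : ∀ u : E₁ˣ, z * u = u * z := fun u => scal_comm _ u
  have hzs : ∀ u v : E₁ˣ, (u : E₁) = (-c) • (v : E₁) ↔ u = z * v := fun u v => by
    rw [← Units.val_inj, Units.val_mul, scal_coe, Units.val_mk0, Algebra.smul_def]
  have hzL : z ∈ L₁ := h.scal_mem _
  have hzm : σ₁.IsSim z (c * c) := by
    have := scal_sim σ₁ (Units.mk0 (-c) (neg_ne_zero.2 hc))
    simpa using this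
  let f : {t : Tw σ₁ L₁ x₁ (c * m) // (twAction h (c * m)).smul ⟨(a, b), ha, hb, ha1, hb1⟩ t = t} →
      {t : Eˣ // (S.embU (x₁, x₁) * t ∈ W.double hγ ∧ σ.IsSim t c ∧
      (t * t : E) = (-c) • (S.embU (a, b) : E)) ∧ ¬ ∃ b, S.embU b = t} := fun t =>
    ⟨S.embU (t.1.1 * γ⁻¹, z * t.1.1⁻¹ * a) * g, by
      obtain ⟨⟨t, ht1, ht2⟩, ht⟩ := t
      have ht : a * t * b⁻¹ = t := congrArg Subtype.val ht
      have e1 : σ₁.IsSim (t * γ⁻¹) (c * m⁻¹) := by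
        convert ht2.mul W.sim_γ.inv using 1; field_simp
      have e2 : σ₁.IsSim (z * t⁻¹ * a) (c * m⁻¹) := by
        convert (hzm.mul ht2.inv).mul ha1 using 1; field_simp
      refine ⟨⟨?_, ?_, ?_⟩, ?_⟩
      · rw [← mul_assoc, ← _root_.map_mul, embU_mul_mem_double]
        refine ⟨?_, ?_, _, h.x_sim.mul e1, h.x_sim.mul e2⟩
        · show x₁ * (t * γ⁻¹) ∈ L₁
          rw [← mul_assoc]
          exact mul_mem ht1 (inv_mem hγ)
        · show x₁ * (z * t⁻¹ * a) ∈ L₁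
          have : x₁ * (z * t⁻¹ * a) = z * (x₁ * (x₁ * t) * x₁)⁻¹ * a := by
            rw [← mul_assoc, ← mul_assoc, ← hz, _root_.mul_inv_rev, _root_.mul_inv_rev,
              _root_.mul_inv_rev, hx]
            have := h.x_sq
            calc _ = z * (x₁ * t⁻¹ * 1) * a := by group
              _ = _ := by rw [← this]; group
          rw [this]
          exact mul_mem (mul_mem hzL (inv_mem (h.conj _ ht1))) ha
      · convert (S.isSim.2 ⟨e1, e2⟩ : σ.IsSim (S.embU (t * γ⁻¹, z * t⁻¹ * a)) _).mul W.sim using 1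
        field_simp
      · rw [← Units.val_mul, W.sq_mul, S.smul_iff, hzs, hzs]
        constructor
        · show t * γ⁻¹ * γ * (z * t⁻¹ * a) = z * a
          rw [hz]; group
        · show z * t⁻¹ * a * (t * γ⁻¹) * γ = z * b
          have : b = t⁻¹ * a * t := by
            rw [mul_assoc, mul_inv_eq_iff_eq_mul.1 ht]; group
          rw [this]; group
      · rintro ⟨b, hb⟩
        exact W.not_embU _ _ hb.symm⟩
  refine (Nat.card_congr (Equiv.ofBijective f ⟨fun t t' htt => ?_, ?_⟩)).symm
  · have := congrArg Prod.fst (S.embU_inj (mul_right_cancel (congrArg Subtype.val htt)))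
    exact Subtype.ext (Subtype.ext (mul_right_cancel this))
  · rintro ⟨t, ⟨⟨k, hk, hkt | hkt⟩, htc, ht⟩, hne⟩
    · exact absurd ⟨(x₁, x₁)⁻¹ * k, by rw [_root_.map_mul, ← hkt, _root_.map_inv]; group⟩ hne
    · obtain ⟨t₁, t₂, rfl⟩ : ∃ t₁ t₂, t = S.embU (t₁, t₂) * g := ⟨_, _, show
        t = S.embU ((x₁, x₁)⁻¹ * k) * g by
          rw [_root_.map_mul, mul_assoc, ← hkt, _root_.map_inv]; group⟩
      rw [← mul_assoc, mul_left_inj, ← _root_.map_mul, S.embU_inj.eq_iff] at hkt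
      subst hkt
      obtain ⟨k1, k2, -⟩ := hk
      have htc' := S.isSim.1 (show σ.IsSim (S.embU (t₁, t₂)) (c * m⁻¹) by
        simpa using htc.mul W.sim.inv)
      rw [← Units.val_mul, W.sq_mul, S.smul_iff, hzs, hzs] at ht
      obtain ⟨ht1, ht2⟩ := ht
      simp only at ht1 ht2
      have e : t₂ = z * (t₁ * γ)⁻¹ * a := by
        rw [hz, mul_assoc, ← ht1]; group
      refine ⟨⟨⟨t₁ * γ, ?_, ?_⟩, Subtype.ext ?_⟩, Subtype.ext ?_⟩
      · rw [← mul_assoc]; exact mul_mem k1 hγ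
      · convert htc'.1.mul W.sim_γ using 1; field_simp
      · show a * (t₁ * γ) * b⁻¹ = t₁ * γ
        rw [mul_inv_eq_iff_eq_mul]
        rw [e, mul_assoc, mul_assoc, mul_assoc, mul_right_inj, inv_mul_eq_iff_eq_mul] at ht2
        exact ht2
      · show S.embU (t₁ * γ * γ⁻¹, z * (t₁ * γ)⁻¹ * a) * g = S.embU (t₁, t₂) * g
        rw [← e, mul_inv_cancel_right]

theorem _root_.AntiInv.isSim_smul (σ : AntiInv F E) {c d : F} (hc : c ≠ 0) {t l : Eˣ}
    (hl : σ.IsSim l d) (h : (t * t : E) = (-c) • (l : E)) : σ.IsSim (t * t) (c * c * d) := by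
  have : t * t = scal F (Units.mk0 (-c) (neg_ne_zero.2 hc)) * l := by
    ext
    rw [Units.val_mul, h, Units.val_mul, scal_coe, Units.val_mk0, Algebra.smul_def]
  rw [this]
  convert (scal_sim σ _).mul hl using 1
  simp

theorem double_psd [Nontrivial E₁] [Finite E] (h : TData σ₁ s₁ P₁ L₁ x₁) (W : S.Swap g γ m)
    (hγ : γ ∈ L₁) {c : F} (hc : c ≠ 0) :
    IsPSD (fun l : W.double hγ => theta σ (W.double hγ) (S.embU (x₁, x₁)) c l) := by
  have : Finite E₁ˣ := Finite.of_injective (fun u => S.embU (u, 1)) fun u v huv =>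
    congrArg Prod.fst (S.embU_inj huv)
  have : Nontrivial E := ⟨S.emb (1, 1), S.emb (0, 0), fun h => one_ne_zero (congrArg Prod.fst (S.inj h))⟩
  have hsplit : ∀ l : Eˣ, theta σ (W.double hγ) (S.embU (x₁, x₁)) c l =
      ((Nat.card {t : Eˣ // (S.embU (x₁, x₁) * t ∈ W.double hγ ∧ σ.IsSim t c ∧
      (t * t : E) = (-c) • (l : E)) ∧ ∃ b, S.embU b = t} : ℕ) : ℂ) +
      ((Nat.card {t : Eˣ // (S.embU (x₁, x₁) * t ∈ W.double hγ ∧ σ.IsSim t c ∧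
      (t * t : E) = (-c) • (l : E)) ∧ ¬ ∃ b, S.embU b = t} : ℕ) : ℂ) := fun l => by
    rw [← Nat.cast_add, ← card_split, theta]
  have hsq : ∀ t : Eˣ, S.embU (x₁, x₁) * t ∈ W.double hγ → ∃ b, S.embU b = t * t := by
    rintro t ⟨k, hk, hkt | hkt⟩
    · obtain rfl : t = S.embU ((x₁, x₁)⁻¹ * k) := by
        rw [_root_.map_mul, ← hkt, _root_.map_inv]; group
      exact ⟨_, _root_.map_mul _ _ _⟩
    · obtain rfl : t = S.embU ((x₁, x₁)⁻¹ * k) * g := by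
        rw [_root_.map_mul, mul_assoc, ← hkt, _root_.map_inv]; group
      rw [W.sq_mul]
      exact ⟨_, rfl⟩
  have hl : ∀ t l : Eˣ, S.embU (x₁, x₁) * t ∈ W.double hγ → (t * t : E) = (-c) • (l : E) →
      ∃ b, S.embU b = l := by
    intro t l ht htl
    obtain ⟨b, hb⟩ := hsq t ht
    have : t * t = scal F (Units.mk0 (-c) (neg_ne_zero.2 hc)) * l := by
      ext
      rw [Units.val_mul, htl, Units.val_mul, scal_coe, Units.val_mk0, Algebra.smul_def]
    refine ⟨(scal F (Units.mk0 (-c) (neg_ne_zero.2 hc)),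
      scal F (Units.mk0 (-c) (neg_ne_zero.2 hc)))⁻¹ * b, ?_⟩
    rw [_root_.map_mul, hb, _root_.map_inv, S.scal_eq, this, inv_mul_cancel_left]
  simp only [hsplit]
  refine IsPSD.add ?_ ?_
  · refine (amalgam_psd (x := (x₁, x₁)) (h.psd c hc) (h.psd c hc)).extend (G := W.double hγ)
      ((S.embU.comp (amalgam σ₁ σ₁ L₁ L₁).subtype).codRestrict _
        (fun a => embU_mem_double.2 a.2)) ?_ ?_
    · intro a
      exact card_even h W hγ c a.1
    · rintro ⟨l, hl'⟩ hne
      rw [Nat.cast_eq_zero]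
      refine @Nat.card_of_isEmpty _ ⟨fun t => hne ?_⟩
      obtain ⟨b, rfl⟩ := hl _ _ t.2.1.1 t.2.1.2.2
      exact ⟨⟨b, embU_mem_double.1 hl'⟩, rfl⟩
  · have hI : ∀ a ∈ isom σ₁ L₁, a ∈ amalgam σ₁ σ₁ L₁ L₁ := fun a ha =>
      ⟨ha.1, ha.2.1, 1, ha.2.2.1, ha.2.2.2⟩
    let := twAction h (c * m)
    refine (IsPSD.fixedPoints (K := isom σ₁ L₁) (X := Tw σ₁ L₁ x₁ (c * m))).extend
      (G := W.double hγ) ((S.embU.comp (isom σ₁ L₁).subtype).codRestrict _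
        (fun a => embU_mem_double.2 (hI _ a.2))) ?_ ?_
    · intro a
      exact congrArg Nat.cast (card_odd h W hγ hc a)
    · rintro ⟨l, hl'⟩ hne
      rw [Nat.cast_eq_zero]
      refine @Nat.card_of_isEmpty _ ⟨fun t => hne ?_⟩
      obtain ⟨t, ⟨ht1, ht2, ht3⟩, hnt⟩ := t
      obtain ⟨⟨a, b⟩, rfl⟩ := hl _ _ ht1 ht3
      obtain ⟨k1, k2, d, k3, k4⟩ := embU_mem_double.1 hl'
      have hd : d = 1 := by
        have e1 := (σ.isSim_smul hc (S.isSim.2 ⟨k3, k4⟩) ht3)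
        have e2 := e1.unique (ht2.mul ht2)
        field_simp at e2
        exact e2
      subst hd
      exact ⟨⟨(a, b), k1, k2, k3, k4⟩, rfl⟩

/-- Data for a pair of exchanged summands. -/
theorem tdata_double [Nontrivial E₁] [Finite E] {s : Eˣ} {P : Subgroup Eˣ}
    (h : TData σ₁ s₁ P₁ L₁ x₁) (W : S.Swap g γ m) (hγ : γ ∈ L₁)
    (hs : S.embU (s₁, s₁) = s) (hsg : g * s = s * g) (hss : ∃ c, σ.IsSim s c)
    (hP : ∀ p ∈ P, (∃ c, σ.IsSim p c) ∧
      ∃ a, a.1 ∈ P₁ ∧ a.2 ∈ P₁ ∧ (p = S.embU a ∨ p = S.embU a * g)) :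
    TData σ s P (W.double hγ) (S.embU (x₁, x₁)) where
  P_le := by
    intro p hp
    obtain ⟨⟨c, hc⟩, a, ha1, ha2, rfl | rfl⟩ := hP p hp
    · exact ⟨a, ⟨h.P_le ha1, h.P_le ha2, c, S.isSim.1 hc⟩, Or.inl rfl⟩
    · refine ⟨a, ⟨h.P_le ha1, h.P_le ha2, c * m⁻¹, S.isSim.1 ?_⟩, Or.inr rfl⟩
      simpa using hc.mul W.sim.inv
  s_mem := by
    obtain ⟨c, hc⟩ := hss
    rw [← hs] at hc
    exact ⟨(s₁, s₁), ⟨h.s_mem, h.s_mem, c, S.isSim.1 hc⟩, Or.inl hs.symm⟩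
  comm := by
    have : ∀ a ∈ amalgam σ₁ σ₁ L₁ L₁, S.embU a * s = s * S.embU a := by
      intro a ha
      rw [← hs, ← _root_.map_mul, ← _root_.map_mul]
      congr 1
      exact Prod.ext (h.comm _ ha.1) (h.comm _ ha.2.1)
    rintro _ ⟨a, ha, rfl | rfl⟩
    · exact this a ha
    · rw [mul_assoc, hsg, ← mul_assoc, this a ha, mul_assoc]
  sim := by
    rintro _ ⟨a, ⟨_, _, c, hc⟩, rfl | rfl⟩
    · exact ⟨c, S.isSim.2 hc⟩
    · exact ⟨_, (S.isSim.2 hc).mul W.sim⟩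
  scal_mem := fun c => ⟨_, ⟨h.scal_mem c, h.scal_mem c, _, scal_sim _ c, scal_sim _ c⟩,
    Or.inl (S.scal_eq c).symm⟩
  x_sim := S.isSim.2 ⟨h.x_sim, h.x_sim⟩
  x_sq := by
    rw [← _root_.map_mul, ← S.embU.map_one]
    congr 1
    exact Prod.ext h.x_sq h.x_sq
  conj := by
    rintro _ ⟨a, ha, rfl | rfl⟩
    · rw [← _root_.map_mul, ← _root_.map_mul]
      exact ⟨_, amalgam_conj h h ha, Or.inl rfl⟩
    · refine ⟨(x₁, x₁) * a * (γ * x₁ * γ⁻¹, x₁), ?_, Or.inr ?_⟩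
      · obtain ⟨k1, k2, c, k3, k4⟩ := ha
        refine ⟨?_, h.conj _ k2, -1 * c * -1, ?_, (h.x_sim.mul k4).mul h.x_sim⟩
        · have : x₁ * a.1 * (γ * x₁ * γ⁻¹) = (x₁ * (a.1 * γ) * x₁) * γ⁻¹ := by group
          show x₁ * a.1 * (γ * x₁ * γ⁻¹) ∈ L₁
          rw [this]
          exact mul_mem (h.conj _ (mul_mem k1 hγ)) (inv_mem hγ)
        · convert (h.x_sim.mul k3).mul ((W.sim_γ.mul h.x_sim).mul W.sim_γ.inv) using 1
          · rfl
          rw [show m * m * -1 * (m * m)⁻¹ = -(m * m * (m * m)⁻¹) by ring,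
            mul_inv_cancel₀ W.sim_γ.1]
      · rw [mul_assoc, mul_assoc, W.comm, ← mul_assoc, ← mul_assoc, _root_.map_mul,
          _root_.map_mul]
  x_s := by
    intro c hc
    rw [← hs] at hc
    rw [← hs, ← _root_.map_mul, ← _root_.map_mul, ← _root_.map_mul, embU_coe,
      ← _root_.map_one S.emb, ← _root_.map_smul]
    congr 1
    exact Prod.ext (h.x_s _ (S.isSim.1 hc).1) (h.x_s _ (S.isSim.1 hc).2)
  psd := fun c hc => double_psd h W hγ hc

end Swap

end Split

/-- An identification of `E₁` with the corner of `E` at an idempotent. -/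
structure Cor {F E E₁ : Type} [Field F] [Ring E] [Algebra F E] [Ring E₁] [Algebra F E₁]
    (σ : AntiInv F E) (σ₁ : AntiInv F E₁) (e : E) where
  /-- the embedding -/
  j : E₁ →ₗ[F] E
  mul : ∀ a b, j (a * b) = j a * j b
  one : j 1 = e
  inj : Function.Injective j
  star : ∀ a, σ (j a) = j (σ₁ a)
  range : ∀ b, e * b * e = b → ∃ a, j a = b

namespace Cor

variable {F E E₁ E₂ : Type} [Field F] [Ring E] [Algebra F E] [Ring E₁] [Algebra F E₁]
    [Ring E₂] [Algebra F E₂] {σ : AntiInv F E} {σ₁ : AntiInv F E₁} {σ₂ : AntiInv F E₂} {e : E}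

/-- Conjugation of a corner. -/
def conj (C : Cor σ σ₁ e) {g : Eˣ} {c : F} (hg : σ.IsSim g c) : Cor σ σ₁ (cj F g e) where
  j := (cj F g).toLinearMap ∘ₗ C.j
  mul a b := by simp [C.mul]
  one := by simp [C.one]
  inj := (cj F g).injective.comp C.inj
  star a := by
    show σ (cj F g (C.j a)) = cj F g (C.j (σ₁ a))
    rw [hg.conj, C.star]
  range b hb := by
    obtain ⟨a, ha⟩ := C.range ((cj F g).symm b) ((cj F g).injective (by simpa using hb))
    exact ⟨a, show cj F g (C.j a) = b by rw [ha]; simp⟩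

theorem idem (C : Cor σ σ₁ e) : e * e = e := by rw [← C.one, ← C.mul, one_mul]

theorem e_mul (C : Cor σ σ₁ e) (a : E₁) : e * C.j a = C.j a :=
  (congrArg (· * C.j a) C.one.symm).trans (by rw [← C.mul, one_mul])

theorem mul_e (C : Cor σ σ₁ e) (a : E₁) : C.j a * e = C.j a :=
  (congrArg (C.j a * ·) C.one.symm).trans (by rw [← C.mul, mul_one])

theorem j_j (C₁ : Cor σ σ₁ e) (C₂ : Cor σ σ₂ (1 - e)) (a : E₁) (b : E₂) :
    C₁.j a * C₂.j b = 0 := by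
  rw [← C₁.mul_e, ← C₂.e_mul, mul_assoc, ← mul_assoc e, mul_sub, mul_one, C₁.idem, sub_self,
    zero_mul, mul_zero]

theorem j_j' (C₁ : Cor σ σ₁ e) (C₂ : Cor σ σ₂ (1 - e)) (a : E₁) (b : E₂) :
    C₂.j b * C₁.j a = 0 := by
  rw [← C₂.mul_e, ← C₁.e_mul, mul_assoc, ← mul_assoc (1 - e), sub_mul, one_mul, C₁.idem, sub_self,
    zero_mul, mul_zero]

/-- Complementary corners give a splitting. -/
def split (C₁ : Cor σ σ₁ e) (C₂ : Cor σ σ₂ (1 - e)) (h2 : (2 : F) ≠ 0) : Split σ σ₁ σ₂ where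
  emb := AlgHom.ofLinearMap (C₁.j.coprod C₂.j)
    (by show C₁.j 1 + C₂.j 1 = 1
        rw [C₁.one, C₂.one, add_sub_cancel])
    (by
      rintro ⟨a, b⟩ ⟨a', b'⟩
      show C₁.j (a * a') + C₂.j (b * b') = (C₁.j a + C₂.j b) * (C₁.j a' + C₂.j b')
      rw [C₁.mul, C₂.mul, add_mul, mul_add, mul_add, j_j, j_j', add_zero, zero_add])
  inj := by
    rintro ⟨a, b⟩ ⟨a', b'⟩ h
    have h : C₁.j a + C₂.j b = C₁.j a' + C₂.j b' := h
    have h1 := congrArg (C₁.j 1 * ·) h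
    have h2 := congrArg (C₂.j 1 * ·) h
    simp only [mul_add, j_j, j_j', add_zero, zero_add, ← C₁.mul, ← C₂.mul, one_mul] at h1 h2
    exact Prod.ext (C₁.inj h1) (C₂.inj h2)
  star := by
    rintro ⟨a, b⟩
    show σ (C₁.j a + C₂.j b) = C₁.j (σ₁ a) + C₂.j (σ₂ b)
    rw [σ.map_add, C₁.star, C₂.star]
  range := by
    intro b hb
    have hb : b * (C₁.j 1 + C₂.j (-1)) = (C₁.j 1 + C₂.j (-1)) * b := hb
    rw [_root_.map_neg, C₁.one, C₂.one] at hb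
    have hb : b * e = e * b := by
      have h3 : (2 : F) • (b * e) = (2 : F) • (e * b) := by
        rw [two_smul, two_smul]
        have : b * (e + -(1 - e)) = b * e + b * e - b := by noncomm_ring
        have h' : (e + -(1 - e)) * b = e * b + e * b - b := by noncomm_ring
        rw [this, h', sub_left_inj] at hb
        exact hb
      have := congrArg ((2 : F)⁻¹ • ·) h3
      simpa [smul_smul, h2] using this
    have he := C₁.idem
    obtain ⟨x, hx⟩ := C₁.range (e * b) (by rw [← mul_assoc, he, mul_assoc, hb, ← mul_assoc, he])
    obtain ⟨y, hy⟩ := C₂.range (b - e * b) (by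
      have e1 : (1 - e) * (b - e * b) = b - e * b := by
        rw [sub_mul, one_mul, mul_sub, ← mul_assoc, he, sub_self, sub_zero]
      have e2 : (b - e * b) * e = 0 := by
        rw [sub_mul, mul_assoc, hb, ← mul_assoc, he, sub_self]
      rw [e1, mul_sub, mul_one, e2, sub_zero])
    exact ⟨(x, y), show C₁.j x + C₂.j y = b by rw [hx, hy, add_sub_cancel]⟩

theorem split_emb (C₁ : Cor σ σ₁ e) (C₂ : Cor σ σ₂ (1 - e)) (h2 : (2 : F) ≠ 0) (a : E₁) (b : E₂) :
    (C₁.split C₂ h2).emb (a, b) = C₁.j a + C₂.j b := rfl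

end Cor

section Submodule

variable {F V : Type} [Field F] [AddCommGroup V] [Module F V] {B : LinearMap.BilinForm F V}
  {σ : AntiInv F (Module.End F V)} {e : Module.End F V}

/-- The embedding of endomorphisms of the image of an idempotent. -/
def cornerJ (e : Module.End F V) :
    Module.End F (LinearMap.range e) →ₗ[F] Module.End F V where
  toFun a := (LinearMap.range e).subtype ∘ₗ a ∘ₗ e.rangeRestrict
  map_add' a b := by ext; simp
  map_smul' a b := by ext; simp

/-- Restriction of endomorphisms to a corner. -/
def cornerR (e : Module.End F V) :
    Module.End F V →ₗ[F] Module.End F (LinearMap.range e) where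
  toFun a := e.rangeRestrict ∘ₗ a ∘ₗ (LinearMap.range e).subtype
  map_add' a b := by ext; simp
  map_smul' a b := by ext; simp

theorem cornerJ_apply (a : Module.End F (LinearMap.range e)) (v : V) :
    cornerJ e a v = a (e.rangeRestrict v) := rfl

theorem cornerR_apply (b : Module.End F V) (v : LinearMap.range e) :
    (cornerR e b v : V) = e (b v) := rfl

theorem apply_range (he : e * e = e) (v : LinearMap.range e) : e (v : V) = v := by
  obtain ⟨_, u, rfl⟩ := v
  exact LinearMap.congr_fun he u

theorem rangeRestrict_coe (he : e * e = e) (v : LinearMap.range e) :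
    e.rangeRestrict (v : V) = v := Subtype.ext (apply_range he v)

theorem cornerR_cornerJ (he : e * e = e) (a : Module.End F (LinearMap.range e)) :
    cornerR e (cornerJ e a) = a := by
  ext v
  rw [cornerR_apply, cornerJ_apply, rangeRestrict_coe he, apply_range he]

theorem cornerJ_cornerR (he : e * e = e) (b : Module.End F V) :
    cornerJ e (cornerR e b) = e * b * e := by
  ext v
  rfl

theorem cornerJ_mul (he : e * e = e) (a b : Module.End F (LinearMap.range e)) :
    cornerJ e (a * b) = cornerJ e a * cornerJ e b := by
  ext v
  rw [Module.End.mul_apply, cornerJ_apply, cornerJ_apply, cornerJ_apply, rangeRestrict_coe he]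
  rfl

theorem cornerJ_one : cornerJ e 1 = e := rfl

theorem cornerJ_inj (he : e * e = e) : Function.Injective (cornerJ e) :=
  Function.LeftInverse.injective (cornerR_cornerJ he)

theorem cornerJ_sigma (he : e * e = e) (hσ : σ e = e) (a : Module.End F (LinearMap.range e)) :
    cornerJ e (cornerR e (σ (cornerJ e a))) = σ (cornerJ e a) := by
  have h1 : cornerJ e a = e * cornerJ e a * e := by
    rw [← cornerJ_cornerR he, cornerR_cornerJ he]
  rw [cornerJ_cornerR he]
  conv_rhs => rw [h1, σ.map_mul, σ.map_mul, hσ]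
  rw [mul_assoc]

/-- The anti-involution of a corner. -/
def cornerInv (σ : AntiInv F (Module.End F V)) (he : e * e = e) (hσ : σ e = e) :
    AntiInv F (Module.End F (LinearMap.range e)) where
  toFun a := cornerR e (σ (cornerJ e a))
  map_add' a b := by simp
  map_mul' a b := cornerJ_inj he (by
    rw [cornerJ_sigma he hσ, cornerJ_mul he, cornerJ_mul he, cornerJ_sigma he hσ,
      cornerJ_sigma he hσ, σ.map_mul])
  map_smul' a b := by simp
  invol' a := by rw [cornerJ_sigma he hσ, σ.invol, cornerR_cornerJ he]

/-- The corner at a symmetric idempotent. -/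
def cornerCor (σ : AntiInv F (Module.End F V)) (he : e * e = e) (hσ : σ e = e) :
    Cor σ (cornerInv σ he hσ) e where
  j := cornerJ e
  mul := cornerJ_mul he
  one := cornerJ_one
  inj := cornerJ_inj he
  star a := (cornerJ_sigma he hσ a).symm
  range b hb := ⟨cornerR e b, by rw [cornerJ_cornerR he, hb]⟩

theorem Adj.symm_apply (h : Adj B σ) (hσ : σ e = e) (u v : V) : B (e u) v = B u (e v) :=
  (h.adj e u v).trans (by rw [hσ])

theorem cornerAdj (h : Adj B σ) (he : e * e = e) (hσ : σ e = e) :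
    Adj (B.restrict (LinearMap.range e)) (cornerInv σ he hσ) where
  alt v := h.alt v
  nondeg v hv := Subtype.ext (h.nondeg v fun u => by
    have := hv (e.rangeRestrict u)
    change B v (e u) = 0 at this
    rw [← h.symm_apply hσ, apply_range he] at this
    exact this)
  adj a u v := by
    have h1 : (a u : V) = cornerJ e a u := by rw [cornerJ_apply, rangeRestrict_coe he]
    change B (a u : V) v = B (u : V) (e (σ (cornerJ e a) v))
    rw [h1, h.adj]
    rw [← h.symm_apply hσ, apply_range he]

end Submodule

/-- A similitude and a `2`-group of similitudes commuting with it. -/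
structure TwoLocal {F E : Type} [Field F] [Ring E] [Algebra F E] (σ : AntiInv F E) (s : Eˣ)
    (P : Subgroup Eˣ) : Prop where
  s_sim : ∃ c : F, σ.IsSim s c
  P_sim : ∀ p ∈ P, ∃ c : F, σ.IsSim p c
  P_two : ∀ p ∈ P, ∃ k : ℕ, p ^ 2 ^ k = 1
  P_s : ∀ p ∈ P, p * s = s * p

namespace Split

variable {F E E₁ E₂ : Type} [Field F] [Ring E] [Algebra F E] [Ring E₁] [Algebra F E₁]
    [Ring E₂] [Algebra F E₂] {σ : AntiInv F E} {σ₁ : AntiInv F E₁} {σ₂ : AntiInv F E₂}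
    (S : Split σ σ₁ σ₂) {s₁ : E₁ˣ} {s₂ : E₂ˣ} {P : Subgroup Eˣ}

theorem twoLocal_fst (h : TwoLocal σ (S.embU (s₁, s₂)) P) :
    TwoLocal σ₁ s₁ ((P.comap S.embU).map (MonoidHom.fst _ _)) where
  s_sim := h.s_sim.imp fun _ hc => (S.isSim.1 hc).1
  P_sim := by
    rintro _ ⟨a, ha, rfl⟩
    exact (h.P_sim _ ha).imp fun _ hc => (S.isSim.1 hc).1
  P_two := by
    rintro _ ⟨a, ha, rfl⟩
    obtain ⟨k, hk⟩ := h.P_two _ ha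
    rw [← _root_.map_pow, ← S.embU.map_one] at hk
    exact ⟨k, congrArg Prod.fst (S.embU_inj hk)⟩
  P_s := by
    rintro _ ⟨a, ha, rfl⟩
    have := h.P_s _ ha
    rw [← _root_.map_mul, ← _root_.map_mul] at this
    exact congrArg Prod.fst (S.embU_inj this)

theorem twoLocal_snd (h : TwoLocal σ (S.embU (s₁, s₂)) P) :
    TwoLocal σ₂ s₂ ((P.comap S.embU).map (MonoidHom.snd _ _)) where
  s_sim := h.s_sim.imp fun _ hc => (S.isSim.1 hc).2
  P_sim := by
    rintro _ ⟨a, ha, rfl⟩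
    exact (h.P_sim _ ha).imp fun _ hc => (S.isSim.1 hc).2
  P_two := by
    rintro _ ⟨a, ha, rfl⟩
    obtain ⟨k, hk⟩ := h.P_two _ ha
    rw [← _root_.map_pow, ← S.embU.map_one] at hk
    exact ⟨k, congrArg Prod.snd (S.embU_inj hk)⟩
  P_s := by
    rintro _ ⟨a, ha, rfl⟩
    have := h.P_s _ ha
    rw [← _root_.map_mul, ← _root_.map_mul] at this
    exact congrArg Prod.snd (S.embU_inj this)

end Split

theorem TData.of_subsingleton {F E : Type} [Field F] [Ring E] [Algebra F E] [Subsingleton E]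
    (σ : AntiInv F E) (s : Eˣ) (P : Subgroup Eˣ) : ∃ L x, TData σ s P L x := by
  have hs : ∀ (u : Eˣ) (c : F), c ≠ 0 → σ.IsSim u c := fun u c hc => ⟨hc, Subsingleton.elim _ _⟩
  refine ⟨⊤, 1, le_top, trivial, fun _ _ => Units.ext (Subsingleton.elim _ _),
    fun l _ => ⟨1, hs _ _ one_ne_zero⟩, fun _ => trivial, hs _ _ (neg_ne_zero.2 one_ne_zero),
    mul_one 1, fun _ _ => trivial, fun _ _ => Subsingleton.elim _ _, fun c hc => ?_⟩
  refine ⟨Unit, inferInstance, fun _ _ => 1, fun g h => ?_⟩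
  have : Unique {t : Eˣ // 1 * t ∈ (⊤ : Subgroup Eˣ) ∧ σ.IsSim t c ∧
      (t * t : E) = (-c) • (((g⁻¹ * h : (⊤ : Subgroup Eˣ)) : Eˣ) : E)} :=
    { default := ⟨1, trivial, hs _ _ hc, Subsingleton.elim _ _⟩
      uniq := fun t => Subtype.ext (Units.ext (Subsingleton.elim _ _)) }
  show theta σ ⊤ 1 c _ = _
  rw [theta, Nat.card_unique]
  simp

theorem TwoLocal.exists_TData {F : Type} [Field F] [Finite F] (h2 : (2 : F) ≠ 0) (N : ℕ) :
    ∀ (V : Type) [AddCommGroup V] [Module F V] [Finite V] (B : LinearMap.BilinForm F V)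
      (σ : AntiInv F (Module.End F V)) (_ : Adj B σ) (s : (Module.End F V)ˣ)
      (P : Subgroup (Module.End F V)ˣ) (_ : TwoLocal σ s P), Module.finrank F V = N →
      ∃ L x, TData σ s P L x := by
  induction N using Nat.strong_induction_on with
  | _ N ih =>
  intro V _ _ _ B σ hB s P hP hN
  have hfin : Finite (Module.End F V) :=
    Finite.of_injective (fun a : Module.End F V => (a : V → V)) DFunLike.coe_injective
  rcases subsingleton_or_nontrivial (Module.End F V) with hsub | hnt
  · exact TData.of_subsingleton σ s P
  obtain ⟨M, hM⟩ := exists_ssPow F (Module.End F V) h2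
  obtain ⟨D, hDσ, hDs, hDP⟩ : ∃ D : Frame F (Module.End F V), D.σ = σ ∧ D.s = s ∧ D.P = P :=
    ⟨⟨σ, M, hM, s, P, h2, hP.s_sim, hP.P_sim, hP.P_two, hP.P_s⟩, rfl, rfl, rfl⟩
  obtain ⟨A, good, max, inv⟩ := D.exists_maximal
  by_cases hs : ∀ u ∈ A, u * u = 1 → D.σ u = u → u = 1 ∨ u = -1
  · obtain ⟨w, hw⟩ := Frame.exists_prim good max inv hs
    have := hw.exists_TData (hDσ ▸ hB)
    rwa [hDσ, hDs, hDP] at this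
  push Not at hs
  obtain ⟨u, huA, huu, hσu, hu1, hu2, huP⟩ := good.exists_involution hs
  rw [hDσ] at hσu
  rw [hDP] at huP
  have hus := good.s_comm u huA
  rw [hDs] at hus
  obtain ⟨e, he⟩ : ∃ e : Module.End F V, e = (2 : F)⁻¹ • (1 + u) := ⟨_, rfl⟩
  have hue : u = e + e - 1 := by
    rw [he, ← two_smul F, smul_smul, mul_inv_cancel₀ h2, one_smul, add_sub_cancel_left]
  have hee : e * e = e := by
    have h4 : (2 : F)⁻¹ * (2 : F)⁻¹ * 2 = 2⁻¹ := by field_simp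
    rw [he, smul_mul_smul_comm, show (1 + u) * (1 + u) = 1 + u + u + u * u by noncomm_ring, huu,
      show (1 + u + u + 1) = (2 : F) • (1 + u) by rw [two_smul]; abel, smul_smul, h4]
  have hσe : σ e = e := by rw [he, σ.map_smul, σ.map_add, σ.map_one, hσu]
  have hee' : (1 - e) * (1 - e) = 1 - e := by
    rw [mul_sub, mul_one, sub_mul, one_mul, hee, sub_self, sub_zero]
  have hσe' : σ (1 - e) = 1 - e := by rw [σ.map_sub, σ.map_one, hσe]
  have he1 : e ≠ 1 := fun h => hu1 (by rw [hue, h]; simp)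
  have he0 : e ≠ 0 := fun h => hu2 (by rw [hue, h]; simp)
  have hdim : ∀ f : Module.End F V, f * f = f → f ≠ 1 →
      Module.finrank F (LinearMap.range f) < N := by
    intro f hf hf1
    rw [← hN]
    refine Submodule.finrank_lt fun htop => hf1 ?_
    ext v
    obtain ⟨w, rfl⟩ := LinearMap.range_eq_top.1 htop v
    exact LinearMap.congr_fun hf w
  have hse : e * s = s * e := by
    rw [he, smul_mul_assoc, mul_smul_comm, add_mul, mul_add, hus, one_mul, mul_one]
  have hcomm : ∀ p : (Module.End F V)ˣ, cj F p u = u → (p : Module.End F V) * e = e * p := by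
    intro p hp
    rw [cj_eq_self] at hp
    rw [he, smul_mul_assoc, mul_smul_comm, add_mul, mul_add, hp, one_mul, mul_one]
  let C₁ := cornerCor σ hee hσe
  have hSu : ∀ {E₂ : Type} [Ring E₂] [Algebra F E₂] {σ₂ : AntiInv F E₂}
      (C₂ : Cor σ σ₂ (1 - e)) (p : (Module.End F V)ˣ), (p : Module.End F V) * e = e * p →
      ∃ a, (C₁.split C₂ h2).embU a = p := by
    intro E₂ _ _ σ₂ C₂ p hp
    apply Split.exists_embU
    rw [Cor.split_emb, _root_.map_neg, C₁.one, C₂.one]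
    rw [mul_add, add_mul, hp, mul_neg, neg_mul, mul_sub, sub_mul, hp, mul_one, one_mul]
  by_cases hall : ∀ p ∈ P, cj F p u = u
  · let S := C₁.split (cornerCor σ hee' hσe') h2
    obtain ⟨⟨s₁, s₂⟩, rfl⟩ := hSu (cornerCor σ hee' hσe') s hse.symm
    obtain ⟨L₁, x₁, h₁⟩ := ih _ (hdim e hee he1) _ _ _ (cornerAdj hB hee hσe) _ _
      (S.twoLocal_fst hP) rfl
    obtain ⟨L₂, x₂, h₂⟩ := ih _ (hdim (1 - e) hee' (by simpa using he0)) _ _ _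
      (cornerAdj hB hee' hσe') _ _ (S.twoLocal_snd hP) rfl
    refine ⟨_, _, S.tdata_sum h₁ h₂ rfl hP.s_sim fun p hp => ⟨hP.P_sim p hp, ?_⟩⟩
    obtain ⟨a, ha⟩ := hSu (cornerCor σ hee' hσe') p (hcomm p (hall p hp))
    have hap : a ∈ P.comap S.embU := by
      show S.embU a ∈ P
      rwa [show S.embU a = p from ha]
    exact ⟨a, ⟨a, hap, rfl⟩, ⟨a, hap, rfl⟩, ha⟩
  · push Not at hall
    obtain ⟨g, hgP, hgu⟩ := hall
    have hgu := (huP g hgP).resolve_left hgu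
    obtain ⟨m, hm⟩ := hP.P_sim g hgP
    have hge : cj F g e = 1 - e := by
      rw [he, _root_.map_smul, _root_.map_add, _root_.map_one, hgu]
      have : (1 : Module.End F V) = (2 : F)⁻¹ • (1 + u) + (2 : F)⁻¹ • (1 - u) := by
        rw [← smul_add, show (1 + u) + (1 - u) = (2 : F) • (1 : Module.End F V) by
          rw [two_smul]; abel, smul_smul, inv_mul_cancel₀ h2, one_smul]
      rw [eq_sub_iff_add_eq, add_comm]
      conv_rhs => rw [this]
      rw [sub_eq_add_neg]
    obtain ⟨C₂, hC₂⟩ : ∃ C₂ : Cor σ (cornerInv σ hee hσe) (1 - e),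
        ∀ a, C₂.j a = cj F g (C₁.j a) := by
      rw [← hge]
      exact ⟨C₁.conj hm, fun _ => rfl⟩
    let S := C₁.split C₂ h2
    have hSe : ∀ a b, S.emb (a, b) = C₁.j a + cj F g (C₁.j b) := fun a b => by
      rw [← hC₂]; rfl
    obtain ⟨⟨s₁, s₂⟩, hs⟩ := hSu C₂ s hse.symm
    obtain ⟨⟨γ, γ'⟩, hγ⟩ := hSu C₂ (g * g) (hcomm _ (by
      rw [← cj_cj, hgu, _root_.map_neg, hgu, neg_neg]))
    have hs : S.embU (s₁, s₂) = s := hs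
    have hγ : S.embU (γ, γ') = g * g := hγ
    have hcj : ∀ a b, cj F g (S.emb (a, b)) = S.emb (γ * b * ↑γ⁻¹, a) := by
      intro a b
      have h1 : cj F g (cj F g (C₁.j b)) = S.emb (γ * b * ↑γ⁻¹, 0) := by
        have e1 : C₁.j b = S.emb (b, 0) := by rw [hSe]; simp
        rw [cj_cj, e1, ← hγ, cj_apply, ← _root_.map_inv, S.embU_coe, S.embU_coe,
          ← _root_.map_mul, ← _root_.map_mul]
        simp
      rw [hSe, _root_.map_add, h1, hSe, hSe, add_comm]
      simp
    have hγγ : γ' = γ := by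
      have h1 : cj F g (S.emb (γ, γ')) = S.emb (γ, γ') := by
        rw [show S.emb ((γ : Module.End F (LinearMap.range e)), (γ' : Module.End F (LinearMap.range e)))
          = ((g * g : (Module.End F V)ˣ) : Module.End F V) from congrArg Units.val hγ, cj_eq_self,
          Units.val_mul, mul_assoc]
      rw [hcj] at h1
      exact (Units.ext (congrArg Prod.snd (S.inj h1))).symm
    subst hγγ
    have hW : S.Swap g γ' m :=
      { comm := fun a => Units.ext (by
          rw [Units.val_mul, Units.val_mul, S.embU_coe, S.embU_coe, ← cj_mul_unit (F := F), hcj]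
          rfl)
        sq := hγ.symm
        sim := hm
        ne := fun h => by
          apply he0
          have h3 := congrArg C₁.j h
          rw [_root_.map_neg, C₁.one, eq_neg_iff_add_eq_zero, ← two_smul F] at h3
          exact (smul_eq_zero.1 h3).resolve_left h2 }
    have hss : s₂ = s₁ := by
      have h1 : cj F g (S.emb (s₁, s₂)) = S.emb (s₁, s₂) := by
        rw [show S.emb ((s₁ : Module.End F (LinearMap.range e)), (s₂ : Module.End F (LinearMap.range e)))
          = (s : Module.End F V) from congrArg Units.val hs, cj_eq_self, ← Units.val_mul,
          hP.P_s g hgP, Units.val_mul]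
      rw [hcj] at h1
      exact (Units.ext (congrArg Prod.snd (S.inj h1))).symm
    subst hss
    have hP' : TwoLocal σ (S.embU (s₂, s₂)) P := by rwa [hs]
    obtain ⟨L₁, x₁, h₁⟩ := ih _ (hdim e hee he1) _ _ _ (cornerAdj hB hee hσe) _ _
      (S.twoLocal_fst hP') rfl
    have hnt : Nontrivial (Module.End F (LinearMap.range e)) := by
      refine ⟨1, 0, fun h => he0 ?_⟩
      rw [← C₁.one, h, _root_.map_zero]
    have hγP : γ' ∈ (P.comap S.embU).map (MonoidHom.fst _ _) :=
      ⟨(γ', γ'), show S.embU (γ', γ') ∈ P by rw [hγ]; exact mul_mem hgP hgP, rfl⟩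
    have hsnd : ∀ a, S.embU a ∈ P → a.1 ∈ (P.comap S.embU).map (MonoidHom.fst _ _) ∧
        a.2 ∈ (P.comap S.embU).map (MonoidHom.fst _ _) := by
      intro a ha
      refine ⟨⟨a, ha, rfl⟩, ?_⟩
      have h1 : S.embU (γ' * a.2 * γ'⁻¹, a.1) ∈ P := by
        rw [← mul_inv_eq_iff_eq_mul.2 (hW.comm a)]
        exact mul_mem (mul_mem hgP ha) (inv_mem hgP)
      have h2 : γ' * a.2 * γ'⁻¹ ∈ (P.comap S.embU).map (MonoidHom.fst _ _) := ⟨_, h1, rfl⟩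
      have := mul_mem (mul_mem (inv_mem hγP) h2) hγP
      simpa [mul_assoc] using this
    refine ⟨_, _, Split.Swap.tdata_double h₁ hW (h₁.P_le hγP) hs (hP.P_s g hgP) hP.s_sim
      fun p hp => ⟨hP.P_sim p hp, ?_⟩⟩
    rcases huP p hp with hpu | hpu
    · obtain ⟨a, ha⟩ := hSu C₂ p (hcomm p hpu)
      have ha : S.embU a = p := ha
      have := hsnd a (ha ▸ hp)
      exact ⟨a, this.1, this.2, Or.inl ha.symm⟩
    · obtain ⟨a, ha⟩ := hSu C₂ (p * g⁻¹) (hcomm _ (by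
        rw [← cj_cj, (cj_inv_eq (a := -u) (b := u)).1 (by rw [_root_.map_neg, hgu, neg_neg]),
          _root_.map_neg, hpu, neg_neg]))
      have ha : S.embU a = p * g⁻¹ := ha
      have := hsnd a (ha ▸ mul_mem hp (inv_mem hgP))
      exact ⟨a, this.1, this.2, Or.inr (by rw [ha, inv_mul_cancel_right])⟩

section MatrixRep

variable {G : Type} [Group G] [Fintype G] {ι : Type} [Fintype ι] [DecidableEq ι]

open scoped MatrixOrder ComplexOrder in
/-- A matrix representation of a finite group becomes unitary after a change of basis. -/
theorem exists_unitarization (ρ : G →* Matrix ι ι ℂ) :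
    ∃ Q : Matrix ι ι ℂ, IsUnit Q ∧ ∀ g, ρ g⁻¹ = (Qᴴ * Q)⁻¹ * (ρ g)ᴴ * (Qᴴ * Q) := by
  let A : Matrix ι ι ℂ := ∑ g : G, (ρ g)ᴴ * ρ g
  have hA : A.PosDef := by
    refine Matrix.posDef_sum ⟨1, Finset.mem_univ _⟩ fun g _ => ?_
    have h1 : IsUnit (ρ g) := ⟨⟨ρ g, ρ g⁻¹, by rw [← _root_.map_mul, mul_inv_cancel, _root_.map_one],
      by rw [← _root_.map_mul, inv_mul_cancel, _root_.map_one]⟩, rfl⟩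
    exact PosDef.conjTranspose_mul_self _ (Matrix.mulVec_injective_of_isUnit h1)
  have hinv : ∀ g, (ρ g)ᴴ * A * ρ g = A := by
    intro g
    simp only [A, Finset.mul_sum, Finset.sum_mul]
    refine Fintype.sum_equiv (Equiv.mulRight g) _ _ fun x => ?_
    simp [Matrix.conjTranspose_mul, mul_assoc]
  obtain ⟨Q, hQ⟩ := CStarAlgebra.nonneg_iff_eq_star_mul_self.mp
    (show (0 : Matrix ι ι ℂ) ≤ A from hA.posSemidef.nonneg)
  rw [star_eq_conjTranspose] at hQ
  have hdet : A.det ≠ 0 := ((Matrix.isUnit_iff_isUnit_det _).1 hA.isUnit).ne_zero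
  refine ⟨Q, ?_, fun g => ?_⟩
  · rw [Matrix.isUnit_iff_isUnit_det, isUnit_iff_ne_zero]
    intro h
    rw [hQ, Matrix.det_mul, h, mul_zero] at hdet
    exact hdet rfl
  · rw [← hQ]
    have h1 : (ρ g)ᴴ * A = A * ρ g⁻¹ := by
      conv_rhs => rw [← hinv g]
      rw [mul_assoc _ _ (ρ g⁻¹), ← _root_.map_mul, mul_inv_cancel, _root_.map_one, mul_one]
    rw [mul_assoc, h1, ← mul_assoc, Matrix.nonsing_inv_mul _ (isUnit_iff_ne_zero.2 hdet), one_mul]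

theorem trace_rep_inv (ρ : G →* Matrix ι ι ℂ) (g : G) :
    (ρ g⁻¹).trace = (starRingEnd ℂ) (ρ g).trace := by
  obtain ⟨Q, hQ, h⟩ := exists_unitarization ρ
  have hd : IsUnit (Qᴴ * Q).det := (Matrix.isUnit_iff_isUnit_det _).1 (hQ.star.mul hQ)
  rw [h, Matrix.trace_mul_comm, ← mul_assoc, Matrix.mul_nonsing_inv _ hd, one_mul,
    Matrix.trace_conjTranspose]
  rfl

theorem isPSD_trace_rep (ρ : G →* Matrix ι ι ℂ) : IsPSD fun g => (ρ g).trace := by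
  obtain ⟨Q, hQ, h⟩ := exists_unitarization ρ
  have hd : IsUnit Q.det := (Matrix.isUnit_iff_isUnit_det _).1 hQ
  refine ⟨ι × ι, inferInstance, fun i g => (Q * ρ g * Q⁻¹) i.1 i.2, fun g k => ?_⟩
  have h1 : (ρ (g⁻¹ * k)).trace = ((Q * ρ g * Q⁻¹)ᴴ * (Q * ρ k * Q⁻¹)).trace := by
    rw [_root_.map_mul, h, Matrix.mul_inv_rev, Matrix.conjTranspose_mul, Matrix.conjTranspose_mul,
      Matrix.conjTranspose_nonsing_inv]
    rw [show Q⁻¹ * Qᴴ⁻¹ * (ρ g)ᴴ * (Qᴴ * Q) * ρ k = Q⁻¹ * (Qᴴ⁻¹ * (ρ g)ᴴ * (Qᴴ * Q) * ρ k) by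
      simp only [mul_assoc], Matrix.trace_mul_comm]
    simp only [mul_assoc]
  refine h1.trans ?_
  rw [Fintype.sum_prod_type, Finset.sum_comm]
  simp only [Matrix.trace, Matrix.diag]
  refine Finset.sum_congr rfl fun i _ => ?_
  rw [Matrix.mul_apply]
  rfl

end MatrixRep

namespace IsPSD

variable {G : Type} [Group G]

theorem mul {θ θ' : G → ℂ} (h : IsPSD θ) (h' : IsPSD θ') : IsPSD fun g => θ g * θ' g :=
  (h.prod h').comp ((MonoidHom.id G).prod (MonoidHom.id G))

theorem sum_nonneg [Fintype G] {θ : G → ℂ} (h : IsPSD θ) : 0 ≤ (∑ g, θ g).re := by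
  obtain ⟨ι, _, f, hf⟩ := h
  have h1 : (Fintype.card G : ℂ) * ∑ g, θ g = ∑ i, (starRingEnd ℂ) (∑ g, f i g) * ∑ g, f i g := by
    have h2 : ∀ g : G, ∑ k, θ (g⁻¹ * k) = ∑ k, θ k := fun g =>
      Fintype.sum_equiv (Equiv.mulLeft g⁻¹) _ _ fun x => rfl
    calc (Fintype.card G : ℂ) * ∑ g, θ g = ∑ g : G, ∑ k, θ (g⁻¹ * k) := by
          simp [h2]
      _ = ∑ g : G, ∑ k, ∑ i, (starRingEnd ℂ) (f i g) * f i k := by simp only [hf]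
      _ = ∑ i, ∑ g, ∑ k, (starRingEnd ℂ) (f i g) * f i k := by
          rw [Finset.sum_comm]
          refine Eq.trans ?_ Finset.sum_comm
          rw [Finset.sum_comm]
          exact Finset.sum_congr rfl fun g _ => Finset.sum_comm
      _ = _ := by
          refine Finset.sum_congr rfl fun i _ => ?_
          rw [map_sum, Finset.sum_mul_sum]
  have h3 : (0 : ℝ) ≤ ((Fintype.card G : ℂ) * ∑ g, θ g).re := by
    rw [h1, Complex.re_sum]
    refine Finset.sum_nonneg fun i _ => ?_
    rw [mul_comm, Complex.mul_conj, Complex.ofReal_re]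
    exact Complex.normSq_nonneg _
  rw [← Complex.ofReal_natCast, Complex.re_ofReal_mul] at h3
  exact nonneg_of_mul_nonneg_right h3 (by exact_mod_cast Fintype.card_pos)

end IsPSD

section Schur

variable {G : Type} [Group G] [Fintype G] {ι : Type} [Fintype ι] [DecidableEq ι]

/-- The commutant of a matrix representation consists of scalars. -/
def IsSchur (ρ : G →* Matrix ι ι ℂ) : Prop :=
  ∀ A : Matrix ι ι ℂ, (∀ g, ρ g * A = A * ρ g) → ∃ c : ℂ, A = c • 1

theorem IsSchur.sum_conj {ρ : G →* Matrix ι ι ℂ} (h : IsSchur ρ) [Nonempty ι] (A : Matrix ι ι ℂ) :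
    ∑ g, ρ g * A * ρ g⁻¹ = ((Fintype.card G : ℂ) * A.trace / Fintype.card ι) • 1 := by
  obtain ⟨c, hc⟩ := h (∑ g, ρ g * A * ρ g⁻¹) fun k => by
    rw [Finset.mul_sum, Finset.sum_mul]
    refine Fintype.sum_equiv (Equiv.mulLeft k) _ _ fun x => ?_
    simp only [Equiv.coe_mulLeft, _root_.mul_inv_rev, _root_.map_mul, mul_assoc]
    rw [← _root_.map_mul ρ k⁻¹ k, inv_mul_cancel, _root_.map_one, mul_one]
  have h1 := congrArg Matrix.trace hc
  rw [Matrix.trace_sum, Matrix.trace_smul, Matrix.trace_one, smul_eq_mul] at h1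
  have h2 : ∀ g, (ρ g * A * ρ g⁻¹).trace = A.trace := fun g => by
    rw [Matrix.trace_mul_comm, ← mul_assoc, ← _root_.map_mul, inv_mul_cancel, _root_.map_one,
      one_mul]
  simp only [h2, Finset.sum_const, Finset.card_univ, nsmul_eq_mul] at h1
  rw [hc, h1, mul_div_assoc, div_self (by simp), mul_one]

theorem IsSchur.orthogonality {ρ : G →* Matrix ι ι ℂ} (h : IsSchur ρ) [Nonempty ι]
    (i j k l : ι) : ∑ g, ρ g i j * ρ g⁻¹ k l =
      if j = k ∧ i = l then (Fintype.card G : ℂ) / Fintype.card ι else 0 := by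
  have := congrFun (congrFun (h.sum_conj (Matrix.single j k 1)) i) l
  rw [Matrix.sum_apply, Matrix.smul_apply, Matrix.one_apply] at this
  have h2 : ∀ g, (ρ g * (Matrix.single j k 1 : Matrix ι ι ℂ) * ρ g⁻¹) i l = ρ g i j * ρ g⁻¹ k l := by
    intro g
    simp [Matrix.mul_apply, Matrix.single_apply, ite_and, Finset.sum_ite_eq]
  simp only [h2] at this
  rw [this]
  by_cases h3 : j = k
  · subst h3
    by_cases h4 : i = l <;> simp [h4]
  · simp [h3]

theorem IsSchur.sum_trace_mul_inv {ρ : G →* Matrix ι ι ℂ} (h : IsSchur ρ) [Nonempty ι] :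
    ∑ g, (ρ g).trace * (ρ g⁻¹).trace = Fintype.card G := by
  simp only [Matrix.trace, Matrix.diag, Finset.sum_mul_sum]
  rw [Finset.sum_comm]
  have : ∀ i, ∑ g, ∑ j, ρ g i i * ρ g⁻¹ j j = (Fintype.card G : ℂ) / Fintype.card ι := by
    intro i
    rw [Finset.sum_comm]
    simp [h.orthogonality]
  simp only [this, Finset.sum_const, Finset.card_univ, nsmul_eq_mul]
  field_simp

/-- The Frobenius-Schur sum of a representation with an invariant form of sign `ε`, twisted by
a map `κ`. -/
theorem IsSchur.sum_trace_twist {ρ : G →* Matrix ι ι ℂ} (h : IsSchur ρ) [Nonempty ι]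
    {X : Matrix ι ι ℂ} (hX : IsUnit X) {κ : G → G} (hκ : ∀ g, X * ρ (κ g) = (ρ g⁻¹)ᵀ * X)
    {ε : ℂ} (hε : Xᵀ = ε • X) : ∑ g, (ρ (g * κ g)).trace = ε * Fintype.card G := by
  have hd : IsUnit X.det := (Matrix.isUnit_iff_isUnit_det _).1 hX
  have h1 : ∀ g, (ρ (g * κ g)).trace =
      ∑ a, ∑ b, ∑ c, ∑ d, X⁻¹ b c * X d a * (ρ g a b * ρ g⁻¹ d c) := by
    intro g
    have h2 : ρ (κ g) = X⁻¹ * (ρ g⁻¹)ᵀ * X := by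
      rw [mul_assoc, ← hκ, ← mul_assoc, Matrix.nonsing_inv_mul _ hd, one_mul]
    rw [_root_.map_mul, h2]
    simp only [Matrix.trace, Matrix.diag, Matrix.mul_apply, Matrix.transpose_apply,
      Finset.mul_sum, Finset.sum_mul]
    refine Finset.sum_congr rfl fun a _ => Finset.sum_congr rfl fun b _ => ?_
    rw [Finset.sum_comm]
    exact Finset.sum_congr rfl fun c _ => Finset.sum_congr rfl fun d _ => by ring
  have h3 : ∑ g, (ρ (g * κ g)).trace = ∑ a, ∑ b, ∑ c, ∑ d, X⁻¹ b c * X d a *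
      ∑ g, (ρ g a b * ρ g⁻¹ d c) := by
    simp only [h1, Finset.mul_sum]
    rw [Finset.sum_comm]
    refine Finset.sum_congr rfl fun a _ => ?_
    rw [Finset.sum_comm]
    refine Finset.sum_congr rfl fun b _ => ?_
    rw [Finset.sum_comm]
    refine Finset.sum_congr rfl fun c _ => ?_
    rw [Finset.sum_comm]
  rw [h3]
  simp only [h.orthogonality, ite_and, mul_ite, mul_zero, Finset.sum_ite_eq, Finset.mem_univ,
    if_true]
  have h4 : ∑ a, ∑ b, X⁻¹ b a * X b a = (X⁻¹ * Xᵀ).trace := by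
    simp only [Matrix.trace, Matrix.diag, Matrix.mul_apply, Matrix.transpose_apply]
    exact Finset.sum_comm
  simp only [← Finset.sum_mul]
  rw [h4, hε, Matrix.mul_smul, Matrix.nonsing_inv_mul _ hd, Matrix.trace_smul, Matrix.trace_one,
    smul_eq_mul]
  field_simp

end Schur

section LinearRep

variable {G : Type} [Group G] {V : Type} [AddCommGroup V] [Module ℂ V]

/-- A subspace stable under all operators of a representation. -/
def InvSub (ρ : G →* Module.End ℂ V) (p : Submodule ℂ V) : Prop := ∀ g, ∀ v ∈ p, ρ g v ∈ p

/-- Irreducibility of a representation. -/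
def IrrRep (ρ : G →* Module.End ℂ V) : Prop :=
  Nontrivial V ∧ ∀ p, InvSub ρ p → p = ⊥ ∨ p = ⊤

/-- The representation on an invariant subspace. -/
def InvSub.restr {ρ : G →* Module.End ℂ V} {p : Submodule ℂ V} (h : InvSub ρ p) :
    G →* Module.End ℂ p where
  toFun g := (ρ g).restrict (h g)
  map_one' := by ext; simp
  map_mul' a b := by ext; simp

theorem InvSub.restr_coe {ρ : G →* Module.End ℂ V} {p : Submodule ℂ V} (h : InvSub ρ p) (g : G)
    (v : p) : ((h.restr g v : p) : V) = ρ g v := rfl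

theorem InvSub.sup {ρ : G →* Module.End ℂ V} {p p' : Submodule ℂ V} (h : InvSub ρ p)
    (h' : InvSub ρ p') : InvSub ρ (p ⊔ p') := fun g v hv => by
  obtain ⟨a, ha, b, hb, rfl⟩ := Submodule.mem_sup.1 hv
  rw [_root_.map_add]
  exact Submodule.add_mem_sup (h g a ha) (h' g b hb)

theorem rep_inv_apply (ρ : G →* Module.End ℂ V) (g : G) (v : V) : ρ g⁻¹ (ρ g v) = v := by
  rw [← Module.End.mul_apply, ← _root_.map_mul, inv_mul_cancel, _root_.map_one]; rfl

theorem rep_apply_inv (ρ : G →* Module.End ℂ V) (g : G) (v : V) : ρ g (ρ g⁻¹ v) = v := by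
  rw [← Module.End.mul_apply, ← _root_.map_mul, mul_inv_cancel, _root_.map_one]; rfl

variable [FiniteDimensional ℂ V]

theorem InvSub.exists_irr_le {ρ : G →* Module.End ℂ V} {p : Submodule ℂ V} (h : InvSub ρ p)
    (h0 : p ≠ ⊥) : ∃ t ≤ p, ∃ ht : InvSub ρ t, t ≠ ⊥ ∧ IrrRep ht.restr := by
  obtain ⟨t, ⟨ht, ht0, htp⟩, hmin⟩ := wellFounded_lt.has_min
    {t : Submodule ℂ V | InvSub ρ t ∧ t ≠ ⊥ ∧ t ≤ p} ⟨p, h, h0, le_rfl⟩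
  refine ⟨t, htp, ht, ht0, Submodule.nontrivial_iff_ne_bot.2 ht0, fun r hr => ?_⟩
  by_cases hr0 : r = ⊥
  · exact Or.inl hr0
  right
  have h1 : r.map t.subtype ≤ t := Submodule.map_subtype_le _ _
  have h2 : InvSub ρ (r.map t.subtype) := by
    rintro g _ ⟨v, hv, rfl⟩
    exact ⟨ht.restr g v, hr g v hv, rfl⟩
  have h3 : r.map t.subtype ≠ ⊥ := fun h => hr0 (by
    apply Submodule.map_injective_of_injective t.injective_subtype
    rw [h, Submodule.map_bot])
  have h4 := hmin _ ⟨h2, h3, h1.trans htp⟩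
  have h5 : r.map t.subtype = t := by
    by_contra h6
    exact h4 (lt_of_le_of_ne h1 h6)
  apply Submodule.map_injective_of_injective t.injective_subtype
  rw [h5, Submodule.map_top, Submodule.range_subtype]

/-- The matrix form of a representation. -/
def matRep (ρ : G →* Module.End ℂ V) :
    G →* Matrix (Fin (Module.finrank ℂ V)) (Fin (Module.finrank ℂ V)) ℂ :=
  ((LinearMap.toMatrixAlgEquiv (Module.finBasis ℂ V) : _ →* _)).comp ρ

theorem matRep_apply (ρ : G →* Module.End ℂ V) (g : G) :
    matRep ρ g = LinearMap.toMatrix (Module.finBasis ℂ V) (Module.finBasis ℂ V) (ρ g) := rfl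

theorem trace_matRep (ρ : G →* Module.End ℂ V) (g : G) :
    (matRep ρ g).trace = LinearMap.trace ℂ V (ρ g) := by
  rw [matRep_apply, LinearMap.trace_eq_matrix_trace ℂ (Module.finBasis ℂ V)]

theorem IrrRep.nonempty {ρ : G →* Module.End ℂ V} (h : IrrRep ρ) :
    Nonempty (Fin (Module.finrank ℂ V)) := by
  have := h.1
  exact ⟨⟨0, Module.finrank_pos⟩⟩

theorem IrrRep.scalar {ρ : G →* Module.End ℂ V} (h : IrrRep ρ) (a : Module.End ℂ V)
    (ha : ∀ g, ρ g * a = a * ρ g) : ∃ c : ℂ, a = c • 1 := by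
  have := h.1
  obtain ⟨c, hc⟩ := Module.End.exists_eigenvalue a
  refine ⟨c, ?_⟩
  have h1 : InvSub ρ (Module.End.eigenspace a c) := fun g v hv => by
    rw [Module.End.mem_eigenspace_iff] at hv ⊢
    rw [← Module.End.mul_apply, ← ha, Module.End.mul_apply, hv, _root_.map_smul]
  rcases h.2 _ h1 with h2 | h2
  · exact absurd h2 hc
  · ext v
    exact Module.End.mem_eigenspace_iff.1 (h2 ▸ Submodule.mem_top)

theorem IrrRep.isSchur {ρ : G →* Module.End ℂ V} (h : IrrRep ρ) : IsSchur (matRep ρ) := by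
  intro A hA
  let e := LinearMap.toMatrixAlgEquiv (Module.finBasis ℂ V)
  obtain ⟨c, hc⟩ := h.scalar (e.symm A) fun g => by
    apply e.injective
    rw [_root_.map_mul, _root_.map_mul, AlgEquiv.apply_symm_apply]
    exact hA g
  refine ⟨c, ?_⟩
  have := congrArg e hc
  rwa [AlgEquiv.apply_symm_apply, _root_.map_smul, _root_.map_one] at this

variable [Fintype G]

theorem trace_inv_rep (ρ : G →* Module.End ℂ V) (g : G) :
    LinearMap.trace ℂ V (ρ g⁻¹) = (starRingEnd ℂ) (LinearMap.trace ℂ V (ρ g)) := by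
  rw [← trace_matRep, ← trace_matRep, trace_rep_inv]

theorem IrrRep.sum_mul_inv {ρ : G →* Module.End ℂ V} (h : IrrRep ρ) :
    ∑ g, LinearMap.trace ℂ V (ρ g) * LinearMap.trace ℂ V (ρ g⁻¹) = Fintype.card G := by
  have := h.nonempty
  simp only [← trace_matRep]
  exact h.isSchur.sum_trace_mul_inv

theorem IrrRep.sum_twist {ρ : G →* Module.End ℂ V} (h : IrrRep ρ)
    (b : LinearMap.BilinForm ℂ V) (hb : ∀ v, (∀ u, b u v = 0) → v = 0) {κ : G → G}
    (hκ : ∀ g u v, b (ρ g u) (ρ (κ g) v) = b u v) {ε : ℂ} (hε : ∀ u v, b u v = ε * b v u) :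
    ∑ g, LinearMap.trace ℂ V (ρ (g * κ g)) = ε * Fintype.card G := by
  have := h.nonempty
  let e := Module.finBasis ℂ V
  have hX : IsUnit (LinearMap.BilinForm.toMatrix e b) := by
    rw [← Matrix.mulVec_injective_iff_isUnit, ← Matrix.coe_mulVecLin, ← LinearMap.ker_eq_bot,
      LinearMap.ker_eq_bot']
    intro w hw
    have h1 : e.equivFun.symm w = 0 := by
      apply hb
      intro u
      rw [LinearMap.BilinForm.apply_eq_dotProduct_toMatrix_mulVec e b u (e.equivFun.symm w)]
      have h2 : (e.repr (e.equivFun.symm w) : _ → ℂ) = w := e.equivFun.apply_symm_apply w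
      rw [h2]
      have h3 : LinearMap.BilinForm.toMatrix e b *ᵥ w = 0 := hw
      rw [h3, dotProduct_zero]
    exact e.equivFun.symm.injective (h1.trans (_root_.map_zero _).symm)
  have h1 : ∀ g, LinearMap.BilinForm.toMatrix e b * matRep ρ (κ g) = (matRep ρ g⁻¹)ᵀ * LinearMap.BilinForm.toMatrix e b := by
    intro g
    rw [matRep_apply, matRep_apply, ← LinearMap.BilinForm.toMatrix_compRight,
      ← LinearMap.BilinForm.toMatrix_compLeft]
    congr 1
    ext u v
    show b u (ρ (κ g) v) = b (ρ g⁻¹ u) v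
    rw [← hκ g (ρ g⁻¹ u), rep_apply_inv]
  have h2 : (LinearMap.BilinForm.toMatrix e b)ᵀ = ε • LinearMap.BilinForm.toMatrix e b := by
    ext i j
    simp only [Matrix.transpose_apply, Matrix.smul_apply, LinearMap.BilinForm.toMatrix_apply, smul_eq_mul]
    exact hε _ _
  have := h.isSchur.sum_trace_twist hX h1 h2
  simpa only [trace_matRep] using this

end LinearRep

/-- Every operator has an adjoint of the same trace with respect to a nondegenerate form. -/
theorem exists_adjoint_trace {V : Type} [AddCommGroup V] [Module ℂ V] [FiniteDimensional ℂ V]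
    (b : LinearMap.BilinForm ℂ V) (hb : ∀ v, (∀ u, b u v = 0) → v = 0) (a : Module.End ℂ V) :
    ∃ a' : Module.End ℂ V, (∀ u v, b (a u) v = b u (a' v)) ∧
      LinearMap.trace ℂ V a' = LinearMap.trace ℂ V a := by
  have hinj : Function.Injective b.flip := by
    rw [← LinearMap.ker_eq_bot, LinearMap.ker_eq_bot']
    exact fun v hv => hb v fun u => LinearMap.congr_fun hv u
  let e : V ≃ₗ[ℂ] Module.Dual ℂ V :=
    LinearEquiv.ofInjectiveOfFinrankEq b.flip hinj Subspace.dual_finrank_eq.symm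
  have he : ∀ u v, e v u = b u v := fun u v => rfl
  refine ⟨e.symm.conj (Module.Dual.transpose (R := ℂ) a), fun u v => ?_, ?_⟩
  · rw [← he, ← he, LinearEquiv.conj_apply_apply, LinearEquiv.apply_symm_apply]
    rfl
  · rw [LinearMap.trace_conj', LinearMap.trace_transpose']

section Average

variable {G : Type} [Group G] [Fintype G] {V : Type} [AddCommGroup V] [Module ℂ V]

/-- Maschke: an invariant subspace is the range of an equivariant projection. -/
theorem InvSub.exists_proj {ρ : G →* Module.End ℂ V} {p : Submodule ℂ V} (h : InvSub ρ p) :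
    ∃ e : Module.End ℂ V, (∀ g, ρ g * e = e * ρ g) ∧ (∀ v, e v ∈ p) ∧ ∀ v ∈ p, e v = v := by
  obtain ⟨q, hq⟩ := p.exists_isCompl
  let π : Module.End ℂ V := p.subtype ∘ₗ p.projectionOnto q hq
  have hπ : ∀ v, π v ∈ p := fun v => (p.projectionOnto q hq v).2
  have hπ' : ∀ v ∈ p, π v = v := fun v hv =>
    congrArg Subtype.val (Submodule.projectionOnto_apply_left hq ⟨v, hv⟩)
  refine ⟨(Fintype.card G : ℂ)⁻¹ • ∑ g, ρ g * π * ρ g⁻¹, fun k => ?_, fun v => ?_, fun v hv => ?_⟩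
  · rw [mul_smul_comm, smul_mul_assoc, Finset.mul_sum, Finset.sum_mul]
    congr 1
    refine Fintype.sum_equiv (Equiv.mulLeft k) _ _ fun x => ?_
    simp only [Equiv.coe_mulLeft, _root_.mul_inv_rev, _root_.map_mul, mul_assoc]
    rw [← _root_.map_mul ρ k⁻¹ k, inv_mul_cancel, _root_.map_one, mul_one]
  · rw [LinearMap.smul_apply, LinearMap.sum_apply]
    exact p.smul_mem _ (p.sum_mem fun g _ => h g _ (hπ _))
  · rw [LinearMap.smul_apply, LinearMap.sum_apply]
    have : ∀ g, (ρ g * π * ρ g⁻¹) v = v := fun g => by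
      rw [Module.End.mul_apply, Module.End.mul_apply, hπ' _ (h g⁻¹ v hv), rep_apply_inv]
    simp only [this, Finset.sum_const, Finset.card_univ]
    rw [← Nat.cast_smul_eq_nsmul ℂ, smul_smul, inv_mul_cancel₀ (by simp), one_smul]

omit [Fintype G] in
theorem InvSub.trace_restr [FiniteDimensional ℂ V] {ρ : G →* Module.End ℂ V} {p : Submodule ℂ V} (h : InvSub ρ p)
    {e : Module.End ℂ V} (he : ∀ v, e v ∈ p) (he' : ∀ v ∈ p, e v = v) (g : G) :
    LinearMap.trace ℂ p (h.restr g) = LinearMap.trace ℂ V (ρ g * e) := by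
  let π : V →ₗ[ℂ] p := e.codRestrict p he
  have h1 : ρ g * e = (ρ g ∘ₗ p.subtype) ∘ₗ π := rfl
  rw [h1, LinearMap.trace_comp_comm']
  congr 1
  ext v
  exact (he' _ (h g _ v.2)).symm

end Average

section Lagrangian

variable {L : Type} [Group L] [Fintype L] {U : Type} [AddCommGroup U] [Module ℂ U]
  [FiniteDimensional ℂ U]

/-- If the twisted square-root counting function of `κ` is positive semidefinite, then no
irreducible representation carries a nondegenerate skew form invariant under `(id, κ)`. -/
theorem IrrRep.no_skew {κ : L → L} {ρ : L →* Module.End ℂ U} (h : IrrRep ρ)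
    (hN : IsPSD fun h : L => (Nat.card {l : L // l * κ l = h} : ℂ))
    (b : LinearMap.BilinForm ℂ U) (hb : ∀ v, (∀ u, b u v = 0) → v = 0)
    (hκ : ∀ g u v, b (ρ g u) (ρ (κ g) v) = b u v) (hs : ∀ u v, b u v = -b v u) : False := by
  have h1 := h.sum_twist b hb hκ (ε := -1) fun u v => by rw [hs, neg_one_mul]
  have h2 := (hN.mul (isPSD_trace_rep (matRep ρ))).sum_nonneg
  have h3 : ∑ h : L, (Nat.card {l : L // l * κ l = h} : ℂ) * (matRep ρ h).trace =
      ∑ l, LinearMap.trace ℂ U (ρ (l * κ l)) := by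
    rw [← Finset.sum_fiberwise Finset.univ (fun l => l * κ l)
      (fun l => LinearMap.trace ℂ U (ρ (l * κ l)))]
    refine Finset.sum_congr rfl fun h _ => ?_
    rw [Finset.sum_congr rfl (g := fun _ => (matRep ρ h).trace) fun l hl =>
      (congrArg (fun k => LinearMap.trace ℂ U (ρ k)) (Finset.mem_filter.1 hl).2).trans
        (trace_matRep ρ h).symm, Finset.sum_const, nsmul_eq_mul,
      Nat.card_eq_fintype_card, Fintype.card_subtype]
  rw [h3, h1] at h2
  have h4 : (0 : ℝ) < Fintype.card L := by exact_mod_cast Fintype.card_pos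
  simp at h2

/-- A representation with a skew form invariant under `(id, κ)` is hyperbolic. -/
theorem exists_lagrangian_char {κ : L →* L} (hκκ : ∀ l, κ (κ l) = l) (ρ : L →* Module.End ℂ U)
    (hN : IsPSD fun h : L => (Nat.card {l : L // l * κ l = h} : ℂ))
    (b : LinearMap.BilinForm ℂ U) (hb : ∀ v, (∀ u, b u v = 0) → v = 0)
    (hκ : ∀ g u v, b (ρ g u) (ρ (κ g) v) = b u v) (hs : ∀ u v, b u v = -b v u) :
    ∃ (m : ℕ) (β : L →* Matrix (Fin m) (Fin m) ℂ), ∀ l,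
      LinearMap.trace ℂ U (ρ l) = (β l).trace + (β (κ l⁻¹)).trace := by
  obtain ⟨S, ⟨hS, hSi⟩, hmax⟩ := wellFounded_gt.has_min
    {S : Submodule ℂ U | InvSub ρ S ∧ ∀ u ∈ S, ∀ v ∈ S, b u v = 0}
    ⟨⊥, fun g v hv => by rw [(Submodule.mem_bot ℂ).1 hv]; simp, fun u hu v _ => by
      rw [(Submodule.mem_bot ℂ).1 hu]; simp⟩
  obtain ⟨e, hcomm, he, he'⟩ := hS.exists_proj
  have hadj : ∀ g u v, b (ρ (κ g⁻¹) u) v = b u (ρ g v) := fun g u v => by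
    rw [← hκ (κ g⁻¹) u, hκκ, rep_inv_apply]
  have hperp : ∀ v, (∀ u ∈ S, b u v = 0) → v ∈ S := by
    by_contra hcon
    push Not at hcon
    obtain ⟨v, hv, hvS⟩ := hcon
    let K : Submodule ℂ U :=
      { carrier := {w | (∀ u ∈ S, b u w = 0) ∧ e w = 0}
        add_mem' := fun {x y} hx hy => ⟨fun u hu => by
          rw [_root_.map_add, hx.1 u hu, hy.1 u hu, add_zero], by
          rw [_root_.map_add, hx.2, hy.2, add_zero]⟩
        zero_mem' := ⟨fun u _ => _root_.map_zero _, _root_.map_zero _⟩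
        smul_mem' := fun c x hx => ⟨fun u hu => by
          rw [_root_.map_smul, hx.1 u hu, smul_zero], by rw [_root_.map_smul, hx.2, smul_zero]⟩ }
    have hK : InvSub ρ K := fun g w hw => ⟨fun u hu => by
      rw [← hadj]; exact hw.1 _ (hS _ _ hu), by
      rw [← Module.End.mul_apply, ← hcomm, Module.End.mul_apply, hw.2, _root_.map_zero]⟩
    have hK0 : K ≠ ⊥ := fun h => by
      have h1 : v - e v ∈ K := ⟨fun u hu => by
        rw [_root_.map_sub, hv u hu, hSi u hu _ (he v), sub_zero], by
        rw [_root_.map_sub, he' _ (he v), sub_self]⟩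
      rw [h, Submodule.mem_bot, sub_eq_zero] at h1
      exact hvS (h1 ▸ he v)
    obtain ⟨t, htK, ht, ht0, hirr⟩ := hK.exists_irr_le hK0
    let R : Submodule ℂ t :=
      { carrier := {w | ∀ u : t, b u w = 0}
        add_mem' := fun {x y} hx hy u => by
          rw [Submodule.coe_add, _root_.map_add, hx u, hy u, add_zero]
        zero_mem' := fun u => _root_.map_zero _
        smul_mem' := fun c x hx u => by
          rw [Submodule.coe_smul, _root_.map_smul, hx u, smul_zero] }
    have hR : InvSub ht.restr R := fun g w hw u => by
      rw [ht.restr_coe, ← hadj]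
      exact hw (ht.restr _ u)
    rcases hirr.2 R hR with h0 | h0
    · exact hirr.no_skew hN (b.restrict t) (fun v hv => by
        have : v ∈ R := hv
        rwa [h0, Submodule.mem_bot] at this) (fun g u v => hκ g u v) fun u v => hs u v
    · have htiso : ∀ u ∈ t, ∀ w ∈ t, b u w = 0 := fun u hu w hw =>
        (show (⟨w, hw⟩ : t) ∈ R from h0 ▸ Submodule.mem_top) ⟨u, hu⟩
      refine hmax (S ⊔ t) ⟨hS.sup ht, fun u hu w hw => ?_⟩ ?_
      · obtain ⟨u₁, hu₁, u₂, hu₂, rfl⟩ := Submodule.mem_sup.1 hu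
        obtain ⟨w₁, hw₁, w₂, hw₂, rfl⟩ := Submodule.mem_sup.1 hw
        rw [_root_.map_add b, LinearMap.add_apply, _root_.map_add, _root_.map_add, hSi _ hu₁ _ hw₁,
          (htK hw₂).1 _ hu₁, htiso _ hu₂ _ hw₂, hs u₂, (htK hu₂).1 _ hw₁]
        simp
      · refine lt_of_le_of_ne le_sup_left fun h => ht0 ?_
        rw [eq_bot_iff]
        intro w hw
        have h1 : w ∈ S := h ▸ Submodule.mem_sup_right hw
        rw [Submodule.mem_bot, ← he' w h1, (htK hw).2]
  obtain ⟨p, hp, -⟩ := exists_adjoint_trace b hb e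
  have hext : ∀ v w, (∀ u, b u v = b u w) → v = w := fun v w h => by
    rw [← sub_eq_zero]
    exact hb _ fun u => by rw [_root_.map_sub, h, sub_self]
  have hpcomm : ∀ g, ρ g * p = p * ρ g := fun g => by
    ext v
    refine hext _ _ fun u => ?_
    rw [Module.End.mul_apply, ← hadj, ← hp, Module.End.mul_apply, ← hp, ← hadj,
      ← Module.End.mul_apply, ← Module.End.mul_apply, hcomm]
  have hpe : p * e = 0 := by
    ext v
    refine hext _ _ fun u => ?_
    rw [Module.End.mul_apply, ← hp, hSi _ (he u) _ (he v)]
    simp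
  have hpp : p * p = p := by
    ext v
    refine hext _ _ fun u => ?_
    rw [Module.End.mul_apply, ← hp, ← hp, he' _ (he u), hp]
  have hker : ∀ v, p v = 0 → e v = v := fun v hv => by
    refine he' v (hperp v fun u hu => ?_)
    rw [← he' u hu, hp, hv, _root_.map_zero]
  have hep : (1 - e) * (1 - p) = 0 := by
    ext v
    have h1 : p ((1 - p) v) = 0 := by
      rw [← Module.End.mul_apply, mul_sub, mul_one, hpp, sub_self]; rfl
    rw [Module.End.mul_apply, LinearMap.sub_apply, hker _ h1]
    simp
  have htr : ∀ g, LinearMap.trace ℂ U (ρ g * p) = LinearMap.trace ℂ U (ρ g * (1 - e)) := by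
    intro g
    have h1 : p * (1 - e) = p := by rw [mul_sub, hpe, mul_one, sub_zero]
    have h2 : (1 - e) * p = 1 - e := by
      have := hep
      rw [mul_sub, mul_one, sub_eq_zero] at this
      exact this.symm
    rw [← h1, ← mul_assoc, LinearMap.trace_mul_comm, ← mul_assoc, sub_mul, one_mul, ← hcomm,
      ← mul_one_sub, mul_assoc, h2]
  refine ⟨_, matRep hS.restr, fun g => ?_⟩
  rw [trace_matRep, trace_matRep, hS.trace_restr he he', hS.trace_restr he he']
  have h1 : LinearMap.trace ℂ U (ρ (κ g⁻¹) * e) = LinearMap.trace ℂ U (ρ g * p) := by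
    obtain ⟨a, ha, hat⟩ := exists_adjoint_trace b hb (ρ (κ g⁻¹) * e)
    rw [← hat]
    congr 1
    ext v
    refine hext _ _ fun u => ?_
    rw [← ha, Module.End.mul_apply, hadj, hp, hpcomm]
    rfl
  rw [h1, htr, ← _root_.map_add, ← mul_add, add_sub_cancel, mul_one]

end Lagrangian

/-- The complex numbers that are algebraic integers up to an odd denominator. -/
def oddInt : Subring ℂ where
  carrier := {x | ∃ m : ℕ, Odd m ∧ IsIntegral ℤ ((m : ℂ) * x)}
  mul_mem' := by
    rintro x y ⟨m, hm, hx⟩ ⟨k, hk, hy⟩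
    refine ⟨m * k, hm.mul hk, ?_⟩
    rw [show ((m * k : ℕ) : ℂ) * (x * y) = (m * x) * (k * y) by push_cast; ring]
    exact hx.mul hy
  one_mem' := ⟨1, odd_one, by simpa using isIntegral_one⟩
  add_mem' := by
    rintro x y ⟨m, hm, hx⟩ ⟨k, hk, hy⟩
    refine ⟨m * k, hm.mul hk, ?_⟩
    rw [show ((m * k : ℕ) : ℂ) * (x + y) = (k : ℂ) * (m * x) + (m : ℂ) * (k * y) by
      push_cast; ring]
    exact ((isIntegral_algebraMap (R := ℤ) (A := ℂ) (x := (k : ℤ))).mul hx).add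
      ((isIntegral_algebraMap (R := ℤ) (A := ℂ) (x := (m : ℤ))).mul hy)
  zero_mem' := ⟨1, odd_one, by simpa using isIntegral_zero⟩
  neg_mem' := by
    rintro x ⟨m, hm, hx⟩
    exact ⟨m, hm, by rw [mul_neg]; exact hx.neg⟩

theorem oddInt_of_integral {x : ℂ} (h : IsIntegral ℤ x) : x ∈ oddInt :=
  ⟨1, odd_one, by simpa using h⟩

theorem oddInt_inv {m : ℕ} (h : Odd m) : (m : ℂ)⁻¹ ∈ oddInt :=
  ⟨m, h, by
    rw [mul_inv_cancel₀ (Nat.cast_ne_zero.2 fun h0 => by simp [h0] at h)]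
    exact isIntegral_one⟩

theorem two_mul_oddInt_ne_one {x : ℂ} (h : x ∈ oddInt) : 2 * x ≠ 1 := by
  intro hx
  obtain ⟨m, hm, hi⟩ := h
  have h1 : (m : ℂ) * x = algebraMap ℚ ℂ ((m : ℚ) / 2) := by
    have : x = 1 / 2 := by rw [eq_div_iff two_ne_zero, mul_comm]; exact hx
    rw [this]; simp; ring
  rw [h1, isIntegral_algebraMap_iff (algebraMap ℚ ℂ).injective] at hi
  obtain ⟨z, hz⟩ := IsIntegrallyClosed.isIntegral_iff.1 hi
  have h2 : (2 * z : ℚ) = m := by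
    rw [show (z : ℚ) = algebraMap ℤ ℚ z from rfl, hz]; ring
  have h3 : 2 * z = m := by exact_mod_cast h2
  obtain ⟨k, hk⟩ := hm
  omega

theorem isIntegral_trace_of_pow {ι : Type} [Fintype ι] [DecidableEq ι] {T : Matrix ι ι ℂ} {m : ℕ}
    (hm : 0 < m) (hT : T ^ (m + 1) = T) : IsIntegral ℤ T.trace := by
  rw [Matrix.trace_eq_sum_roots_charpoly]
  refine IsIntegral.multiset_sum fun c hc => ?_
  have h1 : Module.End.HasEigenvalue (Matrix.toLin' T) c := by
    rw [Module.End.hasEigenvalue_iff_isRoot_charpoly, Matrix.charpoly_toLin']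
    exact (Polynomial.mem_roots'.1 hc).2
  obtain ⟨v, hv⟩ := h1.exists_hasEigenvector
  have h2 : c ^ (m + 1) • v = c • v := by
    rw [← hv.pow_apply, ← hv.apply_eq_smul, ← Matrix.toLin'_pow, hT]
  have h3 : c ^ (m + 1) = c := smul_left_injective ℂ hv.2 h2
  refine ⟨Polynomial.X ^ (m + 1) - Polynomial.X, ?_, by simp [h3]⟩
  exact Polynomial.monic_X_pow_sub (by rw [Polynomial.degree_X]; exact_mod_cast Nat.succ_lt_succ hm)

/-- A function on a group is a character if it is the trace of a matrix representation. -/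
def IsChar {K : Type} [Group K] (φ : K → ℂ) : Prop :=
  ∃ (ι : Type) (_ : Fintype ι) (_ : DecidableEq ι) (ρ : K →* Matrix ι ι ℂ), ∀ k, φ k = (ρ k).trace

namespace IsChar

variable {K K' : Type} [Group K] [Group K']

theorem comp {φ : K → ℂ} (h : IsChar φ) (j : K' →* K) : IsChar fun k => φ (j k) := by
  obtain ⟨ι, _, _, ρ, hρ⟩ := h
  exact ⟨ι, inferInstance, inferInstance, ρ.comp j, fun k => hρ _⟩

theorem conj_eq {φ : K → ℂ} (h : IsChar φ) (a k : K) : φ (a * k * a⁻¹) = φ k := by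
  obtain ⟨ι, _, _, ρ, hρ⟩ := h
  rw [hρ, hρ, _root_.map_mul, Matrix.trace_mul_comm, ← _root_.map_mul]
  simp

theorem inv {φ : K → ℂ} (h : IsChar φ) : IsChar fun k => φ k⁻¹ := by
  obtain ⟨ι, _, _, ρ, hρ⟩ := h
  refine ⟨ι, inferInstance, inferInstance,
    { toFun := fun k => (ρ k⁻¹)ᵀ, map_one' := by simp, map_mul' := fun a b => by simp }, fun k => ?_⟩
  exact (hρ _).trans (Matrix.trace_transpose _).symm

theorem add {φ φ' : K → ℂ} (h : IsChar φ) (h' : IsChar φ') : IsChar fun k => φ k + φ' k := by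
  obtain ⟨ι, _, _, ρ, hρ⟩ := h
  obtain ⟨ι', _, _, ρ', hρ'⟩ := h'
  refine ⟨ι ⊕ ι', inferInstance, inferInstance,
    { toFun := fun k => Matrix.fromBlocks (ρ k) 0 0 (ρ' k)
      map_one' := by simp
      map_mul' := fun a b => by simp [Matrix.fromBlocks_multiply] }, fun k => ?_⟩
  simp [Matrix.trace, Fintype.sum_sum_type, hρ, hρ']

theorem mul {φ φ' : K → ℂ} (h : IsChar φ) (h' : IsChar φ') : IsChar fun k => φ k * φ' k := by
  obtain ⟨ι, _, _, ρ, hρ⟩ := h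
  obtain ⟨ι', _, _, ρ', hρ'⟩ := h'
  refine ⟨ι × ι', inferInstance, inferInstance,
    { toFun := fun k => Matrix.kronecker (ρ k) (ρ' k)
      map_one' := by simp
      map_mul' := fun a b => by simp [Matrix.mul_kronecker_mul] }, fun k => ?_⟩
  simp [Matrix.trace_kronecker, hρ, hρ']

theorem one : IsChar fun _ : K => (1 : ℂ) :=
  ⟨Unit, inferInstance, inferInstance, 1, fun k => by simp⟩

theorem pow {φ : K → ℂ} (h : IsChar φ) (n : ℕ) : IsChar fun k => φ k ^ n := by
  induction n with
  | zero => simpa using one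
  | succ n ih => simpa only [pow_succ] using ih.mul h

theorem fixedPoints {X : Type} [Finite X] [MulAction K X] :
    IsChar fun k : K => (Nat.card {x : X // k • x = x} : ℂ) := by
  have := Fintype.ofFinite X
  refine ⟨X, inferInstance, inferInstance,
    { toFun := fun k => Matrix.of fun i j => if i = k • j then 1 else 0
      map_one' := by ext i j; simp [Matrix.one_apply]
      map_mul' := fun a b => by
        ext i j
        simp [Matrix.mul_apply, mul_smul] }, fun k => ?_⟩
  show (Nat.card {x : X // k • x = x} : ℂ) = Matrix.trace (Matrix.of fun i j => if i = k • j then 1 else 0)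
  rw [Nat.card_eq_fintype_card, Fintype.card_subtype, Finset.card_filter]
  simp [Matrix.trace, eq_comm]

/-- Averages of characters over a commuting finite group are algebraic integers. -/
theorem integral_avg {φ : K → ℂ} (h : IsChar φ) [Finite K] {Q : Type} [Group Q] [Fintype Q]
    (j : Q →* K) (s : K) (hs : ∀ q, s * j q = j q * s) :
    IsIntegral ℤ ((Fintype.card Q : ℂ)⁻¹ * ∑ q, φ (s * j q)) := by
  obtain ⟨ι, _, _, ρ, hρ⟩ := h
  let e : Matrix ι ι ℂ := (Fintype.card Q : ℂ)⁻¹ • ∑ q, ρ (j q)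
  have h1 : ∀ q, ρ (j q) * e = e := fun q => by
    rw [mul_smul_comm, Finset.mul_sum]
    congr 1
    exact Fintype.sum_equiv (Equiv.mulLeft q) _ _ fun x => by simp
  have he : e * e = e := by
    conv_lhs => enter [1]; rw [show e = (Fintype.card Q : ℂ)⁻¹ • ∑ q, ρ (j q) from rfl]
    rw [smul_mul_assoc, Finset.sum_mul]
    simp only [h1, Finset.sum_const, Finset.card_univ]
    rw [← Nat.cast_smul_eq_nsmul ℂ, smul_smul, inv_mul_cancel₀ (by simp), one_smul]
  have hc : ρ s * e = e * ρ s := by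
    rw [mul_smul_comm, smul_mul_assoc, Finset.mul_sum, Finset.sum_mul]
    simp only [← _root_.map_mul, hs]
  have h2 : (ρ s * e).trace = (Fintype.card Q : ℂ)⁻¹ * ∑ q, φ (s * j q) := by
    rw [mul_smul_comm, Finset.mul_sum, Matrix.trace_smul, Matrix.trace_sum, smul_eq_mul]
    simp only [← _root_.map_mul, hρ]
  rw [← h2]
  refine isIntegral_trace_of_pow (orderOf_pos s) ?_
  have h3 : Commute (ρ s) e := hc
  rw [h3.mul_pow, ← map_pow ρ, pow_succ s, pow_orderOf_eq_one, one_mul]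
  congr 1
  have : IsIdempotentElem e := he
  exact this.pow_succ_eq _

theorem integral {φ : K → ℂ} (h : IsChar φ) [Finite K] (k : K) : IsIntegral ℤ (φ k) := by
  have := h.integral_avg (Q := Unit) 1 k fun q => by simp
  simpa using this

end IsChar

section SylowCount

variable {C : Type} [Group C]

theorem mem_smul_sylow {a x : C} {Q : Sylow 2 C} : x ∈ a • Q ↔ a⁻¹ * x * a ∈ Q := by
  show x ∈ ((a • Q : Sylow 2 C) : Set C) ↔ _
  rw [Sylow.coe_smul, Set.mem_smul_set_iff_inv_smul_mem, ← _root_.map_inv, MulAut.smul_def,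
    MulAut.conj_apply, inv_inv]
  rfl

/-- The number of Sylow 2-subgroups normalized by an element. -/
def sylFix (c : C) : ℕ := Nat.card {Q : Sylow 2 C // c • Q = Q}

theorem sylFix_isChar [Finite C] : IsChar fun c : C => (sylFix c : ℂ) := IsChar.fixedPoints

theorem sylFix_mul_central {s : C} (hs : ∀ c, s * c = c * s) (c : C) :
    sylFix (s * c) = sylFix c := by
  have h : ∀ Q : Sylow 2 C, s • Q = Q := fun Q =>
    Sylow.smul_eq_iff_mem_normalizer.2 (Subgroup.mem_normalizer_iff.2 fun k => by
      rw [hs, mul_inv_cancel_right])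
  simp only [sylFix, mul_smul, h]

theorem sylFix_inv (c : C) : sylFix c⁻¹ = sylFix c :=
  Nat.card_congr (Equiv.subtypeEquivRight fun Q => by
    rw [inv_smul_eq_iff, eq_comm])

theorem sylFix_aut (κ : MulAut C) (c : C) : sylFix (κ c) = sylFix c := by
  have h : ∀ Q : Sylow 2 C, κ c • κ • Q = κ • c • Q := fun Q => by
    rw [Sylow.smul_def, Sylow.smul_def, smul_smul, smul_smul]
    congr 1
    ext x
    simp [MulAut.conj_apply]
  exact (Nat.card_congr ((MulAction.toPerm κ).subtypeEquiv fun Q => by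
    rw [MulAction.toPerm_apply, h, smul_left_cancel_iff])).symm

theorem smul_sylow_iff_mem {u : C} (hu : ∃ k, u ^ 2 ^ k = 1) (Q : Sylow 2 C) :
    u • Q = Q ↔ u ∈ Q := by
  obtain ⟨k, hk⟩ := hu
  have hp : IsPGroup 2 (Subgroup.zpowers u) := IsPGroup.of_card_dvd_pow (n := k) (by
    rw [Nat.card_zpowers]; exact orderOf_dvd_of_pow_eq_one hk)
  rw [Sylow.smul_eq_iff_mem_normalizer]
  have h := hp.inf_normalizer_sylow Q
  constructor
  · intro h1
    have : u ∈ Subgroup.zpowers u ⊓ Subgroup.normalizer (Q : Set C) := ⟨Subgroup.mem_zpowers u, h1⟩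
    exact (h ▸ this).2
  · exact fun h1 => Subgroup.le_normalizer h1

theorem sylFix_odd [Finite C] {u : C} (hu : ∃ k, u ^ 2 ^ k = 1) : Odd (sylFix u) := by
  obtain ⟨k, hk⟩ := hu
  have hp : IsPGroup 2 (Subgroup.zpowers u) := IsPGroup.of_card_dvd_pow (n := k) (by
    rw [Nat.card_zpowers]; exact orderOf_dvd_of_pow_eq_one hk)
  have h1 := hp.card_modEq_card_fixedPoints (Sylow 2 C)
  have h2 := card_sylow_modEq_one 2 C
  have h3 : Nat.card (MulAction.fixedPoints (Subgroup.zpowers u) (Sylow 2 C)) = sylFix u := by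
    refine Nat.card_congr (Equiv.subtypeEquivRight fun Q => ?_)
    constructor
    · exact fun h => h ⟨u, Subgroup.mem_zpowers u⟩
    · rintro h ⟨_, z, rfl⟩
      have : u ∈ MulAction.stabilizer C Q := h
      exact (MulAction.stabilizer C Q).zpow_mem this z
  rw [h3] at h1
  exact Nat.odd_iff.2 (h1.symm.trans h2)

theorem sylow_sum_eq [Fintype C] (P : Sylow 2 C) {φ : C → ℂ} (hφ : ∀ a c, φ (a * c * a⁻¹) = φ c) :
    ∑ u : C with (∃ k, u ^ 2 ^ k = 1), φ u * sylFix u =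
      Nat.card (Sylow 2 C) * ∑ u : (P : Subgroup C), φ u := by
  have := Fintype.ofFinite (Sylow 2 C)
  have h1 : ∀ u : C, (∃ k, u ^ 2 ^ k = 1) →
      φ u * sylFix u = ∑ Q : Sylow 2 C, if u ∈ Q then φ u else 0 := fun u hu => by
    rw [sylFix, Nat.card_eq_fintype_card, Fintype.card_subtype, ← Finset.sum_filter,
      Finset.sum_const, nsmul_eq_mul, mul_comm]
    simp only [smul_sylow_iff_mem hu]
  rw [Finset.sum_congr rfl fun u hu => h1 u (Finset.mem_filter.1 hu).2, Finset.sum_comm]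
  have h2 : ∀ Q : Sylow 2 C, (∑ u : C with (∃ k, u ^ 2 ^ k = 1), if u ∈ Q then φ u else 0) =
      ∑ u : (P : Subgroup C), φ u := by
    intro Q
    obtain ⟨a, ha⟩ := MulAction.exists_smul_eq C P Q
    rw [← Finset.sum_filter, Finset.filter_filter]
    have h3 : (Finset.univ.filter fun u : C => (∃ k, u ^ 2 ^ k = 1) ∧ u ∈ Q) =
        Finset.univ.filter fun u : C => u ∈ Q := by
      refine Finset.filter_congr fun u _ => ⟨fun h => h.2, fun h => ⟨?_, h⟩⟩
      obtain ⟨k, hk⟩ := Q.isPGroup' ⟨u, h⟩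
      exact ⟨k, congrArg Subtype.val hk⟩
    have hPQ : ∀ x, x ∈ Q ↔ a⁻¹ * x * a ∈ P := fun x => by rw [← ha, mem_smul_sylow]
    rw [h3, ← Finset.sum_subtype (Finset.univ.filter fun u : C => u ∈ P) (fun x => by simp; rfl) φ]
    refine Finset.sum_bij' (fun u _ => a⁻¹ * u * a) (fun u _ => a * u * a⁻¹) ?_ ?_ ?_ ?_ ?_
    · intro u hu
      simpa [hPQ] using hu
    · intro u hu
      simpa [hPQ, mul_assoc] using hu
    · intro u _; group
    · intro u _; group
    · intro u _
      have := hφ a⁻¹ u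
      rw [inv_inv] at this
      exact this.symm
  simp [h2]

theorem pow_two_pow_dvd {r : ℤ} (hr : Odd r) (N : ℕ) : (2 : ℤ) ^ (N + 1) ∣ r ^ 2 ^ N - 1 := by
  induction N with
  | zero => simpa using (hr.sub_odd odd_one).two_dvd
  | succ N ih =>
    have h : r ^ 2 ^ (N + 1) - 1 = (r ^ 2 ^ N - 1) * (r ^ 2 ^ N + 1) := by ring
    rw [h, pow_succ]
    exact mul_dvd_mul ih ((hr.pow).add_odd odd_one).two_dvd

theorem exists_conj_into_sylow [Finite C] (P : Sylow 2 C) {L : Subgroup C} (hPL : (P : Subgroup C) ≤ L)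
    (κ : MulAut C) (hκL : ∀ l ∈ L, κ l ∈ L) :
    ∃ l : L, ∀ p ∈ P, (l : C)⁻¹ * κ p * l ∈ P := by
  have h2 : ((κ • P : Sylow 2 C) : Subgroup C) ≤ L := by
    rintro _ ⟨p, hp, rfl⟩
    exact hκL _ (hPL hp)
  obtain ⟨l, hl⟩ := MulAction.exists_smul_eq L (P.subtype hPL) ((κ • P).subtype h2)
  refine ⟨l, fun p hp => ?_⟩
  have h3 : κ p ∈ (κ • P : Sylow 2 C) := ⟨p, hp, rfl⟩
  have h4 : (⟨κ p, h2 h3⟩ : L) ∈ (κ • P).subtype h2 := h3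
  rw [← hl, Sylow.smul_subtype] at h4
  have h5 : κ p ∈ (l : C) • P := h4
  exact mem_smul_sylow.1 h5

end SylowCount

/-- If a class function restricts to `f + f ∘ κ ∘ (·)⁻¹` on a subgroup containing a Sylow
2-subgroup, its sum over a 2-section is twice the group order, up to an odd-integral factor. -/
theorem exists_two_section_sum {C : Type} [Group C] [Fintype C] {s : C} (hs : ∀ c, s * c = c * s)
    (κ : MulAut C) (hκs : κ s = s⁻¹) (L : Subgroup C) (hsL : s ∈ L) (κL : L →* L)
    (hκL : ∀ l : L, ((κL l : L) : C) = κ l) (P : Sylow 2 C) (hPL : (P : Subgroup C) ≤ L)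
    {Φ : C → ℂ} (hΦ : ∀ a c, Φ (a * c * a⁻¹) = Φ c) (hΦo : ∀ c, Φ c ∈ oddInt)
    {f : L → ℂ} (hf : IsChar f) (hΦf : ∀ l : L, Φ l = f l + f (κL l⁻¹)) :
    ∃ x ∈ oddInt, ∑ u : C with (∃ k, u ^ 2 ^ k = 1), Φ (s * u) = Fintype.card C * (2 * x) := by
  have hφ : ∀ a c, Φ (s * (a * c * a⁻¹)) = Φ (s * c) := fun a c => by
    rw [← hΦ a (s * c)]
    congr 1
    rw [← mul_assoc, ← mul_assoc, hs a, mul_assoc a]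
  obtain ⟨N, hN⟩ := (IsPGroup.iff_card.1 P.isPGroup')
  set k := 2 ^ N with hk
  have hk0 : k - 1 + 1 = k := Nat.sub_add_cancel Nat.one_le_two_pow
  obtain ⟨m, hm⟩ : ∃ m, Nat.card C = k * m := ⟨(P : Subgroup C).index, by
    rw [← hN, mul_comm, Subgroup.index_mul_card]⟩
  have hmodd : Odd m := by
    have h1 : (P : Subgroup C).index * k = Nat.card C := by rw [← hN, Subgroup.index_mul_card]
    have h2 : (P : Subgroup C).index = m :=
      Nat.eq_of_mul_eq_mul_right (Nat.two_pow_pos N) (by rw [h1, hm, mul_comm])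
    rw [← h2, ← Nat.not_even_iff_odd, even_iff_two_dvd]
    exact P.not_dvd_index
  have hr : ∀ u : C, (∃ k, u ^ 2 ^ k = 1) → ∃ z : ℤ, ((sylFix u : ℂ)) ^ k - 1 = k * 2 * z := by
    intro u hu
    obtain ⟨z, hz⟩ := pow_two_pow_dvd (r := (sylFix u : ℤ)) (by exact_mod_cast sylFix_odd hu) N
    refine ⟨z, ?_⟩
    rw [pow_succ] at hz
    rw [hk]
    exact_mod_cast congrArg (Int.cast : ℤ → ℂ) hz
  choose! z hz using hr
  let sL : L := ⟨s, hsL⟩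
  let j : (P : Subgroup C) →* L := Subgroup.inclusion hPL
  let h : L → ℂ := fun l => f l * (sylFix (l : C) : ℂ) ^ (k - 1)
  have hh : IsChar h := hf.mul ((sylFix_isChar.comp L.subtype).pow (k - 1))
  have hint := hh.integral_avg j sL fun q => Subtype.ext (hs _)
  obtain ⟨l₀, hl₀⟩ := exists_conj_into_sylow P hPL κ fun l hl => by
    rw [← hκL ⟨l, hl⟩]; exact (κL _).2
  let t : ↥(P : Subgroup C) → ↥(P : Subgroup C) := fun p =>
    ⟨(l₀ : C)⁻¹ * κ p⁻¹ * l₀, hl₀ _ (P.inv_mem p.2)⟩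
  have ht : Function.Bijective t := Finite.injective_iff_bijective.1 fun a b hab => by
    have := congrArg Subtype.val hab
    simpa [t] using this
  have hsum : ∑ p : (P : Subgroup C), h (κL (sL * j p)⁻¹) = ∑ p : (P : Subgroup C), h (sL * j p) := by
    refine Fintype.sum_bijective t ht (fun p => h (κL (sL * j p)⁻¹))
      (fun p => h (sL * j p)) fun p => ?_
    rw [← hh.conj_eq l₀⁻¹ (κL _)]
    congr 1
    apply Subtype.ext
    have h1 : ((κL (sL * j p)⁻¹ : L) : C) = κ (s * p)⁻¹ := hκL _
    have h2 : ((l₀⁻¹ * κL (sL * j p)⁻¹ * l₀⁻¹⁻¹ : L) : C) = (l₀ : C)⁻¹ * κ (s * p)⁻¹ * l₀ := by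
      rw [Subgroup.coe_mul, Subgroup.coe_mul, h1, inv_inv, Subgroup.coe_inv]
    rw [h2]
    show _ = s * ((l₀ : C)⁻¹ * κ (p : C)⁻¹ * l₀)
    have h3 : κ (s * p)⁻¹ = s * κ (p : C)⁻¹ := by
      rw [_root_.mul_inv_rev, _root_.map_mul, _root_.map_inv κ s, hκs, inv_inv, hs]
    rw [h3, ← mul_assoc, ← mul_assoc, ← mul_assoc, hs]
  have hP : ∑ u : (P : Subgroup C), Φ (s * u) * (sylFix (u : C) : ℂ) ^ (k - 1) =
      2 * ∑ p : (P : Subgroup C), h (sL * j p) := by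
    rw [two_mul]
    conv_rhs => arg 2; rw [← hsum]
    rw [← Finset.sum_add_distrib]
    refine Finset.sum_congr rfl fun p _ => ?_
    have h1 : Φ (s * p) = f (sL * j p) + f (κL (sL * j p)⁻¹) := hΦf (sL * j p)
    have h2 : sylFix ((sL * j p : L) : C) = sylFix (p : C) := sylFix_mul_central hs _
    have h3 : sylFix ((κL (sL * j p)⁻¹ : L) : C) = sylFix (p : C) := by
      rw [hκL, sylFix_aut, ← h2]
      exact sylFix_inv _
    simp only [h, h1, h2, h3]
    ring
  have hmain := sylow_sum_eq P (φ := fun u => Φ (s * u) * (sylFix u : ℂ) ^ (k - 1)) fun a c => by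
    show Φ (s * (a * c * a⁻¹)) * (sylFix (a * c * a⁻¹) : ℂ) ^ (k - 1) = _
    rw [hφ, sylFix_isChar.conj_eq]
  have hcard : (Fintype.card (P : Subgroup C) : ℂ) = k := by rw [← hN, Nat.card_eq_fintype_card]
  refine ⟨(m : ℂ)⁻¹ * (Nat.card (Sylow 2 C) * ((Fintype.card (P : Subgroup C) : ℂ)⁻¹ *
      ∑ p : (P : Subgroup C), h (sL * j p)) -
    ∑ u : C with (∃ k, u ^ 2 ^ k = 1), Φ (s * u) * z u), ?_, ?_⟩
  · refine oddInt.mul_mem (oddInt_inv hmodd) (oddInt.sub_mem (oddInt.mul_mem (natCast_mem _ _)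
      (oddInt_of_integral hint)) (oddInt.sum_mem fun u _ => oddInt.mul_mem (hΦo _)
      (intCast_mem _ _)))
  · have hm0 : (m : ℂ) ≠ 0 := Nat.cast_ne_zero.2 fun h0 => by simp [h0] at hmodd
    have hk1 : (k : ℂ) ≠ 0 := by rw [hk]; simp
    have hC : (Fintype.card C : ℂ) = k * m := by
      rw [← Nat.card_eq_fintype_card, hm]; push_cast; ring
    have h1 : ∑ u : C with (∃ k, u ^ 2 ^ k = 1), Φ (s * u) =
        ∑ u : C with (∃ k, u ^ 2 ^ k = 1), Φ (s * u) * (sylFix u : ℂ) ^ (k - 1) * sylFix u -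
        (k * 2) * ∑ u : C with (∃ k, u ^ 2 ^ k = 1), Φ (s * u) * z u := by
      rw [Finset.mul_sum, ← Finset.sum_sub_distrib]
      refine Finset.sum_congr rfl fun u hu => ?_
      have h2 := hz u (Finset.mem_filter.1 hu).2
      rw [mul_assoc, ← pow_succ, hk0]
      linear_combination (-Φ (s * u)) * h2
    rw [h1, hmain, hP, hC, hcard]
    field_simp

section Section

variable {G : Type} [Group G]

theorem card_conj_mul_card_centralizer [Finite G] (s : G) :
    Nat.card {t : G // IsConj s t} * Nat.card (Subgroup.centralizer {s}) = Nat.card G := by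
  rw [Subgroup.nat_card_centralizer_nat_card_stabilizer]
  have h1 := (MulAction.stabilizer (ConjAct G) s).card_mul_index
  rw [MulAction.index_stabilizer] at h1
  have h2 : (MulAction.orbit (ConjAct G) s).ncard = Nat.card {t : G // IsConj s t} := by
    rw [← Nat.card_coe_set_eq]
    exact Nat.card_congr (Equiv.subtypeEquivRight fun t => by
      rw [ConjAct.mem_orbit_conjAct, isConj_comm])
  rw [← h2, mul_comm, h1]
  rfl

theorem sum_class_eq [Fintype G] {T X : G → ℂ} (hT : ∀ s, T s = Nat.card (Subgroup.centralizer {s}) * (2 * X s))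
    (hX : ∀ s t, IsConj s t → X s = X t) (hXo : ∀ s, X s ∈ oddInt) :
    ∃ y ∈ oddInt, ∑ s, T s = Fintype.card G * (2 * y) := by
  have := Fintype.ofFinite (ConjClasses G)
  refine ⟨∑ c : ConjClasses G, X c.out, oddInt.sum_mem fun c _ => hXo _, ?_⟩
  rw [← Fintype.sum_fiberwise (fun s : G => ConjClasses.mk s) T, Finset.mul_sum, Finset.mul_sum]
  refine Finset.sum_congr rfl fun c _ => ?_
  have hc : ConjClasses.mk c.out = c := Quotient.out_eq c
  have h1 : ∀ i : {s : G // ConjClasses.mk s = c},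
      T i = Nat.card (Subgroup.centralizer {c.out}) * (2 * X c.out) := by
    rintro ⟨i, hi⟩
    have hi' : IsConj c.out i := by rw [← ConjClasses.mk_eq_mk_iff_isConj, hc, hi]
    have h2 := card_conj_mul_card_centralizer i
    have h3 := card_conj_mul_card_centralizer c.out
    have h4 : Nat.card {t : G // IsConj i t} = Nat.card {t : G // IsConj c.out t} :=
      Nat.card_congr (Equiv.subtypeEquivRight fun t =>
        ⟨fun h => hi'.trans h, fun h => hi'.symm.trans h⟩)
    rw [h4, ← h3] at h2
    have h5 : 0 < Nat.card {t : G // IsConj c.out t} := by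
      have : Nonempty {t : G // IsConj c.out t} := ⟨⟨_, IsConj.refl _⟩⟩
      exact Nat.card_pos
    show T i = _
    rw [hT, hX _ _ hi', Nat.eq_of_mul_eq_mul_left h5 h2]
  rw [Finset.sum_congr rfl fun i _ => h1 i, Finset.sum_const, nsmul_eq_mul, ← mul_assoc,
    ← Nat.cast_mul, Finset.card_univ]
  congr 2
  rw [← Nat.card_eq_fintype_card (α := G), ← card_conj_mul_card_centralizer c.out,
    ← Nat.card_eq_fintype_card]
  congr 1
  exact Nat.card_congr (Equiv.subtypeEquivRight fun t => by
    rw [← ConjClasses.mk_eq_mk_iff_isConj, hc, eq_comm])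

theorem exists_sum_of_two_sections [Fintype G] {Φ : G → ℂ} (hΦ : ∀ a c, Φ (a * c * a⁻¹) = Φ c)
    (hloc : ∀ s : G, Odd (orderOf s) → ∃ x ∈ oddInt,
      ∑ u : G with (u * s = s * u ∧ ∃ k, u ^ 2 ^ k = 1), Φ (s * u) =
        Nat.card (Subgroup.centralizer {s}) * (2 * x)) :
    ∃ y ∈ oddInt, ∑ g, Φ g = Fintype.card G * (2 * y) := by
  obtain ⟨N, m, hm, hG⟩ : ∃ N m, Odd m ∧ Nat.card G = 2 ^ N * m := by
    obtain ⟨N, m, h1, h2⟩ := Nat.exists_eq_pow_mul_and_not_dvd (Nat.card_pos (α := G)).ne' 2 (by simp)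
    exact ⟨N, m, by rwa [← Nat.not_even_iff_odd, even_iff_two_dvd], h2⟩
  obtain ⟨e, he1, he2⟩ := Nat.chineseRemainder
    (Nat.Coprime.pow_left N (Nat.coprime_two_left.2 hm)) 0 1
  have he2N : 2 ^ N ∣ e := (Nat.modEq_zero_iff_dvd).1 he1
  let T : G → ℂ := fun s => ∑ g : G with g ^ e = s, Φ g
  have hTsum : ∑ g, Φ g = ∑ s, T s := by
    rw [← Finset.sum_fiberwise Finset.univ (fun g : G => g ^ e)]
  have hTconj : ∀ s t, IsConj s t → T s = T t := by
    intro s t h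
    obtain ⟨a, rfl⟩ := isConj_iff.1 h
    refine Finset.sum_bij' (fun u _ => a * u * a⁻¹) (fun u _ => a⁻¹ * u * a) ?_ ?_ ?_ ?_ ?_
    · intro u hu
      simpa [conj_pow] using hu
    · intro u hu
      have h1 := (Finset.mem_filter.1 hu).2
      have h2 : (a⁻¹ * u * a) ^ e = a⁻¹ * u ^ e * a := by
        have := conj_pow (i := e) (a := a⁻¹) (b := u)
        rwa [inv_inv] at this
      simp only [Finset.mem_filter, Finset.mem_univ, true_and]
      rw [h2, h1]; group
    · intro u _; group
    · intro u _; group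
    · intro u _; exact (hΦ a u).symm
  have hx : ∀ s : G, ∃ x ∈ oddInt, T s = Nat.card (Subgroup.centralizer {s}) * (2 * x) := by
    intro s
    by_cases hs : s ^ m = 1
    · have hso : Odd (orderOf s) := hm.of_dvd_nat (orderOf_dvd_of_pow_eq_one hs)
      obtain ⟨x, hxo, hx⟩ := hloc s hso
      refine ⟨x, hxo, ?_⟩
      rw [← hx]
      have hse : s ^ e = s := by
        conv_rhs => rw [← pow_one s]
        exact pow_eq_pow_iff_modEq.2 (he2.of_dvd (orderOf_dvd_of_pow_eq_one hs))
      refine Finset.sum_bij' (fun g _ => s⁻¹ * g) (fun u _ => s * u) ?_ ?_ ?_ ?_ ?_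
      · intro g hg
        have hg : g ^ e = s := (Finset.mem_filter.1 hg).2
        have hc : Commute s g := by rw [← hg]; exact (Commute.refl g).pow_left e
        simp only [Finset.mem_filter, Finset.mem_univ, true_and]
        refine ⟨by rw [mul_assoc, ← hc.eq, inv_mul_cancel_left, mul_inv_cancel_left], N, ?_⟩
        rw [hc.inv_left.mul_pow, inv_pow, inv_mul_eq_one, ← hg, ← pow_mul, pow_eq_pow_iff_modEq]
        refine Nat.ModEq.of_dvd (n := m * 2 ^ N) ?_ ?_
        · rw [mul_comm, ← hG]; exact orderOf_dvd_natCard g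
        · have := he2.mul_right' (2 ^ N)
          rwa [one_mul] at this
      · intro u hu
        obtain ⟨hc, k, hk⟩ := (Finset.mem_filter.1 hu).2
        simp only [Finset.mem_filter, Finset.mem_univ, true_and]
        have hc' : Commute s u := hc.symm
        have h1 : orderOf u ∣ 2 ^ N := by
          obtain ⟨i, _, hi⟩ := (Nat.dvd_prime_pow Nat.prime_two).1 (orderOf_dvd_of_pow_eq_one hk)
          have h2 := orderOf_dvd_natCard u
          rw [hG] at h2
          refine Nat.Coprime.dvd_of_dvd_mul_right ?_ h2
          rw [hi]
          exact Nat.Coprime.pow_left _ (Nat.coprime_two_left.2 hm)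
        rw [hc'.mul_pow, hse, orderOf_dvd_iff_pow_eq_one.1 (h1.trans he2N), mul_one]
      · intro u _; group
      · intro u _; group
      · intro u _; simp
    · refine ⟨0, oddInt.zero_mem, ?_⟩
      rw [mul_zero, mul_zero]
      refine Finset.sum_eq_zero fun g hg => absurd ?_ hs
      rw [← (Finset.mem_filter.1 hg).2, ← pow_mul]
      refine orderOf_dvd_iff_pow_eq_one.1 ((orderOf_dvd_natCard g).trans ?_)
      rw [hG]
      exact Nat.mul_dvd_mul_right he2N m
  choose x hxo hx using hx
  rw [hTsum]
  refine sum_class_eq hx (fun s t h => ?_) hxo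
  have h1 := hTconj s t h
  rw [hx, hx] at h1
  have h2 := card_conj_mul_card_centralizer s
  have h3 := card_conj_mul_card_centralizer t
  have h4 : Nat.card {r : G // IsConj s r} = Nat.card {r : G // IsConj t r} :=
    Nat.card_congr (Equiv.subtypeEquivRight fun r =>
      ⟨fun h' => h.symm.trans h', fun h' => h.trans h'⟩)
  have h5 : 0 < Nat.card {r : G // IsConj t r} := by
    have : Nonempty {r : G // IsConj t r} := ⟨⟨_, IsConj.refl _⟩⟩
    exact Nat.card_pos
  rw [h4, ← h3] at h2
  rw [Nat.eq_of_mul_eq_mul_left h5 h2] at h1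
  exact mul_left_cancel₀ two_ne_zero
    (mul_left_cancel₀ (Nat.cast_ne_zero.2 Nat.card_pos.ne') h1)

end Section

section Parity

variable {U : Type} [AddCommGroup U] [Module ℂ U] [FiniteDimensional ℂ U]

theorem isChar_trace {K : Type} [Group K] (ρ : K →* Module.End ℂ U) :
    IsChar fun k => LinearMap.trace ℂ U (ρ k) :=
  ⟨_, inferInstance, inferInstance, matRep ρ, fun k => (trace_matRep ρ k).symm⟩

theorem exists_two_section_sum_rep {C : Type} [Group C] [Fintype C] {s : C}
    (hs : ∀ c, s * c = c * s) (κ : MulAut C) (hκκ : ∀ c, κ (κ c) = c) (hκs : κ s = s⁻¹)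
    (L : Subgroup C) (hsL : s ∈ L) (hκL : ∀ l ∈ L, κ l ∈ L)
    (P : Sylow 2 C) (hPL : (P : Subgroup C) ≤ L)
    (hN : IsPSD fun h : L => (Nat.card {l : L // (l : C) * κ l = h} : ℂ))
    (ρ : C →* Module.End ℂ U) (b : LinearMap.BilinForm ℂ U) (hb : ∀ v, (∀ u, b u v = 0) → v = 0)
    (hκ : ∀ g u v, b (ρ g u) (ρ (κ g) v) = b u v) (hskew : ∀ u v, b u v = -b v u) :
    ∃ x ∈ oddInt, ∑ u : C with (∃ k, u ^ 2 ^ k = 1), LinearMap.trace ℂ U (ρ (s * u)) *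
      LinearMap.trace ℂ U (ρ (s * u)⁻¹) = Fintype.card C * (2 * x) := by
  let κL : L →* L := (κ.toMonoidHom.comp L.subtype).codRestrict L fun l => hκL l l.2
  have hκL' : ∀ l : L, ((κL l : L) : C) = κ l := fun l => rfl
  have hκκL : ∀ l, κL (κL l) = l := fun l => Subtype.ext (hκκ l)
  have := Fintype.ofFinite L
  obtain ⟨m, β, hβ⟩ := exists_lagrangian_char (κ := κL) hκκL (ρ.comp L.subtype)
    (by
      have : ∀ l h : L, l * κL l = h ↔ (l : C) * κ l = h := fun l h => Subtype.ext_iff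
      simpa only [this] using hN) b hb (fun g => hκ g) hskew
  have hβc : IsChar fun l => (β l).trace := ⟨_, inferInstance, inferInstance, β, fun _ => rfl⟩
  have hf : IsChar fun l => (β l).trace * (β l⁻¹).trace + (β l).trace * (β (κL l)).trace :=
    (hβc.mul hβc.inv).add (hβc.mul (hβc.comp κL))
  have hχ := isChar_trace ρ
  refine exists_two_section_sum
    (Φ := fun c => LinearMap.trace ℂ U (ρ c) * LinearMap.trace ℂ U (ρ c⁻¹)) hs κ hκs L hsL κL hκL' P hPL
    (hχ.mul hχ.inv).conj_eq (fun c => oddInt_of_integral ((hχ.mul hχ.inv).integral c)) hf fun l => ?_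
  have h1 : LinearMap.trace ℂ U (ρ (l : C)) = _ := hβ l
  have h2 : LinearMap.trace ℂ U (ρ (l : C)⁻¹) = _ := hβ l⁻¹
  rw [h1, h2, inv_inv]
  simp only [_root_.map_inv, hκκL, inv_inv]
  ring

theorem IrrRep.false_of_twisted_skew {G : Type} [Group G] [Fintype G] {ρ : G →* Module.End ℂ U}
    (hirr : IrrRep ρ)
    (hloc : ∀ s : G, Odd (orderOf s) → ∃ (κ : MulAut (Subgroup.centralizer {s}))
      (L : Subgroup (Subgroup.centralizer {s})) (P : Sylow 2 (Subgroup.centralizer {s}))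
      (s' : Subgroup.centralizer {s}) (b : LinearMap.BilinForm ℂ U), (s' : G) = s ∧
      (∀ c, κ (κ c) = c) ∧ κ s' = s'⁻¹ ∧ s' ∈ L ∧ (∀ l ∈ L, κ l ∈ L) ∧ (P : Subgroup _) ≤ L ∧
      IsPSD (fun h : L => (Nat.card {l : L // (l : Subgroup.centralizer {s}) * κ l = h} : ℂ)) ∧
      (∀ v, (∀ u, b u v = 0) → v = 0) ∧
      (∀ (g : Subgroup.centralizer {s}) u v, b (ρ g u) (ρ (κ g) v) = b u v) ∧
      ∀ u v, b u v = -b v u) : False := by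
  have hχ := isChar_trace ρ
  obtain ⟨y, hyo, hy⟩ := exists_sum_of_two_sections
    (Φ := fun c => LinearMap.trace ℂ U (ρ c) * LinearMap.trace ℂ U (ρ c⁻¹))
    (hχ.mul hχ.inv).conj_eq fun s hs => by
      obtain ⟨κ, L, P, s', b, hs', hκκ, hκs, hsL, hκL, hPL, hN, hb, hκ, hskew⟩ := hloc s hs
      have := Fintype.ofFinite (Subgroup.centralizer {s})
      obtain ⟨x, hxo, hx⟩ := exists_two_section_sum_rep (s := s') (fun c => Subtype.ext (by
        show (s' : G) * c = c * s'
        rw [hs', Subgroup.mem_centralizer_singleton_iff.1 c.2])) κ hκκ hκs L hsL hκL P hPL hN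
        (ρ.comp (Subgroup.centralizer {s}).subtype) b hb hκ hskew
      refine ⟨x, hxo, ?_⟩
      rw [Nat.card_eq_fintype_card, ← hx]
      refine Finset.sum_bij'
        (fun u hu => (⟨u, Subgroup.mem_centralizer_singleton_iff.2 (Finset.mem_filter.1 hu).2.1⟩ :
          Subgroup.centralizer {s})) (fun u _ => (u : G)) ?_ ?_ ?_ ?_ ?_
      · intro u hu
        obtain ⟨-, -, k, hk⟩ := Finset.mem_filter.1 hu
        exact Finset.mem_filter.2 ⟨Finset.mem_univ _, k, Subtype.ext hk⟩
      · intro u hu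
        obtain ⟨-, k, hk⟩ := Finset.mem_filter.1 hu
        exact Finset.mem_filter.2 ⟨Finset.mem_univ _, Subgroup.mem_centralizer_singleton_iff.1 u.2,
          k, congrArg Subtype.val hk⟩
      · intro u _; rfl
      · intro u _; rfl
      · intro u _
        show _ = LinearMap.trace ℂ U (ρ ((s' : G) * u)) * LinearMap.trace ℂ U (ρ ((s' : G) * u)⁻¹)
        rw [hs']
  have h1 : ∑ g, LinearMap.trace ℂ U (ρ g) * LinearMap.trace ℂ U (ρ g⁻¹) = Fintype.card G :=
    hirr.sum_mul_inv
  rw [h1] at hy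
  refine two_mul_oddInt_ne_one hyo ?_
  have h2 : (Fintype.card G : ℂ) ≠ 0 := Nat.cast_ne_zero.2 Fintype.card_ne_zero
  exact mul_left_cancel₀ h2 (by rw [← hy, mul_one])

end Parity

section InvariantForm

variable {G : Type} [Group G] {V : Type} [AddCommGroup V] [Module ℂ V]

theorem IrrRep.nondeg_of_ne_zero {ρ : G →* Module.End ℂ V} (h : IrrRep ρ)
    {b : LinearMap.BilinForm ℂ V} (hb : b ≠ 0) (hinv : ∀ g u v, b (ρ g u) (ρ g v) = b u v) :
    ∀ v, (∀ u, b u v = 0) → v = 0 := by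
  let p : Submodule ℂ V := LinearMap.ker b.flip
  have hp : ∀ v, v ∈ p ↔ ∀ u, b u v = 0 := fun v => by
    rw [LinearMap.mem_ker, LinearMap.ext_iff]; rfl
  have hi : InvSub ρ p := fun g v hv => by
    rw [hp] at hv ⊢
    intro u
    rw [← rep_apply_inv ρ g u, hinv, hv]
  rcases h.2 p hi with h0 | h0
  · intro v hv
    have : v ∈ p := (hp v).2 hv
    rwa [h0, Submodule.mem_bot] at this
  · refine absurd ?_ hb
    ext u v
    exact (hp v).1 (h0 ▸ Submodule.mem_top) u

variable [FiniteDimensional ℂ V] [Fintype G]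

theorem IrrRep.exists_inv_form {ρ : G →* Module.End ℂ V} (h : IrrRep ρ)
    (hreal : ∀ g, LinearMap.trace ℂ V (ρ g⁻¹) = LinearMap.trace ℂ V (ρ g)) :
    ∃ b : LinearMap.BilinForm ℂ V, b ≠ 0 ∧ ∀ g u v, b (ρ g u) (ρ g v) = b u v := by
  by_contra hno
  push Not at hno
  let avg (f f' : V →ₗ[ℂ] ℂ) : LinearMap.BilinForm ℂ V :=
    ∑ g, LinearMap.BilinForm.linMulLin (f.comp (ρ g)) (f'.comp (ρ g))
  have hap : ∀ f f' u v, avg f f' u v = ∑ g, f (ρ g u) * f' (ρ g v) := fun f f' u v => by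
    simp [avg, LinearMap.sum_apply]
  have havg : ∀ f f', avg f f' = 0 := by
    intro f f'
    by_contra h0
    obtain ⟨g, u, v, hg⟩ := hno _ h0
    refine hg ?_
    rw [hap, hap]
    refine Fintype.sum_equiv (Equiv.mulRight g) _ _ fun x => ?_
    simp
  let e := Module.finBasis ℂ V
  have htr : ∀ g, LinearMap.trace ℂ V (ρ g) = ∑ i, e.coord i (ρ g (e i)) := fun g => by
    rw [LinearMap.trace_eq_matrix_trace ℂ e]
    simp [Matrix.trace, LinearMap.toMatrix_apply]
  have h1 := h.sum_mul_inv
  simp only [hreal, htr, Finset.sum_mul_sum] at h1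
  rw [Finset.sum_comm] at h1
  have h2 : ∀ i, ∑ g, ∑ j, e.coord i (ρ g (e i)) * e.coord j (ρ g (e j)) = 0 := fun i => by
    rw [Finset.sum_comm]
    refine Finset.sum_eq_zero fun j _ => ?_
    rw [← hap, havg]; rfl
  rw [Finset.sum_eq_zero fun i _ => h2 i] at h1
  exact Fintype.card_ne_zero (α := G) (by exact_mod_cast h1.symm)

theorem IrrRep.exists_form {ρ : G →* Module.End ℂ V} (h : IrrRep ρ)
    (hreal : ∀ g, LinearMap.trace ℂ V (ρ g⁻¹) = LinearMap.trace ℂ V (ρ g)) :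
    ∃ b : LinearMap.BilinForm ℂ V, (∀ v, (∀ u, b u v = 0) → v = 0) ∧
      (∀ g u v, b (ρ g u) (ρ g v) = b u v) ∧
      ((∀ u v, b u v = b v u) ∨ ∀ u v, b u v = -b v u) := by
  obtain ⟨b, hb, hinv⟩ := h.exists_inv_form hreal
  by_cases hs : b + b.flip = 0
  · refine ⟨b, h.nondeg_of_ne_zero hb hinv, hinv, Or.inr fun u v => ?_⟩
    have := LinearMap.congr_fun (LinearMap.congr_fun hs u) v
    exact eq_neg_of_add_eq_zero_left this
  · have hinv' : ∀ g u v, (b + b.flip) (ρ g u) (ρ g v) = (b + b.flip) u v := fun g u v => by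
      show b _ _ + b _ _ = b _ _ + b _ _
      rw [hinv, hinv]
    exact ⟨b + b.flip, h.nondeg_of_ne_zero hs hinv', hinv', Or.inl fun u v => add_comm _ _⟩

end InvariantForm

section IndexTwo

variable {G H W : Type} [Group G] [Group H] [AddCommGroup W] [Module ℂ W]

/-- An involution in the nontrivial coset together with a stable subgroup of the centralizer of `s`
containing a Sylow 2-subgroup on which the twisted square-root counting function is positive. -/
def GoodInvolution (i : G →* H) (s : G) (y : H) : Prop :=
  ∃ (κ : MulAut (Subgroup.centralizer {s})) (L : Subgroup (Subgroup.centralizer {s}))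
    (P : Sylow 2 (Subgroup.centralizer {s})) (s' : Subgroup.centralizer {s}),
    (s' : G) = s ∧ (∀ c : Subgroup.centralizer {s}, y * i c * y = i (κ c)) ∧
    κ s' = s'⁻¹ ∧ s' ∈ L ∧ (∀ l ∈ L, κ l ∈ L) ∧ (P : Subgroup _) ≤ L ∧
    IsPSD (fun h : L => (Nat.card {l : L // (l : Subgroup.centralizer {s}) * κ l = h} : ℂ))

variable [FiniteDimensional ℂ W] [Fintype G] [Fintype H]

theorem IrrRep.false_of_skew {i : G →* H} (hi : Function.Injective i)
    (hindex : i.range.index = 2) {τ : H} (hτ : τ ∉ i.range) {z : G} (hz : τ * τ = i z) {κ : G → G}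
    (hκ : ∀ g, τ⁻¹ * i g * τ = i (κ g)) (hκc : ∀ g, IsConj (κ g) g⁻¹)
    (hloc : ∀ s : G, Odd (orderOf s) → ∃ x : G, (τ * i x) * (τ * i x) = 1 ∧
      GoodInvolution i s (τ * i x))
    {σ : H →* Module.End ℂ W} (h : IrrRep σ) (B : LinearMap.BilinForm ℂ W)
    (hB : ∀ v, (∀ u, B u v = 0) → v = 0) (hinv : ∀ g u v, B (σ g u) (σ g v) = B u v)
    (hskew : ∀ u v, B u v = -B v u) : False := by
  have hcov : ∀ a : H, a ∈ i.range ∨ ∃ g, a = τ * i g := fun a => by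
    by_cases ha : a ∈ i.range
    · exact Or.inl ha
    · right
      obtain ⟨g, hg⟩ := (Subgroup.mul_mem_iff_of_index_two hindex (a := τ⁻¹) (b := a)).2
        (iff_of_false (fun h' => hτ (by simpa using i.range.inv_mem h')) ha)
      exact ⟨g, by rw [hg, mul_inv_cancel_left]⟩
  have hκs : ∀ g, κ (z * κ g * z⁻¹) = g := fun g => hi (by
    rw [← hκ, _root_.map_mul, _root_.map_mul, _root_.map_inv, ← hz, ← hκ]; group)
  have hτg : ∀ g w, σ (i g) (σ τ w) = σ τ (σ (i (κ g)) w) := fun g w => by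
    rw [← Module.End.mul_apply, ← Module.End.mul_apply, ← _root_.map_mul, ← _root_.map_mul, ← hκ]
    congr 2; group
  let ρ : G →* Module.End ℂ W := σ.comp i
  have htop : InvSub ρ ⊤ := fun g v _ => Submodule.mem_top
  have := h.1
  obtain ⟨U, -, hU, hU0, hUirr⟩ := htop.exists_irr_le (top_ne_bot)
  by_cases hc : ∀ u ∈ U, ∀ v ∈ U, B u (σ τ v) = 0
  · let q : Submodule ℂ W := U ⊔ U.map (σ τ)
    have hq : InvSub σ q := by
      have hqτ : ∀ w ∈ q, σ τ w ∈ q := fun w hw => by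
        obtain ⟨a, ha, _, ⟨b, hb, rfl⟩, rfl⟩ := Submodule.mem_sup.1 hw
        rw [_root_.map_add]
        refine add_mem (Submodule.mem_sup_right ⟨a, ha, rfl⟩) (Submodule.mem_sup_left ?_)
        rw [← Module.End.mul_apply, ← _root_.map_mul, hz]
        exact hU z b hb
      have hqG : ∀ g, ∀ w ∈ q, σ (i g) w ∈ q := fun g w hw => by
        obtain ⟨a, ha, _, ⟨b, hb, rfl⟩, rfl⟩ := Submodule.mem_sup.1 hw
        rw [_root_.map_add, hτg]
        exact add_mem (Submodule.mem_sup_left (hU g a ha))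
          (Submodule.mem_sup_right ⟨_, hU (κ g) b hb, rfl⟩)
      intro a w hw
      obtain ⟨g, rfl⟩ | ⟨g, rfl⟩ := hcov a
      · exact hqG g w hw
      · rw [_root_.map_mul]
        exact hqτ _ (hqG g w hw)
    have hqtop : q = ⊤ := (h.2 q hq).resolve_left fun h0 =>
      hU0 (le_bot_iff.1 (h0 ▸ le_sup_left))
    have hBU : ∀ v ∈ U, (∀ u ∈ U, B u v = 0) → v = 0 := fun v hv h0 => hB v fun w => by
      obtain ⟨a, ha, _, ⟨b, hb, rfl⟩, rfl⟩ := Submodule.mem_sup.1 (hqtop ▸ Submodule.mem_top : w ∈ q)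
      rw [_root_.map_add, LinearMap.add_apply, h0 a ha, hskew, hc v hv b hb, neg_zero, add_zero]
    let χ : G → ℂ := fun g => LinearMap.trace ℂ U (hU.restr g)
    have hχc : ∀ g g', IsConj g g' → χ g = χ g' := fun g g' h' => by
      obtain ⟨a, rfl⟩ := isConj_iff.1 h'
      exact ((isChar_trace hU.restr).conj_eq a g).symm
    have hχ : ∀ g, χ g⁻¹ = χ g := fun g => by
      obtain ⟨a, ha, hat⟩ := exists_adjoint_trace (B.restrict U)
        (fun v hv => Subtype.ext (hBU v v.2 fun u hu => hv ⟨u, hu⟩)) (hU.restr g)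
      have h1 : a = hU.restr g⁻¹ := by
        ext v
        rw [← sub_eq_zero, ← AddSubgroupClass.coe_sub]
        refine hBU _ (a v - hU.restr g⁻¹ v).2 fun u hu => ?_
        have h2 : B (σ (i g) u) v = B u (a v) := ha ⟨u, hu⟩ v
        have h3 : B (σ (i g) u) v = B u (σ (i g)⁻¹ v) := by
          conv_lhs => rw [← rep_apply_inv σ (i g) (v : W), hinv]
        rw [AddSubgroupClass.coe_sub, _root_.map_sub, ← h2, h3, ← _root_.map_inv]
        exact sub_self _
      show LinearMap.trace ℂ U (hU.restr g⁻¹) = LinearMap.trace ℂ U (hU.restr g)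
      rw [← hat, h1]
    let E : U × U →ₗ[ℂ] W := LinearMap.coprod U.subtype ((σ τ).comp U.subtype)
    have hE : Function.Bijective E := by
      constructor
      · rw [← LinearMap.ker_eq_bot, LinearMap.ker_eq_bot']
        rintro ⟨u, v⟩ huv
        have h1 : (u : W) + σ τ v = 0 := huv
        have hu : (u : W) = 0 := hBU u u.2 fun w hw => by
          rw [eq_neg_of_add_eq_zero_left h1, _root_.map_neg, hc w hw v v.2, neg_zero]
        rw [hu, zero_add] at h1
        have hv : (v : W) = 0 := by
          rw [← rep_inv_apply σ τ v, h1, _root_.map_zero]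
        exact Prod.ext (Subtype.ext hu) (Subtype.ext hv)
      · intro w
        obtain ⟨a, ha, _, ⟨b, hb, rfl⟩, rfl⟩ :=
          Submodule.mem_sup.1 (hqtop ▸ Submodule.mem_top : w ∈ q)
        exact ⟨(⟨a, ha⟩, ⟨b, hb⟩), rfl⟩
    have htr : ∀ g, LinearMap.trace ℂ W (σ (i g)) = 2 * χ g := fun g => by
      have h1 : σ (i g) = (LinearEquiv.ofBijective E hE).conj
          ((hU.restr g).prodMap (hU.restr (κ g))) := by
        ext w
        obtain ⟨⟨u, v⟩, rfl⟩ := hE.2 w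
        rw [LinearEquiv.conj_apply_apply]
        have h2 : (LinearEquiv.ofBijective E hE).symm (E (u, v)) = (u, v) :=
          (LinearEquiv.ofBijective E hE).symm_apply_apply (u, v)
        rw [h2]
        show σ (i g) (u + σ τ v) = σ (i g) u + σ τ (σ (i (κ g)) v)
        rw [_root_.map_add, hτg]
      rw [h1, LinearMap.trace_conj', LinearMap.trace_prodMap', two_mul]
      congr 1
      show χ (κ g) = χ g
      rw [hχc _ _ (hκc g), hχ]
    have h4 : ∑ g : G, LinearMap.trace ℂ W (σ (i g)) * LinearMap.trace ℂ W (σ (i g)⁻¹) =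
        4 * Fintype.card G := by
      rw [← hUirr.sum_mul_inv, Finset.mul_sum]
      refine Finset.sum_congr rfl fun g _ => ?_
      rw [← _root_.map_inv, htr, htr]
      show 2 * χ g * (2 * χ g⁻¹) = 4 * (χ g * χ g⁻¹)
      ring
    have hf : ∀ a : H, (LinearMap.trace ℂ W (σ a) * LinearMap.trace ℂ W (σ a⁻¹)).re =
        Complex.normSq (LinearMap.trace ℂ W (σ a)) := fun a => by
      rw [trace_inv_rep, Complex.mul_conj, Complex.ofReal_re]
    have h5 := congrArg Complex.re h.sum_mul_inv
    have h6 := congrArg Complex.re h4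
    simp only [Complex.re_sum, hf] at h5 h6
    have h7 : ∑ g : G, Complex.normSq (LinearMap.trace ℂ W (σ (i g))) ≤
        ∑ a : H, Complex.normSq (LinearMap.trace ℂ W (σ a)) := by
      refine (Finset.sum_map Finset.univ ⟨i, hi⟩
        fun a => Complex.normSq (LinearMap.trace ℂ W (σ a))).symm.trans_le ?_
      exact Finset.sum_le_sum_of_subset_of_nonneg (Finset.subset_univ _) fun _ _ _ =>
        Complex.normSq_nonneg _
    have h8 : Fintype.card H = 2 * Fintype.card G := by
      rw [← Nat.card_eq_fintype_card, ← i.range.index_mul_card, hindex, ← Nat.card_eq_fintype_card]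
      congr 1
      exact Nat.card_congr (MonoidHom.ofInjective hi).symm.toEquiv
    have h9 : (4 * Fintype.card G : ℂ).re = 4 * (Fintype.card G : ℝ) := by
      rw [← Complex.ofReal_natCast, ← Complex.ofReal_ofNat, ← Complex.ofReal_mul, Complex.ofReal_re]
    rw [h5, h6, h9, h8, Complex.natCast_re] at h7
    have h10 : (0 : ℝ) < Fintype.card G := Nat.cast_pos.2 Fintype.card_pos
    push_cast at h7
    linarith
  · push Not at hc
    let form (a : H) : LinearMap.BilinForm ℂ U :=
      LinearMap.compl₁₂ B U.subtype ((σ a).comp U.subtype)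
    have hform : ∀ a u v, form a u v = B u (σ a v) := fun a u v => rfl
    have hgood : ∀ v, (∀ u, form τ u v = 0) → v = 0 := by
      have hp : InvSub hU.restr (LinearMap.ker (form τ).flip) := fun g v hv => by
        rw [LinearMap.mem_ker, LinearMap.ext_iff] at hv ⊢
        intro u
        obtain ⟨g, rfl⟩ : ∃ g', κ g' = g := ⟨_, hκs g⟩
        have h1 : B (hU.restr g⁻¹ u : U) (σ τ v) = 0 := hv (hU.restr g⁻¹ u)
        show B u (σ τ (σ (i (κ g)) v)) = 0
        rw [← hτg, ← h1, hU.restr_coe]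
        show _ = B (σ (i g⁻¹) u) (σ τ v)
        conv_rhs => rw [← hinv (i g), _root_.map_inv, rep_apply_inv]
      rcases hUirr.2 _ hp with h0 | h0
      · intro v hv
        have h1 : v ∈ LinearMap.ker (form τ).flip := by
          rw [LinearMap.mem_ker, LinearMap.ext_iff]; exact hv
        rwa [h0, Submodule.mem_bot] at h1
      · obtain ⟨u, hu, v, hv, huv⟩ := hc
        have h1 : (⟨v, hv⟩ : U) ∈ LinearMap.ker (form τ).flip := h0 ▸ Submodule.mem_top
        exact absurd (LinearMap.congr_fun (LinearMap.mem_ker.1 h1) ⟨u, hu⟩) huv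
    refine hUirr.false_of_twisted_skew fun s hs => ?_
    obtain ⟨x, hy, κ', L, P, s', hs', hκ', hκs', hsL, hκL, hPL, hN⟩ := hloc s hs
    obtain ⟨y, hydef⟩ : ∃ y, y = τ * i x := ⟨_, rfl⟩
    rw [← hydef] at hy hκ'
    have hyinv : y⁻¹ = y := inv_eq_of_mul_eq_one_left hy
    refine ⟨κ', L, P, s', form y, hs', fun c => ?_, hκs', hsL, hκL, hPL, hN, fun v hv => ?_, ?_, ?_⟩
    · refine Subtype.ext (hi ?_)
      rw [← hκ', ← hκ', ← mul_assoc, ← mul_assoc, hy, one_mul, mul_assoc, hy, mul_one]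
    · have h1 : hU.restr x v = 0 := hgood _ fun u => by
        rw [← hv u, hform, hform, hydef, _root_.map_mul]
        rfl
      rw [← rep_inv_apply hU.restr x v, h1, _root_.map_zero]
    · intro g u v
      show B (σ (i g) u) (σ y (σ (i (κ' g)) v)) = B u (σ y v)
      rw [← hκ', ← Module.End.mul_apply, ← _root_.map_mul,
        show y * (y * i g * y) = i g * y by rw [← mul_assoc, ← mul_assoc, hy, one_mul],
        _root_.map_mul, Module.End.mul_apply, hinv]
    · intro u v
      show B u (σ y v) = -B v (σ y u)
      rw [← hinv y, ← Module.End.mul_apply, ← _root_.map_mul, hy, _root_.map_one, hskew]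
      rfl

end IndexTwo

theorem FDRep.irrRep {H : Type} [Group H] (ψ : FDRep ℂ H) (hψ : Simple ψ) : IrrRep ψ.ρ := by
  constructor
  · by_contra hn
    rw [not_nontrivial_iff_subsingleton] at hn
    apply id_nonzero ψ
    apply Action.hom_ext
    ext v
    exact Subsingleton.elim _ _
  · intro p hp
    let j : FDRep.of hp.restr ⟶ ψ :=
      { hom := FGModuleCat.ofHom p.subtype
        comm := fun g => by ext v; rfl }
    have hj : ∀ v : p, j.hom.hom.hom v = v := fun v => rfl
    have hm : Mono j := ⟨fun {Z} a b hab => by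
      apply Action.hom_ext
      ext v
      have h1 := congrArg (fun f => f.hom.hom.hom v) hab
      exact h1⟩
    by_cases h0 : j = 0
    · left
      rw [Submodule.eq_bot_iff]
      intro v hv
      exact congrArg (fun f => f.hom.hom.hom (⟨v, hv⟩ : p)) h0
    · right
      have := (Simple.mono_isIso_iff_nonzero j).2 h0
      rw [eq_top_iff]
      intro v _
      have h1 : inv j ≫ j = 𝟙 ψ := IsIso.inv_hom_id j
      have h2 : j.hom.hom.hom ((inv j).hom.hom.hom v) = v :=
        congrArg (fun f => f.hom.hom.hom v) h1
      rw [← h2]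
      exact ((inv j).hom.hom.hom v : p).2

theorem IrrRep.fsIndicator_eq_one {H : Type} [Group H] [Fintype H] (ψ : FDRep ℂ H)
    (h : IrrRep ψ.ρ) (hreal : ∀ h : H, IsConj h h⁻¹)
    (hskew : ∀ B : LinearMap.BilinForm ℂ ψ, (∀ v, (∀ u, B u v = 0) → v = 0) →
      (∀ g u v, B (ψ.ρ g u) (ψ.ρ g v) = B u v) → (∀ u v, B u v = -B v u) → False) :
    fsIndicator H ψ.character = 1 := by
  have hr : ∀ g, LinearMap.trace ℂ ψ (ψ.ρ g⁻¹) = LinearMap.trace ℂ ψ (ψ.ρ g) := fun g => by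
    obtain ⟨a, ha⟩ := isConj_iff.1 (hreal g)
    rw [← ha]
    exact FDRep.char_conj ψ g a
  obtain ⟨B, hB, hinv, hsymm | hs⟩ := h.exists_form hr
  · have h1 := h.sum_twist B hB (κ := id) hinv (ε := 1) fun u v => by rw [one_mul, hsymm]
    rw [one_mul] at h1
    rw [fsIndicator]
    have h2 : ∑ g, ψ.character (g * g) = Fintype.card H := h1
    rw [h2, inv_mul_cancel₀]
    exact Nat.cast_ne_zero.2 Fintype.card_ne_zero
  · exact (hskew B hB hinv hs).elim

section Extension

variable {F E G H : Type} [Field F] [Ring E] [Algebra F E] [Group G] [Group H]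

/-- An extension by an element `τ` acting on the similitude group as `g ↦ μ(g)⁻¹ g`. -/
structure SimExt (σ : AntiInv F E) (j : G →* Eˣ) (φ : G →* H) (τ : H) (κ : G → G) (z : G) :
    Prop where
  j_inj : Function.Injective j
  φ_inj : Function.Injective φ
  sim : ∀ g, ∃ c, σ.IsSim (j g) c
  surj : ∀ t c, σ.IsSim t c → ∃ g, j g = t
  κ_coe : ∀ g c, σ.IsSim (j g) c → (j (κ g) : E) = c⁻¹ • (j g : E)
  τ_conj : ∀ g, τ⁻¹ * φ g * τ = φ (κ g)
  z_coe : (j z : E) = -1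
  τ_sq : τ * τ = φ z

namespace SimExt

variable {σ : AntiInv F E} {j : G →* Eˣ} {φ : G →* H} {τ : H} {κ : G → G} {z : G}
  (S : SimExt σ j φ τ κ z)

include S

theorem ext_coe {a b : G} (h : (j a : E) = j b) : a = b := S.j_inj (Units.ext h)

theorem comm (g : G) : φ g * τ = τ * φ (κ g) := by rw [← S.τ_conj]; group

theorem y_sq {X : G} (hX : σ.IsSim (j X) (-1)) (hXX : j X * j X = 1) :
    (τ * φ X) * (τ * φ X) = 1 := by
  have h1 : z * κ X * X = 1 := S.ext_coe (by
    rw [_root_.map_mul, _root_.map_mul, Units.val_mul, Units.val_mul, S.z_coe, S.κ_coe X _ hX,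
      _root_.map_one, inv_neg_one, neg_one_smul, neg_one_mul, neg_neg, ← Units.val_mul, hXX])
  calc (τ * φ X) * (τ * φ X) = τ * (φ X * τ) * φ X := by group
    _ = (τ * τ) * φ (κ X) * φ X := by rw [S.comm]; group
    _ = 1 := by rw [S.τ_sq, ← _root_.map_mul, ← _root_.map_mul, h1, _root_.map_one]

theorem y_conj {X : G} (hX : σ.IsSim (j X) (-1)) (hXX : j X * j X = 1) (g : G) :
    (τ * φ X) * φ g * (τ * φ X) = φ (X * κ g * X) := by
  have hXX' : X * X = 1 := S.j_inj (by rw [_root_.map_mul, hXX, _root_.map_one])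
  have h1 : (τ * φ X)⁻¹ = τ * φ X := inv_eq_of_mul_eq_one_left (S.y_sq hX hXX)
  have h2 : (φ X)⁻¹ = φ X := by
    rw [← _root_.map_inv, inv_eq_of_mul_eq_one_left hXX']
  calc (τ * φ X) * φ g * (τ * φ X) = (τ * φ X)⁻¹ * φ g * (τ * φ X) := by rw [h1]
    _ = (φ X)⁻¹ * (τ⁻¹ * φ g * τ) * φ X := by group
    _ = φ (X * κ g * X) := by rw [h2, S.τ_conj, _root_.map_mul, _root_.map_mul]

theorem inverts {X g : G} (hs : ∀ c, σ.IsSim (j g) c →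
    ((j X * j g * j X * j g : Eˣ) : E) = c • (1 : E)) : X * κ g * X = g⁻¹ := by
  obtain ⟨c, hc⟩ := S.sim g
  rw [eq_inv_iff_mul_eq_one]
  refine S.ext_coe ?_
  have h1 := hs c hc
  simp only [_root_.map_mul, Units.val_mul, S.κ_coe g c hc, _root_.map_one, Units.val_one,
    mul_smul_comm, smul_mul_assoc] at h1 ⊢
  rw [h1, smul_smul, inv_mul_cancel₀ hc.1, one_smul]

theorem inverts_coset {X g : G} (hX : σ.IsSim (j X) (-1)) (hXX : j X * j X = 1)
    (hs : ∀ c, σ.IsSim (j g) c → ((j X * j g * j X * j g : Eˣ) : E) = c • (1 : E)) :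
    IsConj (τ * φ g) (τ * φ g)⁻¹ := by
  obtain ⟨c, hc⟩ := S.sim g
  have hXX' : X * X = 1 := S.j_inj (by rw [_root_.map_mul, hXX, _root_.map_one])
  have h0 : (φ X)⁻¹ = φ X := by
    rw [← _root_.map_inv, inv_eq_of_mul_eq_one_left hXX']
  have hκX : (j (κ X) : E) = -j X := by
    rw [S.κ_coe X _ hX, inv_neg_one, neg_one_smul]
  have hκX' : σ.IsSim (j (κ X)) (-1) := by
    rw [AntiInv.IsSim.iff_mul] at hX ⊢
    rw [hκX, ← neg_one_smul F (j X : E), σ.map_smul, smul_mul_smul_comm, hX.2, smul_smul]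
    exact ⟨hX.1, by norm_num⟩
  have hκκ : (j (κ (κ X)) : E) = j X := by
    rw [S.κ_coe _ _ hκX', hκX, inv_neg_one, neg_one_smul, neg_neg]
  have hgX : σ.IsSim (j (g * X)) (c * -1) := by
    rw [_root_.map_mul]; exact hc.mul hX
  have h1 : z * κ (κ X) * κ (g * X) * g = 1 := S.ext_coe (by
    have h2 := hs c hc
    simp only [_root_.map_mul, Units.val_mul, S.z_coe, hκκ, S.κ_coe _ _ hgX, _root_.map_one,
      Units.val_one, mul_smul_comm, smul_mul_assoc, neg_mul] at h2 ⊢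
    rw [← mul_assoc, one_mul, h2, mul_neg_one, inv_neg, neg_smul, smul_neg, neg_neg, smul_smul,
      inv_mul_cancel₀ hc.1, one_smul])
  refine isConj_iff.2 ⟨φ X, ?_⟩
  rw [h0, eq_inv_iff_mul_eq_one]
  calc φ X * (τ * φ g) * φ X * (τ * φ g)
      = (φ X * τ) * (φ (g * X) * τ) * φ g := by rw [_root_.map_mul]; group
    _ = τ * (φ (κ X) * τ) * φ (κ (g * X)) * φ g := by rw [S.comm, S.comm]; group
    _ = (τ * τ) * φ (κ (κ X)) * φ (κ (g * X)) * φ g := by rw [S.comm]; group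
    _ = 1 := by
      rw [S.τ_sq, ← _root_.map_mul, ← _root_.map_mul, ← _root_.map_mul, h1, _root_.map_one]

end SimExt

end Extension

/-- Conjugation by an involution as an automorphism of a centralizer. -/
theorem exists_centralizer_aut {G H : Type} [Group G] [Group H] {φ : G →* H}
    (hφ : Function.Injective φ) {y : H} (hy : y * y = 1) {f : G → G}
    (hf : ∀ g, y * φ g * y = φ (f g)) {s : G} (hs : f s = s⁻¹) :
    ∃ κ : MulAut (Subgroup.centralizer {s}), ∀ c, ((κ c : Subgroup.centralizer {s}) : G) = f c := by
  have hff : ∀ g, f (f g) = g := fun g => hφ (by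
    rw [← hf, ← hf]
    calc y * (y * φ g * y) * y = (y * y) * φ g * (y * y) := by group
      _ = φ g := by rw [hy, one_mul, mul_one])
  have hmul : ∀ a b, f (a * b) = f a * f b := fun a b => hφ (by
    rw [_root_.map_mul, ← hf, ← hf, ← hf, _root_.map_mul]
    calc y * (φ a * φ b) * y = y * φ a * 1 * φ b * y := by group
      _ = y * φ a * y * (y * φ b * y) := by rw [← hy]; group)
  have hmem : ∀ c ∈ Subgroup.centralizer {s}, f c ∈ Subgroup.centralizer {s} := fun c hc => by
    rw [Subgroup.mem_centralizer_singleton_iff] at hc ⊢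
    have h1 : f s * f c = f c * f s := by rw [← hmul, ← hmul, hc]
    rw [hs] at h1
    calc f c * s = s * (s⁻¹ * f c) * s := by group
      _ = s * f c := by rw [h1]; group
  exact ⟨{ toFun := fun c => ⟨f c, hmem c c.2⟩
           invFun := fun c => ⟨f c, hmem c c.2⟩
           left_inv := fun c => Subtype.ext (hff c)
           right_inv := fun c => Subtype.ext (hff c)
           map_mul' := fun a b => Subtype.ext (hmul a b) }, fun c => rfl⟩

theorem IsPSD.zero {G : Type} [Group G] : IsPSD fun _ : G => (0 : ℂ) :=
  ⟨Empty, inferInstance, fun e => e.elim, fun g h => by simp⟩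

theorem IsPSD.one {G : Type} [Group G] : IsPSD fun _ : G => (1 : ℂ) :=
  ⟨Unit, inferInstance, fun _ _ => 1, fun g h => by simp⟩

theorem IsPSD.sum {G ι : Type} [Group G] (t : Finset ι) {θ : ι → G → ℂ}
    (h : ∀ i ∈ t, IsPSD (θ i)) : IsPSD fun g => ∑ i ∈ t, θ i g := by
  induction t using Finset.induction_on with
  | empty => simpa using IsPSD.zero
  | insert a t ha ih =>
    simp only [Finset.sum_insert ha]
    exact (h a (Finset.mem_insert_self a t)).add
      (ih fun i hi => h i (Finset.mem_insert_of_mem hi))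

namespace SimExt

variable {F E G H : Type} [Field F] [Ring E] [Algebra F E] [Group G] [Group H]
  {σ : AntiInv F E} {j : G →* Eˣ} {φ : G →* H} {τ : H} {κ : G → G} {z : G}

theorem card_eq_sum_theta (S : SimExt σ j φ τ κ z) [Fintype F] [Finite E] [Nontrivial E] {s X : G}
    {P L : Subgroup Eˣ} (T : TData σ (j s) P L (j X))
    (κ' : MulAut (Subgroup.centralizer {s}))
    (hκ' : ∀ c, ((κ' c : Subgroup.centralizer {s}) : G) = X * κ c * X)
    (h : L.comap (j.comp (Subgroup.centralizer {s}).subtype)) :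
    (Nat.card {l : L.comap (j.comp (Subgroup.centralizer {s}).subtype) //
      (l : Subgroup.centralizer {s}) * κ' l = h} : ℂ) =
    ∑ c : Fˣ, theta σ L (j X) c (j h) := by
  have := Finite.of_injective j S.j_inj
  choose m hm using S.sim
  let f : {l : L.comap (j.comp (Subgroup.centralizer {s}).subtype) //
      (l : Subgroup.centralizer {s}) * κ' l = h} → Fˣ := fun l =>
    -Units.mk0 (m l.1.1.1) (hm l.1.1.1).1
  have hf : ∀ l c, f l = c ↔ σ.IsSim (j l.1.1.1) (-(c : F)) := fun l c => by
    constructor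
    · rintro rfl
      show σ.IsSim _ (-((-Units.mk0 _ _ : Fˣ) : F))
      rw [Units.val_neg, neg_neg]
      exact hm _
    · intro hc
      refine Units.ext ?_
      show ((-Units.mk0 _ _ : Fˣ) : F) = c
      rw [Units.val_neg, Units.val_mk0, (hm _).unique hc, neg_neg]
  have hxx : (j X : E) * j X = 1 := by rw [← Units.val_mul, T.x_sq, Units.val_one]
  have hkey : ∀ (l : L.comap (j.comp (Subgroup.centralizer {s}).subtype)) (c : Fˣ),
      σ.IsSim (j l.1.1) (-(c : F)) →
      ((l : Subgroup.centralizer {s}) * κ' l = h ↔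
      ((j l.1.1 * j X : Eˣ) * (j l.1.1 * j X : Eˣ) : E) = (-(c : F)) • (j h : E)) :=
      fun l c hc => by
    have h0 : (-(c : F)) ≠ 0 := hc.1
    have h1 : (j ((l : Subgroup.centralizer {s}) * κ' l : Subgroup.centralizer {s}) : E) =
        (-(c : F))⁻¹ • ((j l.1.1 * j X : Eˣ) * (j l.1.1 * j X : Eˣ) : E) := by
      rw [Subgroup.coe_mul, hκ']
      simp only [_root_.map_mul, Units.val_mul, S.κ_coe _ _ hc, mul_smul_comm, smul_mul_assoc,
        mul_assoc]
    constructor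
    · intro e
      rw [← e, h1, smul_smul, mul_inv_cancel₀ h0, one_smul]
    · intro e
      rw [e, smul_smul, inv_mul_cancel₀ h0, one_smul] at h1
      exact Subtype.ext (S.ext_coe h1)
  rw [Nat.card_congr (Equiv.sigmaFiberEquiv f).symm, Nat.card_sigma, Nat.cast_sum]
  refine Finset.sum_congr rfl fun c _ => ?_
  rw [theta, Nat.cast_inj]
  refine Nat.card_eq_of_bijective (fun a => ⟨j a.1.1.1.1 * j X, ?_, ?_, ?_⟩) ⟨?_, ?_⟩
  · rw [← mul_assoc]; exact T.conj _ a.1.1.2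
  · have h2 := ((hf _ _).1 a.2).mul T.x_sim
    rwa [neg_mul_neg, mul_one] at h2
  · exact (hkey a.1.1 c ((hf _ _).1 a.2)).1 a.1.2
  · intro a b hab
    have h2 : j a.1.1.1.1 * j X = j b.1.1.1.1 * j X := congrArg Subtype.val hab
    exact Subtype.ext (Subtype.ext (Subtype.ext (Subtype.ext (S.j_inj (mul_right_cancel h2)))))
  · rintro ⟨t, ht, htc, hth⟩
    have h3 : σ.IsSim (t * j X) (-(c : F)) := by
      have h2 := htc.mul T.x_sim
      rwa [mul_neg_one] at h2
    obtain ⟨l, hl⟩ := S.surj _ _ h3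
    have h4 : t * j X ∈ L := by
      have h5 := T.conj _ ht
      rwa [← mul_assoc, T.x_sq, one_mul] at h5
    have h6 : l ∈ Subgroup.centralizer {s} := by
      rw [Subgroup.mem_centralizer_singleton_iff]
      apply S.j_inj
      have h5 := T.comm _ h4
      rw [_root_.map_mul, _root_.map_mul, hl, h5]
    have h7 : j l * j X = t := by rw [hl, mul_assoc, T.x_sq, mul_one]
    let l' : L.comap (j.comp (Subgroup.centralizer {s}).subtype) :=
      ⟨⟨l, h6⟩, show j l ∈ L by rw [hl]; exact h4⟩
    have h8 : σ.IsSim (j l'.1.1) (-(c : F)) := by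
      show σ.IsSim (j l) _
      rw [hl]; exact h3
    have h9 : (l' : Subgroup.centralizer {s}) * κ' l' = h := (hkey l' c h8).2 (by
      show ((j l * j X : Eˣ) * (j l * j X : Eˣ) : E) = _
      rw [h7]; exact hth)
    exact ⟨⟨⟨l', h9⟩, (hf _ _).2 h8⟩, Subtype.ext h7⟩

theorem goodInvolution (S : SimExt σ j φ τ κ z) [Finite F] [Finite E] {s X : G}
    (Q : Sylow 2 (Subgroup.centralizer {s})) {L : Subgroup Eˣ}
    (T : TData σ (j s) ((Q : Subgroup (Subgroup.centralizer {s})).map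
      (j.comp (Subgroup.centralizer {s}).subtype)) L (j X)) :
    GoodInvolution φ s (τ * φ X) := by
  have := Fintype.ofFinite F
  have hc := S.y_conj T.x_sim T.x_sq
  obtain ⟨κ', hκ'⟩ := exists_centralizer_aut S.φ_inj (S.y_sq T.x_sim T.x_sq) hc
    (S.inverts T.x_s)
  refine ⟨κ', L.comap (j.comp (Subgroup.centralizer {s}).subtype), Q,
    ⟨s, Subgroup.mem_centralizer_singleton_iff.2 rfl⟩, rfl, fun c => ?_, ?_, T.s_mem, ?_, ?_, ?_⟩
  · rw [hc, hκ']
  · exact Subtype.ext ((hκ' _).trans (S.inverts T.x_s))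
  · intro l hl
    obtain ⟨c, hcl⟩ := S.sim l
    show j (κ' l : Subgroup.centralizer {s}) ∈ L
    rw [hκ']
    have h1 : j (X * κ l * X) = (scal F (Units.mk0 c hcl.1))⁻¹ * (j X * j l * j X) := by
      rw [eq_inv_mul_iff_mul_eq]
      ext
      simp only [_root_.map_mul, Units.val_mul, S.κ_coe _ _ hcl, scal_coe, Units.val_mk0,
        mul_smul_comm, smul_mul_assoc, ← Algebra.smul_def]
      rw [smul_smul, inv_mul_cancel₀ hcl.1, one_smul]
    rw [h1]
    exact L.mul_mem (L.inv_mem (T.scal_mem _)) (T.conj _ hl)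
  · exact Subgroup.map_le_iff_le_comap.1 T.P_le
  · rcases subsingleton_or_nontrivial E with hE | hE
    · have : Subsingleton G := S.j_inj.subsingleton
      have h1 : ∀ h : L.comap (j.comp (Subgroup.centralizer {s}).subtype),
          (Nat.card {l : L.comap (j.comp (Subgroup.centralizer {s}).subtype) //
            (l : Subgroup.centralizer {s}) * κ' l = h} : ℂ) = 1 := fun h => by
        have : Unique {l : L.comap (j.comp (Subgroup.centralizer {s}).subtype) //
            (l : Subgroup.centralizer {s}) * κ' l = h} :=
          ⟨⟨⟨h, Subsingleton.elim _ _⟩⟩, fun _ => Subsingleton.elim _ _⟩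
        rw [Nat.card_unique, Nat.cast_one]
      simp only [h1]
      exact IsPSD.one
    · simp only [S.card_eq_sum_theta T κ' hκ']
      refine IsPSD.sum _ fun c _ => ?_
      let j' : L.comap (j.comp (Subgroup.centralizer {s}).subtype) →* L :=
        ((j.comp (Subgroup.centralizer {s}).subtype).subgroupComap L)
      exact (T.psd c c.ne_zero).comp j'

end SimExt

section Symplectic

variable (n : ℕ) (F : Type) [Field F]

theorem Jsp_transpose : (Jsp n F)ᵀ = -Jsp n F := by
  simp [Jsp, Matrix.fromBlocks_transpose, Matrix.fromBlocks_neg]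

theorem Jsp_mul_self : Jsp n F * Jsp n F = -1 := by
  rw [Jsp, Matrix.fromBlocks_multiply, ← Matrix.fromBlocks_one, Matrix.fromBlocks_neg]
  simp

/-- The adjoint with respect to the standard symplectic form. -/
def symplecticAdjoint : AntiInv F (Module.End F (Fin n ⊕ Fin n → F)) where
  toFun a := Matrix.toLin' (-Jsp n F * (LinearMap.toMatrix' a)ᵀ * Jsp n F)
  map_add' a b := by
    rw [← _root_.map_add, _root_.map_add, Matrix.transpose_add, Matrix.mul_add, Matrix.add_mul]
  map_mul' a b := by
    rw [Module.End.mul_eq_comp, LinearMap.toMatrix'_comp, Matrix.transpose_mul,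
      Module.End.mul_eq_comp, ← Matrix.toLin'_mul]
    congr 1
    calc -Jsp n F * ((LinearMap.toMatrix' b)ᵀ * (LinearMap.toMatrix' a)ᵀ) * Jsp n F
        = -Jsp n F * (LinearMap.toMatrix' b)ᵀ * (-(-1)) * (LinearMap.toMatrix' a)ᵀ * Jsp n F := by
          rw [neg_neg, mul_one]; simp only [Matrix.mul_assoc]
      _ = _ := by
          rw [← Jsp_mul_self]; simp only [Matrix.mul_assoc, Matrix.neg_mul, Matrix.mul_neg]
  map_smul' c a := by
    rw [_root_.map_smul, Matrix.transpose_smul, Matrix.mul_smul, Matrix.smul_mul,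
      _root_.map_smul]
  invol' a := by
    rw [LinearMap.toMatrix'_toLin', Matrix.transpose_mul, Matrix.transpose_mul,
      Matrix.transpose_transpose, Matrix.transpose_neg, Jsp_transpose, neg_neg]
    have h1 : -Jsp n F * (-Jsp n F * (LinearMap.toMatrix' a * Jsp n F)) * Jsp n F =
        (Jsp n F * Jsp n F) * LinearMap.toMatrix' a * (Jsp n F * Jsp n F) := by
      simp only [Matrix.mul_assoc, Matrix.neg_mul, Matrix.mul_neg, neg_neg]
    rw [h1, Jsp_mul_self, Matrix.neg_mul, Matrix.one_mul, Matrix.mul_neg, Matrix.mul_one, neg_neg,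
      Matrix.toLin'_toMatrix']

theorem symplecticAdjoint_apply (a : Module.End F (Fin n ⊕ Fin n → F)) :
    symplecticAdjoint n F a = Matrix.toLin' (-Jsp n F * (LinearMap.toMatrix' a)ᵀ * Jsp n F) := rfl

theorem adj_symplectic :
    Adj (Matrix.toLinearMap₂' F (Jsp n F)) (symplecticAdjoint n F) where
  alt v := by
    rw [Matrix.toLinearMap₂'_apply', Jsp, Matrix.fromBlocks_mulVec, dotProduct,
      Fintype.sum_sum_type]
    simp only [Matrix.zero_mulVec, Matrix.one_mulVec, Matrix.neg_mulVec, zero_add, add_zero,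
      Sum.elim_inl, Sum.elim_inr, Pi.neg_apply, Function.comp_apply, mul_neg,
      Finset.sum_neg_distrib]
    rw [add_neg_eq_zero]
    exact Finset.sum_congr rfl fun i _ => mul_comm _ _
  nondeg v h := by
    have h1 : ∀ u, v ⬝ᵥ u = 0 := fun u => by
      have h2 := h (-(Jsp n F *ᵥ u))
      rw [Matrix.toLinearMap₂'_apply', Matrix.mulVec_neg, Matrix.mulVec_mulVec, Jsp_mul_self,
        Matrix.neg_mulVec, neg_neg, Matrix.one_mulVec] at h2
      exact h2
    exact dotProduct_eq_zero v h1
  adj a u v := by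
    rw [Matrix.toLinearMap₂'_apply', Matrix.toLinearMap₂'_apply', symplecticAdjoint_apply,
      Matrix.toLin'_apply, Matrix.mulVec_mulVec]
    have h1 : Jsp n F * (-Jsp n F * (LinearMap.toMatrix' a)ᵀ * Jsp n F) =
        (LinearMap.toMatrix' a)ᵀ * Jsp n F := by
      rw [← Matrix.mul_assoc, ← Matrix.mul_assoc, Matrix.mul_neg, Jsp_mul_self, neg_neg,
        Matrix.one_mul]
    rw [h1, ← Matrix.mulVec_mulVec, Matrix.mulVec_transpose, dotProduct_comm u,
      ← Matrix.dotProduct_mulVec, dotProduct_comm]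
    congr 1
    rw [← Matrix.toLin'_apply, Matrix.toLin'_toMatrix']

/-- The symplectic similitude group as linear automorphisms. -/
def gspToUnits : GSp n F →* (Module.End F (Fin n ⊕ Fin n → F))ˣ :=
  (Units.map ((Matrix.toLinAlgEquiv' : Matrix (Fin n ⊕ Fin n) (Fin n ⊕ Fin n) F ≃ₐ[F] _) :
    Matrix (Fin n ⊕ Fin n) (Fin n ⊕ Fin n) F →* Module.End F (Fin n ⊕ Fin n → F))).comp
    (GSp n F).subtype

theorem gspToUnits_coe (g : GSp n F) :
    (gspToUnits n F g : Module.End F (Fin n ⊕ Fin n → F)) = Matrix.toLin' (matOf g) := rfl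

theorem gspToUnits_injective : Function.Injective (gspToUnits n F) := fun a b h => by
  have h1 := congrArg Units.val h
  rw [gspToUnits_coe, gspToUnits_coe] at h1
  exact Subtype.ext (Units.ext (Matrix.toLin'.injective h1))

theorem isSim_symplectic_iff (u : (Module.End F (Fin n ⊕ Fin n → F))ˣ) (c : F) :
    (symplecticAdjoint n F).IsSim u c ↔ c ≠ 0 ∧
      (LinearMap.toMatrix' (u : Module.End F _))ᵀ * Jsp n F * LinearMap.toMatrix' u.1 =
        c • Jsp n F := by
  rw [AntiInv.IsSim.iff_mul]
  refine and_congr_right fun _ => ?_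
  rw [symplecticAdjoint_apply]
  have h1 : Matrix.toLin' (-Jsp n F * (LinearMap.toMatrix' u.1)ᵀ * Jsp n F) * u.1 =
      Matrix.toLin' (-Jsp n F * ((LinearMap.toMatrix' u.1)ᵀ * Jsp n F * LinearMap.toMatrix' u.1)) := by
    conv_lhs => rw [← Matrix.toLin'_toMatrix' u.1]
    rw [Module.End.mul_eq_comp, ← Matrix.toLin'_mul, LinearMap.toMatrix'_toLin']
    simp only [Matrix.mul_assoc]
  have h2 : c • (1 : Module.End F (Fin n ⊕ Fin n → F)) =
      Matrix.toLin' (-Jsp n F * (c • Jsp n F)) := by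
    rw [Matrix.mul_smul, Matrix.neg_mul, Jsp_mul_self, neg_neg, _root_.map_smul,
      Matrix.toLin'_one]
    rfl
  rw [h1, h2, Matrix.toLin'.injective.eq_iff]
  constructor
  · intro h
    have h3 := congrArg (Jsp n F * ·) h
    simpa only [← Matrix.mul_assoc, Matrix.mul_neg, Matrix.neg_mul, Jsp_mul_self, neg_neg,
      Matrix.one_mul] using h3
  · intro h
    rw [h]

theorem gspToUnits_isSim_iff (g : GSp n F) (c : F) :
    (symplecticAdjoint n F).IsSim (gspToUnits n F g) c ↔ c ≠ 0 ∧
      (matOf g)ᵀ * Jsp n F * matOf g = c • Jsp n F := by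
  rw [isSim_symplectic_iff, gspToUnits_coe, LinearMap.toMatrix'_toLin']

theorem exists_gspToUnits (t : (Module.End F (Fin n ⊕ Fin n → F))ˣ) (c : F)
    (h : (symplecticAdjoint n F).IsSim t c) : ∃ g, gspToUnits n F g = t := by
  obtain ⟨h0, h1⟩ := (isSim_symplectic_iff n F t c).1 h
  let g : GL (Fin n ⊕ Fin n) F := Units.map
    ((Matrix.toLinAlgEquiv' : Matrix (Fin n ⊕ Fin n) (Fin n ⊕ Fin n) F ≃ₐ[F] _).symm :
    Module.End F (Fin n ⊕ Fin n → F) →* Matrix (Fin n ⊕ Fin n) (Fin n ⊕ Fin n) F) t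
  refine ⟨⟨g, Units.mk0 c h0, h1⟩, Units.ext ?_⟩
  exact Matrix.toLin'_toMatrix' _

end Symplectic

theorem adj_scal_sim (n : ℕ) (F : Type) [Field F] (c : Fˣ) :
    ∃ d, (symplecticAdjoint n F).IsSim (scal F c) d := by
  refine ⟨(c : F) * c, (AntiInv.IsSim.iff_mul).2 ⟨mul_ne_zero c.ne_zero c.ne_zero, ?_⟩⟩
  rw [scal_coe, Algebra.algebraMap_eq_smul_one, (symplecticAdjoint n F).map_smul,
    (symplecticAdjoint n F).map_one, smul_mul_smul_comm, one_mul]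

theorem SimExt.main {F V G H : Type} [Field F] [Finite F] [AddCommGroup V] [Module F V] [Finite V]
    [Group G] [Group H] [Fintype H] {B : LinearMap.BilinForm F V}
    {σ : AntiInv F (Module.End F V)} {j : G →* (Module.End F V)ˣ} {φ : G →* H} {τ : H} {κ : G → G}
    {z : G} (S : SimExt σ j φ τ κ z) (h2 : (2 : F) ≠ 0) (hadj : Adj B σ)
    (hindex : φ.range.index = 2) (hτ : τ ∉ φ.range) :
    (∀ ψ : FDRep ℂ H, Simple ψ → fsIndicator H ψ.character = 1) ∧ ∀ h : H, IsConj h h⁻¹ := by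
  have : Finite (Module.End F V) :=
    Finite.of_injective (fun a : Module.End F V => (a : V → V)) DFunLike.coe_injective
  have : Finite G := Finite.of_injective φ S.φ_inj
  have := Fintype.ofFinite G
  have hloc : ∀ g : G, ∃ X : G, σ.IsSim (j X) (-1) ∧ j X * j X = 1 ∧
      ∀ c, σ.IsSim (j g) c → ((j X * j g * j X * j g : (Module.End F V)ˣ) : Module.End F V) =
        c • (1 : Module.End F V) := fun g => by
    obtain ⟨L, x, T⟩ := TwoLocal.exists_TData h2 _ V B σ hadj (j g) ⊥
      ⟨S.sim g, fun p hp => ⟨1, by rw [Subgroup.mem_bot.1 hp]; exact AntiInv.IsSim.one⟩,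
        fun p hp => ⟨0, by rw [Subgroup.mem_bot.1 hp, one_pow]⟩,
        fun p hp => by rw [Subgroup.mem_bot.1 hp, one_mul, mul_one]⟩ rfl
    obtain ⟨X, rfl⟩ := S.surj _ _ T.x_sim
    exact ⟨X, T.x_sim, T.x_sq, T.x_s⟩
  have hκc : ∀ g, IsConj (κ g) g⁻¹ := fun g => by
    obtain ⟨X, -, hXX, hs⟩ := hloc g
    have hXX' : X * X = 1 := S.j_inj (by rw [_root_.map_mul, hXX, _root_.map_one])
    refine isConj_iff.2 ⟨X, ?_⟩
    rw [inv_eq_of_mul_eq_one_left hXX', S.inverts hs]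
  have hconj : ∀ h : H, IsConj h h⁻¹ := fun h => by
    by_cases hh : h ∈ φ.range
    · obtain ⟨g, rfl⟩ := hh
      obtain ⟨a, ha⟩ := isConj_iff.1 (hκc g)
      refine isConj_iff.2 ⟨φ a * τ⁻¹, ?_⟩
      rw [← _root_.map_inv, ← ha, _root_.map_mul, _root_.map_mul, _root_.map_inv, ← S.τ_conj]
      group
    · obtain ⟨g, hg⟩ := (Subgroup.mul_mem_iff_of_index_two hindex (a := τ⁻¹) (b := h)).2
        (iff_of_false (fun h' => hτ (by simpa using φ.range.inv_mem h')) hh)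
      obtain ⟨X, hX, hXX, hs⟩ := hloc g
      rw [show h = τ * φ g by rw [hg, mul_inv_cancel_left]]
      exact S.inverts_coset hX hXX hs
  refine ⟨fun ψ hψ => ?_, hconj⟩
  have hirr := FDRep.irrRep ψ hψ
  refine IrrRep.fsIndicator_eq_one ψ hirr hconj fun A hA hinv hskew => ?_
  refine hirr.false_of_skew S.φ_inj hindex hτ S.τ_sq S.τ_conj hκc (fun s _ => ?_) A hA hinv hskew
  have Q : Sylow 2 (Subgroup.centralizer {s}) := default
  obtain ⟨L, x, T⟩ := TwoLocal.exists_TData h2 _ V B σ hadj (j s)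
    ((Q : Subgroup (Subgroup.centralizer {s})).map (j.comp (Subgroup.centralizer {s}).subtype))
    { s_sim := S.sim s
      P_sim := by
        rintro _ ⟨p, -, rfl⟩
        exact S.sim p
      P_two := by
        rintro _ ⟨p, hp, rfl⟩
        obtain ⟨k, hk⟩ := Q.isPGroup' ⟨p, hp⟩
        refine ⟨k, ?_⟩
        rw [← _root_.map_pow, show p ^ 2 ^ k = 1 from congrArg Subtype.val hk, _root_.map_one]
      P_s := by
        rintro _ ⟨p, -, rfl⟩
        show j p * j s = j s * j p
        rw [← _root_.map_mul, ← _root_.map_mul, Subgroup.mem_centralizer_singleton_iff.1 p.2] } rfl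
  obtain ⟨X, rfl⟩ := S.surj _ _ T.x_sim
  exact ⟨X, S.y_sq T.x_sim T.x_sq, S.goodInvolution Q T⟩

theorem stmt_2 (n : ℕ) (q : ℕ) (hq : ∃ p r : ℕ, p.Prime ∧ Odd p ∧ 0 < r ∧ q = p ^ r)
    (F : Type) [Field F] [Fintype F] [DecidableEq F] (hF : Fintype.card F = q)
    (H : Type) [Group H] [Fintype H]
    (φ : ↥(GSp n F) →* H) (hφ : Function.Injective φ)
    (hindex : φ.range.index = 2)
    (τ : H) (hτ : τ ∉ φ.range)
    (hτsq : τ * τ = φ ⟨-1, neg_one_mem_similitudeGroup (Jsp n F)⟩)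
    (hτconj : ∀ (g g' : ↥(GSp n F)) (c : Fˣ),
      (matOf g)ᵀ * Jsp n F * matOf g = (c : F) • Jsp n F →
      matOf g' = ((c : F))⁻¹ • matOf g →
      τ⁻¹ * φ g * τ = φ g') :
    (∀ ψ : FDRep ℂ H, Simple ψ → fsIndicator H ψ.character = 1) ∧
    (∀ h : H, IsConj h h⁻¹) := by
  have h2 : (2 : F) ≠ 0 := by
    obtain ⟨p, r, hp, hodd, -, rfl⟩ := hq
    intro h
    have h0 : ringChar F = 2 :=
      (((Nat.dvd_prime Nat.prime_two).1 ((ringChar.spec F 2).1 (by exact_mod_cast h)))).resolve_left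
        (CharP.ringChar_ne_one)
    have h1 := FiniteField.even_card_of_char_two h0
    rw [hF] at h1
    exact (Nat.not_even_iff_odd.2 (hodd.pow (n := r))) (Nat.even_iff.2 h1)
  let σ := symplecticAdjoint n F
  let j := gspToUnits n F
  have hκ : ∀ g : GSp n F, ∃ g' : GSp n F, (∀ c, σ.IsSim (j g) c →
      (j g' : Module.End F (Fin n ⊕ Fin n → F)) = c⁻¹ • (j g : Module.End F _)) ∧
      τ⁻¹ * φ g * τ = φ g' := fun g => by
    obtain ⟨c, hc⟩ := g.2
    have hs : σ.IsSim (j g) c := (gspToUnits_isSim_iff n F g c).2 ⟨c.ne_zero, hc⟩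
    obtain ⟨d, hd⟩ := adj_scal_sim n F c⁻¹
    obtain ⟨g', hg'⟩ := exists_gspToUnits n F (scal F c⁻¹ * j g) _ (hd.mul hs)
    have hg'' : (j g' : Module.End F (Fin n ⊕ Fin n → F)) =
        (c : F)⁻¹ • (j g : Module.End F _) := by
      show (gspToUnits n F g' : Module.End F (Fin n ⊕ Fin n → F)) = _
      rw [hg', Units.val_mul, scal_coe, ← Algebra.smul_def, Units.val_inv_eq_inv_val]
    refine ⟨g', fun e he => ?_, hτconj g g' c hc ?_⟩
    · rcases subsingleton_or_nontrivial (Module.End F (Fin n ⊕ Fin n → F)) with hE | hE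
      · exact Subsingleton.elim _ _
      · rw [he.unique hs, hg'']
    · rw [gspToUnits_coe, gspToUnits_coe, ← _root_.map_smul] at hg''
      exact Matrix.toLin'.injective hg''
  choose κ hκ1 hκ2 using hκ
  have S : SimExt σ j φ τ κ ⟨-1, neg_one_mem_similitudeGroup (Jsp n F)⟩ :=
    { j_inj := gspToUnits_injective n F
      φ_inj := hφ
      sim := fun g => by
        obtain ⟨c, hc⟩ := g.2
        exact ⟨c, (gspToUnits_isSim_iff n F g c).2 ⟨c.ne_zero, hc⟩⟩
      surj := exists_gspToUnits n F
      κ_coe := hκ1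
      τ_conj := hκ2
      z_coe := by
        show (gspToUnits n F _ : Module.End F (Fin n ⊕ Fin n → F)) = _
        rw [gspToUnits_coe]
        show Matrix.toLin' (-1 : Matrix (Fin n ⊕ Fin n) (Fin n ⊕ Fin n) F) = _
        rw [_root_.map_neg, Matrix.toLin'_one]
        rfl
      τ_sq := hτsq }
  exact S.main h2 (adj_symplectic n F) hindex hτ

end
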